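/- Let G be a simple graph. The following are equivalent: (1) G is a circle graph; (2) the isotropic 3-matroid Z₃(G) is representable over every field; (3) Z₃(G) is representable over some field of characteristic different from 2. -/

import Mathlib

open Matrix

noncomputable section

/-- The rank over `F` of the set of columns of `M` indexed by `S`. -/
def colSpanRank (F : Type*) [Field F] {m n : Type*} (M : Matrix m n F) (S : Set n) : ℕ :=
  Module.finrank F ↥(Submodule.span F ((fun j i => M i j) '' S))

/-- A subtransversal of `W(G) = V × {φ,χ,ψ}`: at most one element of each triple. -/
def Subtransversal3 {V : Type*} (S : Set (V × Fin 3)) : Prop :=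
  ∀ v i j, (v, i) ∈ S → (v, j) ∈ S → i = j

/-- The matrix `IAS(G) = (I | A | I + A)` over GF(2); the columns `(v,0)`, `(v,1)`,
`(v,2)` are `φ_G(v)`, `χ_G(v)`, `ψ_G(v)` respectively. -/
def IASmat {V : Type*} [DecidableEq V] (A : Matrix V V (ZMod 2)) :
    Matrix V (V × Fin 3) (ZMod 2) :=
  Matrix.of fun v p =>
    if p.2 = 0 then (if v = p.1 then 1 else 0)
    else if p.2 = 1 then A v p.1
    else (if v = p.1 then 1 else 0) + A v p.1

/-- The isotropic 3-matroid `Z₃(G)` is representable over `F`: some matrix over `F`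
with columns indexed by `W(G)` has the same rank as `IAS(G)` on every subtransversal. -/
def Z3Rep (F : Type*) [Field F] {V : Type*} [Fintype V] [DecidableEq V]
    (A : Matrix V V (ZMod 2)) : Prop :=
  ∃ (k : ℕ) (P : Matrix (Fin k) (V × Fin 3) F),
    ∀ S : Set (V × Fin 3), Subtransversal3 S →
      colSpanRank F P S = colSpanRank (ZMod 2) (IASmat A) S

/-- `w` is a double occurrence word on `V`: each element of `V` occurs exactly twice. -/
def IsDOW {V : Type*} [DecidableEq V] (w : List V) : Prop := ∀ v : V, w.count v = 2

/-- Distinct `u` and `v` are interlaced in `w`: their occurrences appear in the order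
`u v u v` or `v u v u`. -/
def Interlaced {V : Type*} (w : List V) (u v : V) : Prop :=
  [u, v, u, v].Sublist w ∨ [v, u, v, u].Sublist w

/-- `G` (a simple graph given by its adjacency matrix over GF(2)) is a circle graph:
it is the interlacement graph of some double occurrence word on its vertex set. -/
def IsCircleGraph {V : Type*} [Fintype V] [DecidableEq V] (A : Matrix V V (ZMod 2)) : Prop :=
  ∃ w : List V, IsDOW w ∧ ∀ u v : V, A u v = 1 ↔ (u ≠ v ∧ Interlaced w u v)

set_option linter.unusedSectionVars false
set_option linter.unusedSimpArgs false
set_option linter.unusedVariables false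
namespace Z3
open Finset

/-- The Klein four-group, a symplectic plane over GF(2). -/
abbrev K := ZMod 2 × ZMod 2

/-- Subspaces of `V → K`. -/
abbrev Spc (V : Type) := Submodule (ZMod 2) (V → K)

/-- The symplectic form on `K`. -/
def om (a b : K) : ZMod 2 := a.1 * b.2 + a.2 * b.1

theorem om_comm : ∀ a b : K, om a b = om b a := by decide
theorem om_add_left : ∀ a b c : K, om (a + b) c = om a c + om b c := by decide
theorem om_add_right : ∀ a b c : K, om a (b + c) = om a b + om a c := by decide
theorem om_self : ∀ a : K, om a a = 0 := by decide
theorem om_zero_left : ∀ a : K, om 0 a = 0 := by decide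
theorem om_zero_right : ∀ a : K, om a 0 = 0 := by decide
theorem om_eq_zero : ∀ a b : K, b ≠ 0 → om a b = 0 → a = 0 ∨ a = b := by decide
theorem om_eq_zero_iff : ∀ a b : K, om a b = 0 ↔ a = 0 ∨ b = 0 ∨ a = b := by decide
theorem om_ne : ∀ a b : K, a ≠ 0 → b ≠ 0 → a ≠ b → om a b = 1 := by decide
theorem z2 : ∀ a : ZMod 2, a = 0 ∨ a = 1 := by decide
theorem z2add : ∀ a : ZMod 2, a + a = 0 := by decide
theorem kadd : ∀ a : K, a + a = 0 := by decide

variable {V : Type} [Fintype V] [DecidableEq V]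

theorem vadd (R : V → K) : R + R = 0 := by ext1 v; exact kadd _
theorem vadd_cancel (R Q : V → K) : R + Q + Q = R := by rw [add_assoc, vadd, add_zero]
theorem vadd_eq_zero {R Q : V → K} : R + Q = 0 ↔ R = Q := by
  constructor
  · intro h; have := congrArg (· + Q) h; simpa [vadd_cancel] using this
  · rintro rfl; exact vadd _

/-- The symplectic form on `V → K`. -/
def omV (R Q : V → K) : ZMod 2 := ∑ v, om (R v) (Q v)

theorem omV_comm (R Q : V → K) : omV R Q = omV Q R := by
  unfold omV; exact sum_congr rfl fun v _ => om_comm _ _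
theorem omV_add_left (R S Q : V → K) : omV (R + S) Q = omV R Q + omV S Q := by
  simp [omV, om_add_left, sum_add_distrib]
theorem omV_add_right (R S Q : V → K) : omV Q (R + S) = omV Q R + omV Q S := by
  simp [omV, om_add_right, sum_add_distrib]
theorem omV_zero_left (Q : V → K) : omV 0 Q = 0 := by simp [omV, om_zero_left]
theorem omV_zero_right (Q : V → K) : omV Q 0 = 0 := by simp [omV, om_zero_right]
theorem omV_single (R : V → K) (u : V) (i : K) : omV R (Pi.single u i) = om (R u) i := by
  unfold omV
  rw [sum_eq_single u]
  · simp
  · intro b _ hb; simp [hb, om_zero_right]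
  · simp

/-- Bilinear form version. -/
def omB : LinearMap.BilinForm (ZMod 2) (V → K) :=
  LinearMap.mk₂ (ZMod 2) omV (fun _ _ _ => omV_add_left _ _ _)
    (fun c m n => by rcases z2 c with h | h <;> simp [h, omV_zero_left])
    (fun _ _ _ => omV_add_right _ _ _)
    (fun c m n => by rcases z2 c with h | h <;> simp [h, omV_zero_right])

theorem omV_nondeg {R : V → K} (h : ∀ Q, omV R Q = 0) : R = 0 := by
  ext1 v
  have h1 := h (Pi.single v (1,0)); have h2 := h (Pi.single v (0,1))
  rw [omV_single] at h1 h2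
  revert h1 h2; simp only [Pi.zero_apply]; generalize R v = a; revert a; decide

theorem omB_nondeg : (omB (V := V)).Nondegenerate := by
  refine ⟨fun x hx => omV_nondeg hx, fun x hx => omV_nondeg fun Q => ?_⟩
  rw [omV_comm]; exact hx Q

/-- Vectors supported in `X`. -/
def W (X : Finset V) : Spc V where
  carrier := {R | ∀ v ∉ X, R v = 0}
  add_mem' := by intro a b ha hb v hv; simp [ha v hv, hb v hv]
  zero_mem' := by intro v _; rfl
  smul_mem' := by intro c x hx v hv; simp [hx v hv]

theorem mem_W {X : Finset V} {R : V → K} : R ∈ W X ↔ ∀ v ∉ X, R v = 0 := Iff.rfl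

theorem W_mono {X Y : Finset V} (h : X ⊆ Y) : W X ≤ W Y := fun _ hR v hv => hR v fun h' => hv (h h')

theorem W_inf (X Y : Finset V) : W X ⊓ W Y = W (X ∩ Y) := by
  ext R; simp only [Submodule.mem_inf, mem_W, mem_inter, not_and_or]
  constructor
  · rintro ⟨h1, h2⟩ v (hv | hv); exacts [h1 v hv, h2 v hv]
  · intro h; exact ⟨fun v hv => h v (Or.inl hv), fun v hv => h v (Or.inr hv)⟩

theorem finrank_W (X : Finset V) : Module.finrank (ZMod 2) (W X) = 2 * X.card := by
  have e : W X ≃ₗ[ZMod 2] (X → K) :=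
    { toFun := fun R v => R.1 v
      map_add' := fun _ _ => rfl
      map_smul' := fun _ _ => rfl
      invFun := fun f => ⟨fun v => if h : v ∈ X then f ⟨v, h⟩ else 0, fun v hv => by simp [hv]⟩
      left_inv := fun R => by
        ext1; ext1 v; by_cases h : v ∈ X
        · simp [h]
        · simp [h, R.2 v h]
      right_inv := fun f => by ext1 v; simp }
  rw [e.finrank_eq, Module.finrank_pi_fintype]
  simp [mul_comm]

/-- `L` is a Lagrangian subspace of the vectors supported on `E`. -/
def Lag (E : Finset V) (L : Spc V) : Prop :=
  ∀ R, R ∈ L ↔ (∀ v ∉ E, R v = 0) ∧ ∀ Q ∈ L, omV R Q = 0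

theorem Lag.supp {E : Finset V} {L : Spc V} (h : Lag E L) {R} (hR : R ∈ L) :
    ∀ v ∉ E, R v = 0 := ((h R).1 hR).1
theorem Lag.iso {E : Finset V} {L : Spc V} (h : Lag E L) {R Q} (hR : R ∈ L)
    (hQ : Q ∈ L) : omV R Q = 0 := ((h R).1 hR).2 Q hQ
theorem Lag.mem {E : Finset V} {L : Spc V} (h : Lag E L) {R}
    (h1 : ∀ v ∉ E, R v = 0) (h2 : ∀ Q ∈ L, omV R Q = 0) : R ∈ L := (h R).2 ⟨h1, h2⟩

theorem W_orth (X : Finset V) : omB.orthogonal (W X) = W (Xᶜ) := by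
  ext R
  rw [LinearMap.BilinForm.mem_orthogonal_iff]
  constructor
  · intro h v hv
    have hv : v ∈ X := by simpa using hv
    have : ∀ i, om (R v) i = 0 := fun i => by
      rw [← omV_single, omV_comm]
      exact h (Pi.single v i) (fun w hw => by
        rw [Pi.single_eq_of_ne]; rintro rfl; exact hw hv)
    have h1 := this (1,0); have h2 := this (0,1)
    revert h1 h2; generalize R v = a; revert a; decide
  · intro h Q hQ
    change omV Q R = 0
    unfold omV; apply sum_eq_zero; intro v _
    by_cases hv : v ∈ X
    · rw [h v (by simpa using hv), om_zero_right]
    · rw [hQ v hv, om_zero_left]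

/-- The connectivity-type dimension function. -/
def d (L : Spc V) (X : Finset V) : ℕ :=
  Module.finrank (ZMod 2) ↥(L ⊓ W X)

theorem orth_inf (A B : Spc V) :
    omB.orthogonal (A ⊔ B) = omB.orthogonal A ⊓ omB.orthogonal B := by
  apply le_antisymm
  · exact le_inf (LinearMap.BilinForm.orthogonal_le le_sup_left)
      (LinearMap.BilinForm.orthogonal_le le_sup_right)
  · rintro x ⟨hA, hB⟩
    intro y hy
    obtain ⟨a, ha, b, hb, rfl⟩ := Submodule.mem_sup.1 hy
    have h1 : omB a x = 0 := hA a ha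
    have h2 : omB b x = 0 := hB b hb
    change omB (a + b) x = 0
    simp [h1, h2]

theorem Lag.eq_inf {E : Finset V} {L : Spc V} (h : Lag E L) :
    L = omB.orthogonal L ⊓ W E := by
  ext R
  rw [h R, Submodule.mem_inf, LinearMap.BilinForm.mem_orthogonal_iff, and_comm]
  apply and_congr_left'
  exact forall₂_congr fun Q _ => by rw [omV_comm]; rfl

theorem finrank_VK : Module.finrank (ZMod 2) (V → K) = 2 * Fintype.card V := by
  rw [Module.finrank_pi_fintype]; simp [mul_comm]

theorem Lag.le_W {E : Finset V} {L : Spc V} (h : Lag E L) : L ≤ W E :=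
  fun _ hR => h.supp hR

theorem finrank_orth (A : Spc V) :
    Module.finrank (ZMod 2) (omB.orthogonal A) = 2 * Fintype.card V - Module.finrank (ZMod 2) A := by
  rw [LinearMap.BilinForm.finrank_orthogonal omB_nondeg, finrank_VK]

theorem Lag.dual' {E : Finset V} {L : Spc V} (h : Lag E L) {X : Finset V}
    (hX : X ⊆ E) : d L X + Module.finrank (ZMod 2) L = 2 * X.card + d L (E \ X) := by
  have h1 : L ⊓ W X = omB.orthogonal (L ⊔ W Xᶜ) := by
    rw [orth_inf, W_orth, compl_compl]
    conv_lhs => rw [h.eq_inf]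
    rw [inf_assoc, inf_eq_right.2 (W_mono hX)]
  have h2 : L ⊓ W (E \ X) = L ⊓ W Xᶜ := by
    conv_rhs => rw [← inf_eq_left.2 h.le_W]
    rw [inf_assoc, W_inf]; congr 2; ext v; simp
  have h3 := Submodule.finrank_sup_add_finrank_inf_eq L (W Xᶜ)
  have h4 := finrank_W (Xᶜ)
  have h5 := finrank_orth (L ⊔ W Xᶜ)
  have h6 : Module.finrank (ZMod 2) ↥(L ⊔ W Xᶜ) ≤ 2 * Fintype.card V := by
    rw [← finrank_VK]; exact Submodule.finrank_le _
  have h7 := card_add_card_compl X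
  unfold d
  rw [h1, h2]; omega

theorem Lag.finrank {E : Finset V} {L : Spc V} (h : Lag E L) :
    Module.finrank (ZMod 2) L = E.card := by
  have h1 := h.dual' (empty_subset E)
  have h2 : d L (E \ ∅) = Module.finrank (ZMod 2) L := by
    unfold d; rw [sdiff_empty, inf_eq_left.2 h.le_W]
  have h3 := h.dual' (subset_refl E)
  have h4 : d L E = Module.finrank (ZMod 2) L := by
    unfold d; rw [inf_eq_left.2 h.le_W]
  have h5 : d L (E \ E) = 0 := by
    unfold d; rw [sdiff_self]
    have : W (∅ : Finset V) = ⊥ := by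
      ext R; simp only [mem_W, Submodule.mem_bot]
      constructor
      · intro h; ext1 v; exact h v (by simp)
      · rintro rfl; simp
    rw [bot_eq_empty, this]; simp
  omega

theorem Lag.dual {E : Finset V} {L : Spc V} (h : Lag E L) {X : Finset V}
    (hX : X ⊆ E) : d L X + (E \ X).card = d L (E \ X) + X.card := by
  have h1 := h.dual' hX
  have := card_sdiff_add_card_eq_card hX
  rw [h.finrank] at h1; omega

theorem Lag.eq_of_le {E : Finset V} {L L' : Spc V} (h : Lag E L) (h' : Lag E L')
    (hle : L ≤ L') : L = L' :=
  Submodule.eq_of_le_of_finrank_eq hle (by rw [h.finrank, h'.finrank])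

/-- The minor of `L` at `u` in direction `i`. -/
def mnr (L : Spc V) (u : V) (i : K) : Spc V where
  carrier := {R | R u = 0 ∧ (R ∈ L ∨ R + Pi.single u i ∈ L)}
  zero_mem' := ⟨rfl, Or.inl L.zero_mem⟩
  add_mem' := by
    rintro a b ⟨ha, ha'⟩ ⟨hb, hb'⟩
    refine ⟨by simp [ha, hb], ?_⟩
    rcases ha' with ha' | ha' <;> rcases hb' with hb' | hb'
    · exact Or.inl (L.add_mem ha' hb')
    · right; rw [add_assoc]; exact L.add_mem ha' hb'
    · right; rw [add_right_comm]; exact L.add_mem ha' hb'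
    · left; have := L.add_mem ha' hb'
      rwa [add_add_add_comm, vadd, add_zero] at this
  smul_mem' := by
    rintro c x ⟨h1, h2⟩
    rcases z2 c with h | h
    · simp [h]
    · simpa [h] using ⟨h1, h2⟩

theorem mem_mnr {L : Spc V} {u : V} {i : K} {R : V → K} :
    R ∈ mnr L u i ↔ R u = 0 ∧ (R ∈ L ∨ R + Pi.single u i ∈ L) := Iff.rfl

/-- zero out coordinate u -/
def kill (u : V) (R : V → K) : V → K := Function.update R u 0

theorem kill_eq (u : V) (R : V → K) : kill u R = R + Pi.single u (R u) := by
  ext1 v; by_cases h : v = u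
  · subst h; simp [kill, kadd]
  · simp [kill, h]

theorem kill_same (u : V) (R : V → K) : kill u R u = 0 := by simp [kill]
theorem kill_ne {u v : V} (h : v ≠ u) (R : V → K) : kill u R v = R v := by simp [kill, h]

theorem kill_mem_mnr {L : Spc V} {u : V} {i : K} {R : V → K}
    (hR : R ∈ L) (h : R u = 0 ∨ R u = i) : kill u R ∈ mnr L u i := by
  refine ⟨kill_same _ _, ?_⟩
  rw [kill_eq]
  rcases h with h | h
  · left; simpa [h] using hR
  · right; rw [h, vadd_cancel]; exact hR

theorem mem_mnr_iff {L : Spc V} {u : V} {i : K} {R : V → K} :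
    R ∈ mnr L u i ↔ ∃ Q ∈ L, (Q u = 0 ∨ Q u = i) ∧ R = kill u Q := by
  constructor
  · rintro ⟨h, h1 | h1⟩
    · exact ⟨R, h1, Or.inl h, by rw [kill_eq, h]; simp⟩
    · refine ⟨_, h1, Or.inr (by simp [h]), ?_⟩
      rw [kill_eq]; simp [h, vadd_cancel]
  · rintro ⟨Q, h1, h2, rfl⟩; exact kill_mem_mnr h1 h2

theorem omV_kill {u : V} {R Q : V → K} (h : om (R u) (Q u) = 0) : omV (kill u R) Q = omV R Q := by
  rw [kill_eq, omV_add_left, omV_comm (Pi.single _ _), omV_single, om_comm, h, add_zero]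

theorem kill_of_zero {u : V} {R : V → K} (h : R u = 0) : kill u R = R := by
  rw [kill_eq, h]; simp

theorem Lag.mnr {E : Finset V} {L : Spc V} (h : Lag E L) {u : V} (hu : u ∈ E)
    {i : K} (hi : i ≠ 0) : Lag (E.erase u) (mnr L u i) := by
  intro R
  constructor
  · intro hR
    obtain ⟨Q, hQ, hQi, rfl⟩ := mem_mnr_iff.1 hR
    refine ⟨?_, ?_⟩
    · intro v hv
      by_cases hvu : v = u
      · subst hvu; exact kill_same _ _
      · rw [kill_ne hvu]; exact h.supp hQ v (fun h' => hv (mem_erase.2 ⟨hvu, h'⟩))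
    · intro S hS
      obtain ⟨S, hS', hSi, rfl⟩ := mem_mnr_iff.1 hS
      have : om (Q u) (S u) = 0 := by
        rw [om_eq_zero_iff]; rcases hQi with a | a <;> rcases hSi with b | b <;> simp [a, b]
      rw [omV_kill, omV_comm, omV_kill, omV_comm, h.iso hQ hS']
      · rw [om_comm, this]
      · rw [kill_same, om_zero_right]
  · rintro ⟨h1, h2⟩
    have hu0 : R u = 0 := h1 u (by simp)
    have hsupp : ∀ v ∉ E, R v = 0 := fun v hv => h1 v (fun h' => hv (mem_of_mem_erase h'))
    refine ⟨hu0, ?_⟩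
    have key : ∀ Q ∈ L, om (Q u) i = 0 → omV R Q = 0 := by
      intro Q hQ ho
      have := h2 _ (kill_mem_mnr hQ (om_eq_zero _ _ hi ho))
      rwa [omV_comm, omV_kill, omV_comm] at this
      rw [hu0, om_zero_right]
    have hsup2 : ∀ v ∉ E, (R + Pi.single u i : V → K) v = 0 := fun v hv => by
      have : v ≠ u := by rintro rfl; exact hv hu
      simp [hsupp v hv, this]
    by_cases hex : ∃ Q0 ∈ L, om (Q0 u) i = 1
    · obtain ⟨Q0, hQ0, ho⟩ := hex
      rcases z2 (omV R Q0) with hz | hz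
      · left; refine h.mem hsupp fun Q hQ => ?_
        rcases z2 (om (Q u) i) with h0 | h0
        · exact key Q hQ h0
        · have := key _ (L.add_mem hQ hQ0) (by simp [om_add_left, h0, ho, z2add])
          rwa [omV_add_right, hz, add_zero] at this
      · right; refine h.mem hsup2 fun Q hQ => ?_
        rw [omV_add_left, omV_comm (Pi.single _ _), omV_single]
        rcases z2 (om (Q u) i) with h0 | h0
        · rw [key Q hQ h0, h0, add_zero]
        · have := key _ (L.add_mem hQ hQ0) (by simp [om_add_left, h0, ho, z2add])
          rw [omV_add_right, hz] at this; rw [h0, this]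
    · push Not at hex
      left; refine h.mem hsupp fun Q hQ => key Q hQ ?_
      rcases z2 (om (Q u) i) with h0 | h0
      · exact h0
      · exact absurd h0 (hex Q hQ)

/-- Connected. -/
def Conn (E : Finset V) (L : Spc V) : Prop :=
  ∀ X, X ⊆ E → X.Nonempty → X ≠ E → d L X + 1 ≤ X.card

/-- Prime (3-connected, no splits). -/
def Prim (E : Finset V) (L : Spc V) : Prop :=
  Conn E L ∧ ∀ X, X ⊆ E → 2 ≤ X.card → 2 ≤ (E \ X).card → d L X + 2 ≤ X.card

/-- Vectors of `L` supported on `X ∪ u` with type `i` at `u`. -/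
def U (L : Spc V) (u : V) (i : K) (X : Finset V) :
    Spc V :=
  L ⊓ W (insert u X) ⊓
    { carrier := {R | R u = 0 ∨ R u = i}
      zero_mem' := Or.inl rfl
      add_mem' := by
        rintro a b (ha | ha) (hb | hb) <;> simp [ha, hb, kadd]
      smul_mem' := by
        rintro c x hx; rcases z2 c with h | h
        · simp [h]
        · simpa [h] using hx }

theorem d_mnr_le (L : Spc V) (u : V) (i : K) (X : Finset V) :
    d (mnr L u i) X ≤ Module.finrank (ZMod 2) (U L u i X) := by
  let k : (V → K) →ₗ[ZMod 2] (V → K) :=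
    { toFun := kill u
      map_add' := fun a b => by ext1 v; by_cases h : v = u <;> simp [kill, h]
      map_smul' := fun a b => by ext1 v; by_cases h : v = u <;> simp [kill, h] }
  have : mnr L u i ⊓ W X ≤ (U L u i X).map k := by
    rintro R ⟨h1, h2⟩
    obtain ⟨Q, hQ, hQi, rfl⟩ := mem_mnr_iff.1 h1
    refine ⟨Q, ⟨⟨hQ, ?_⟩, hQi⟩, rfl⟩
    intro v hv
    have hv : v ≠ u ∧ v ∉ X := by simpa using hv
    rw [← kill_ne hv.1 Q]; exact h2 v hv.2
  exact (Submodule.finrank_mono this).trans (Submodule.finrank_map_le _ _)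

theorem U_le (L : Spc V) (u : V) (i : K) (X : Finset V) :
    Module.finrank (ZMod 2) (U L u i X) ≤ d L (insert u X) :=
  Submodule.finrank_mono inf_le_left

theorem cross (L : Spc V) (u : V) {i j : K} (hij : i ≠ j) (X Y : Finset V) :
    d (mnr L u i) X + d (mnr L u j) Y ≤ d L (X ∩ Y) + d L (insert u (X ∪ Y)) := by
  have h1 := d_mnr_le L u i X
  have h2 := d_mnr_le L u j Y
  have h3 := Submodule.finrank_sup_add_finrank_inf_eq (U L u i X) (U L u j Y)
  have h4 : U L u i X ⊔ U L u j Y ≤ L ⊓ W (insert u (X ∪ Y)) := by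
    apply sup_le
    · rintro R ⟨⟨a, b⟩, _⟩
      exact ⟨a, W_mono (insert_subset_insert _ subset_union_left) b⟩
    · rintro R ⟨⟨a, b⟩, _⟩
      exact ⟨a, W_mono (insert_subset_insert _ subset_union_right) b⟩
  have h5 : U L u i X ⊓ U L u j Y ≤ L ⊓ W (X ∩ Y) := by
    rintro R ⟨⟨⟨a, b⟩, c⟩, ⟨⟨a', b'⟩, c'⟩⟩
    refine ⟨a, fun v hv => ?_⟩
    have hu : R u = 0 := by
      rcases c with c | c
      · exact c
      · rcases c' with c' | c'
        · exact c'
        · exact absurd (c.symm.trans c') hij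
    by_cases hvu : v = u
    · rw [hvu, hu]
    · rw [mem_inter, not_and_or] at hv
      rcases hv with hv | hv
      · exact b v (by simp [hvu, hv])
      · exact b' v (by simp [hvu, hv])
  have h6 := Submodule.finrank_mono h4
  have h7 := Submodule.finrank_mono h5
  unfold d at *
  omega
variable {E X : Finset V} {L : Spc V} {R Q : V → K} {u : V} {τ : K}
variable {F : Type} [Field F] {t : V × K → F} {p : V × K → ZMod 2} {e : V × K}
variable {M : Type} [AddCommGroup M] [Module F M]
variable {ι : V × K → V × K} {A : Matrix V V (ZMod 2)}

section
theorem conn2_aux (hc : Conn E L) (hu : u ∈ E) {i j : K} (hij : i ≠ j) {X Y : Finset V}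
    (hX : X ⊆ E.erase u) (hY : Y ⊆ E.erase u) (h1 : X.card ≤ d (mnr L u i) X)
    (h2 : Y.card ≤ d (mnr L u j) Y) : X ∩ Y = ∅ ∨ X ∪ Y = E.erase u := by
  by_contra hcon
  push Not at hcon
  obtain ⟨ha, hb⟩ := hcon
  have hu1 : u ∉ X := fun h => by simpa using hX h
  have hu2 : u ∉ Y := fun h => by simpa using hY h
  have h3 := cross L u hij X Y
  have h4 := hc (X ∩ Y) (fun x hx => mem_of_mem_erase (hX (mem_inter.1 hx).1))
    (nonempty_iff_ne_empty.2 (by simpa [nonempty_iff_ne_empty] using ha))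
    (fun h => hu1 (mem_inter.1 (h ▸ hu)).1)
  have h5 := hc (insert u (X ∪ Y)) (by
      intro x hx; rcases mem_insert.1 hx with rfl | hx
      · exact hu
      · rcases mem_union.1 hx with hx | hx
        · exact mem_of_mem_erase (hX hx)
        · exact mem_of_mem_erase (hY hx)) (insert_nonempty _ _) (fun h => hb (by
          rw [← h, erase_insert]; simp [hu1, hu2]))
  rw [card_insert_of_notMem (by simp [hu1, hu2])] at h5
  have := card_union_add_card_inter X Y
  omega

theorem conn2 (hL : Lag E L) (hc : Conn E L) (hu : u ∈ E) {i j : K} (hi : i ≠ 0)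
    (hj : j ≠ 0) (hij : i ≠ j) : Conn (E.erase u) (mnr L u i) ∨ Conn (E.erase u) (mnr L u j) := by
  by_contra hcon
  simp only [not_or, Conn, not_forall] at hcon
  obtain ⟨⟨X, hX, hXn, hXE, h1⟩, ⟨Y, hY, hYn, hYE, h2⟩⟩ := hcon
  have h3 := (hL.mnr hu hi).dual hX
  have a1 := conn2_aux hc hu hij hX hY (by omega) (by omega)
  have a2 := conn2_aux hc hu hij (sdiff_subset (s := E.erase u) (t := X)) hY (by omega) (by omega)
  generalize E.erase u = E' at *
  rcases a1 with a1 | a1 <;> rcases a2 with a2 | a2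
  · obtain ⟨y, hy⟩ := hYn
    by_cases hyx : y ∈ X
    · exact notMem_empty y (a1 ▸ mem_inter.2 ⟨hyx, hy⟩)
    · exact notMem_empty y (a2 ▸ mem_inter.2 ⟨mem_sdiff.2 ⟨hY hy, hyx⟩, hy⟩)
  · obtain ⟨x, hx⟩ := hXn
    have : x ∈ E' \ X ∪ Y := by rw [a2]; exact hX hx
    rcases mem_union.1 this with h | h
    · exact (mem_sdiff.1 h).2 hx
    · exact notMem_empty x (a1 ▸ mem_inter.2 ⟨hx, h⟩)
  · apply hXE; apply subset_antisymm hX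
    intro x hx
    by_contra hxX
    have : x ∈ X ∪ Y := a1 ▸ hx
    rcases mem_union.1 this with h | h
    · exact hxX h
    · exact notMem_empty x (a2 ▸ mem_inter.2 ⟨mem_sdiff.2 ⟨hx, hxX⟩, h⟩)
  · apply hYE; apply subset_antisymm hY
    intro x hx
    by_contra hxY
    have h1 : x ∈ X ∪ Y := a1 ▸ hx
    have h2 : x ∈ E' \ X ∪ Y := by rw [a2]; exact hx
    simp [hxY] at h1 h2
    exact h2.2 h1

theorem split_aux (hc : Prim E L) (hu : u ∈ E) {i j : K} (hij : i ≠ j) {X Y : Finset V}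
    (hX : X ⊆ E.erase u) (hY : Y ⊆ E.erase u) (h1 : X.card ≤ d (mnr L u i) X + 1)
    (h2 : Y.card ≤ d (mnr L u j) Y + 1) :
    (X ∩ Y).card ≤ 1 ∨ (E.erase u \ (X ∪ Y)).card ≤ 1 := by
  by_contra hcon
  push Not at hcon
  obtain ⟨ha, hb⟩ := hcon
  have hu1 : u ∉ X := fun h => by simpa using hX h
  have hu2 : u ∉ Y := fun h => by simpa using hY h
  have h3 := cross L u hij X Y
  have hXE : X ⊆ E := fun x hx => mem_of_mem_erase (hX hx)
  have hYE : Y ⊆ E := fun x hx => mem_of_mem_erase (hY hx)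
  have h4 := hc.2 (X ∩ Y) (fun x hx => hXE (mem_inter.1 hx).1) ha (by
    refine le_trans hb (card_le_card fun x hx => ?_)
    simp at hx ⊢; tauto)
  have h5 := hc.2 (insert u (X ∪ Y)) (by
      intro x hx; rcases mem_insert.1 hx with rfl | hx
      · exact hu
      · rcases mem_union.1 hx with hx | hx
        · exact hXE hx
        · exact hYE hx) (by
      refine le_trans ha (card_le_card fun x hx => ?_)
      simp at hx ⊢; tauto) (by
      refine le_trans hb (card_le_card fun x hx => ?_)
      simp at hx ⊢; tauto)
  rw [card_insert_of_notMem (by simp [hu1, hu2])] at h5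
  have := card_union_add_card_inter X Y
  omega

theorem Prim.mnr_conn (hL : Lag E L) (hp : Prim E L) (hn : 5 ≤ E.card) (hu : u ∈ E) {i : K}
    (hi : i ≠ 0) : Conn (E.erase u) (mnr L u i) := by
  have hc := card_erase_of_mem hu
  have key : ∀ X, X ⊆ E.erase u → X.Nonempty → 2 ≤ (E.erase u \ X).card →
      d (mnr L u i) X + 1 ≤ X.card := by
    intro X hX hXn h2
    have hu1 : u ∉ X := fun h => by simpa using hX h
    have h3 := (d_mnr_le L u i X).trans (U_le L u i X)
    have h4 := hp.2 (insert u X) (insert_subset hu (fun x hx => mem_of_mem_erase (hX hx)))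
      (by rw [card_insert_of_notMem hu1]; have := hXn.card_pos; omega)
      (by refine le_trans h2 (card_le_card fun x hx => ?_)
          simp at hx ⊢; tauto)
    rw [card_insert_of_notMem hu1] at h4
    omega
  intro X hX hXn hXE
  by_cases h2 : 2 ≤ (E.erase u \ X).card
  · exact key X hX hXn h2
  · have h3 := card_sdiff_add_card_eq_card hX
    have h4 : (E.erase u \ X).Nonempty := by
      rw [sdiff_nonempty]; exact fun h => hXE (subset_antisymm hX h)
    have h5 := key _ sdiff_subset h4 (by rw [Finset.sdiff_sdiff_eq_self hX]; omega)
    have h6 := (hL.mnr hu hi).dual hX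
    have := h4.card_pos
    omega

theorem finrank_le_one {A : Spc V} (h : Module.finrank (ZMod 2) A ≤ 1)
    {x y : V → K} (hx : x ∈ A) (hy : y ∈ A) (hx0 : x ≠ 0) (hy0 : y ≠ 0) : x = y := by
  by_contra hxy
  have : LinearIndependent (ZMod 2) ![(⟨x, hx⟩ : A), ⟨y, hy⟩] := by
    rw [Fintype.linearIndependent_iff]
    intro g hg
    simp only [Fin.sum_univ_two, Matrix.cons_val_zero, Matrix.cons_val_one] at hg
    have hg := congrArg Subtype.val hg
    rcases z2 (g 0) with h0 | h0 <;> rcases z2 (g 1) with h1 | h1 <;>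
      simp [h0, h1, vadd_eq_zero] at hg <;> first | contradiction | skip
    intro i; fin_cases i <;> simp [h0, h1]
  have := this.fintype_card_le_finrank
  simp at this; omega

theorem finrank_le_two {A : Spc V} (h : Module.finrank (ZMod 2) A ≤ 2)
    {x y z : V → K} (hx : x ∈ A) (hy : y ∈ A) (hz : z ∈ A) (hx0 : x ≠ 0) (hy0 : y ≠ 0)
    (hxy : x ≠ y) : z = 0 ∨ z = x ∨ z = y ∨ z = x + y := by
  by_contra hcon
  push Not at hcon
  obtain ⟨c1, c2, c3, c4⟩ := hcon
  have : LinearIndependent (ZMod 2) ![(⟨x, hx⟩ : A), ⟨y, hy⟩, ⟨z, hz⟩] := by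
    rw [Fintype.linearIndependent_iff]
    intro g hg
    simp only [Fin.sum_univ_three, Matrix.cons_val_zero, Matrix.cons_val_one, Matrix.cons_val] at hg
    have hg := congrArg Subtype.val hg
    rcases z2 (g 0) with h0 | h0 <;> rcases z2 (g 1) with h1 | h1 <;>
    rcases z2 (g 2) with h2 | h2 <;>
      simp [h0, h1, h2, vadd_eq_zero] at hg <;>
      first | contradiction | (exfalso; first | exact c2 hg.symm | exact c3 hg.symm | exact c4 hg.symm) | skip
    intro i; fin_cases i <;> simp [h0, h1, h2]
  have := this.fintype_card_le_finrank
  simp at this; omega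

theorem mem_inter_W (hL : Lag E L) {R} (hR : R ∈ L) (hX : R ∈ W X) :
    R ∈ L ⊓ W (E ∩ X) := by
  rw [← W_inf]; exact ⟨hR, hL.le_W hR, hX⟩

theorem Prim.pair (hL : Lag E L) (hp : Prim E L) (hn : 4 ≤ E.card) {R} (hR : R ∈ L)
    (hX : R ∈ W X) (hc : X.card ≤ 2) : R = 0 := by
  have h1 := mem_inter_W hL hR hX
  have h2 : (E ∩ X).card ≤ 2 := (card_le_card inter_subset_right).trans hc
  have hd : d L (E ∩ X) = 0 := by
    by_cases h0 : (E ∩ X).card = 0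
    · rw [card_eq_zero.1 h0]; unfold d
      rw [Submodule.finrank_eq_zero, eq_bot_iff]
      rintro Q ⟨_, hQ⟩; ext1 v; exact hQ v (by simp)
    · by_cases h3 : (E ∩ X).card = 2
      · have := hp.2 (E ∩ X) inter_subset_left h3.ge (by
          have := card_sdiff_add_card_eq_card (inter_subset_left (s₁ := E) (s₂ := X)); omega)
        omega
      · have := hp.1 (E ∩ X) inter_subset_left (card_pos.1 (by omega)) (fun h => by rw [h] at h2; omega)
        omega
  unfold d at hd
  rw [Submodule.finrank_eq_zero] at hd
  rw [hd] at h1; simpa using h1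

theorem Prim.triple (hL : Lag E L) (hp : Prim E L) (hn : 5 ≤ E.card) {R Q} (hR : R ∈ L)
    (hX : R ∈ W X) (hQ : Q ∈ L) (hQX : Q ∈ W X) (hc : X.card ≤ 3) (hR0 : R ≠ 0) (hQ0 : Q ≠ 0) :
    R = Q := by
  by_cases hle : X.card ≤ 2
  · exact absurd (hp.pair hL (by omega) hR hX hle) hR0
  by_cases hle : (E ∩ X).card ≤ 2
  · exact absurd (hp.pair hL (by omega) hR (mem_inter_W hL hR hX).2 hle) hR0
  have h2 : (E ∩ X).card ≤ 3 := (card_le_card inter_subset_right).trans hc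
  have := hp.2 (E ∩ X) inter_subset_left (by omega) (by
    have := card_sdiff_add_card_eq_card (inter_subset_left (s₁ := E) (s₂ := X)); omega)
  exact finrank_le_one (A := L ⊓ W (E ∩ X)) (by unfold d at this; omega)
    (mem_inter_W hL hR hX) (mem_inter_W hL hQ hQX) hR0 hQ0

theorem Prim.quad (hL : Lag E L) (hp : Prim E L) (hn : 6 ≤ E.card) {R Q S} (hR : R ∈ L)
    (hX : R ∈ W X) (hQ : Q ∈ L) (hQX : Q ∈ W X) (hS : S ∈ L) (hSX : S ∈ W X) (hc : X.card ≤ 4)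
    (hR0 : R ≠ 0) (hQ0 : Q ≠ 0) (hRQ : R ≠ Q) :
    S = 0 ∨ S = R ∨ S = Q ∨ S = R + Q := by
  by_cases hle : (E ∩ X).card ≤ 3
  · exact absurd (hp.triple hL (by omega) hR (mem_inter_W hL hR hX).2 hQ
      (mem_inter_W hL hQ hQX).2 hle hR0 hQ0) hRQ
  have h2 : (E ∩ X).card ≤ 4 := (card_le_card inter_subset_right).trans hc
  have := hp.2 (E ∩ X) inter_subset_left (by omega) (by
    have := card_sdiff_add_card_eq_card (inter_subset_left (s₁ := E) (s₂ := X)); omega)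
  exact finrank_le_two (A := L ⊓ W (E ∩ X)) (by unfold d at this; omega)
    (mem_inter_W hL hR hX) (mem_inter_W hL hQ hQX) (mem_inter_W hL hS hSX) hR0 hQ0 hRQ

/-- `R` is a vector of `L` with support exactly `{v,a,b}`. -/
structure Tr (L : Spc V) (v a b : V) (R : V → K) : Prop where
  mem : R ∈ L
  hv : R v ≠ 0
  ha : R a ≠ 0
  hb : R b ≠ 0
  va : v ≠ a
  vb : v ≠ b
  ab : a ≠ b
  zero : ∀ x, x ≠ v → x ≠ a → x ≠ b → R x = 0

theorem Tr.swap {v a b : V} (h : Tr L v a b R) : Tr L v b a R :=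
  ⟨h.mem, h.hv, h.hb, h.ha, h.vb, h.va, h.ab.symm, fun x h1 h2 h3 => h.zero x h1 h3 h2⟩
theorem Tr.rot {v a b : V} (h : Tr L v a b R) : Tr L a b v R :=
  ⟨h.mem, h.ha, h.hb, h.hv, h.ab, h.va.symm, h.vb.symm, fun x h1 h2 h3 => h.zero x h3 h1 h2⟩
theorem Tr.mem_W {v a b : V} (h : Tr L v a b R) : R ∈ W {v, a, b} := by
  intro x hx; simp at hx; exact h.zero x hx.1 hx.2.1 hx.2.2
theorem Tr.ne_zero {v a b : V} (h : Tr L v a b R) : R ≠ 0 := fun h0 => h.hv (by simp [h0])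

theorem omV_two {R Q : V → K} {v x : V} (hvx : v ≠ x)
    (h : ∀ w, w ≠ v → w ≠ x → R w = 0 ∨ Q w = 0) :
    omV R Q = om (R v) (Q v) + om (R x) (Q x) := by
  unfold omV
  rw [← sum_pair hvx (f := fun w => om (R w) (Q w))]
  symm; apply sum_subset (subset_univ _)
  intro w _ hw
  simp at hw
  rcases h w hw.1 hw.2 with h | h
  · rw [h, om_zero_left]
  · rw [h, om_zero_right]

theorem omV_one {R Q : V → K} {v : V} (h : ∀ w, w ≠ v → R w = 0 ∨ Q w = 0) :
    omV R Q = om (R v) (Q v) := by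
  unfold omV
  apply sum_eq_single_of_mem v (mem_univ _)
  intro w _ hw
  rcases h w hw with h | h
  · rw [h, om_zero_left]
  · rw [h, om_zero_right]

theorem Tr.share (hL : Lag E L) (hp : Prim E L) (hn : 5 ≤ E.card) {v a b c e : V} {R Q : V → K}
    (hR : Tr L v a b R) (hQ : Tr L v c e Q) (hRQ : R v ≠ Q v) :
    ∃ x y z, Tr L v x y R ∧ Tr L v x z Q ∧ y ≠ z ∧ R x ≠ Q x ∧ ((x = a ∧ y = b) ∨ (x = b ∧ y = a)) ∧
      ((x = c ∧ z = e) ∨ (x = e ∧ z = c)) := by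
  have main : ∀ {x y z : V}, Tr L v x y R → Tr L v x z Q → y ≠ z ∧ R x ≠ Q x := by
    intro x y z h1 h2
    have hyz : y ≠ z := by
      rintro rfl
      have := hp.triple hL hn h1.mem h1.mem_W h2.mem h2.mem_W card_le_three h1.ne_zero h2.ne_zero
      exact hRQ (by rw [this])
    refine ⟨hyz, fun hx => ?_⟩
    have := hL.iso h1.mem h2.mem
    rw [omV_two h1.va (fun w h3 h4 => ?_), hx, om_self, om_ne _ _ h1.hv h2.hv hRQ] at this
    · exact absurd this (by decide)
    · by_cases hw : w = y
      · right; exact h2.zero w h3 h4 (by rw [hw]; exact hyz)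
      · left; exact h1.zero w h3 h4 hw
  have : a = c ∨ a = e ∨ b = c ∨ b = e := by
    by_contra hcon
    push Not at hcon
    have := hL.iso hR.mem hQ.mem
    rw [omV_one (v := v) (fun w h3 => ?_), om_ne _ _ hR.hv hQ.hv hRQ] at this
    · exact absurd this (by decide)
    · by_cases h1 : w = a
      · right; subst h1; exact hQ.zero w h3 hcon.1 hcon.2.1
      by_cases h2 : w = b
      · right; subst h2; exact hQ.zero w h3 hcon.2.2.1 hcon.2.2.2
      left; exact hR.zero w h3 h1 h2
  rcases this with h | h | h | h
  · subst h; exact ⟨_, _, _, hR, hQ, (main hR hQ).1, (main hR hQ).2, by simp, by simp⟩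
  · subst h; exact ⟨_, _, _, hR, hQ.swap, (main hR hQ.swap).1, (main hR hQ.swap).2, by simp, by simp⟩
  · subst h; exact ⟨_, _, _, hR.swap, hQ, (main hR.swap hQ).1, (main hR.swap hQ).2, by simp, by simp⟩
  · subst h; exact ⟨_, _, _, hR.swap, hQ.swap, (main hR.swap hQ.swap).1, (main hR.swap hQ.swap).2, by simp, by simp⟩

/-- Reducible vertex. -/
def Redu (E : Finset V) (L : Spc V) (u : V) : Prop :=
  ∃ i : K, i ≠ 0 ∧ Prim (E.erase u) (mnr L u i)

theorem exists_split (hL : Lag E L) (hp : Prim E L) (hn : 5 ≤ E.card) (hu : u ∈ E)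
    (hr : ¬ Redu E L u) {i : K} (hi : i ≠ 0) :
    ∃ X, X ⊆ E.erase u ∧ 2 ≤ X.card ∧ 2 ≤ (E.erase u \ X).card ∧
      X.card ≤ d (mnr L u i) X + 1 := by
  by_contra hcon
  push Not at hcon
  refine hr ⟨i, hi, hp.mnr_conn hL hn hu hi, fun X h1 h2 h3 => ?_⟩
  have := hcon X h1 h2 h3
  omega

theorem tri_of_two (hL : Lag E L) (hp : Prim E L) (hn : 5 ≤ E.card) (hu : u ∈ E) {i : K}
    (hi : i ≠ 0) (hX : X ⊆ E.erase u) (h2 : X.card = 2) (h : 2 ≤ d (mnr L u i) X + 1) :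
    ∃ a b R, X = {a, b} ∧ Tr L u a b R ∧ R u = i := by
  obtain ⟨a, b, hab, rfl⟩ := card_eq_two.1 h2
  have hua : u ≠ a := fun h => by simpa [h] using hX (show a ∈ ({a, b} : Finset V) by simp)
  have hub : u ≠ b := fun h => by simpa [h] using hX (show b ∈ ({a, b} : Finset V) by simp)
  have h3 : 0 < Module.finrank (ZMod 2) (mnr L u i ⊓ W {a, b} : Spc V) := by
    unfold d at h; omega
  have : (mnr L u i ⊓ W {a, b} : Spc V) ≠ ⊥ := fun h0 => by
    rw [h0] at h3; simp at h3
  obtain ⟨Q, ⟨hQ, hQW⟩, hQ0⟩ := Submodule.exists_mem_ne_zero_of_ne_bot this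
  obtain ⟨R, hR, hRi, rfl⟩ := mem_mnr_iff.1 hQ
  have hz : ∀ x, x ≠ u → x ≠ a → x ≠ b → R x = 0 := fun x h1 h2 h3 => by
    have := hQW x (by simp [h2, h3]); rwa [kill_ne h1] at this
  have hR0 : R ≠ 0 := by rintro rfl; apply hQ0; ext1 x; by_cases h : x = u <;> simp [kill, h]
  have hnz : ∀ x y, (∀ z, z ≠ x → z ≠ y → R z = 0) → False := fun x y hh => by
    refine hR0 (hp.pair hL (by omega) hR (X := {x, y}) (fun z hz => ?_) card_le_two)
    simp at hz; exact hh z hz.1 hz.2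
  have hRu : R u ≠ 0 := fun h0 => hnz a b (fun z h1 h2 => by
    by_cases h : z = u
    · rw [h, h0]
    · exact hz z h h1 h2)
  refine ⟨a, b, R, rfl, ⟨hR, hRu, fun h0 => hnz u b (fun z h1 h2 => ?_), fun h0 => hnz u a (fun z h1 h2 => ?_), hua, hub, hab, hz⟩, hRi.resolve_left hRu⟩
  · by_cases h : z = a
    · rw [h, h0]
    · exact hz z h1 h h2
  · by_cases h : z = b
    · rw [h, h0]
    · exact hz z h1 h2 h

theorem two_types (hL : Lag E L) (hp : Prim E L) (hn : 5 ≤ E.card) (hu : u ∈ E)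
    (hr : ¬ Redu E L u) {i j : K} (hi : i ≠ 0) (hj : j ≠ 0) (hij : i ≠ j) :
    (∃ a b R, Tr L u a b R ∧ R u = i) ∨ (∃ a b R, Tr L u a b R ∧ R u = j) := by
  obtain ⟨X, hX, hX2, hX2', hXd⟩ := exists_split hL hp hn hu hr hi
  obtain ⟨Y, hY, hY2, hY2', hYd⟩ := exists_split hL hp hn hu hr hj
  have eX := (hL.mnr hu hi).dual hX
  have eY := (hL.mnr hu hj).dual hY
  have hX' : E.erase u \ X ⊆ E.erase u := sdiff_subset
  have hY' : E.erase u \ Y ⊆ E.erase u := sdiff_subset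
  have a1 := split_aux hp hu hij hX hY hXd hYd
  have a2 := split_aux hp hu hij hX' hY (by omega) hYd
  have c1 := card_inter_add_card_sdiff Y X
  have c2 := card_inter_add_card_sdiff X Y
  have c3 := card_inter_add_card_sdiff (E.erase u \ X) Y
  have c4 := card_inter_add_card_sdiff (E.erase u \ Y) X
  have e1 : Y ∩ X = X ∩ Y := inter_comm _ _
  have e2 : Y \ X = (E.erase u \ X) ∩ Y := by
    ext x; simp only [mem_sdiff, mem_inter]
    constructor
    · rintro ⟨h1, h2⟩; exact ⟨⟨hY h1, h2⟩, h1⟩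
    · rintro ⟨⟨h1, h2⟩, h3⟩; exact ⟨h3, h2⟩
  have e3 : X \ Y = E.erase u \ (E.erase u \ X ∪ Y) := by
    ext x; simp only [mem_sdiff, mem_union]
    constructor
    · rintro ⟨h1, h2⟩; exact ⟨hX h1, by tauto⟩
    · rintro ⟨h1, h2⟩; tauto
  have e4 : (E.erase u \ X) \ Y = E.erase u \ (X ∪ Y) := by
    ext x; simp only [mem_sdiff, mem_union]; tauto
  have e5 : (E.erase u \ Y) \ X = E.erase u \ (X ∪ Y) := by
    ext x; simp only [mem_sdiff, mem_union]; tauto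
  have e6 : (E.erase u \ Y) ∩ X = X \ Y := by
    ext x; simp only [mem_sdiff, mem_inter]
    constructor
    · rintro ⟨h1, h2⟩; exact ⟨h2, h1.2⟩
    · rintro ⟨h1, h2⟩; exact ⟨⟨hX h1, h2⟩, h1⟩
  rw [e1, e2] at c1
  rw [e3] at c2
  rw [e4] at c3
  rw [e5, e6, e3] at c4
  have : X.card = 2 ∨ (E.erase u \ X).card = 2 ∨ Y.card = 2 ∨ (E.erase u \ Y).card = 2 := by
    omega
  rcases this with h | h | h | h
  · obtain ⟨a, b, R, _, hh⟩ := tri_of_two hL hp hn hu hi hX h (by omega); exact Or.inl ⟨a, b, R, hh⟩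
  · obtain ⟨a, b, R, _, hh⟩ := tri_of_two hL hp hn hu hi hX' h (by omega); exact Or.inl ⟨a, b, R, hh⟩
  · obtain ⟨a, b, R, _, hh⟩ := tri_of_two hL hp hn hu hj hY h (by omega); exact Or.inr ⟨a, b, R, hh⟩
  · obtain ⟨a, b, R, _, hh⟩ := tri_of_two hL hp hn hu hj hY' h (by omega); exact Or.inr ⟨a, b, R, hh⟩

theorem Tr.inE (hL : Lag E L) {v a b : V} (h : Tr L v a b R) : v ∈ E ∧ a ∈ E ∧ b ∈ E := by
  refine ⟨?_, ?_, ?_⟩ <;> by_contra hc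
  · exact h.hv (hL.supp h.mem _ hc)
  · exact h.ha (hL.supp h.mem _ hc)
  · exact h.hb (hL.supp h.mem _ hc)

theorem sub4a (v a b f : V) : ({v, a, b} : Finset V) ⊆ {v, a, b, f} := by
  intro z; simp; tauto
theorem sub4b (v a b f : V) : ({v, a, f} : Finset V) ⊆ {v, a, b, f} := by
  intro z; simp; tauto

theorem red_of_three (hL : Lag E L) (hp : Prim E L) (hn : 6 ≤ E.card) {v a b c e : V} {R S T : V → K}
    (hR : Tr L v a b R) (hS : Tr L v a c S) (hT : Tr L v a e T) (hbc : b ≠ c) (hbe : b ≠ e)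
    (hce : c ≠ e) (h1 : (R + S + T) v = 0) (h2 : (R + S + T) a = 0) : Redu E L b := by
  by_contra hr
  have hU : Tr L b c e (R + S + T) := by
    refine ⟨L.add_mem (L.add_mem hR.mem hS.mem) hT.mem, ?_, ?_, ?_, hbc, hbe, hce, ?_⟩
    · simp [hS.zero b hR.vb.symm hR.ab.symm hbc, hT.zero b hR.vb.symm hR.ab.symm hbe, hR.hb]
    · simp [hR.zero c hS.vb.symm hS.ab.symm hbc.symm, hT.zero c hS.vb.symm hS.ab.symm hce, hS.hb]
    · simp [hR.zero e hT.vb.symm hT.ab.symm hbe.symm, hS.zero e hT.vb.symm hT.ab.symm hce.symm, hT.hb]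
    · intro x x1 x2 x3
      by_cases x4 : x = v
      · rw [x4, h1]
      by_cases x5 : x = a
      · rw [x5, h2]
      simp [hR.zero x x4 x5 x1, hS.zero x x4 x5 x2, hT.zero x x4 x5 x3]
  have hUb : (R + S + T) b = R b := by
    simp [hS.zero b hR.vb.symm hR.ab.symm hbc, hT.zero b hR.vb.symm hR.ab.symm hbe]
  have htypes : ∀ k : K, k ≠ 0 → ∃ i j : K, i ≠ 0 ∧ j ≠ 0 ∧ i ≠ j ∧ i ≠ k ∧ j ≠ k := by decide
  obtain ⟨i, j, hi, hj, hij, hik, hjk⟩ := htypes (R b) hR.hb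
  have : ∃ x y Q, Tr L b x y Q ∧ Q b ≠ R b := by
    rcases two_types hL hp (by omega) (hR.inE hL).2.2 hr hi hj hij with ⟨x, y, Q, h, h'⟩ | ⟨x, y, Q, h, h'⟩
    · exact ⟨x, y, Q, h, h' ▸ hik⟩
    · exact ⟨x, y, Q, h, h' ▸ hjk⟩
  obtain ⟨x, y, Q, hQ, hQb⟩ := this
  obtain ⟨x1, y1, z1, -, -, -, -, hA, hB⟩ := hQ.share hL hp (by omega) hR.rot.rot hQb
  obtain ⟨x2, y2, z2, -, -, -, -, hC, hD⟩ := hQ.share hL hp (by omega) hU (by rw [hUb]; exact hQb)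
  have hx1 : x1 = v ∨ x1 = a := by rcases hB with h | h <;> simp [h.1]
  have fin : ∀ (f : V) (P : V → K), Tr L v a f P → b ≠ f → (f = x1 ∨ f = y1) →
      (f ≠ x1) → False := by
    intro f P hP hbf hf hfx
    have hf : f = y1 := hf.resolve_left hfx
    have hPb : P b = 0 := hP.zero b hR.vb.symm hR.ab.symm hbf
    have hcard : ({v, a, b, f} : Finset V).card ≤ 4 := card_le_four
    have := hp.quad hL hn hR.mem (W_mono (sub4a v a b f) hR.mem_W) hP.mem
      (W_mono (sub4b v a b f) hP.mem_W) hQ.mem (X := {v, a, b, f}) (fun z hz => by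
        simp only [mem_insert, mem_singleton, not_or] at hz
        have hzx : z ≠ x1 := by
          rcases hx1 with h3 | h3 <;> rw [h3]
          exacts [hz.1, hz.2.1]
        have hzy : z ≠ y1 := hf ▸ hz.2.2.2
        rcases hA with ⟨h, h'⟩ | ⟨h, h'⟩
        · exact hQ.zero z hz.2.2.1 (h ▸ hzx) (h' ▸ hzy)
        · exact hQ.zero z hz.2.2.1 (h' ▸ hzy) (h ▸ hzx)) hcard hR.ne_zero hP.ne_zero
      (fun h => hR.hb (h ▸ hPb))
    rcases this with h | h | h | h
    · exact hQ.hv (by rw [h]; rfl)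
    · exact hQb (by rw [h])
    · exact hQ.hv (by rw [h, hPb])
    · exact hQb (by rw [h]; simp [hPb])
  have hx2 : x2 = c ∨ x2 = e := by rcases hD with h | h <;> simp [h.1]
  have hx2' : x2 = x1 ∨ x2 = y1 := by
    rcases hA with ⟨h, h'⟩ | ⟨h, h'⟩ <;> rcases hC with ⟨k, k'⟩ | ⟨k, k'⟩ <;> simp [h, h', k, k']
  rcases hx2 with h | h
  · refine fin c S hS hbc (h ▸ hx2') ?_
    rcases hx1 with h | h <;> rw [h]
    exacts [hS.vb.symm, hS.ab.symm]
  · refine fin e T hT hbe (h ▸ hx2') ?_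
    rcases hx1 with h | h <;> rw [h]
    exacts [hT.vb.symm, hT.ab.symm]

theorem split_type (hL : Lag E L) (hp : Prim E L) (hu : u ∈ E) {i : K} 
    (hX : X ⊆ E.erase u) (h2 : 1 ≤ X.card) (h2' : 2 ≤ (E.erase u \ X).card)
    (h : X.card ≤ d (mnr L u i) X + 1) (hR : R ∈ L) (hRW : R ∈ W (insert u X)) :
    R u = 0 ∨ R u = i := by
  have hu1 : u ∉ X := fun h => by simpa using hX h
  have h1 := d_mnr_le L u i X
  have h3 := hp.2 (insert u X) (insert_subset hu (fun x hx => mem_of_mem_erase (hX hx)))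
      (by rw [card_insert_of_notMem hu1]; omega)
      (by refine le_trans h2' (card_le_card fun x hx => ?_)
          simp at hx ⊢; tauto)
  rw [card_insert_of_notMem hu1] at h3
  have : U L u i X = L ⊓ W (insert u X) :=
    Submodule.eq_of_le_of_finrank_le inf_le_left (by unfold d at *; omega)
  have h4 : R ∈ U L u i X := this ▸ ⟨hR, hRW⟩
  exact h4.2

theorem third_tri (hL : Lag E L) (hp : Prim E L) (hn : 6 ≤ E.card) {v a b c : V} {R S : V → K}
    (hr : ¬ Redu E L v)
    (hR : Tr L v a b R) (hS : Tr L v a c S) (hbc : b ≠ c) (h1 : R v ≠ S v) (h2 : R a ≠ S a) :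
    ∃ e T, Tr L v a e T ∧ e ≠ b ∧ e ≠ c ∧ T v = R v + S v := by
  have hv := (hR.inE hL).1
  have hk : R v + S v ≠ 0 := fun h => h1 (by
    have := congrArg (· + S v) h; simpa [add_assoc, kadd] using this)
  have hRk : ¬ (R v = 0 ∨ R v = R v + S v) := by
    rintro (h | h)
    · exact hR.hv h
    · exact hS.hv (by simpa using h.symm)
  have hSk : ¬ (S v = 0 ∨ S v = R v + S v) := by
    rintro (h | h)
    · exact hS.hv h
    · exact hR.hv (by simpa using h.symm)
  obtain ⟨X, ⟨hX, hX2, hX2', hXd⟩, haX⟩ : ∃ X, (X ⊆ E.erase v ∧ 2 ≤ X.card ∧ 2 ≤ (E.erase v \ X).card ∧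
      X.card ≤ d (mnr L v (R v + S v)) X + 1) ∧ a ∈ X := by
    obtain ⟨X, hX, hX2, hX2', hXd⟩ := exists_split hL hp (by omega) hv hr hk
    by_cases ha : a ∈ X
    · exact ⟨X, ⟨hX, hX2, hX2', hXd⟩, ha⟩
    · have eX := (hL.mnr hv hk).dual hX
      refine ⟨E.erase v \ X, ⟨sdiff_subset, hX2', ?_, by omega⟩, ?_⟩
      · rw [Finset.sdiff_sdiff_eq_self hX]; exact hX2
      · exact mem_sdiff.2 ⟨mem_erase.2 ⟨hR.va.symm, (hR.inE hL).2.1⟩, ha⟩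
  · have eX := (hL.mnr hv hk).dual hX
    have hbX : b ∉ X := fun hb => hRk (split_type hL hp hv hX (by omega) hX2' hXd hR.mem
      (W_mono (by intro z; simp; rintro (rfl | rfl | rfl) <;> simp [haX, hb]) hR.mem_W))
    have hcX : c ∉ X := fun hb => hSk (split_type hL hp hv hX (by omega) hX2' hXd hS.mem
      (W_mono (by intro z; simp; rintro (rfl | rfl | rfl) <;> simp [haX, hb]) hS.mem_W))
    have hbE : b ∈ E.erase v := mem_erase.2 ⟨hR.vb.symm, (hR.inE hL).2.2⟩
    have hcE : c ∈ E.erase v := mem_erase.2 ⟨hS.vb.symm, (hS.inE hL).2.2⟩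
    have hX3 : X.card = 2 := by
      by_contra hX3
      set Y := E.erase v \ X with hY
      have haY : a ∉ Y := by simp [hY, haX]
      have hbY : b ∈ Y := by simp only [hY, mem_sdiff]; exact ⟨hbE, hbX⟩
      have hcY : c ∈ Y := by simp only [hY, mem_sdiff]; exact ⟨hcE, hcX⟩
      have hsub : insert a Y ⊆ E.erase v := insert_subset (hX haX) sdiff_subset
      have hlt : d (mnr L v (R v + S v)) Y < d (mnr L v (R v + S v)) (insert a Y) := by
        apply Submodule.finrank_lt_finrank_of_lt
        refine lt_of_le_of_ne (inf_le_inf le_rfl (W_mono (subset_insert _ _))) fun heq => ?_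
        have hm : kill v (R + S) ∈ mnr L v (R v + S v) ⊓ W (insert a Y) := by
          refine ⟨kill_mem_mnr (L.add_mem hR.mem hS.mem) (Or.inr rfl), fun z hz => ?_⟩
          by_cases hzv : z = v
          · rw [hzv, kill_same]
          · have hz1 : z ≠ a := by rintro rfl; simp at hz
            have hz2 : z ≠ b := by rintro rfl; simp [hbY] at hz
            have hz3 : z ≠ c := by rintro rfl; simp [hcY] at hz
            rw [kill_ne hzv]; simp [hR.zero z hzv hz1 hz2, hS.zero z hzv hz1 hz3]
        rw [← heq] at hm
        have := hm.2 a haY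
        rw [kill_ne hR.va.symm] at this
        apply h2
        have h3 : R a + S a = 0 := this
        have := congrArg (· + S a) h3; simpa [add_assoc, kadd] using this
      have hc1 : (insert a Y).card = Y.card + 1 := card_insert_of_notMem haY
      have hc2 := card_sdiff_add_card_eq_card hsub
      have hc3 : Y.card + X.card = (E.erase v).card := card_sdiff_add_card_eq_card hX
      refine hRk (split_type hL hp hv hsub (by omega) (by omega) (by omega) hR.mem
        (W_mono (by intro z; simp only [mem_insert, mem_singleton]
                    rintro (rfl | rfl | rfl) <;> simp [hbY]) hR.mem_W))
    obtain ⟨x, y, T, hxy, hT, hTk⟩ := tri_of_two hL hp (by omega) hv hk hX hX3 (by omega)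
    have : a = x ∨ a = y := by rw [hxy] at haX; simpa using haX
    have hbX' : b ≠ x ∧ b ≠ y := by rw [hxy] at hbX; simpa using hbX
    have hcX' : c ≠ x ∧ c ≠ y := by rw [hxy] at hcX; simpa using hcX
    rcases this with rfl | rfl
    · exact ⟨y, T, hT, hbX'.2.symm, hcX'.2.symm, hTk⟩
    · exact ⟨x, T, hT.swap, hbX'.1.symm, hcX'.1.symm, hTk⟩

theorem three_red (hL : Lag E L) (hp : Prim E L) (hn : 6 ≤ E.card) :
    ∃ a b c, a ∈ E ∧ b ∈ E ∧ c ∈ E ∧ a ≠ b ∧ a ≠ c ∧ b ≠ c ∧ Redu E L a ∧ Redu E L b ∧ Redu E L c := by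
  by_cases hall : ∀ v ∈ E, Redu E L v
  · obtain ⟨a, ha, b, hb, c, hc, h1, h2, h3⟩ := two_lt_card.1 (show 2 < E.card by omega)
    exact ⟨a, b, c, ha, hb, hc, h1, h2, h3, hall a ha, hall b hb, hall c hc⟩
  push Not at hall
  obtain ⟨v, hv, hr⟩ := hall
  have : ∃ a b c e R S, Tr L v a b R ∧ Tr L v c e S ∧ R v ≠ S v := by
    have h1 := two_types hL hp (by omega) hv hr (i := (1,0)) (j := (0,1)) (by decide) (by decide) (by decide)
    have h2 := two_types hL hp (by omega) hv hr (i := (1,0)) (j := (1,1)) (by decide) (by decide) (by decide)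
    have h3 := two_types hL hp (by omega) hv hr (i := (0,1)) (j := (1,1)) (by decide) (by decide) (by decide)
    rcases h1 with ⟨a, b, R, hR, e1⟩ | ⟨a, b, R, hR, e1⟩
    · rcases h3 with ⟨c, e, S, hS, e2⟩ | ⟨c, e, S, hS, e2⟩
      · exact ⟨a, b, c, e, R, S, hR, hS, by rw [e1, e2]; decide⟩
      · exact ⟨a, b, c, e, R, S, hR, hS, by rw [e1, e2]; decide⟩
    · rcases h2 with ⟨c, e, S, hS, e2⟩ | ⟨c, e, S, hS, e2⟩
      · exact ⟨a, b, c, e, R, S, hR, hS, by rw [e1, e2]; decide⟩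
      · exact ⟨a, b, c, e, R, S, hR, hS, by rw [e1, e2]; decide⟩
  obtain ⟨a, b, c, e, R, S, hR, hS, hne⟩ := this
  obtain ⟨a, b, c, hR, hS, hbc, hne', -⟩ := hR.share hL hp (by omega) hS hne
  obtain ⟨e, T, hT, heb, hec, hTv⟩ := third_tri hL hp hn hr hR hS hbc hne hne'
  have hRT : R v ≠ T v := by rw [hTv]; intro h; exact hS.hv (by simpa using h.symm)
  have hST : S v ≠ T v := by rw [hTv]; intro h; exact hR.hv (by simpa using h.symm)
  have iso1 := hL.iso hR.mem hT.mem
  rw [omV_two hR.va (fun w h3 h4 => ?_), om_ne _ _ hR.hv hT.hv hRT] at iso1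
  have iso2 := hL.iso hS.mem hT.mem
  rw [omV_two hS.va (fun w h3 h4 => ?_), om_ne _ _ hS.hv hT.hv hST] at iso2
  have hTa : R a + S a + T a = 0 := by
    have := hR.ha; have := hS.ha; have := hT.ha
    clear hTv hRT hST
    revert iso1 iso2 hne' this
    generalize R a = x; generalize S a = y; generalize T a = z
    revert x y z; decide
  have hTv' : R v + S v + T v = 0 := by rw [hTv, kadd]
  refine ⟨b, c, e, (hR.inE hL).2.2, (hS.inE hL).2.2, (hT.inE hL).2.2, hbc, heb.symm, hec.symm, ?_, ?_, ?_⟩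
  · exact red_of_three hL hp hn hR hS hT hbc heb.symm hec.symm hTv' hTa
  · refine red_of_three hL hp hn hS hR hT hbc.symm hec.symm heb.symm ?_ ?_
    · rw [add_comm S R]; exact hTv'
    · rw [add_comm S R]; exact hTa
  · refine red_of_three hL hp hn hT hR hS heb hec hbc ?_ ?_
    · rw [add_assoc, add_comm]; exact hTv'
    · rw [add_assoc, add_comm]; exact hTa
  · by_cases hw : w = c
    · right; exact hT.zero w h3 h4 (by rw [hw]; exact hec.symm)
    · left; exact hS.zero w h3 h4 hw
  · by_cases hw : w = b
    · right; exact hT.zero w h3 h4 (by rw [hw]; exact heb.symm)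
    · left; exact hR.zero w h3 h4 hw
end

section
/-- A 4-regular multigraph on `E`: a pairing of the half-edges `V × K`. -/
structure Dg (E : Finset V) (ι : V × K → V × K) : Prop where
  inv : ∀ e, ι (ι e) = e
  fixE : ∀ e, e.1 ∈ E → ι e ≠ e
  out : ∀ e, e.1 ∉ E → ι e = e

theorem Dg.mem (h : Dg E ι) (he : e.1 ∈ E) : (ι e).1 ∈ E := by
  by_contra hc
  have := h.out _ hc
  rw [h.inv] at this
  exact h.fixE e he this.symm

theorem Dg.mem_iff (h : Dg E ι) : (ι e).1 ∈ E ↔ e.1 ∈ E :=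
  ⟨fun he => by have := h.mem he; rwa [h.inv] at this, h.mem⟩

/-- Even edge sets, as functions on half-edges. -/
structure Cyc (E : Finset V) (ι : V × K → V × K) (p : V × K → ZMod 2) : Prop where
  inv : ∀ e, p (ι e) = p e
  even : ∀ v, ∑ y, p (v, y) = 0
  supp : ∀ e, e.1 ∉ E → p e = 0

theorem sumK {M : Type*} [AddCommMonoid M] (f : K → M) :
    ∑ y, f y = f (0,0) + f (1,0) + f (0,1) + f (1,1) := by
  have : (univ : Finset K) = {(0,0), (1,0), (0,1), (1,1)} := by decide
  rw [this, sum_insert (by decide), sum_insert (by decide), sum_insert (by decide), sum_singleton]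
  simp [add_assoc]

/-- local boundary -/
def bdK (f : K → ZMod 2) : K := (f (1,0) + f (1,1), f (0,1) + f (1,1))
/-- boundary -/
def bd (p : V × K → ZMod 2) (v : V) : K := bdK fun y => p (v, y)

theorem ext4 {P : (K → ZMod 2) → Prop}
    (h : ∀ a b c e : ZMod 2, P (fun y => if y = (0,0) then a else if y = (1,0) then b else if y = (0,1) then c else e))
    (f : K → ZMod 2) : P f := by
  have := h (f (0,0)) (f (1,0)) (f (0,1)) (f (1,1))
  convert this using 1
  ext1 y
  have : y = (0,0) ∨ y = (1,0) ∨ y = (0,1) ∨ y = (1,1) := by revert y; decide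
  rcases this with rfl | rfl | rfl | rfl <;> rfl

theorem even_om : ∀ f : K → ZMod 2, ∑ y, f y = 0 → ∀ y k, f y + f (y + k) = om (bdK f) k := by
  apply ext4; simp only [sumK]; decide

theorem even_eq {f : K → ZMod 2} (h : ∑ y, f y = 0) {y k : K} (hk : om (bdK f) k = 0) :
    f (y + k) = f y := by
  have := even_om f h y k
  rw [hk] at this
  generalize f y = a at *; generalize f (y + k) = b at *
  revert a b; decide

theorem bdK_add (f g : K → ZMod 2) : bdK (fun y => f y + g y) = bdK f + bdK g := by
  simp only [bdK, Prod.mk_add_mk]; ext <;> simp <;> ring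

theorem bd_add (p q : V × K → ZMod 2) : bd (p + q) = bd p + bd q := by
  ext1 v; exact bdK_add _ _

theorem bdK_const (c : ZMod 2) : bdK (fun _ => c) = 0 := by revert c; decide

theorem bdK_eq {f : K → ZMod 2} {r : K} (h : ∀ k, f 0 + f k = om r k) : bdK f = r := by
  have h1 := h (1,0); have h2 := h (0,1); have h3 := h (1,1)
  unfold bdK
  have e0 : f 0 = f (0,0) := rfl
  rw [e0] at *
  generalize f (0,0) = a at *; generalize f (1,0) = b at *; generalize f (0,1) = c at *
  generalize f (1,1) = e at *
  clear h e0
  revert a b c e r; decide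

theorem local_dot : ∀ f g : K → ZMod 2, ∑ y, f y = 0 → ∑ y, g y = 0 →
    om (bdK f) (bdK g) = ∑ y, f y * g y := by
  apply ext4; intro a b c e; apply ext4; revert a b c e; simp only [sumK, bdK, om]; decide

theorem Cyc.add {p q : V × K → ZMod 2} (hp : Cyc E ι p) (hq : Cyc E ι q) :
    Cyc E ι (p + q) :=
  ⟨fun e => by simp [hp.inv, hq.inv], fun v => by simp [sum_add_distrib, hp.even, hq.even],
    fun e he => by simp [hp.supp e he, hq.supp e he]⟩

theorem Cyc.zero : Cyc E ι 0 := ⟨fun _ => rfl, fun _ => by simp, fun _ _ => rfl⟩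

theorem bd_zero : bd (0 : V × K → ZMod 2) = 0 := by ext1 v; exact bdK_const 0

/-- The Lagrangian space of a 4-regular graph. -/
def LD (E : Finset V) (ι : V × K → V × K) : Spc V where
  carrier := {R | ∃ p, Cyc E ι p ∧ bd p = R}
  zero_mem' := ⟨0, Cyc.zero, bd_zero⟩
  add_mem' := by
    rintro _ _ ⟨p, hp, rfl⟩ ⟨q, hq, rfl⟩
    exact ⟨p + q, hp.add hq, bd_add _ _⟩
  smul_mem' := by
    rintro c _ ⟨p, hp, rfl⟩
    rcases z2 c with h | h
    · exact ⟨0, Cyc.zero, by simp [h, bd_zero]⟩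
    · exact ⟨p, hp, by simp [h]⟩

theorem mem_LD : R ∈ LD E ι ↔ ∃ p, Cyc E ι p ∧ bd p = R := Iff.rfl

theorem Cyc.bd_supp (hp : Cyc E ι p) {v : V} (hv : v ∉ E) :
    bd p v = 0 := by
  have : (fun y => p (v, y)) = fun _ => 0 := by ext1 y; exact hp.supp _ hv
  unfold bd; rw [this, bdK_const]

theorem omV_bd {p q : V × K → ZMod 2} (hp : ∀ v, ∑ y, p (v, y) = 0) (hq : ∀ v, ∑ y, q (v, y) = 0) :
    omV (bd p) (bd q) = ∑ e, p e * q e := by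
  rw [Fintype.sum_prod_type]
  unfold omV bd
  exact sum_congr rfl fun v _ => local_dot _ _ (hp v) (hq v)

theorem sum_inv_zero (h : Dg E ι) (f : V × K → ZMod 2) (hf : ∀ e, f (ι e) = f e)
    (hs : ∀ e, e.1 ∉ E → f e = 0) : ∑ e, f e = 0 := by
  apply sum_involution (fun e _ => ι e)
  · intro e _; rw [hf, z2add]
  · intro e _ he; apply h.fixE
    by_contra hc; exact he (hs e hc)
  · intro e _; exact mem_univ _
  · intro e _; exact h.inv e

theorem LD_iso (h : Dg E ι) {p q : V × K → ZMod 2} (hp : Cyc E ι p)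
    (hq : Cyc E ι q) : omV (bd p) (bd q) = 0 := by
  rw [omV_bd hp.even hq.even]
  exact sum_inv_zero h _ (fun e => by rw [hp.inv, hq.inv]) (fun e he => by rw [hp.supp e he, zero_mul])

section dot
variable {H : Type} [Fintype H] [DecidableEq H]
/-- Dot product form. -/
def dotB : LinearMap.BilinForm (ZMod 2) (H → ZMod 2) :=
  LinearMap.mk₂ (ZMod 2) (fun a b => ∑ e, a e * b e)
    (fun a b c => by simp [add_mul, sum_add_distrib])
    (fun c a b => by simp [mul_sum, mul_assoc])
    (fun a b c => by simp [mul_add, sum_add_distrib])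
    (fun c a b => by simp only [Pi.smul_apply, smul_eq_mul, mul_sum]; exact sum_congr rfl fun _ _ => by ring)

theorem dotB_apply (a b : H → ZMod 2) : dotB a b = ∑ e, a e * b e := rfl

theorem dotB_refl : (dotB (H := H)).IsRefl := by
  intro x y h; rw [dotB_apply] at *; simpa [mul_comm] using h

theorem dotB_single (a : H → ZMod 2) (e : H) : dotB (Pi.single e 1) a = a e := by
  rw [dotB_apply, sum_eq_single e]
  · simp
  · intro b _ hb; simp [hb]
  · simp

theorem dotB_nondeg : (dotB (H := H)).Nondegenerate := by
  refine ⟨fun x hx => ?_, fun x hx => ?_⟩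
  · ext1 e; rw [← dotB_single x e]; exact dotB_refl _ _ (hx _)
  · ext1 e; rw [← dotB_single x e]; exact hx _

theorem dot_orth (A B : Submodule (ZMod 2) (H → ZMod 2)) {q : H → ZMod 2}
    (h : ∀ p ∈ A, p ∈ B → ∑ e, p e * q e = 0) :
    ∃ i c : H → ZMod 2, q = i + c ∧ (∀ p ∈ A, ∑ e, p e * i e = 0) ∧ (∀ p ∈ B, ∑ e, p e * c e = 0) := by
  have h1 : dotB.orthogonal (dotB.orthogonal A ⊔ dotB.orthogonal B) ≤ A ⊓ B := by
    have hA := LinearMap.BilinForm.orthogonal_orthogonal dotB_nondeg dotB_refl A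
    have hB := LinearMap.BilinForm.orthogonal_orthogonal dotB_nondeg dotB_refl B
    refine le_inf ?_ ?_
    · conv_rhs => rw [← hA]
      exact LinearMap.BilinForm.orthogonal_le le_sup_left
    · conv_rhs => rw [← hB]
      exact LinearMap.BilinForm.orthogonal_le le_sup_right
  have h2 : q ∈ dotB.orthogonal (A ⊓ B) := by
    rintro p ⟨hp1, hp2⟩; exact h p hp1 hp2
  have h3 := LinearMap.BilinForm.orthogonal_le (B := dotB) h1 h2
  rw [LinearMap.BilinForm.orthogonal_orthogonal dotB_nondeg dotB_refl] at h3
  obtain ⟨i, hi, c, hc, rfl⟩ := Submodule.mem_sup.1 h3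
  exact ⟨i, c, rfl, fun p hp => hi p hp, fun p hp => hc p hp⟩
end dot

theorem sum_pair_mul {H : Type} [Fintype H] [DecidableEq H] (a b : H) (f : H → ZMod 2) :
    ∑ e, (Pi.single a 1 + Pi.single b 1 : H → ZMod 2) e * f e = f a + f b := by
  simp only [Pi.add_apply, add_mul, sum_add_distrib]
  rw [← dotB_single f a, ← dotB_single f b]; rfl

theorem LD_lag (h : Dg E ι) : Lag E (LD E ι) := by
  intro R
  constructor
  · rintro ⟨p, hp, rfl⟩
    refine ⟨fun v hv => hp.bd_supp hv, ?_⟩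
    rintro _ ⟨q, hq, rfl⟩
    exact LD_iso h hp hq
  · rintro ⟨hR, hQ⟩
    let q : V × K → ZMod 2 := fun e => om (R e.1) e.2
    have hqe : ∀ v, ∑ y, q (v, y) = 0 := by
      intro v; simp only [q, sumK]; generalize R v = r; revert r; decide
    have hqb : bd q = R := by
      ext1 v; apply bdK_eq; intro k; simp [q, om_zero_right]
    let A : Submodule (ZMod 2) (V × K → ZMod 2) :=
      { carrier := {p | (∀ e, p (ι e) = p e) ∧ ∀ e, e.1 ∉ E → p e = 0}
        zero_mem' := by simp
        add_mem' := by rintro a b ⟨h1, h2⟩ ⟨h3, h4⟩; exact ⟨fun e => by simp [h1, h3], fun e he => by simp [h2 e he, h4 e he]⟩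
        smul_mem' := by rintro c a ⟨h1, h2⟩; exact ⟨fun e => by simp [h1], fun e he => by simp [h2 e he]⟩ }
    let B : Submodule (ZMod 2) (V × K → ZMod 2) :=
      { carrier := {p | ∀ v, ∑ y, p (v, y) = 0}
        zero_mem' := by simp
        add_mem' := by intro a b h1 h2 v; simp [sum_add_distrib, h1 v, h2 v]
        smul_mem' := by intro c a h1 v; simp [← mul_sum, h1 v] }
    obtain ⟨i, c, hic, hi, hc⟩ := dot_orth A B (q := q) (fun p hpA hpB => by
      rw [← omV_bd hpB hqe, hqb, omV_comm]
      exact hQ _ ⟨p, ⟨hpA.1, hpB, hpA.2⟩, rfl⟩)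
    have hi' : ∀ e, e.1 ∈ E → i (ι e) = i e := by
      intro e he
      have := hi (Pi.single e 1 + Pi.single (ι e) 1) ⟨?_, ?_⟩
      · rw [sum_pair_mul] at this
        generalize i e = a at *; generalize i (ι e) = b at *; revert a b; decide
      · intro f
        by_cases h1 : f = e
        · subst h1; simp [h.fixE f he, (h.fixE f he).symm, h.inv]
        by_cases h2 : f = ι e
        · subst h2; simp [h.inv, h.fixE e he, (h.fixE e he).symm]
        have h3 : ι f ≠ e := fun h' => h2 (by rw [← h', h.inv])
        have h4 : ι f ≠ ι e := fun h' => h1 (by rw [← h.inv f, h', h.inv])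
        simp [h1, h2, h3, h4]
      · intro f hf
        have h1 : f ≠ e := by rintro rfl; exact hf he
        have h2 : f ≠ ι e := by rintro rfl; exact hf (h.mem he)
        simp [h1, h2]
    have hc' : ∀ v y, c (v, y) = c (v, 0) := by
      intro v y
      have := hc (Pi.single (v, y) 1 + Pi.single (v, 0) 1) ?_
      · rw [sum_pair_mul] at this
        generalize c (v, y) = a at *; generalize c (v, 0) = b at *; revert a b; decide
      · intro w
        have : ∀ z, ∑ y', (Pi.single (v, z) 1 : V × K → ZMod 2) (w, y') = if w = v then 1 else 0 := by
          intro z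
          by_cases hw : w = v
          · subst hw
            rw [sum_eq_single z]
            · simp
            · intro b _ hb
              exact Pi.single_eq_of_ne (by simpa using hb) _
            · simp
          · rw [if_neg hw]; apply sum_eq_zero; intro y' _; exact Pi.single_eq_of_ne (by simp [hw]) _
        simp only [Pi.add_apply, sum_add_distrib, this, z2add]
    have hval : ∀ v y, i (v, y) = q (v, y) + c (v, 0) := by
      intro v y; rw [hic, Pi.add_apply, hc' v y, add_assoc, z2add, add_zero]
    refine ⟨fun e => if e.1 ∈ E then i e else 0, ⟨?_, ?_, ?_⟩, ?_⟩
    · intro e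
      by_cases he : e.1 ∈ E
      · simp [he, h.mem he, hi' e he]
      · simp [he, h.out e he]
    · intro v
      by_cases hv : v ∈ E
      · simp only [hv, if_true, hval, sum_add_distrib, hqe]
        simp only [sumK]; generalize c (v, 0) = a; revert a; decide
      · simp [hv]
    · intro e he; simp [he]
    · ext1 v
      by_cases hv : v ∈ E
      · rw [← congrFun hqb v]
        simp only [bd, hv, if_true, hval]
        rw [bdK_add, bdK_const, add_zero]
      · simp only [bd, hv, if_false, bdK_const, hR v hv]

/-- Connectedness of the graph, as an induction principle. -/
theorem conn_prop (h : Dg E ι) (hc : Conn E (LD E ι)) (P : V → Prop)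
    (hP : ∀ v ∈ E, P v → ∀ y, P (ι (v, y)).1) {v0 : V} (hv0 : v0 ∈ E) (h0 : P v0) :
    ∀ v ∈ E, P v := by
  classical
  set X := E.filter P with hX
  have hXE : X ⊆ E := filter_subset _ _
  by_contra hcon
  push Not at hcon
  obtain ⟨v1, hv1, h1⟩ := hcon
  have hPi : ∀ e : V × K, e.1 ∈ E → (P (ι e).1 ↔ P e.1) := by
    intro e he
    refine ⟨fun hp => ?_, fun hp => hP e.1 he hp e.2⟩
    have := hP _ (h.mem he) hp (ι e).2
    rwa [Prod.mk.eta, h.inv] at this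
  have h2 := hc X hXE ⟨v0, mem_filter.2 ⟨hv0, h0⟩⟩ (fun he => h1 (mem_filter.1 (he ▸ hv1)).2)
  have hdual := (LD_lag h).dual hXE
  have hle : LD E ι ≤ (LD E ι ⊓ W X) ⊔ (LD E ι ⊓ W (E \ X)) := by
    rintro R ⟨p, hp, rfl⟩
    have hp1 : Cyc E ι (fun e => if P e.1 then p e else 0) := by
      refine ⟨fun e => ?_, fun v => ?_, fun e he => by simp [hp.supp e he]⟩
      · by_cases he : e.1 ∈ E
        · simp [hPi e he, hp.inv]
        · simp [h.out e he]
      · by_cases hv : P v <;> simp [hv, hp.even]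
    have hb : bd (fun e => if P e.1 then p e else 0) = fun v => if P v then bd p v else 0 := by
      ext1 v; by_cases hv : P v <;> simp [bd, hv, bdK_const]
    have m1 : bd (fun e => if P e.1 then p e else 0) ∈ LD E ι := ⟨_, hp1, rfl⟩
    have m2 : bd p ∈ LD E ι := ⟨_, hp, rfl⟩
    rw [hb] at m1
    refine Submodule.mem_sup.2 ⟨_, ⟨m1, fun v hv => ?_⟩, _, ⟨add_mem m2 m1, fun v hv => ?_⟩, ?_⟩
    · by_cases hPv : P v
      · have : v ∉ E := fun hvE => hv (mem_filter.2 ⟨hvE, hPv⟩)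
        simp [hPv, hp.bd_supp this]
      · simp [hPv]
    · by_cases hvE : v ∈ E
      · have : P v := by simp [hX, hvE] at hv; exact hv
        simp [this, kadd]
      · simp [hp.bd_supp hvE]
    · rw [add_comm (bd p), ← add_assoc, vadd, zero_add]
  have h3 := Submodule.finrank_mono hle
  have h4 := Submodule.finrank_add_le_finrank_add_finrank (LD E ι ⊓ W X) (LD E ι ⊓ W (E \ X))
  rw [(LD_lag h).finrank] at h3
  have := card_sdiff_add_card_eq_card hXE
  unfold d at *
  omega

/-- A vertex-constant invariant function is constant. -/
theorem conn_const (h : Dg E ι) (hc : Conn E (LD E ι)) {T : Type} (p : V × K → T)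
    (hp : ∀ e, e.1 ∈ E → p (ι e) = p e) (hv : ∀ v ∈ E, ∀ y, p (v, y) = p (v, 0)) :
    ∀ e e', e.1 ∈ E → e'.1 ∈ E → p e = p e' := by
  intro e e' he he'
  have := conn_prop h hc (fun v => p (v, 0) = p e) (fun v hvE hpv y => by
    rw [← hpv, ← hv v hvE y, ← hp (v, y) hvE, ← hv _ (h.mem (e := (v, y)) hvE) (ι (v, y)).2]) he
    (hv e.1 he e.2).symm e'.1 he'
  rw [← hv _ he' e'.2] at this
  exact this.symm

theorem single_notMem (hc : Conn E L) (hn : 2 ≤ E.card) (hu : u ∈ E) {i : K}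
    (hi : i ≠ 0) : Pi.single u i ∉ L := by
  intro hm
  have h1 := hc {u} (by simpa using hu) (by simp) (fun h => by rw [← h] at hn; simp at hn)
  simp at h1
  unfold d at h1
  rw [Submodule.finrank_eq_zero] at h1
  have : Pi.single u i ∈ L ⊓ W {u} := ⟨hm, fun v hv => by simp at hv; simp [hv]⟩
  rw [h1] at this
  simp at this
  exact hi this

theorem bdK_pair {a b : K} (hab : a ≠ b) : bdK (fun y => if y = a ∨ y = b then 1 else 0) = a + b ∧
    ∑ y, (if y = a ∨ y = b then 1 else 0 : ZMod 2) = 0 := by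
  simp only [sumK, bdK]; revert a b; decide

theorem no_loop (h : Dg E ι) (hc : Conn E (LD E ι)) (hn : 2 ≤ E.card) 
    (hu : u ∈ E) (y : K) : (ι (u, y)).1 ≠ u := by
  intro hl
  obtain ⟨w, z⟩ : V × K := ι (u, y)
  rcases hh : ι (u, y) with ⟨w, z⟩
  rw [hh] at hl; simp at hl; subst hl
  have hyz : y ≠ z := by rintro rfl; exact h.fixE _ hu hh
  apply single_notMem hc hn hu (i := y + z) (by
    intro h0; exact hyz (by have := congrArg (· + z) h0; simpa [add_assoc, kadd] using this))
  have hh' : ι (w, z) = (w, y) := by rw [← hh, h.inv]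
  refine ⟨fun e => if e.1 = w ∧ (e.2 = y ∨ e.2 = z) then 1 else 0, ⟨?_, ?_, ?_⟩, ?_⟩
  · intro e
    congr 1
    apply propext
    have key : ∀ e : V × K, (e.1 = w ∧ (e.2 = y ∨ e.2 = z)) → ((ι e).1 = w ∧ ((ι e).2 = y ∨ (ι e).2 = z)) := by
      rintro ⟨a, b⟩ ⟨rfl, h1⟩
      simp only at h1
      rcases h1 with rfl | rfl
      · rw [hh]; simp
      · rw [hh']; simp
    exact ⟨fun h1 => by have := key _ h1; rwa [h.inv] at this, key e⟩
  · intro v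
    by_cases hv : v = w
    · simp only [hv, true_and]; exact (bdK_pair hyz).2
    · simp [hv]
  · intro e he
    have : e.1 ≠ w := by rintro rfl; exact he hu
    simp [this]
  · ext1 v
    by_cases hv : v = w
    · subst hv; simp only [bd, true_and, Pi.single_eq_same]; exact (bdK_pair hyz).1
    · simp [bd, hv, bdK_const]

/-- Smoothing. -/
def smo (ι : V × K → V × K) (u : V) (τ : K) (e : V × K) : V × K :=
  if e.1 = u then e else if (ι e).1 = u then ι (u, (ι e).2 + τ) else ι e

theorem smo_u (h : e.1 = u) : smo ι u τ e = e := by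
  simp [smo, h]
theorem smo_at {z : K} (h : e.1 ≠ u)
    (h2 : ι e = (u, z)) : smo ι u τ e = ι (u, z + τ) := by
  simp [smo, h, h2]
theorem smo_ne (h : e.1 ≠ u)
    (h2 : (ι e).1 ≠ u) : smo ι u τ e = ι e := by
  simp [smo, h, h2]

theorem smo_dg (h : Dg E ι) (hl : ∀ y, (ι (u, y)).1 ≠ u)
    (hτ : τ ≠ 0) : Dg (E.erase u) (smo ι u τ) := by
  have hi : ∀ e, e.1 ≠ u → (ι e).1 = u → ∃ z, ι e = (u, z) := fun e _ h2 => ⟨(ι e).2, by rw [← h2]⟩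
  constructor
  · intro e
    by_cases h1 : e.1 = u
    · rw [smo_u h1, smo_u h1]
    by_cases h2 : (ι e).1 = u
    · obtain ⟨z, hz⟩ := hi e h1 h2
      rw [smo_at h1 hz, smo_at (hl _) (h.inv _), add_assoc, kadd, add_zero, ← hz, h.inv]
    · rw [smo_ne h1 h2, smo_ne h2 (by rwa [h.inv]), h.inv]
  · intro e he
    have h1 := (mem_erase.1 he).1
    by_cases h2 : (ι e).1 = u
    · obtain ⟨z, hz⟩ := hi e h1 h2
      rw [smo_at h1 hz]
      intro h3
      have := congrArg ι h3
      rw [h.inv, hz] at this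
      exact hτ (by simpa using this)
    · rw [smo_ne h1 h2]; exact h.fixE _ (mem_erase.1 he).2
  · intro e he
    by_cases h1 : e.1 = u
    · exact smo_u h1
    · have : e.1 ∉ E := fun h' => he (mem_erase.2 ⟨h1, h'⟩)
      rw [smo_ne h1 (by rwa [h.out e this]), h.out e this]

theorem smo_LD (h : Dg E ι) (hu : u ∈ E) (hl : ∀ y, (ι (u, y)).1 ≠ u)
    (hτ : τ ≠ 0) : mnr (LD E ι) u τ = LD (E.erase u) (smo ι u τ) := by
  apply ((LD_lag h).mnr hu hτ).eq_of_le (LD_lag (smo_dg h hl hτ))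
  intro R hR
  obtain ⟨_, ⟨p, hp, rfl⟩, hQ, rfl⟩ := mem_mnr_iff.1 hR
  have hpu : ∀ y, p (u, y + τ) = p (u, y) := by
    intro y; exact even_eq (f := fun y => p (u, y)) (hp.even u) (by
      change om (bd p u) τ = 0
      rcases hQ with h0 | h0 <;> rw [h0]
      · exact om_zero_left _
      · exact om_self _)
  refine ⟨fun e => if e.1 = u then 0 else p e, ⟨?_, ?_, ?_⟩, ?_⟩
  · intro e
    by_cases h1 : e.1 = u
    · simp [smo_u h1]
    by_cases h2 : (ι e).1 = u
    · have hz : ι e = (u, (ι e).2) := by rw [← h2]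
      rw [smo_at h1 hz]
      simp only [hl, h1, if_false]
      rw [hp.inv, hpu, ← hz, hp.inv]
    · rw [smo_ne h1 h2]; simp [h1, h2, hp.inv]
  · intro v
    by_cases hv : v = u <;> simp [hv, hp.even]
  · intro e he
    by_cases h1 : e.1 = u
    · simp [h1]
    · have : e.1 ∉ E := fun h' => he (mem_erase.2 ⟨h1, h'⟩)
      simp [h1, hp.supp e this]
  · ext1 v
    by_cases hv : v = u
    · subst hv; simp [bd, bdK_const, kill_same]
    · rw [kill_ne hv]; simp [bd, hv]

/-- Lift of a cycle of the smoothing. -/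
def lft (ι : V × K → V × K) (u : V) (p : V × K → ZMod 2) (e : V × K) : ZMod 2 :=
  if e.1 = u then p (ι e) else p e

theorem lft_cyc (h : Dg E ι) (hu : u ∈ E) (hl : ∀ y, (ι (u, y)).1 ≠ u)
    (hτ : τ ≠ 0) (hp : Cyc (E.erase u) (smo ι u τ) p) :
    Cyc E ι (lft ι u p) ∧ kill u (bd (lft ι u p)) = bd p ∧
      (bd (lft ι u p) u = 0 ∨ bd (lft ι u p) u = τ) ∧ ∀ y, lft ι u p (u, y + τ) = lft ι u p (u, y) := by
  have hpu : ∀ y, lft ι u p (u, y + τ) = lft ι u p (u, y) := by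
    intro y
    simp only [lft, if_true]
    rw [← hp.inv (ι (u, y)), smo_at (hl y) (h.inv _)]
  have hev : ∑ y, lft ι u p (u, y) = 0 := by
    have h1 : ∀ (f : K → ZMod 2) (t : K), t ≠ 0 → (∀ y, f (y + t) = f y) → ∑ y, f y = 0 := by
      apply ext4; simp only [sumK]; decide
    exact h1 (fun y => lft ι u p (u, y)) τ hτ hpu
  have hc : Cyc E ι (lft ι u p) := by
    refine ⟨fun e => ?_, fun v => ?_, fun e he => ?_⟩
    · by_cases h1 : e.1 = u
      · have h2 : (ι e).1 ≠ u := by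
          obtain ⟨a, b⟩ := e; have h1' : a = u := h1; subst h1'; exact hl b
        simp [lft, h1, h2]
      · by_cases h2 : (ι e).1 = u
        · simp [lft, h1, h2, h.inv]
        · simp only [lft, h1, h2, if_false]
          rw [← hp.inv e, smo_ne h1 h2]
    · by_cases hv : v = u
      · rw [hv]; exact hev
      · simp [lft, hv, hp.even]
    · have h1 : e.1 ≠ u := by rintro rfl; exact he hu
      simp only [lft, h1, if_false]; exact hp.supp e (fun h' => he (mem_erase.1 h').2)
  refine ⟨hc, ?_, ?_, hpu⟩
  · ext1 v
    by_cases hv : v = u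
    · subst hv; rw [kill_same, hp.bd_supp (by simp)]
    · rw [kill_ne hv]; simp [bd, lft, hv]
  · apply om_eq_zero _ _ hτ
    have := even_om (fun y => lft ι u p (u, y)) hev 0 τ
    change _ = om (bd (lft ι u p) u) τ at this
    rw [← this]; change lft ι u p (u, 0) + lft ι u p (u, 0 + τ) = 0; rw [hpu, z2add]
end

section
/-- `R` is obtained from `S` by deleting entries. -/
def le (R S : V → K) : Prop := ∀ v, R v = 0 ∨ R v = S v

/-- Minimal vectors. -/
def Min (L : Spc V) (R : V → K) : Prop :=
  R ∈ L ∧ R ≠ 0 ∧ ∀ Q ∈ L, le Q R → Q = 0 ∨ Q = R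

def TT (t : V × K → F) (p : V × K → ZMod 2) : F := ∑ e, if p e = 1 then t e else 0

structure Compat (E : Finset V) (ι : V × K → V × K) (L0 : Spc V)
    (t : V × K → F) : Prop where
  inv : ∀ e, t (ι e) = t e
  supp : ∀ e, e.1 ∉ E → t e = 0
  le : L0 ≤ LD E ι
  idx : ∀ R ∈ LD E ι, ∀ Q ∈ LD E ι, R ∉ L0 → Q ∉ L0 → R + Q ∈ L0
  main : ∀ p, Cyc E ι p → (bd p = 0 ∨ Min (LD E ι) (bd p)) → (TT t p = 0 ↔ bd p ∈ L0)

theorem kill_add (u : V) (R Q : V → K) : kill u (R + Q) = kill u R + kill u Q := by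
  rw [kill_eq, kill_eq, kill_eq, Pi.add_apply, Pi.single_add]; abel

theorem kill_inj (hs : Pi.single u τ ∉ L) (hR : R ∈ L)
    (hu : R u = 0 ∨ R u = τ) (hk : kill u R = 0) : R = 0 := by
  rw [kill_eq, vadd_eq_zero] at hk
  rcases hu with h | h
  · rw [hk, h, Pi.single_zero]
  · rw [h] at hk; exact absurd (hk ▸ hR) hs

theorem kill_mem_iff {L0 : Spc V} (h0 : L0 ≤ L) 
    (hs : Pi.single u τ ∉ L) (hR : R ∈ L) (hu : R u = 0 ∨ R u = τ) :
    kill u R ∈ mnr L0 u τ ↔ R ∈ L0 := by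
  refine ⟨fun h => ?_, fun h => kill_mem_mnr h hu⟩
  obtain ⟨Q, hQ, hQu, hk⟩ := mem_mnr_iff.1 h
  have : R + Q = 0 := by
    refine kill_inj hs (L.add_mem hR (h0 hQ)) ?_ (by rw [kill_add, hk, vadd])
    rcases hu with h | h <;> rcases hQu with h' | h' <;> simp [h, h', kadd]
  rwa [vadd_eq_zero.1 this]

theorem min_lift (hs : Pi.single u τ ∉ L) (hR : R ∈ L)
    (hu : R u = 0 ∨ R u = τ) (h : kill u R = 0 ∨ Min (mnr L u τ) (kill u R)) : R = 0 ∨ Min L R := by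
  rcases h with h | ⟨h1, h2, h3⟩
  · exact Or.inl (kill_inj hs hR hu h)
  · refine Or.inr ⟨hR, ?_, fun Q hQ hle => ?_⟩
    · rintro rfl; apply h2; ext1 v; simp [kill]
    have hQu : Q u = 0 ∨ Q u = τ := by
      rcases hle u with h | h
      · exact Or.inl h
      · rw [h]; exact hu
    rcases h3 _ (kill_mem_mnr hQ hQu) (fun v => by
      by_cases hv : v = u
      · subst hv; left; exact kill_same _ _
      · rw [kill_ne hv, kill_ne hv]; exact hle v) with h | h
    · exact Or.inl (kill_inj hs hQ hQu h)
    · right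
      have : Q + R = 0 := by
        refine kill_inj hs (L.add_mem hQ hR) ?_ (by rw [kill_add, h, vadd])
        rcases hu with h | h <;> rcases hQu with h' | h' <;> simp [h, h', kadd]
      exact vadd_eq_zero.1 this

/-- Smoothing of a labelling. -/
def smt (ι : V × K → V × K) (u : V) (τ : K) (t : V × K → F) (e : V × K) : F :=
  if e.1 = u then 0 else if (ι e).1 = u then t (u, (ι e).2) + t (u, (ι e).2 + τ) else t e

theorem smt_TT (h : Dg E ι) (hl : ∀ y, (ι (u, y)).1 ≠ u)
    (hτ : τ ≠ 0) (ht : ∀ e, t (ι e) = t e) 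
    (hpu : ∀ y, lft ι u p (u, y + τ) = lft ι u p (u, y)) (hp : ∀ y, p (u, y) = 0) :
    TT (smt ι u τ t) p = TT t (lft ι u p) := by
  set c : K → F := fun z => if lft ι u p (u, z) = 1 then t (u, z) else 0 with hc
  set k : V × K → F := fun e => if e.1 = u then c e.2 else 0
  set k2 : V × K → F := fun e => if e.1 = u then c (e.2 + τ) else 0
  have h1 : ∀ e, (if lft ι u p e = 1 then t e else 0)
      = (if p e = 1 then smt ι u τ t e else 0) + k e - k2 (ι e) := by
    rintro ⟨v, y⟩
    by_cases hv : v = u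
    · subst hv; simp [k, k2, hl, hp, c]
    · by_cases h2 : (ι (v, y)).1 = u
      · have hz : ι (v, y) = (u, (ι (v, y)).2) := by rw [← h2]
        set z := (ι (v, y)).2
        have hz2 : ι (u, z) = (v, y) := by rw [← hz, h.inv]
        have e1 : lft ι u p (v, y) = p (v, y) := by simp [lft, hv]
        have e2 : lft ι u p (u, z) = p (v, y) := by simp [lft, hz2]
        have e3 : t (v, y) = t (u, z) := by rw [← hz2, ht]
        have e4 : k (v, y) = 0 := by simp [k, hv]
        have e5 : k2 (ι (v, y)) = if p (v, y) = 1 then t (u, z + τ) else 0 := by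
          rw [hz]; simp only [k2, if_true, c, hpu, e2]
        have e6 : smt ι u τ t (v, y) = t (u, z) + t (u, z + τ) := by simp [smt, hv, h2, z]
        rw [e1, e3, e4, e5, e6]; split_ifs <;> ring
      · simp [lft, hv, h2, k, k2, smt]
  unfold TT
  rw [sum_congr rfl (fun e _ => h1 e), sum_sub_distrib, sum_add_distrib]
  have h2 : ∑ e, k2 (ι e) = ∑ e, k2 e :=
    Equiv.sum_comp (⟨ι, ι, h.inv, h.inv⟩ : Equiv.Perm (V × K)) k2
  have h3 : ∑ e, k2 e = ∑ e, k e := by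
    rw [← Equiv.sum_comp ((Equiv.refl V).prodCongr (Equiv.addRight τ)) k]
    apply sum_congr rfl; rintro ⟨v, y⟩ _
    simp [k, k2]
  rw [h2, h3]; ring

theorem mnr_mono {L0 : Spc V} (h0 : L0 ≤ L) (u : V) (τ : K) :
    mnr L0 u τ ≤ mnr L u τ := by
  intro R hR
  obtain ⟨Q, hQ, hQu, hk⟩ := mem_mnr_iff.1 hR
  exact mem_mnr_iff.2 ⟨Q, h0 hQ, hQu, hk⟩

theorem Compat.smo (h : Dg E ι) (hu : u ∈ E)
    (hl : ∀ y, (ι (u, y)).1 ≠ u) (hτ : τ ≠ 0) (hs : Pi.single u τ ∉ LD E ι)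
    {L0 : Spc V} (hc : Compat E ι L0 t) :
    Compat (E.erase u) (smo ι u τ) (mnr L0 u τ) (smt ι u τ t) := by
  constructor
  · intro e
    by_cases h1 : e.1 = u
    · rw [smo_u h1]
    by_cases h2 : (ι e).1 = u
    · have hz : ι e = (u, (ι e).2) := by rw [← h2]
      rw [smo_at h1 hz]
      simp only [smt, hl, h1, h2, if_false, if_true, h.inv, add_assoc, kadd, add_zero]
      rw [add_comm]
    · rw [smo_ne h1 h2]; simp [smt, h1, h2, h.inv, hc.inv]
  · intro e he
    by_cases h1 : e.1 = u
    · simp [smt, h1]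
    · have : e.1 ∉ E := fun h' => he (mem_erase.2 ⟨h1, h'⟩)
      simp [smt, h1, h.out e this, hc.supp e this]
  · rw [← smo_LD h hu hl hτ]; exact mnr_mono hc.le u τ
  · rw [← smo_LD h hu hl hτ]
    intro R hR Q hQ hR0 hQ0
    obtain ⟨R1, hR1, hRu, rfl⟩ := mem_mnr_iff.1 hR
    obtain ⟨Q1, hQ1, hQu, rfl⟩ := mem_mnr_iff.1 hQ
    rw [kill_mem_iff hc.le hs hR1 hRu] at hR0
    rw [kill_mem_iff hc.le hs hQ1 hQu] at hQ0
    rw [← kill_add]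
    refine kill_mem_mnr (hc.idx _ hR1 _ hQ1 hR0 hQ0) ?_
    rcases hRu with h | h <;> rcases hQu with h' | h' <;> simp [h, h', kadd]
  · rw [← smo_LD h hu hl hτ]
    intro p hp hm
    obtain ⟨h1, h2, h3, h4⟩ := lft_cyc h hu hl hτ hp
    rw [smt_TT h hl hτ hc.inv h4 (fun y => hp.supp _ (by simp))]
    have hm1 : bd (lft ι u p) ∈ LD E ι := ⟨_, h1, rfl⟩
    rw [← h2] at hm ⊢
    rw [kill_mem_iff hc.le hs hm1 h3]
    exact hc.main _ h1 (min_lift hs hm1 h3 hm)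
end

section
/-- Indicator of a cycle passing through the vertices of `X` once. -/
def cyX (X : Finset V) (a b : V → K) (e : V × K) : ZMod 2 :=
  if e.1 ∈ X ∧ (e.2 = a e.1 ∨ e.2 = b e.1) then 1 else 0

theorem cyX_one {a b : V → K} :
    cyX X a b e = 1 ↔ e.1 ∈ X ∧ (e.2 = a e.1 ∨ e.2 = b e.1) := by
  unfold cyX; split_ifs with h <;> simp [h]

theorem eq_of_one {x y : ZMod 2} (h : x = 1 ↔ y = 1) : x = y := by revert x y; decide

theorem cyX_bd {a b : V → K} (hab : ∀ v ∈ X, a v ≠ b v) (v : V) :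
    bd (cyX X a b) v = if v ∈ X then a v + b v else 0 := by
  by_cases hv : v ∈ X
  · simp only [bd, cyX, hv, true_and, if_true]; exact (bdK_pair (hab v hv)).1
  · simp only [bd, cyX, hv, false_and, if_false, bdK_const]

theorem cyX_cyc (h : Dg E ι) (hX : X ⊆ E) {a b : V → K}
    (hab : ∀ v ∈ X, a v ≠ b v)
    (hi : ∀ v ∈ X, (cyX X a b (ι (v, a v)) = 1) ∧ cyX X a b (ι (v, b v)) = 1) :
    Cyc E ι (cyX X a b) := by
  have hi' : ∀ e, cyX X a b e = 1 → cyX X a b (ι e) = 1 := by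
    rintro ⟨v, y⟩ he
    obtain ⟨h1, h2⟩ := cyX_one.1 he
    simp only at h1 h2
    rcases h2 with rfl | rfl
    · exact (hi v h1).1
    · exact (hi v h1).2
  refine ⟨fun e => eq_of_one ⟨fun he => ?_, hi' e⟩, fun v => ?_, fun e he => ?_⟩
  · have := hi' _ he; rwa [h.inv] at this
  · by_cases hv : v ∈ X
    · simp only [cyX, hv, true_and]; exact (bdK_pair (hab v hv)).2
    · simp [cyX, hv]
  · have : e.1 ∉ X := fun h' => he (hX h')
    simp [cyX, this]

theorem cyX_TT {a b : V → K} (hab : ∀ v ∈ X, a v ≠ b v) (t : V × K → F) :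
    TT t (cyX X a b) = ∑ v ∈ X, (t (v, a v) + t (v, b v)) := by
  unfold TT
  simp only [cyX_one]
  rw [Fintype.sum_prod_type, ← Finset.sum_subset (subset_univ X)]
  · refine sum_congr rfl fun v hv => ?_
    simp only [hv, true_and]
    rw [← sum_filter]
    have : (univ.filter fun y => y = a v ∨ y = b v) = {a v, b v} := by ext y; simp
    rw [this, sum_pair (hab v hv)]
  · intro v _ hv
    simp [hv]

theorem E1_base (h2 : (2 : F) ≠ 0) {L0 : Spc V}
    (hE : E.card = 2) (h : Dg E ι) (hcn : Conn E (LD E ι)) (hc : Compat E ι L0 t) :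
    (∀ e e', t e ≠ 0 → t e = t e' → e' = e ∨ e' = ι e) ∧ (∀ e, t e ≠ 0 → ∃ e', t e' = - t e) := by
  obtain ⟨a, b, hab, rfl⟩ := card_eq_two.1 hE
  have haE : a ∈ ({a, b} : Finset V) := by simp
  have hbE : b ∈ ({a, b} : Finset V) := by simp
  have hσ : ∀ y, ι (a, y) = (b, (ι (a, y)).2) := by
    intro y
    have h3 := no_loop h hcn hE.ge haE y
    have h4 := h.mem (e := (a, y)) haE
    simp [h3] at h4
    rw [← h4]
  set σ : K → K := fun y => (ι (a, y)).2 with hσd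
  have hσ' : ∀ y, ι (a, y) = (b, σ y) := hσ
  have hσb : ∀ y, ι (b, σ y) = (a, y) := fun y => by rw [← hσ', h.inv]
  have σinj : ∀ y y', σ y = σ y' → y = y' := by
    intro y y' hy
    have := congrArg ι (show ι (a, y) = ι (a, y') by rw [hσ', hσ', hy])
    rw [h.inv, h.inv] at this; simpa using this
  have det : ∀ c d, d ∈ ({a, b} : Finset V) → (∀ v, v ≠ d → v ≠ c → v ∉ ({a, b} : Finset V)) → ∀ R ∈ LD {a, b} ι, R c = 0 → R = 0 := by
    intro c d hd hcd R hR h0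
    by_contra hne
    have hRs : R = Pi.single d (R d) := by
      ext1 v
      by_cases hv : v = d
      · subst hv; simp
      · by_cases hva : v = c
        · subst hva; simp [h0, hv]
        · rw [(LD_lag h).supp hR v (hcd v hv hva)]; simp [hv]
    refine single_notMem hcn hE.ge hd (i := R d) ?_ (hRs ▸ hR)
    intro hb; apply hne; rw [hRs, hb, Pi.single_zero]
  have detb := det a b hbE fun v h1 h2 => by simp [h1, h2]
  -- pair cycles
  have key : ∀ y y', y ≠ y' → ∃ R ∈ LD {a, b} ι, R a = y + y' ∧ (t (a, y) + t (a, y') = 0 ↔ R ∈ L0) := by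
    intro y y' hyy
    set A : V → K := fun v => if v = a then y else σ y
    set B : V → K := fun v => if v = a then y' else σ y'
    have hAB : ∀ v ∈ ({a, b} : Finset V), A v ≠ B v := by
      intro v hv
      simp only [mem_insert, mem_singleton] at hv
      rcases hv with rfl | rfl
      · simpa [A, B] using hyy
      · simp [A, B, hab.symm]; exact fun hh => hyy (σinj _ _ hh)
    have hcy : Cyc {a, b} ι (cyX {a, b} A B) := by
      refine cyX_cyc h (Subset.refl _) hAB ?_
      intro v hv
      simp only [mem_insert, mem_singleton] at hv
      rcases hv with rfl | rfl
      · simp only [A, B, if_true, hσ', cyX_one]; simp [hab.symm]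
      · simp only [A, B, hab.symm, if_false, hσb, cyX_one]; simp
    have hT : TT t (cyX {a, b} A B) = 2 * (t (a, y) + t (a, y')) := by
      rw [cyX_TT hAB, sum_pair hab]
      simp only [A, B, if_true, hab.symm, if_false]
      rw [← hσ', ← hσ', hc.inv, hc.inv]; ring
    have hRa : bd (cyX {a, b} A B) a = y + y' := by rw [cyX_bd hAB]; simp [A, B]
    have hne : y + y' ≠ 0 := by intro h0; exact hyy (by
      have := congrArg (· + y') h0; simpa [add_assoc, kadd] using this)
    have hm : bd (cyX {a, b} A B) ∈ LD {a, b} ι := ⟨_, hcy, rfl⟩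
    refine ⟨_, hm, hRa, ?_⟩
    rw [← hc.main _ hcy, hT]
    · simp [h2]
    · right
      refine ⟨hm, ?_, fun Q hQ hle => ?_⟩
      · intro h0; apply hne; rw [← hRa, h0]; rfl
      · rcases hle a with h3 | h3
        · exact Or.inl (detb Q hQ h3)
        · right
          refine vadd_eq_zero.1 (detb _ (Submodule.add_mem _ hQ hm) ?_)
          simp [h3, kadd]
  have keyZ : ∀ y y', y ≠ y' → (t (a, y) + t (a, y') = 0 ↔ ∃ R ∈ L0, R a = y + y') := by
    intro y y' hyy
    obtain ⟨R, hR, hRa, hiff⟩ := key y y' hyy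
    rw [hiff]
    refine ⟨fun hh => ⟨R, hh, hRa⟩, ?_⟩
    rintro ⟨Q, hQ, hQa⟩
    have : R + Q = 0 := detb _ (Submodule.add_mem _ hR (hc.le hQ)) (by simp [hRa, hQa, kadd])
    rwa [vadd_eq_zero.1 this]
  obtain ⟨κ, hκ, hZ⟩ : ∃ κ : K, κ ≠ 0 ∧ ∃ R ∈ L0, R a = κ := by
    obtain ⟨R, hR, hRa, -⟩ := key 0 (1, 0) (by decide)
    obtain ⟨Q, hQ, hQa, -⟩ := key 0 (0, 1) (by decide)
    by_cases hR0 : R ∈ L0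
    · exact ⟨_, by decide, R, hR0, hRa⟩
    by_cases hQ0 : Q ∈ L0
    · exact ⟨_, by decide, Q, hQ0, hQa⟩
    · exact ⟨(1, 1), by decide, R + Q, hc.idx R hR Q hQ hR0 hQ0, by simp [hRa, hQa]⟩
  have hyκ : ∀ y : K, y ≠ y + κ := fun y hy => hκ (by simpa using hy.symm)
  have hneg : ∀ y, t (a, y + κ) = - t (a, y) := by
    intro y
    have := (keyZ y (y + κ) (hyκ y)).2 (by rwa [← add_assoc, kadd, zero_add])
    exact eq_neg_of_add_eq_zero_right this
  -- representation of half-edges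
  have hrep : ∀ e, t e ≠ 0 → ∃ y, e = (a, y) ∨ e = ι (a, y) := by
    rintro ⟨v, y⟩ he
    have hv : v ∈ ({a, b} : Finset V) := by by_contra hv; exact he (hc.supp _ hv)
    simp only [mem_insert, mem_singleton] at hv
    rcases hv with rfl | rfl
    · exact ⟨y, Or.inl rfl⟩
    · have h3 := no_loop h hcn hE.ge hbE y
      have h4 := h.mem (e := (v, y)) hbE
      simp [h3] at h4
      refine ⟨(ι (v, y)).2, Or.inr ?_⟩
      rw [← h4, Prod.mk.eta, h.inv]
  have hinj : ∀ y y', t (a, y) ≠ 0 → t (a, y) = t (a, y') → y = y' := by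
    intro y y' h0 heq
    by_contra hyy
    have n1 : ¬ ∃ R ∈ L0, R a = y + y' := by
      rw [← keyZ y y' hyy, ← heq, ← two_mul]; simp [h2, h0]
    have hne : y ≠ y' + κ := by
      rintro rfl
      apply n1; obtain ⟨R, hR, hRa⟩ := hZ
      exact ⟨R, hR, by rw [hRa]; rw [add_right_comm, kadd, zero_add]⟩
    obtain ⟨R, hR, hRa⟩ := (keyZ y (y' + κ) hne).1 (by rw [hneg, heq]; ring)
    obtain ⟨Q, hQ, hQa⟩ := hZ
    exact n1 ⟨R + Q, L0.add_mem hR hQ, by simp [hRa, hQa, add_assoc, kadd]⟩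
  refine ⟨fun e e' he heq => ?_, fun e he => ?_⟩
  · obtain ⟨y, hy⟩ := hrep e he
    obtain ⟨y', hy'⟩ := hrep e' (heq ▸ he)
    have ht : t e = t (a, y) := by rcases hy with rfl | rfl <;> simp [hc.inv]
    have ht' : t e' = t (a, y') := by rcases hy' with rfl | rfl <;> simp [hc.inv]
    have := hinj y y' (ht ▸ he) (by rw [← ht, ← ht', heq])
    subst this
    rcases hy with rfl | rfl <;> rcases hy' with rfl | rfl <;> simp [h.inv]
  · obtain ⟨y, hy⟩ := hrep e he
    have ht : t e = t (a, y) := by rcases hy with rfl | rfl <;> simp [hc.inv]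
    exact ⟨(a, y + κ), by rw [hneg, ht]⟩

theorem two_cover {P : K → Prop} [DecidablePred P] (h : (univ.filter P).card ≤ 2) :
    ∃ a b : K, a ≠ b ∧ ∀ y, P y → y = a ∨ y = b := by
  have key : ∀ S : Finset K, S.card ≤ 2 → ∃ a b : K, a ≠ b ∧ ∀ y ∈ S, y = a ∨ y = b := by decide
  obtain ⟨a, b, hab, hh⟩ := key _ h
  exact ⟨a, b, hab, fun y hy => hh y (by simp [hy])⟩

theorem two_types_ne (c : K) : ∃ i j : K, i ≠ 0 ∧ j ≠ 0 ∧ i ≠ j ∧ i ≠ c ∧ j ≠ c := by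
  revert c; decide

theorem E1 [DecidableEq F] (h2 : (2 : F) ≠ 0) : ∀ (n : ℕ) (E : Finset V) (ι : V × K → V × K)
    (L0 : Spc V) (t : V × K → F), E.card = n → 2 ≤ n → Dg E ι →
    Conn E (LD E ι) → Compat E ι L0 t → (univ.filter fun e => t e ≠ 0).card ≤ 8 →
    (∀ e e', t e ≠ 0 → t e = t e' → e' = e ∨ e' = ι e) ∧ (∀ e, t e ≠ 0 → ∃ e', t e' = - t e) := by
  intro n
  induction n with
  | zero => intro E ι L0 t _ h; omega
  | succ n ih =>
  intro E ι L0 t hE hn h hcn hc h8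
  by_cases hn2 : n + 1 = 2
  · exact E1_base h2 (hE.trans hn2) h hcn hc
  -- choose a vertex
  obtain ⟨u, hu, hu2⟩ : ∃ u ∈ E, (univ.filter fun y => t (u, y) ≠ 0).card ≤ 2 := by
    by_contra hcon
    push Not at hcon
    have h1 : ∑ u ∈ E, (univ.filter fun y => t (u, y) ≠ 0).card ≤ 8 := by
      refine le_trans ?_ h8
      rw [card_filter, Fintype.sum_prod_type]
      refine le_trans (sum_le_sum_of_subset (subset_univ E)) ?_
      refine sum_le_sum fun v _ => ?_
      rw [card_filter]
    have h3 : ∑ u ∈ E, 3 ≤ ∑ u ∈ E, (univ.filter fun y => t (u, y) ≠ 0).card :=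
      sum_le_sum fun u hu => hcon u hu
    rw [sum_const, smul_eq_mul] at h3; omega
  obtain ⟨a, b, hab, hcov⟩ := two_cover hu2
  obtain ⟨i, j, hi, hj, hij, hic, hjc⟩ := two_types_ne (a + b)
  obtain ⟨τ, hτ, hτc, hcn'⟩ : ∃ τ : K, τ ≠ 0 ∧ τ ≠ a + b ∧ Conn (E.erase u) (mnr (LD E ι) u τ) := by
    rcases conn2 (LD_lag h) hcn hu hi hj hij with h | h
    · exact ⟨i, hi, hic, h⟩
    · exact ⟨j, hj, hjc, h⟩
  have hone : ∀ z, t (u, z) ≠ 0 → t (u, z + τ) = 0 := by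
    intro z hz
    by_contra hz'
    have h1 := hcov _ hz
    have h3 := hcov _ hz'
    have k1 : ∀ z w τ : K, z + τ = w → τ = z + w := by decide
    rcases h1 with rfl | rfl <;> rcases h3 with h3 | h3 <;> have h5 := k1 _ _ _ h3
    · exact hτ (h5.trans (kadd _))
    · exact hτc h5
    · exact hτc (h5.trans (add_comm _ _))
    · exact hτ (h5.trans (kadd _))
  have hn2' : 2 ≤ E.card := by omega
  have hl : ∀ y, (ι (u, y)).1 ≠ u := no_loop h hcn hn2' hu
  have hs := single_notMem hcn hn2' hu hτ
  have hc' := hc.smo h hu hl hτ hs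
  rw [smo_LD h hu hl hτ] at hcn'
  have htf : ∀ e, smt ι u τ t e ≠ 0 → e.1 ≠ u ∧
      ((t e ≠ 0 ∧ smt ι u τ t e = t e) ∨ (t e = 0 ∧ (ι e).1 = u ∧ smt ι u τ t e = t (u, (ι e).2 + τ))) := by
    intro e he
    have h1 : e.1 ≠ u := fun h1 => he (by simp [smt, h1])
    refine ⟨h1, ?_⟩
    by_cases h3 : (ι e).1 = u
    · have hz : (u, (ι e).2) = ι e := by rw [← h3]
      have hsm : smt ι u τ t e = t (u, (ι e).2) + t (u, (ι e).2 + τ) := by simp [smt, h1, h3]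
      have hte : t (u, (ι e).2) = t e := by rw [hz, hc.inv]
      by_cases h4 : t e = 0
      · right; refine ⟨h4, h3, ?_⟩; rw [hsm, hte, h4, zero_add]
      · left; refine ⟨h4, ?_⟩; rw [hsm, hone _ (by rwa [hte]), hte, add_zero]
    · have hsm : smt ι u τ t e = t e := by simp [smt, h1, h3]
      left; exact ⟨hsm ▸ he, hsm⟩
  obtain ⟨hinj, hneg⟩ := ih (E.erase u) (smo ι u τ) (mnr L0 u τ) (smt ι u τ t)
    (by rw [card_erase_of_mem hu]; omega) (by omega) (smo_dg h hl hτ) hcn' hc' (by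
      refine le_trans ?_ h8
      refine card_le_card_of_injOn (fun e => if t e ≠ 0 then e else (u, (ι e).2 + τ)) ?_ ?_
      · intro e he
        simp only [coe_filter, mem_univ, true_and, Set.mem_ofPred_eq] at he ⊢
        rcases (htf e he).2 with ⟨h3, h4⟩ | ⟨h3, h4, h5⟩
        · simp [h3]
        · simp [h3, ← h5, he]
      · intro e he e' he' heq
        simp only [coe_filter, mem_univ, true_and, Set.mem_ofPred_eq] at he he' heq
        have k1 := (htf e he).1
        have k2 := (htf e' he').1
        rcases (htf e he).2 with ⟨h3, h4⟩ | ⟨h3, h4, h5⟩ <;>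
          rcases (htf e' he').2 with ⟨h3', h4'⟩ | ⟨h3', h4', h5'⟩
        · simpa [h3, h3'] using heq
        · simp [h3, h3'] at heq; rw [heq] at k1; simp at k1
        · simp [h3, h3'] at heq; rw [← heq] at k2; simp at k2
        · simp [h3, h3'] at heq
          have : ι e = ι e' := Prod.ext (by rw [h4, h4']) heq
          rw [← h.inv e, this, h.inv])
  set g : V × K → V × K := fun e => if e.1 = u then ι e else e with hg
  have hgu : ∀ e, (g e).1 ≠ u := by
    rintro ⟨v, y⟩
    by_cases hv : v = u
    · subst hv; simp [g, hl]
    · simp [g, hv]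
  have hg2 : ∀ e, g e = e ∨ g e = ι e := by intro e; simp only [g]; split_ifs <;> simp
  have hgt : ∀ e, t (g e) = t e := by
    intro e; rcases hg2 e with h | h <;> rw [h]; exact hc.inv e
  have hone' : ∀ e, t e ≠ 0 → (ι e).1 = u → t (u, (ι e).2 + τ) = 0 := by
    intro e he h3
    apply hone
    have hz : (u, (ι e).2) = ι e := by rw [← h3]
    rwa [hz, hc.inv]
  have hgs : ∀ e, t e ≠ 0 → smt ι u τ t (g e) = t e := by
    intro e he
    by_cases h3 : (ι (g e)).1 = u
    · have hz : (u, (ι (g e)).2) = ι (g e) := by rw [← h3]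
      have hsm : smt ι u τ t (g e) = t (u, (ι (g e)).2) + t (u, (ι (g e)).2 + τ) := by
        simp only [smt, hgu, h3, if_true, if_false]
      rw [hsm, hone' (g e) (by rwa [hgt]) h3, hz, hc.inv, hgt, add_zero]
    · have hsm : smt ι u τ t (g e) = t (g e) := by simp only [smt, hgu, h3, if_false]
      rw [hsm, hgt]
  refine ⟨fun e e' he heq => ?_, fun e he => ?_⟩
  · have he' : t e' ≠ 0 := heq ▸ he
    have h1 := hinj (g e) (g e') (by rwa [hgs e he]) (by rw [hgs e he, hgs e' he', heq])
    have hfin : g e' = g e ∨ g e' = ι (g e) := by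
      rcases h1 with h1 | h1
      · exact Or.inl h1
      · by_cases h3 : (ι (g e)).1 = u
        · have hz : ι (g e) = (u, (ι (g e)).2) := by rw [← h3]
          rw [smo_at (hgu e) hz] at h1
          have h4 := hone' (g e) (by rwa [hgt]) h3
          rw [← hc.inv, ← h1, hgt] at h4
          exact absurd h4 he'
        · rw [smo_ne (hgu e) h3] at h1; exact Or.inr h1
    have inj : ∀ x y, ι x = ι y → x = y := fun x y hxy => by rw [← h.inv x, hxy, h.inv]
    rcases hg2 e with k | k <;> rcases hg2 e' with k' | k' <;> rw [k, k'] at hfin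
    · exact hfin
    · rcases hfin with k3 | k3
      · right; rw [← k3, h.inv]
      · left; exact inj _ _ k3
    · rw [h.inv] at hfin; exact hfin.symm
    · rw [h.inv] at hfin
      rcases hfin with k3 | k3
      · left; exact inj _ _ k3
      · right; rw [← k3, h.inv]
  · obtain ⟨e', he'⟩ := hneg (g e) (by rwa [hgs e he])
    rw [hgs e he] at he'
    rcases (htf e' (by rw [he']; simpa using he)).2 with ⟨h3, h4⟩ | ⟨h3, h4, h5⟩
    · exact ⟨e', by rw [← h4, he']⟩
    · exact ⟨_, by rw [← h5, he']⟩
end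

section
section comb
variable {F : Type} [Field F] [DecidableEq F]

/-- Local data at a vertex `u` : the pairing `m` of the neighbours. -/
structure VD (ts : Sym2 V → F) (Adj : V → V → Prop) (u : V) (m : V → V) : Prop where
  adj : ∀ x, Adj u x → Adj u (m x)
  inv : ∀ x, Adj u x → m (m x) = x
  ne : ∀ x, Adj u x → m x ≠ x
  nadj : ∀ x, Adj u x → ¬ Adj x (m x)

def KE (ts : Sym2 V → F) : Finset (Sym2 V) := univ.filter fun s => ts s ≠ 0
def DD (ts : Sym2 V → F) (u : V) : Finset (Sym2 V) := (KE ts).filter fun s => u ∈ s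
def OO (ts : Sym2 V → F) (u : V) : Finset (Sym2 V) := (KE ts).filter fun s => u ∉ s
def PP (ts : Sym2 V → F) (u : V) (m : V → V) (N : Finset V) : Finset V :=
  N.filter fun x => ts s(u, x) + ts s(u, m x) ≠ 0

def Star (ts : Sym2 V → F) (w : V) : Prop := ∀ s, ts s ≠ 0 → w ∈ s

theorem mem_KE {ts : Sym2 V → F} {s : Sym2 V} : s ∈ KE ts ↔ ts s ≠ 0 := by simp [KE]
theorem mem_DD {ts : Sym2 V → F} {s : Sym2 V} : s ∈ DD ts u ↔ ts s ≠ 0 ∧ u ∈ s := by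
  simp [DD, KE]
theorem mem_OO {ts : Sym2 V → F} {s : Sym2 V} : s ∈ OO ts u ↔ ts s ≠ 0 ∧ u ∉ s := by
  simp [OO, KE]
theorem DD_OO (ts : Sym2 V → F) (u : V) : (DD ts u).card + (OO ts u).card = (KE ts).card :=
  card_filter_add_card_filter_not _

theorem DD_card (ts : Sym2 V → F) (u : V) :
    (DD ts u).card = (univ.filter fun x => ts s(u, x) ≠ 0).card := by
  have : DD ts u = (univ.filter fun x => ts s(u, x) ≠ 0).image fun x => s(u, x) := by
    ext s
    rw [mem_DD, mem_image]
    constructor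
    · rintro ⟨h1, h2⟩
      obtain ⟨x, rfl⟩ := Sym2.mem_iff_exists.1 h2
      exact ⟨x, by simp [h1], rfl⟩
    · rintro ⟨x, hx, rfl⟩; simp at hx; simp [hx]
  rw [this, card_image_of_injective]
  intro x y hxy
  exact Sym2.congr_right.1 hxy

/-- The local description of the smoothed labelling at `u`. -/
structure Loc (ts : Sym2 V → F) (Adj : V → V → Prop) (N : V → Finset V) (u : V) (m : V → V) : Prop where
  vd : VD ts Adj u m
  alt : 2 * (OO ts u).card + (PP ts u m (N u)).card = 4 ∨
    ∃ w, w ≠ u ∧ 3 ≤ (OO ts u).card ∧ (∀ s ∈ OO ts u, w ∈ s) ∧ ∀ x ∈ PP ts u m (N u), x = w ∨ m x = w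

variable {ts : Sym2 V → F} {Adj : V → V → Prop} {N : V → Finset V}

theorem sym2_eq {a b : V} {s : Sym2 V} (h : a ≠ b) (h1 : a ∈ s) (h2 : b ∈ s) : s = s(a, b) :=
  (Sym2.mem_and_mem_iff h).1 ⟨h1, h2⟩

theorem lemQ_half (hts : ∀ x y, ts s(x, y) ≠ 0 → Adj x y) (hN : ∀ u x, x ∈ N u ↔ Adj u x)
    {u u' w : V} {m : V → V} (hm : VD ts Adj u m) (huu : u ≠ u') (hw : w ≠ u) (hw' : w ≠ u')
    (hcov : ∀ s, ts s ≠ 0 → w ∈ s ∨ s = s(u, u')) (ht : ts s(u, u') ≠ 0)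
    (hP : ∀ x ∈ PP ts u m (N u), x = w ∨ m x = w) : Adj u w ∧ ¬ Adj u' w := by
  have ha := hts _ _ ht
  have hmw : m u' = w := by
    by_contra hne
    have h0 : ts s(u, m u') = 0 := by
      by_contra h1
      rcases hcov _ h1 with h2 | h2
      · rcases Sym2.mem_iff.1 h2 with h3 | h3
        · exact hw h3
        · exact hne h3.symm
      · exact hm.ne _ ha (Sym2.congr_right.1 h2)
    rcases hP u' (by simp [PP, hN, ha, h0, ht]) with h3 | h3
    · exact hw' h3.symm
    · exact hne h3
  exact ⟨hmw ▸ hm.adj _ ha, hmw ▸ hm.nadj _ ha⟩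

theorem lemQ (hsym : ∀ x y, Adj x y → Adj y x) (hts : ∀ x y, ts s(x, y) ≠ 0 → Adj x y)
    (hN : ∀ u x, x ∈ N u ↔ Adj u x)
    {u u' w : V} {m m' : V → V} (hm : VD ts Adj u m) (hm' : VD ts Adj u' m') (huu : u ≠ u')
    (hw : w ≠ u) (hw' : w ≠ u')
    (hcov : ∀ s, ts s ≠ 0 → w ∈ s ∨ s = s(u, u')) (ht : ts s(u, u') ≠ 0)
    (hP : ∀ x ∈ PP ts u m (N u), x = w ∨ m x = w)
    (hP' : ∀ x ∈ PP ts u' m' (N u'), x = w ∨ m' x = w) : False := by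
  have h1 := lemQ_half hts hN hm huu hw hw' hcov ht hP
  have h2 := lemQ_half hts hN hm' huu.symm hw' hw (by rwa [Sym2.eq_swap]) (by rwa [Sym2.eq_swap]) hP'
  exact h1.2 h2.1

/-- Two vertices of type II without common star. -/
theorem two_II (hsym : ∀ x y, Adj x y → Adj y x) (hts : ∀ x y, ts s(x, y) ≠ 0 → Adj x y)
    (hN : ∀ u x, x ∈ N u ↔ Adj u x) (hstar : ∀ w, ¬ Star ts w)
    {a b w w' : V} {m m' : V → V} (hm : VD ts Adj a m) (hm' : VD ts Adj b m') (hab : a ≠ b)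
    (hwa : w ≠ a) (h3 : 3 ≤ (OO ts a).card) (hO : ∀ s ∈ OO ts a, w ∈ s)
    (hP : ∀ x ∈ PP ts a m (N a), x = w ∨ m x = w)
    (hwb : w' ≠ b) (h3' : 3 ≤ (OO ts b).card) (hO' : ∀ s ∈ OO ts b, w' ∈ s)
    (hP' : ∀ x ∈ PP ts b m' (N b), x = w' ∨ m' x = w') : w = b := by
  by_cases hww : w = w'
  · subst hww
    exfalso
    have hcov : ∀ s, ts s ≠ 0 → w ∈ s ∨ s = s(a, b) := by
      intro s hs
      by_cases ha : a ∈ s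
      · by_cases hb : b ∈ s
        · exact Or.inr (sym2_eq hab ha hb)
        · exact Or.inl (hO' s (mem_OO.2 ⟨hs, hb⟩))
      · exact Or.inl (hO s (mem_OO.2 ⟨hs, ha⟩))
    have : ts s(a, b) ≠ 0 := by
      intro h0
      refine hstar w fun s hs => ?_
      rcases hcov s hs with h | h
      · exact h
      · rw [h] at hs; exact absurd h0 hs
    exact lemQ hsym hts hN hm hm' hab hwa hwb hcov this hP hP'
  · by_contra hwb'
    have hsub : OO ts a ⊆ {s(w, w'), s(w, b)} := by
      intro s hs
      have h1 := hO s hs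
      rw [mem_OO] at hs
      by_cases hb : b ∈ s
      · simp [sym2_eq hwb' h1 hb]
      · simp [sym2_eq hww h1 (hO' s (mem_OO.2 ⟨hs.1, hb⟩))]
    have := (card_le_card hsub).trans card_le_two
    omega

/-- For at least five edges, a vertex of type I forces the other ones to be centered at it. -/
theorem typeI_five (hsym : ∀ x y, Adj x y → Adj y x) (hts : ∀ x y, ts s(x, y) ≠ 0 → Adj x y)
    (hN : ∀ u x, x ∈ N u ↔ Adj u x) (hN4 : ∀ u, (N u).card ≤ 4)  (hstar : ∀ w, ¬ Star ts w)
    (h5 : 5 ≤ (KE ts).card) {u u' u'' : V} {m m' m'' : V → V} (huu' : u ≠ u') (huu'' : u ≠ u'')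
    (huu : u' ≠ u'') (h : Loc ts Adj N u m) (h' : Loc ts Adj N u' m') (h'' : Loc ts Adj N u'' m'')
    (hNu : (N u).card = 4)
    (hI : 2 * (OO ts u).card + (PP ts u m (N u)).card = 4) : False := by
  have hDN : ∀ u, (univ.filter fun x => ts s(u, x) ≠ 0) ⊆ N u := by
    intro u x hx; simp at hx; exact (hN u x).2 (hts _ _ hx)
  have hne : ∀ v, 1 ≤ (OO ts v).card := by
    intro v
    rw [Nat.one_le_iff_ne_zero, Ne, card_eq_zero]
    intro h0
    refine hstar v fun s hs => ?_
    by_contra hv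
    have : s ∈ OO ts v := mem_OO.2 ⟨hs, hv⟩
    rw [h0] at this; simp at this
  have hsum := DD_OO ts u
  have hD4 : (DD ts u).card = 4 := by
    have h1 : (DD ts u).card ≤ 4 := by rw [DD_card]; exact (card_le_card (hDN u)).trans (hN4 u)
    by_contra hne4
    have h3 : (DD ts u).card = 3 := by omega
    have hP0 : (PP ts u m (N u)).card = 0 := by omega
    rw [card_eq_zero] at hP0
    obtain ⟨x, hxN, hx⟩ : ∃ x ∈ N u, ts s(u, x) = 0 := by
      by_contra hcon
      push Not at hcon
      have : N u ⊆ univ.filter fun x => ts s(u, x) ≠ 0 := fun x hx => by simp [hcon x hx]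
      have := card_le_card this
      rw [← DD_card] at this; omega
    have hxa := (hN u x).1 hxN
    have hmx : ts s(u, m x) = 0 := by
      by_contra h0
      have : x ∈ PP ts u m (N u) := by simp [PP, hxN, hx, h0]
      rw [hP0] at this; simp at this
    have hsub : (univ.filter fun y => ts s(u, y) ≠ 0) ⊆ ((N u).erase x).erase (m x) := by
      intro y hy
      have hyN := hDN u hy
      simp at hy
      refine mem_erase.2 ⟨?_, mem_erase.2 ⟨?_, hyN⟩⟩
      · rintro rfl; exact hy hmx
      · rintro rfl; exact hy hx
    have := card_le_card hsub
    rw [← DD_card, card_erase_of_mem (mem_erase.2 ⟨h.vd.ne _ hxa, (hN _ _).2 (h.vd.adj _ hxa)⟩),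
      card_erase_of_mem hxN] at this
    omega
  have hOu : (OO ts u).card ≤ 2 := by omega
  have hother : ∀ v m, u ≠ v → Loc ts Adj N v m → (∀ s ∈ OO ts v, u ∈ s) ∧
      ∀ x ∈ PP ts v m (N v), x = u ∨ m x = u := by
    intro v m huv hv
    have hsub : (DD ts u).erase s(u, v) ⊆ OO ts v := by
      intro s hs
      rw [mem_erase, mem_DD] at hs
      refine mem_OO.2 ⟨hs.2.1, fun hvs => hs.1 (sym2_eq huv hs.2.2 hvs)⟩
    have hc3 : 3 ≤ ((DD ts u).erase s(u, v)).card := by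
      have := pred_card_le_card_erase (s := DD ts u) (a := s(u, v)); omega
    rcases hv.alt with hh | ⟨w, hw, h3, hO, hP⟩
    · have := card_le_card hsub; omega
    · by_cases hwu : w = u
      · subst hwu; exact ⟨hO, hP⟩
      · exfalso
        have hsub2 : (DD ts u).erase s(u, v) ⊆ {s(w, u)} := by
          intro s hs
          have := hO s (hsub hs)
          rw [mem_erase, mem_DD] at hs
          simp [sym2_eq hwu this hs.2.2]
        have := card_le_card hsub2
        simp at this; omega
  obtain ⟨hO', hP'⟩ := hother u' m' huu' h'
  obtain ⟨hO'', hP''⟩ := hother u'' m'' huu'' h''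
  have hcov : ∀ s, ts s ≠ 0 → u ∈ s ∨ s = s(u', u'') := by
    intro s hs
    by_cases ha : u' ∈ s
    · by_cases hb : u'' ∈ s
      · exact Or.inr (sym2_eq huu ha hb)
      · exact Or.inl (hO'' s (mem_OO.2 ⟨hs, hb⟩))
    · exact Or.inl (hO' s (mem_OO.2 ⟨hs, ha⟩))
  have : ts s(u', u'') ≠ 0 := by
    intro h0
    refine hstar u fun s hs => ?_
    rcases hcov s hs with h | h
    · exact h
    · rw [h] at hs; exact absurd h0 hs
  exact lemQ hsym hts hN h'.vd h''.vd huu huu' huu'' hcov this hP' hP''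

theorem typeI_four (hts : ∀ x y, ts s(x, y) ≠ 0 → Adj x y)
    (hN : ∀ u x, x ∈ N u ↔ Adj u x) (hstar : ∀ w, ¬ Star ts w)
    (h4 : (KE ts).card = 4) {m : V → V} (h : Loc ts Adj N u m)
    (hI : 2 * (OO ts u).card + (PP ts u m (N u)).card = 4) :
    ∃ x y, x ≠ y ∧ ts s(u, x) ≠ 0 ∧ ts s(u, y) = - ts s(u, x) := by
  have hne : 1 ≤ (OO ts u).card := by
    rw [Nat.one_le_iff_ne_zero, Ne, card_eq_zero]
    intro h0
    refine hstar u fun s hs => ?_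
    by_contra hv
    have : s ∈ OO ts u := mem_OO.2 ⟨hs, hv⟩
    rw [h0] at this; simp at this
  have hsum := DD_OO ts u
  by_contra hcon
  push Not at hcon
  have hsub : (univ.filter fun x => ts s(u, x) ≠ 0) ⊆ PP ts u m (N u) := by
    intro x hx
    simp at hx
    have ha := hts _ _ hx
    simp only [PP, mem_filter, hN]
    refine ⟨ha, fun h0 => ?_⟩
    exact hcon x (m x) (h.vd.ne _ ha).symm hx (eq_neg_of_add_eq_zero_right h0)
  have := card_le_card hsub
  rw [← DD_card] at this
  omega

theorem comb4_III (hts : ∀ x y, ts s(x, y) ≠ 0 → Adj x y)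
    (hN : ∀ u x, x ∈ N u ↔ Adj u x) (hstar : ∀ w, ¬ Star ts w)
    (h4 : (KE ts).card = 4) (hinj : ∀ s s', ts s ≠ 0 → ts s = ts s' → s = s')
    {a b c : V} {m' m'' m : V → V} (hab : a ≠ b) (hac : a ≠ c)
    (hbc : b ≠ c) (h : Loc ts Adj N a m') (h' : Loc ts Adj N b m'') (h'' : Loc ts Adj N c m)
    (hI : 2 * (OO ts a).card + (PP ts a m' (N a)).card = 4)
    (hI' : 2 * (OO ts b).card + (PP ts b m'' (N b)).card = 4) : False := by
  have disj : ∀ {a b x y z w : V}, a ≠ b → x ≠ y → ts s(a, x) ≠ 0 → ts s(a, y) = - ts s(a, x) →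
      z ≠ w → ts s(b, z) ≠ 0 → ts s(b, w) = - ts s(b, z) → s(a, x) ≠ s(b, z) ∧ s(a, x) ≠ s(b, w) ∧
        s(a, y) ≠ s(b, z) ∧ s(a, y) ≠ s(b, w) := by
    intro a b x y z w hab hxy hx hy hzw hz hw
    have hy0 : ts s(a, y) ≠ 0 := by rw [hy]; simpa using hx
    have hw0 : ts s(b, w) ≠ 0 := by rw [hw]; simpa using hz
    have fin : b ∈ s(a, x) → b ∈ s(a, y) → False := by
      intro h1 h2
      exact hxy (Sym2.congr_right.1 ((sym2_eq hab (by simp) h1).trans (sym2_eq hab (by simp) h2).symm))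
    refine ⟨fun he => ?_, fun he => ?_, fun he => ?_, fun he => ?_⟩
    · refine fin (by rw [he]; simp) ?_
      rw [hinj s(a, y) s(b, w) hy0 (by rw [hy, hw, he])]; simp
    · refine fin (by rw [he]; simp) ?_
      rw [hinj s(a, y) s(b, z) hy0 (by rw [hy, he, hw, neg_neg])]; simp
    · refine fin ?_ (by rw [he]; simp)
      rw [hinj s(a, x) s(b, w) hx (by rw [hw, ← he, hy, neg_neg])]; simp
    · refine fin ?_ (by rw [he]; simp)
      rw [hinj s(a, x) s(b, z) hx (by rw [← neg_inj, ← hy, he, hw])]; simp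
  obtain ⟨x, y, hxy, hx, hy⟩ := typeI_four hts hN hstar h4 h hI
  obtain ⟨z, w, hzw, hz, hw⟩ := typeI_four hts hN hstar h4 h' hI'
  have hy0 : ts s(a, y) ≠ 0 := by rw [hy]; simpa using hx
  have hw0 : ts s(b, w) ≠ 0 := by rw [hw]; simpa using hz
  obtain ⟨d1, d2, d3, d4⟩ := disj hab hxy hx hy hzw hz hw
  have dxy : s(a, x) ≠ s(a, y) := fun h => hxy (Sym2.congr_right.1 h)
  have dzw : s(b, z) ≠ s(b, w) := fun h => hzw (Sym2.congr_right.1 h)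
  have hall : KE ts = {s(a, x), s(a, y), s(b, z), s(b, w)} := by
    symm; apply eq_of_subset_of_card_le
    · intro s hs; simp only [mem_insert, mem_singleton] at hs
      rw [mem_KE]; rcases hs with rfl | rfl | rfl | rfl <;> assumption
    · rw [h4, card_insert_of_notMem (by simp [dxy, d1, d2]),
        card_insert_of_notMem (by simp only [mem_insert, mem_singleton]; tauto), card_pair dzw]
  have hmem : ∀ s, ts s ≠ 0 → s = s(a, x) ∨ s = s(a, y) ∨ s = s(b, z) ∨ s = s(b, w) := by
    intro s hs
    have := mem_KE.2 hs
    rw [hall] at this; simpa only [mem_insert, mem_singleton] using this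
  rcases h''.alt with hI'' | ⟨w0, hw0c, h3, hO, hP⟩
  · obtain ⟨q, r, hqr, hq, hr⟩ := typeI_four hts hN hstar h4 h'' hI''
    have e1 := disj hac hxy hx hy hqr hq hr
    have e2 := disj hbc hzw hz hw hqr hq hr
    rcases hmem _ hq with h | h | h | h
    · exact e1.1 h.symm
    · exact e1.2.2.1 h.symm
    · exact e2.1 h.symm
    · exact e2.2.2.1 h.symm
  · have hsum := DD_OO ts c
    have hcard : (DD ts c).card = 1 := by
      have : (DD ts c).card ≠ 0 := by
        rw [Ne, card_eq_zero]
        intro h0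
        refine hstar w0 fun s hs => hO s (mem_OO.2 ⟨hs, fun hc => ?_⟩)
        have : s ∈ DD ts c := mem_DD.2 ⟨hs, hc⟩
        rw [h0] at this; simp at this
      omega
    obtain ⟨g, hg⟩ := card_eq_one.1 hcard
    have hgD : g ∈ DD ts c := by rw [hg]; simp
    rw [mem_DD] at hgD
    have hgu : ∀ s, ts s ≠ 0 → c ∈ s → s = g := by
      intro s hs hc
      have : s ∈ DD ts c := mem_DD.2 ⟨hs, hc⟩
      rw [hg] at this; simpa using this
    have hgw : w0 ∉ g := by
      intro hw0g
      refine hstar w0 fun s hs => ?_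
      by_cases hc : c ∈ s
      · rw [hgu s hs hc]; exact hw0g
      · exact hO s (mem_OO.2 ⟨hs, hc⟩)
    -- the final contradiction, for a pair of edges at `a`
    have fin : ∀ a x y : V, a ≠ c → x ≠ y → ts s(a, x) ≠ 0 → ts s(a, y) ≠ 0 → g = s(a, x) → False := by
      intro a x y hac hxy hx hy hgx
      have hcx : c = x := by
        have := hgD.2; rw [hgx] at this
        rcases Sym2.mem_iff.1 this with h | h
        · exact absurd h.symm hac
        · exact h
      subst hcx
      have hca : ts s(c, a) ≠ 0 := by rwa [Sym2.eq_swap]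
      have hadj := hts _ _ hca
      have hcm : ts s(c, m a) = 0 := by
        by_contra h0
        have := hgu _ h0 (by simp)
        rw [hgx, Sym2.eq_swap] at this
        exact h''.vd.ne _ hadj (Sym2.congr_left.1 this)
      have haw : a ≠ w0 := by rintro rfl; apply hgw; rw [hgx]; simp
      have hmw : m a = w0 := by
        rcases hP a (by simp [PP, hN, hadj, hcm, hca]) with h | h
        · exact absurd h haw
        · exact h
      have hnadj := h''.vd.nadj _ hadj
      rw [hmw] at hnadj
      have hcy : c ∉ s(a, y) := by
        intro hc; have := hgu _ hy hc; rw [hgx] at this; exact hxy (Sym2.congr_right.1 this).symm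
      have := hO _ (mem_OO.2 ⟨hy, hcy⟩)
      rcases Sym2.mem_iff.1 this with h | h
      · exact haw h.symm
      · subst h; exact hnadj (hts _ _ hy)
    rcases hmem g hgD.1 with h | h | h | h
    · exact fin a x y hac hxy hx hy0 h
    · exact fin a y x hac hxy.symm hy0 hx h
    · exact fin b z w hbc hzw hz hw0 h
    · exact fin b w z hbc hzw.symm hw0 hz h

theorem comb (hsym : ∀ x y, Adj x y → Adj y x) (hts : ∀ x y, ts s(x, y) ≠ 0 → Adj x y)
    (hN : ∀ u x, x ∈ N u ↔ Adj u x) (hN4 : ∀ u, (N u).card ≤ 4) (hstar : ∀ w, ¬ Star ts w)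
    (h4 : 4 ≤ (KE ts).card)
    (hinj : (KE ts).card = 4 → ∀ s s', ts s ≠ 0 → ts s = ts s' → s = s')
    {a b c : V} {m m' m'' : V → V} (hab : a ≠ b) (hac : a ≠ c) (hbc : b ≠ c)
    (h : Loc ts Adj N a m) (h' : Loc ts Adj N b m') (h'' : Loc ts Adj N c m'')
    (ha4 : (N a).card = 4) (hb4 : (N b).card = 4) (hc4 : (N c).card = 4) : False := by
  by_cases h5 : 5 ≤ (KE ts).card
  · rcases h.alt with I1 | ⟨w, hw, h3, hO, hP⟩
    · exact typeI_five hsym hts hN hN4 hstar h5 hab hac hbc h h' h'' ha4 I1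
    rcases h'.alt with I2 | ⟨w', hw', h3', hO', hP'⟩
    · exact typeI_five hsym hts hN hN4 hstar h5 hab.symm hbc hac h' h h'' hb4 I2
    rcases h''.alt with I3 | ⟨w'', hw'', h3'', hO'', hP''⟩
    · exact typeI_five hsym hts hN hN4 hstar h5 hac.symm hbc.symm hab h'' h h' hc4 I3
    have e1 := two_II hsym hts hN hstar h.vd h'.vd hab hw h3 hO hP hw' h3' hO' hP'
    have e2 := two_II hsym hts hN hstar h.vd h''.vd hac hw h3 hO hP hw'' h3'' hO'' hP''
    exact hbc (e1.symm.trans e2)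
  · have h4' : (KE ts).card = 4 := by omega
    have noII : ∀ {a b : V} {m m' : V → V}, a ≠ b → Loc ts Adj N a m → Loc ts Adj N b m' →
        (2 * (OO ts a).card + (PP ts a m (N a)).card = 4) ∨
        (2 * (OO ts b).card + (PP ts b m' (N b)).card = 4) := by
      intro a b m m' hab h h'
      rcases h.alt with I1 | ⟨w, hw, h3, hO, hP⟩
      · exact Or.inl I1
      rcases h'.alt with I2 | ⟨w', hw', h3', hO', hP'⟩
      · exact Or.inr I2
      exfalso
      have e1 := two_II hsym hts hN hstar h.vd h'.vd hab hw h3 hO hP hw' h3' hO' hP'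
      subst e1
      have hsub : OO ts a ∪ OO ts w ⊆ KE ts := union_subset (filter_subset _ _) (filter_subset _ _)
      have hd : Disjoint (OO ts a) (OO ts w) := by
        rw [Finset.disjoint_left]; intro s hs hs'
        exact (mem_OO.1 hs').2 (hO s hs)
      have := card_le_card hsub
      rw [card_union_of_disjoint hd] at this; omega
    have I := hinj h4'
    rcases noII hab h h' with i1 | i1
    · rcases noII hbc h' h'' with i2 | i2
      · exact comb4_III hts hN hstar h4' I hab hac hbc h h' h'' i1 i2
      · exact comb4_III hts hN hstar h4' I hac hab hbc.symm h h'' h' i1 i2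
    · rcases noII hac h h'' with i2 | i2
      · exact comb4_III hts hN hstar h4' I hab hac hbc h h' h'' i2 i1
      · exact comb4_III hts hN hstar h4' I hbc hab.symm hac.symm h' h'' h i1 i2
end comb
end

section
section K5

/-- indicator of a triangle of `K5` -/
def tri (a b c i j : Fin 5) : ZMod 2 :=
  if i ≠ j ∧ (i = a ∨ i = b ∨ i = c) ∧ (j = a ∨ j = b ∨ j = c) then 1 else 0

def wt (T : Fin 5 → Fin 5 → F) (S : Fin 5 → Fin 5 → ZMod 2) : F :=
  ∑ i, ∑ j, if S i j = 1 then T i j else 0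

structure Ev (S : Fin 5 → Fin 5 → ZMod 2) : Prop where
  sym : ∀ i j, S i j = S j i
  diag : ∀ i, S i i = 0
  even : ∀ i, ∑ j, S i j = 0

theorem Ev.add {S S' : Fin 5 → Fin 5 → ZMod 2} (h : Ev S) (h' : Ev S') : Ev (S + S') :=
  ⟨fun i j => by simp [h.sym i j, h'.sym i j], fun i => by simp [h.diag, h'.diag],
   fun i => by simp [sum_add_distrib, h.even, h'.even]⟩

theorem tri_ev : ∀ a b c : Fin 5, a ≠ b → b ≠ c → a ≠ c → Ev (tri a b c) := by
  have h1 : ∀ a b c : Fin 5, a ≠ b → b ≠ c → a ≠ c → ∀ i j, tri a b c i j = tri a b c j i := by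
    decide +kernel
  have h2 : ∀ a b c : Fin 5, a ≠ b → b ≠ c → a ≠ c → ∀ i, ∑ j, tri a b c i j = 0 := by
    decide +kernel
  exact fun a b c h h' h'' => ⟨h1 a b c h h' h'', fun i => by simp [tri], h2 a b c h h' h''⟩

def xg (x : Fin 6 → ZMod 2) (i j : Fin 5) : ZMod 2 :=
  (![![0, x 0, x 1, x 2, 0], ![x 0, 0, x 3, x 4, 0], ![x 1, x 3, 0, x 5, 0], ![x 2, x 4, x 5, 0, 0],
    ![0, 0, 0, 0, 0]] : Fin 5 → Fin 5 → ZMod 2) i j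

def Zp (x : Fin 6 → ZMod 2) (i j : Fin 5) : Prop :=
  ∃ k l, k ≠ l ∧ i ≠ k ∧ j ≠ k ∧ i ≠ l ∧ j ≠ l ∧ xg x i j + xg x j k + xg x i k = 0 ∧
    xg x i j + xg x j l + xg x i l = 0

instance (x : Fin 6 → ZMod 2) (i j : Fin 5) : Decidable (Zp x i j) := by unfold Zp; infer_instance

/-- second-level zero pattern -/
def Zq (x : Fin 6 → ZMod 2) (i j : Fin 5) : Prop :=
  Zp x i j ∨ ∃ k, i ≠ k ∧ j ≠ k ∧ Zp x i k ∧ Zp x j k ∧ xg x i j + xg x j k + xg x i k = 0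

instance (x : Fin 6 → ZMod 2) (i j : Fin 5) : Decidable (Zq x i j) := by unfold Zq; infer_instance

def PA (x : Fin 6 → ZMod 2) : Prop := ∃ w, ∀ i j, i ≠ j → i ≠ w → j ≠ w → Zq x i j
instance (x : Fin 6 → ZMod 2) : Decidable (PA x) := by unfold PA; infer_instance
def PB (x : Fin 6 → ZMod 2) : Prop := ∃ a b c d : Fin 5, a ≠ b ∧ c ≠ d ∧ ∀ i j, i ≠ j → Zq x i j ∨
      (i = a ∧ j = b) ∨ (i = b ∧ j = a) ∨ (i = c ∧ j = d) ∨ (i = d ∧ j = c)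
instance (x : Fin 6 → ZMod 2) : Decidable (PB x) := by unfold PB; infer_instance

theorem pattern : ∀ x0 x1 x2 x3 x4 x5 : ZMod 2, x0 + x1 + x2 + x3 + x4 + x5 = 0 →
    PA ![x0, x1, x2, x3, x4, x5] ∨ PB ![x0, x1, x2, x3, x4, x5] ∨
    (x0 = 1 ∧ x1 = 1 ∧ x2 = 1 ∧ x3 = 1 ∧ x4 = 1 ∧ x5 = 1) := by
  decide +kernel

theorem tri_filter : ∀ a b c : Fin 5, a ≠ b → b ≠ c → a ≠ c →
    (univ.filter fun q : Fin 5 × Fin 5 => tri a b c q.1 q.2 = 1) =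
      {(a, b), (b, a), (b, c), (c, b), (a, c), (c, a)} := by decide +kernel

theorem quad_filter : ∀ a b c d : Fin 5, a ≠ b → a ≠ c → a ≠ d → b ≠ c → b ≠ d → c ≠ d →
    (univ.filter fun q : Fin 5 × Fin 5 => (tri a b c + tri a b d) q.1 q.2 = 1) =
      {(a, c), (c, a), (b, c), (c, b), (a, d), (d, a), (b, d), (d, b)} := by decide +kernel

theorem wt_filter (T : Fin 5 → Fin 5 → F) (S : Fin 5 → Fin 5 → ZMod 2) :
    wt T S = ∑ q ∈ univ.filter (fun q : Fin 5 × Fin 5 => S q.1 q.2 = 1), T q.1 q.2 := by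
  unfold wt; rw [sum_filter, Fintype.sum_prod_type]

theorem wt_tri {T : Fin 5 → Fin 5 → F} (hT : ∀ i j, T i j = T j i) {a b c : Fin 5} (hab : a ≠ b)
    (hbc : b ≠ c) (hac : a ≠ c) : wt T (tri a b c) = 2 * (T a b + T b c + T a c) := by
  rw [wt_filter, tri_filter a b c hab hbc hac]
  repeat rw [sum_insert (by simp [hab, hbc, hac, hab.symm, hbc.symm, hac.symm])]
  rw [sum_singleton]
  simp only [hT b a, hT c b, hT c a]; ring

theorem wt_quad {T : Fin 5 → Fin 5 → F} (hT : ∀ i j, T i j = T j i) {a b c d : Fin 5} (hab : a ≠ b)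
    (hac : a ≠ c) (had : a ≠ d) (hbc : b ≠ c) (hbd : b ≠ d) (hcd : c ≠ d) :
    wt T (tri a b c + tri a b d) = 2 * (T a c + T b c + T a d + T b d) := by
  rw [wt_filter, quad_filter a b c d hab hac had hbc hbd hcd]
  repeat rw [sum_insert (by simp [hab, hbc, hac, hab.symm, hbc.symm, hac.symm, had, had.symm, hbd, hbd.symm, hcd, hcd.symm])]
  rw [sum_singleton]
  simp only [hT d b, hT d a, hT c b, hT c a]; ring

theorem tri_p1 (a b c : Fin 5) : tri a b c = tri a c b := by
  ext1 i; ext1 j; simp only [tri, or_comm]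
theorem tri_p2 (a b c : Fin 5) : tri a b c = tri b a c := by
  ext1 i; ext1 j; simp only [tri, or_left_comm]
theorem tri_p3 (a b c : Fin 5) : tri a b c = tri c a b := by
  rw [tri_p1, tri_p2]

theorem four_e : ∀ a b c d : Fin 5, a ≠ b → a ≠ c → a ≠ d → b ≠ c → b ≠ d → c ≠ d →
      ∀ i j, tri a b c i j = (tri d a b + tri d b c + tri d a c) i j := by decide +kernel
theorem all_e : ∀ i j : Fin 5, (if i = j then (0 : ZMod 2) else 1) =
        (tri 4 0 1 + tri 4 2 3 + tri 0 1 2 + tri 0 1 3) i j := by decide +kernel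
theorem xg_one : ∀ i j k : Fin 5, i ≠ j → j ≠ k → i ≠ k →
          xg ![1, 1, 1, 1, 1, 1] i j + xg ![1, 1, 1, 1, 1, 1] j k + xg ![1, 1, 1, 1, 1, 1] i k = 1 := by
        decide +kernel
theorem xg_symm (x : Fin 6 → ZMod 2) (i j : Fin 5) : xg x i j = xg x j i := by
  fin_cases i <;> fin_cases j <;> rfl
theorem xg_four (x : Fin 6 → ZMod 2) (i : Fin 5) : xg x 4 i = 0 ∧ xg x i 4 = 0 := by
  fin_cases i <;> exact ⟨rfl, rfl⟩
theorem pr_key : ∀ i j : Fin 5, i < j → j ≠ 4 → (i = 0 ∧ j = 1) ∨ (i = 0 ∧ j = 2) ∨ (i = 0 ∧ j = 3) ∨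
        (i = 1 ∧ j = 2) ∨ (i = 1 ∧ j = 3) ∨ (i = 2 ∧ j = 3) := by decide

set_option maxHeartbeats 1000000 in
theorem K5_lemma (h2 : (2 : F) ≠ 0) {T : Fin 5 → Fin 5 → F} (hT : ∀ i j, T i j = T j i)
    (σ : (Fin 5 → Fin 5 → ZMod 2) → ZMod 2) (hσ0 : σ 0 = 0)
    (hσ : ∀ S S', Ev S → Ev S' → σ (S + S') = σ S + σ S')
    (hall : σ (fun i j => if i = j then 0 else 1) = 0)
    (hm : ∀ S, Ev S → (wt T S = 0 ↔ σ S = 0)) :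
    (∃ w, ∀ i j, i ≠ j → i ≠ w → j ≠ w → T i j = 0) ∨
    (∃ a b c d : Fin 5, a ≠ b ∧ c ≠ d ∧ ∀ i j, i ≠ j → T i j = 0 ∨
      (i = a ∧ j = b) ∨ (i = b ∧ j = a) ∨ (i = c ∧ j = d) ∨ (i = d ∧ j = c)) := by
  set x : Fin 6 → ZMod 2 := ![σ (tri 4 0 1), σ (tri 4 0 2), σ (tri 4 0 3), σ (tri 4 1 2), σ (tri 4 1 3),
    σ (tri 4 2 3)] with hx
  have four : ∀ a b c d : Fin 5, a ≠ b → a ≠ c → a ≠ d → b ≠ c → b ≠ d → c ≠ d →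
      σ (tri a b c) = σ (tri d a b) + σ (tri d b c) + σ (tri d a c) := by
    intro a b c d hab hac had hbc hbd hcd
    have e' : tri a b c = tri d a b + tri d b c + tri d a c := by
      ext1 i; ext1 j; exact four_e a b c d hab hac had hbc hbd hcd i j
    have v1 := tri_ev d a b had.symm hab hbd.symm
    have v2 := tri_ev d b c hbd.symm hbc hcd.symm
    have v3 := tri_ev d a c had.symm hac hcd.symm
    rw [e', hσ _ _ (v1.add v2) v3, hσ _ _ v1 v2]
  have hs : ∀ i j k : Fin 5, i ≠ j → j ≠ k → i ≠ k →
      σ (tri i j k) = xg x i j + xg x j k + xg x i k := by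
    have h4 : ∀ i j : Fin 5, i ≠ j → i ≠ 4 → j ≠ 4 → σ (tri 4 i j) = xg x i j := by
      intro i j hij hi hj
      have p : ∀ i j : Fin 5, tri 4 i j = tri 4 j i := fun i j => tri_p1 _ _ _
      have lt : ∀ i j : Fin 5, i < j → j ≠ 4 → σ (tri 4 i j) = xg x i j := by
        intro i j h h'
        rcases pr_key i j h h' with ⟨rfl, rfl⟩ | ⟨rfl, rfl⟩ | ⟨rfl, rfl⟩ | ⟨rfl, rfl⟩ | ⟨rfl, rfl⟩ | ⟨rfl, rfl⟩ <;>
        simp [xg, hx]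
      rcases lt_or_gt_of_ne hij with h | h
      · exact lt i j h hj
      · rw [p, xg_symm]; exact lt j i h hi
    have x4 := xg_four x
    intro i j k hij hjk hik
    by_cases hi : i = 4
    · subst hi; rw [h4 j k hjk hij.symm hik.symm, (x4 _).1, (x4 _).1]; ring
    by_cases hj : j = 4
    · subst hj
      rw [tri_p2 i 4 k,
        h4 i k hik hi hjk.symm, (x4 _).1, (x4 _).2]; ring
    by_cases hk : k = 4
    · subst hk
      rw [tri_p3 i j 4,
        h4 i j hij hi hj, (x4 _).2, (x4 _).2]; ring
    rw [four i j k 4 hij hik hi hjk hj hk, h4 i j hij hi hj, h4 j k hjk hj hk, h4 i k hik hi hk]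
  have hZ : ∀ i j, i ≠ j → Zp x i j → T i j = 0 := by
    rintro i j hij ⟨k, l, hkl, hik, hjk, hil, hjl, e1, e2⟩
    rw [← hs i j k hij hjk hik] at e1
    rw [← hs i j l hij hjl hil] at e2
    have v1 := tri_ev i j k hij hjk hik
    have v2 := tri_ev i j l hij hjl hil
    have e3 : σ (tri i j k + tri i j l) = 0 := by rw [hσ _ _ v1 v2, e1, e2, add_zero]
    rw [← hm _ v1, wt_tri hT hij hjk hik] at e1
    rw [← hm _ v2, wt_tri hT hij hjl hil] at e2
    rw [← hm _ (v1.add v2), wt_quad hT hij hik hil hjk hjl hkl] at e3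
    have : (2 * 2) * T i j = 0 := by linear_combination e1 + e2 - e3
    simpa [h2] using this
  have hZp := hZ
  replace hZ : ∀ i j, i ≠ j → Zq x i j → T i j = 0 := by
    rintro i j hij (h | ⟨k, hik, hjk, e1, e2, e3⟩)
    · exact hZp i j hij h
    · rw [← hs i j k hij hjk hik, ← hm _ (tri_ev i j k hij hjk hik), wt_tri hT hij hjk hik,
        hZp _ _ hik e1, hZp _ _ hjk e2] at e3
      simpa [h2] using e3
  have hsum : x 0 + x 1 + x 2 + x 3 + x 4 + x 5 = 0 := by
    have v1 := tri_ev 4 0 1 (by decide) (by decide) (by decide)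
    have v2 := tri_ev 4 2 3 (by decide) (by decide) (by decide)
    have v3 := tri_ev 0 1 2 (by decide) (by decide) (by decide)
    have v4 := tri_ev 0 1 3 (by decide) (by decide) (by decide)
    have e : (fun i j : Fin 5 => if i = j then (0 : ZMod 2) else 1) =
        tri 4 0 1 + tri 4 2 3 + tri 0 1 2 + tri 0 1 3 := by
      ext1 i; ext1 j; exact all_e i j
    rw [e, hσ _ _ ((v1.add v2).add v3) v4, hσ _ _ (v1.add v2) v3, hσ _ _ v1 v2,
      hs 4 0 1 (by decide) (by decide) (by decide), hs 4 2 3 (by decide) (by decide) (by decide),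
      hs 0 1 2 (by decide) (by decide) (by decide), hs 0 1 3 (by decide) (by decide) (by decide)] at hall
    simp [xg] at hall
    generalize x 0 = a0 at *; generalize x 1 = a1 at *; generalize x 2 = a2 at *
    generalize x 3 = a3 at *; generalize x 4 = a4 at *; generalize x 5 = a5 at *
    have := z2add a0
    linear_combination hall - this
  rcases pattern _ _ _ _ _ _ hsum with h | h | h
  · left
    obtain ⟨w, hw⟩ := h
    have hxx : x = ![x 0, x 1, x 2, x 3, x 4, x 5] := by ext i; fin_cases i <;> rfl
    exact ⟨w, fun i j h1 h3 h4 => hZ i j h1 (by rw [hxx]; exact hw i j h1 h3 h4)⟩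
  · right
    obtain ⟨a, b, c, d, hab, hcd, hw⟩ := h
    have hxx : x = ![x 0, x 1, x 2, x 3, x 4, x 5] := by ext i; fin_cases i <;> rfl
    refine ⟨a, b, c, d, hab, hcd, fun i j h1 => ?_⟩
    rcases hw i j h1 with h | h
    · left; exact hZ i j h1 (by rw [hxx]; exact h)
    · exact Or.inr h
  · exfalso
    obtain ⟨h0, h1, h3, h4, h5, h6⟩ := h
    have hs1 : ∀ i j k : Fin 5, i ≠ j → j ≠ k → i ≠ k → σ (tri i j k) = 1 := by
      have hxx : x = ![1, 1, 1, 1, 1, 1] := by ext i; fin_cases i <;> assumption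
      intro i j k hij hjk hik
      rw [hs i j k hij hjk hik, hxx, xg_one i j k hij hjk hik]
    have hq : ∀ a b c d : Fin 5, a ≠ b → a ≠ c → a ≠ d → b ≠ c → b ≠ d → c ≠ d →
        T a c + T b c + T a d + T b d = 0 := by
      intro a b c d hab hac had hbc hbd hcd
      have v1 := tri_ev a b c hab hbc hac
      have v2 := tri_ev a b d hab hbd had
      have : wt T (tri a b c + tri a b d) = 0 := by
        rw [hm _ (v1.add v2), hσ _ _ v1 v2, hs1 a b c hab hbc hac, hs1 a b d hab hbd had]; rfl
      rw [wt_quad hT hab hac had hbc hbd hcd] at this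
      simpa [h2] using this
    have hd : ∀ a b c d : Fin 5, a ≠ b → a ≠ c → a ≠ d → b ≠ c → b ≠ d → c ≠ d →
        T a b + T c d = 0 := by
      intro a b c d hab hac had hbc hbd hcd
      have e1 := hq a b c d hab hac had hbc hbd hcd
      have e2 := hq a c b d hac hab had hbc.symm hcd hbd
      have e3 := hq a d b c had hab hac hbd.symm hcd.symm hbc
      simp only [hT c b, hT d b, hT d c] at e1 e2 e3
      have : 2 * (T a b + T c d) = 0 := by linear_combination e2 + e3 - e1
      simpa [h2] using this
    have hz : ∀ a b c d e : Fin 5, a ≠ b → a ≠ c → a ≠ d → a ≠ e → b ≠ c → b ≠ d → b ≠ e → c ≠ d →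
        c ≠ e → d ≠ e → T a b = 0 := by
      intro a b c d e hab hac had hae hbc hbd hbe hcd hce hde
      have e1 := hd a b c d hab hac had hbc hbd hcd
      have e2 := hd c d e a hcd hce hac.symm hde had.symm hae.symm
      have e3 := hd e a b c hae.symm hbe.symm hce.symm hab hac hbc
      have e4 := hd b c d e hbc hbd hbe hcd hce hde
      have e5 := hd d e a b hde had.symm hbd.symm hae.symm hbe.symm hab
      have : 2 * T a b = 0 := by linear_combination e1 - e2 + e3 - e4 + e5
      simpa [h2] using this
    have hf : wt T (tri 0 1 2) = 0 := by
      rw [wt_tri hT (by decide) (by decide) (by decide),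
        hz 0 1 2 3 4 (by decide) (by decide) (by decide) (by decide) (by decide) (by decide) (by decide) (by decide) (by decide) (by decide),
        hz 1 2 0 3 4 (by decide) (by decide) (by decide) (by decide) (by decide) (by decide) (by decide) (by decide) (by decide) (by decide),
        hz 0 2 1 3 4 (by decide) (by decide) (by decide) (by decide) (by decide) (by decide) (by decide) (by decide) (by decide) (by decide)]
      ring
    rw [hm _ (tri_ev 0 1 2 (by decide) (by decide) (by decide)),
      hs1 0 1 2 (by decide) (by decide) (by decide)] at hf
    exact one_ne_zero hf

end K5
end

section
theorem simple (h : Dg E ι) (hp : Prim E (LD E ι)) (hn : 4 ≤ E.card) 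
    (hu : u ∈ E) {y y' : K} (hy : (ι (u, y)).1 = (ι (u, y')).1) : y = y' := by
  by_contra hne
  set w := (ι (u, y)).1 with hw
  have hwu : w ≠ u := no_loop h hp.1 (by omega) hu y
  have hwE : w ∈ E := h.mem (e := (u, y)) hu
  set a : V → K := fun v => if v = u then y else (ι (u, y)).2 with ha
  set b : V → K := fun v => if v = u then y' else (ι (u, y')).2 with hb
  have e1 : ι (u, y) = (w, a w) := by rw [ha]; simp only [if_neg hwu]; rw [hw]
  have e2 : ι (u, y') = (w, b w) := by rw [hb]; simp only [if_neg hwu]; rw [hy]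
  have au : a u = y := by simp [ha]
  have bu : b u = y' := by simp [hb]
  have hab : ∀ v ∈ ({u, w} : Finset V), a v ≠ b v := by
    intro v hv
    rw [mem_insert, mem_singleton] at hv
    rcases hv with rfl | rfl
    · rw [au, bu]; exact hne
    · intro hh
      have : ι (u, y) = ι (u, y') := by rw [e1, e2, hh]
      have := congrArg ι this
      rw [h.inv, h.inv] at this
      exact hne (by simpa using this)
  have hcy : Cyc E ι (cyX {u, w} a b) := by
    refine cyX_cyc h ?_ hab ?_
    · intro v hv; rw [mem_insert, mem_singleton] at hv; rcases hv with rfl | rfl <;> assumption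
    · intro v hv; rw [mem_insert, mem_singleton] at hv
      rcases hv with rfl | rfl
      · rw [au, bu, e1, e2]; simp [cyX_one]
      · have := h.inv (u, y); rw [e1] at this
        have h' := h.inv (u, y'); rw [e2] at h'
        rw [this, h']; simp [cyX_one, au, bu]
  have h0 := hp.pair (LD_lag h) hn (R := bd (cyX {u, w} a b)) (X := {u, w}) (mem_LD.2 ⟨_, hcy, rfl⟩)
    (by rw [mem_W]; intro v hv; rw [cyX_bd hab, if_neg hv]) card_le_two
  have h1 := congrFun h0 u
  rw [cyX_bd hab, if_pos (by simp), au, bu] at h1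
  apply hne
  have := congrArg (· + y') h1
  simpa [add_assoc, kadd] using this

theorem four_dvd [DecidableEq F] (h2 : (2 : F) ≠ 0) {H : Type} [Fintype H] [DecidableEq H] {ι : H → H} {t : H → F}
    (ht : ∀ e, t (ι e) = t e) (hf : ∀ e, t e ≠ 0 → ι e ≠ e)
    (h1 : ∀ e e', t e ≠ 0 → t e = t e' → e' = e ∨ e' = ι e)
    (h3 : ∀ e, t e ≠ 0 → ∃ e', t e' = - t e) : 4 ∣ (univ.filter fun e => t e ≠ 0).card := by
  set KH := univ.filter fun e => t e ≠ 0 with hK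
  have c1 : KH.card = 2 * (KH.image t).card := by
    rw [card_eq_sum_card_image t, sum_const_nat (m := 2), mul_comm]
    intro x hx
    obtain ⟨e, he, rfl⟩ := mem_image.1 hx
    have he' : t e ≠ 0 := by simpa [hK] using he
    have : (KH.filter fun a => t a = t e) = {e, ι e} := by
      ext a
      simp only [mem_filter, mem_insert, mem_singleton, hK, mem_univ, true_and]
      constructor
      · rintro ⟨_, h⟩; exact h1 e a he' h.symm
      · rintro (rfl | rfl)
        · exact ⟨he', rfl⟩
        · rw [ht]; exact ⟨he', rfl⟩
    rw [this, card_pair (hf e he').symm]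
  have c2 : Even (KH.image t).card := by
    rw [← ZMod.natCast_eq_zero_iff_even]
    have : ((KH.image t).card : ZMod 2) = ∑ x ∈ KH.image t, (1 : ZMod 2) := by simp
    rw [this]
    refine sum_involution (fun x _ => -x) (fun _ _ => by decide) ?_ ?_ ?_
    · intro x hx _ hxx
      obtain ⟨e, he, rfl⟩ := mem_image.1 hx
      have he' : t e ≠ 0 := by simpa [hK] using he
      have : 2 * t e = 0 := by linear_combination -hxx
      simp [h2, he'] at this
    · intro x hx
      obtain ⟨e, he, rfl⟩ := mem_image.1 hx
      have he' : t e ≠ 0 := by simpa [hK] using he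
      obtain ⟨e', h'⟩ := h3 e he'
      rw [mem_image]; exact ⟨e', by simp [hK, h', he'], h'⟩
    · intro x hx; simp
  obtain ⟨k, hk⟩ := c2
  exact ⟨k, by omega⟩

/-- underlying edge of a half edge -/
def edge (ι : V × K → V × K) (e : V × K) : Sym2 V := s(e.1, (ι e).1)

theorem edge_inv (h : Dg E ι) (e : V × K) : edge ι (ι e) = edge ι e := by
  unfold edge; rw [h.inv, Sym2.eq_swap]

theorem edge_inj (h : Dg E ι) (hp : Prim E (LD E ι)) (hn : 4 ≤ E.card) {e e' : V × K}
    (he : e.1 ∈ E) (hee : edge ι e' = edge ι e) : e' = e ∨ e' = ι e := by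
  unfold edge at hee
  rw [Sym2.eq_iff] at hee
  rcases hee with ⟨h1, h3⟩ | ⟨h1, h3⟩
  · left
    obtain ⟨v, y⟩ := e; obtain ⟨v', y'⟩ := e'
    simp only at h1 he; subst h1
    rw [simple h hp hn he h3]
  · right
    have hE := h.mem he
    have := h.inv e
    set f := ι e with hf
    obtain ⟨v, y⟩ := f; obtain ⟨v', y'⟩ := e'
    simp only at h1 hE; subst h1
    rw [simple h hp hn hE (h3.trans (by rw [this]))]

def tS (ι : V × K → V × K) (t : V × K → F) (s : Sym2 V) : F := ∑ e, if edge ι e = s then t e else 0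

theorem tS_edge (h : Dg E ι) (hp : Prim E (LD E ι)) (hn : 4 ≤ E.card) 
    (ht : ∀ e, t (ι e) = t e) (he : e.1 ∈ E) : tS ι t (edge ι e) = 2 * t e := by
  unfold tS
  rw [← sum_filter]
  have : (univ.filter fun a => edge ι a = edge ι e) = {e, ι e} := by
    ext a; simp only [mem_filter, mem_univ, true_and, mem_insert, mem_singleton]
    constructor
    · exact edge_inj h hp hn he
    · rintro (rfl | rfl)
      · rfl
      · exact edge_inv h e
  rw [this, sum_pair (h.fixE e he).symm, ht]; ring

theorem tS_ne {s : Sym2 V} (hs : tS ι t s ≠ 0) :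
    ∃ e, t e ≠ 0 ∧ edge ι e = s := by
  obtain ⟨e, _, he⟩ := exists_ne_zero_of_sum_ne_zero hs
  by_cases h' : edge ι e = s
  · exact ⟨e, by simpa [h'] using he, h'⟩
  · simp [h'] at he

theorem card_edge (h : Dg E ι) (hp : Prim E (LD E ι)) (hn : 4 ≤ E.card)
    {P : Finset (V × K)} (hP : ∀ e ∈ P, e.1 ∈ E) (hi : ∀ e ∈ P, ι e ∈ P) :
    P.card = 2 * (P.image (edge ι)).card := by
  rw [card_eq_sum_card_image (edge ι), sum_const_nat (m := 2), mul_comm]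
  intro x hx
  obtain ⟨e, he, rfl⟩ := mem_image.1 hx
  have : (P.filter fun a => edge ι a = edge ι e) = {e, ι e} := by
    ext a; simp only [mem_filter, mem_insert, mem_singleton]
    constructor
    · rintro ⟨_, h'⟩; exact edge_inj h hp hn (hP e he) h'
    · rintro (rfl | rfl)
      · exact ⟨he, rfl⟩
      · exact ⟨hi e he, edge_inv h e⟩
  rw [this, card_pair (h.fixE e (hP e he)).symm]

section loc
variable [DecidableEq F]

theorem KE_eq (h2 : (2 : F) ≠ 0) (h : Dg E ι) (hp : Prim E (LD E ι)) (hn : 4 ≤ E.card)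
    (ht : ∀ e, t (ι e) = t e) (hs : ∀ e, e.1 ∉ E → t e = 0) :
    (univ.filter fun e => t e ≠ 0).card = 2 * (KE (tS ι t)).card := by
  rw [card_edge h hp hn (P := univ.filter fun e => t e ≠ 0)]
  · congr 2
    ext s
    rw [mem_KE, mem_image]
    constructor
    · rintro ⟨e, he, rfl⟩
      have he' : t e ≠ 0 := by simpa using he
      rw [tS_edge h hp hn ht (by by_contra hh; exact he' (hs e hh))]
      exact mul_ne_zero h2 he'
    · intro hh; obtain ⟨e, he, rfl⟩ := tS_ne hh; exact ⟨e, by simpa using he, rfl⟩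
  · intro e he; by_contra hh; simp [hs e hh] at he
  · intro e he; simpa [ht] using he

def AdjD (ι : V × K → V × K) (u x : V) : Prop := ∃ y, (ι (u, y)).1 = x
def ND (ι : V × K → V × K) (u : V) : Finset V := univ.image fun y => (ι (u, y)).1

theorem mem_ND {u x : V} : x ∈ ND ι u ↔ AdjD ι u x := by
  simp [ND, AdjD]

theorem card_ND_le (ι : V × K → V × K) (u : V) : (ND ι u).card ≤ 4 :=
  card_image_le.trans (by simp [K, ZMod.card])

theorem card_ND (h : Dg E ι) (hp : Prim E (LD E ι)) (hn : 4 ≤ E.card) 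
    (hu : u ∈ E) : (ND ι u).card = 4 := by
  unfold ND
  rw [card_image_of_injective _ (fun y y' hy => simple h hp hn hu hy)]
  simp [K, ZMod.card]

open Classical in
def mate (ι : V × K → V × K) (u : V) (τ : K) (x : V) : V :=
  if h : ∃ z, (ι (u, z)).1 = x then (ι (u, h.choose + τ)).1 else x

theorem mate_eq (h : Dg E ι) (hp : Prim E (LD E ι)) (hn : 4 ≤ E.card) 
    (hu : u ∈ E) (τ z : K) : mate ι u τ (ι (u, z)).1 = (ι (u, z + τ)).1 := by
  have hh : ∃ z', (ι (u, z')).1 = (ι (u, z)).1 := ⟨z, rfl⟩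
  unfold mate
  rw [dif_pos hh, simple h hp hn hu hh.choose_spec]

theorem loc_vd (h : Dg E ι) (hp : Prim E (LD E ι)) (hn : 5 ≤ E.card) 
    (hu : u ∈ E) (hτ : τ ≠ 0) (hp' : Prim (E.erase u) (LD (E.erase u) (smo ι u τ)))
    (ts : Sym2 V → F) : VD ts (AdjD ι) u (mate ι u τ) := by
  have hn' : 4 ≤ E.card := by omega
  have hl := no_loop h hp.1 (by omega) hu
  have cz : ∀ z : K, z + τ + τ = z := fun z => by rw [add_assoc, kadd, add_zero]
  constructor
  · rintro _ ⟨z, rfl⟩; rw [mate_eq h hp hn' hu]; exact ⟨_, rfl⟩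
  · rintro _ ⟨z, rfl⟩; rw [mate_eq h hp hn' hu, mate_eq h hp hn' hu, cz]
  · rintro _ ⟨z, rfl⟩; rw [mate_eq h hp hn' hu]; intro hh
    have := simple h hp hn' hu hh
    exact hτ (by simpa using this)
  · rintro _ ⟨z, rfl⟩ ⟨y, hy⟩
    rw [mate_eq h hp hn' hu] at hy
    set x := (ι (u, z)).1 with hx
    have hxE : x ∈ E.erase u := mem_erase.2 ⟨hl z, h.mem (e := (u, z)) hu⟩
    have hD' := smo_dg h hl hτ
    have e1 : (smo ι u τ (x, y)).1 = (ι (u, z + τ)).1 := by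
      rw [smo_ne (e := (x, y)) (hl z) (by rw [hy]; exact hl _), hy]
    have e2 : (smo ι u τ (x, (ι (u, z)).2)).1 = (ι (u, z + τ)).1 := by
      rw [smo_at (e := (x, (ι (u, z)).2)) (z := z) (hl z) (h.inv (u, z))]
    have := simple hD' hp' (by rw [card_erase_of_mem hu]; omega) hxE (e1.trans e2.symm)
    rw [this] at hy
    have h3 : ι (x, (ι (u, z)).2) = (u, z) := h.inv (u, z)
    rw [h3] at hy
    exact hl _ hy.symm

theorem loc_card (h2 : (2 : F) ≠ 0) (h : Dg E ι) (hp : Prim E (LD E ι)) (hn : 5 ≤ E.card) 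
    (hu : u ∈ E) (hτ : τ ≠ 0) (ht : ∀ e, t (ι e) = t e) (hs : ∀ e, e.1 ∉ E → t e = 0) :
    (univ.filter fun e => smt ι u τ t e ≠ 0).card =
      2 * (OO (tS ι t) u).card + (PP (tS ι t) u (mate ι u τ) (ND ι u)).card := by
  have hn' : 4 ≤ E.card := by omega
  have hl := no_loop h hp.1 (by omega) hu
  set P := univ.filter fun e : V × K => t e ≠ 0 ∧ e.1 ≠ u ∧ (ι e).1 ≠ u with hP
  set Q := (univ.filter fun z : K => t (u, z) + t (u, z + τ) ≠ 0) with hQ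
  have e0 : (univ.filter fun e => smt ι u τ t e ≠ 0) = P ∪ Q.image (fun z => ι (u, z)) := by
    ext e
    simp only [mem_filter, mem_univ, true_and, mem_union, hP, mem_image, hQ]
    unfold smt
    by_cases h1 : e.1 = u
    · simp only [h1, if_true, ne_eq, not_true, false_and, and_false, false_or, false_iff, not_exists]
      rintro z ⟨_, rfl⟩
      exact hl z h1
    · rw [if_neg h1]
      by_cases h3 : (ι e).1 = u
      · rw [if_pos h3]
        simp only [h3, ne_eq, not_true, and_false, false_or]
        constructor
        · intro hh
          refine ⟨(ι e).2, hh, ?_⟩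
          rw [← h3]; exact h.inv e
        · rintro ⟨z, hz, rfl⟩
          rw [h.inv]; exact hz
      · rw [if_neg h3]
        simp only [h1, h3, ne_eq, not_false_eq_true, and_self, and_true, iff_self_or]
        rintro ⟨z, _, rfl⟩
        rw [h.inv] at h3; exact absurd rfl h3
  have hinj : Function.Injective ι := fun a b hab => by rw [← h.inv a, hab, h.inv]
  rw [e0, card_union_of_disjoint, card_image_of_injective]
  · congr 1
    · rw [card_edge h hp hn' (P := P)]
      · congr 2
        ext s
        rw [mem_OO, mem_image]
        constructor
        · rintro ⟨e, he, rfl⟩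
          simp only [hP, mem_filter, mem_univ, true_and] at he
          rw [tS_edge h hp hn' ht (by by_contra hh; exact he.1 (hs e hh))]
          refine ⟨mul_ne_zero h2 he.1, ?_⟩
          rw [edge, Sym2.mem_iff]; rintro (hh | hh)
          · exact he.2.1 hh.symm
          · exact he.2.2 hh.symm
        · rintro ⟨hh, hu'⟩; obtain ⟨e, he, rfl⟩ := tS_ne hh
          rw [edge, Sym2.mem_iff] at hu'
          push Not at hu'
          exact ⟨e, by simp [hP, he, hu'.1.symm, hu'.2.symm], rfl⟩
      · intro e he; by_contra hh; simp [hP, hs e hh] at he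
      · intro e he
        simp only [hP, mem_filter, mem_univ, true_and] at he ⊢
        rw [ht, h.inv]; exact ⟨he.1, he.2.2, he.2.1⟩
    · have : PP (tS ι t) u (mate ι u τ) (ND ι u) = Q.image (fun z => (ι (u, z)).1) := by
        have key : ∀ z, tS ι t s(u, (ι (u, z)).1) = 2 * t (u, z) := fun z =>
          tS_edge h hp hn' ht (e := (u, z)) hu
        ext x
        simp only [PP, mem_filter, mem_ND, mem_image, hQ, mem_univ, true_and]
        constructor
        · rintro ⟨⟨z, rfl⟩, hz⟩
          rw [mate_eq h hp hn' hu, key, key, ← mul_add] at hz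
          exact ⟨z, (mul_ne_zero_iff.1 hz).2, rfl⟩
        · rintro ⟨z, hz, rfl⟩
          refine ⟨⟨z, rfl⟩, ?_⟩
          rw [mate_eq h hp hn' hu, key, key, ← mul_add]
          exact mul_ne_zero h2 hz
      rw [this, card_image_of_injective _ (fun y y' hy => simple h hp hn' hu hy)]
  · intro a b hab
    have := hinj hab
    simpa using this
  · rw [disjoint_left]
    intro e he he'
    obtain ⟨z, _, rfl⟩ := mem_image.1 he'
    simp [hP, h.inv] at he

/-- conclusion of the star-or-small lemma -/
def Small (ι : V × K → V × K) (t : V × K → F) : Prop :=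
  (univ.filter fun e => t e ≠ 0).card ≤ 4 ∨ ∃ w, ∀ e, t e ≠ 0 → e.1 = w ∨ (ι e).1 = w

theorem star_card (h : Dg E ι) {w : V}
    (hw : ∀ e, t e ≠ 0 → e.1 = w ∨ (ι e).1 = w) : (univ.filter fun e => t e ≠ 0).card ≤ 8 := by
  have : (univ.filter fun e => t e ≠ 0) ⊆
      (univ.image fun y : K => (w, y)) ∪ (univ.image fun y : K => ι (w, y)) := by
    intro e he
    have he' : t e ≠ 0 := by simpa using he
    rw [mem_union, mem_image, mem_image]
    rcases hw e he' with h1 | h1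
    · left; exact ⟨e.2, mem_univ _, by rw [← h1]⟩
    · right; exact ⟨(ι e).2, mem_univ _, by rw [← h1]; exact h.inv e⟩
  refine (card_le_card this).trans ((card_union_le _ _).trans ?_)
  have h1 : (univ.image fun y : K => (w, y)).card ≤ 4 := card_image_le.trans (by simp [K, ZMod.card])
  have h3 : (univ.image fun y : K => ι (w, y)).card ≤ 4 := card_image_le.trans (by simp [K, ZMod.card])
  omega

theorem small_card (h : Dg E ι) (hw : Small ι t) :
    (univ.filter fun e => t e ≠ 0).card ≤ 8 := by
  rcases hw with h1 | ⟨w, hw⟩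
  · omega
  · exact star_card h hw

theorem E1_four (h2 : (2 : F) ≠ 0) (h : Dg E ι) (hc : Conn E (LD E ι)) (hn : 2 ≤ E.card)
    {L0 : Spc V} (hC : Compat E ι L0 t)
    (h8 : (univ.filter fun e => t e ≠ 0).card ≤ 8) : 4 ∣ (univ.filter fun e => t e ≠ 0).card := by
  obtain ⟨h1, h3⟩ := E1 h2 _ E ι L0 t rfl hn h hc hC h8
  refine four_dvd h2 hC.inv ?_ h1 h3
  intro e he; exact h.fixE e (by by_contra hh; exact he (hC.supp e hh))

theorem loc_of (h2 : (2 : F) ≠ 0) (h : Dg E ι) (hp : Prim E (LD E ι)) (hn : 6 ≤ E.card) 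
    (hu : u ∈ E) (hτ : τ ≠ 0) (hp' : Prim (E.erase u) (LD (E.erase u) (smo ι u τ)))
    {L0 : Spc V} (hC : Compat E ι L0 t)
    (hsm : Small (smo ι u τ) (smt ι u τ t)) (hstar : ∀ w, ¬ Star (tS ι t) w) :
    Loc (tS ι t) (AdjD ι) (ND ι) u (mate ι u τ) := by
  have hn' : 4 ≤ E.card := by omega
  have hvd := loc_vd h hp (by omega) hu hτ hp' (tS ι t)
  refine ⟨hvd, ?_⟩
  have hl := no_loop h hp.1 (by omega) hu
  have hD' := smo_dg h hl hτ
  have hC' := hC.smo h hu hl hτ (single_notMem hp.1 (by omega) hu hτ)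
  have hc := loc_card h2 h hp (by omega) hu hτ hC.inv hC.supp
  have h8 := small_card hD' hsm
  have h4 := E1_four h2 hD' hp'.1 (by rw [card_erase_of_mem hu]; omega) hC' h8
  obtain ⟨k, hk⟩ := h4
  rw [← hc]
  have hOO : (OO (tS ι t) u).card ≠ 0 := by
    intro h0
    rw [card_eq_zero] at h0
    refine hstar u fun s hs => ?_
    by_contra hus
    have : s ∈ OO (tS ι t) u := mem_OO.2 ⟨hs, hus⟩
    rw [h0] at this; simp at this
  have hk2 : k = 1 ∨ k = 2 := by omega
  rcases hk2 with rfl | rfl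
  · left; exact hk
  · right
    rcases hsm with h5 | ⟨w, hw⟩
    · omega
    have hsupp : ∀ e, smt ι u τ t e ≠ 0 → e.1 ∈ E.erase u := fun e he => by
      by_contra hh; exact he (hC'.supp e hh)
    have hwu : w ≠ u := by
      rintro rfl
      have : 0 < (univ.filter fun e => smt ι w τ t e ≠ 0).card := by omega
      obtain ⟨e, he⟩ := card_pos.1 this
      have he' : smt ι w τ t e ≠ 0 := by simpa using he
      have h5 := hsupp e he'
      have h6 := hD'.mem h5
      rcases hw e he' with h7 | h7
      · rw [h7] at h5; simp at h5
      · rw [h7] at h6; simp at h6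
    have hPP : ∀ x ∈ PP (tS ι t) u (mate ι u τ) (ND ι u), x = w ∨ mate ι u τ x = w := by
      intro x hx
      simp only [PP, mem_filter, mem_ND] at hx
      obtain ⟨⟨z, rfl⟩, hz⟩ := hx
      have key : ∀ z, tS ι t s(u, (ι (u, z)).1) = 2 * t (u, z) := fun z =>
          tS_edge h hp hn' hC.inv (e := (u, z)) hu
      rw [mate_eq h hp hn' hu, key, key, ← mul_add] at hz
      have hz' := (mul_ne_zero_iff.1 hz).2
      have : smt ι u τ t (ι (u, z)) ≠ 0 := by
        unfold smt; rw [if_neg (hl z), h.inv, if_pos rfl]; exact hz'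
      rw [mate_eq h hp hn' hu]
      rcases hw _ this with h7 | h7
      · left; exact h7
      · right; rwa [smo_at (hl z) (h.inv _)] at h7
    have hPc : (PP (tS ι t) u (mate ι u τ) (ND ι u)).card ≤ 2 := by
      refine (card_le_card (t := {w, mate ι u τ w}) ?_).trans card_le_two
      intro x hx
      rw [mem_insert, mem_singleton]
      rcases hPP x hx with h7 | h7
      · left; exact h7
      · right
        simp only [PP, mem_filter, mem_ND] at hx
        rw [← h7, hvd.inv x hx.1]
    refine ⟨w, hwu, by omega, ?_, hPP⟩
    intro s hs
    obtain ⟨h5, h6⟩ := mem_OO.1 hs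
    obtain ⟨e, he, rfl⟩ := tS_ne h5
    rw [edge, Sym2.mem_iff] at h6 ⊢
    push Not at h6
    have : smt ι u τ t e ≠ 0 := by
      unfold smt; rw [if_neg h6.1.symm, if_neg h6.2.symm]; exact he
    rcases hw e this with h7 | h7
    · left; exact h7.symm
    · right; rw [smo_ne h6.1.symm h6.2.symm] at h7; exact h7.symm

theorem E_step (h2 : (2 : F) ≠ 0) (h : Dg E ι) (hp : Prim E (LD E ι)) (hn : 6 ≤ E.card)
    {L0 : Spc V} (hC : Compat E ι L0 t)
    (ih : ∀ u ∈ E, ∀ τ : K, τ ≠ 0 → Prim (E.erase u) (LD (E.erase u) (smo ι u τ)) →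
      Small (smo ι u τ) (smt ι u τ t)) : Small ι t := by
  by_contra hns
  have hn' : 4 ≤ E.card := by omega
  unfold Small at hns
  push Not at hns
  obtain ⟨h5, hst⟩ := hns
  have hstar : ∀ w, ¬ Star (tS ι t) w := by
    intro w hw
    obtain ⟨e, he, h6, h7⟩ := hst w
    have heE : e.1 ∈ E := by by_contra hh; exact he (hC.supp e hh)
    have := hw (edge ι e) (by rw [tS_edge h hp hn' hC.inv heE]; exact mul_ne_zero h2 he)
    rw [edge, Sym2.mem_iff] at this
    rcases this with h8 | h8
    · exact h6 h8.symm
    · exact h7 h8.symm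
  have hKE := KE_eq h2 h hp hn' hC.inv hC.supp
  have hloc : ∀ u ∈ E, Redu E (LD E ι) u → ∃ m, Loc (tS ι t) (AdjD ι) (ND ι) u m := by
    rintro u hu ⟨τ, hτ, hpr⟩
    have hl := no_loop h hp.1 (by omega) hu
    rw [smo_LD h hu hl hτ] at hpr
    exact ⟨_, loc_of h2 h hp hn hu hτ hpr hC (ih u hu τ hτ hpr) hstar⟩
  obtain ⟨a, b, c, ha, hb, hc, hab, hac, hbc, ra, rb, rc⟩ := three_red (LD_lag h) hp hn
  obtain ⟨m, la⟩ := hloc a ha ra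
  obtain ⟨m', lb⟩ := hloc b hb rb
  obtain ⟨m'', lc⟩ := hloc c hc rc
  refine comb (ts := tS ι t) (Adj := AdjD ι) (N := ND ι) ?_ ?_ (fun u x => mem_ND) (card_ND_le ι) hstar ?_ ?_ hab hac hbc la lb lc
    (card_ND h hp hn' ha) (card_ND h hp hn' hb) (card_ND h hp hn' hc)
  · rintro x _ ⟨y, rfl⟩
    exact ⟨(ι (x, y)).2, by
      have := h.inv (x, y)
      rw [show ((ι (x, y)).1, (ι (x, y)).2) = ι (x, y) from rfl, this]⟩
  · intro x y hxy
    obtain ⟨e, he, hh⟩ := tS_ne hxy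
    rw [edge, Sym2.eq_iff] at hh
    rcases hh with ⟨rfl, rfl⟩ | ⟨rfl, rfl⟩
    · exact ⟨e.2, rfl⟩
    · refine ⟨(ι e).2, ?_⟩
      rw [show ((ι e).1, (ι e).2) = ι e from rfl, h.inv]
  · by_contra hlt
    have h8 : (univ.filter fun e => t e ≠ 0).card ≤ 8 := by omega
    obtain ⟨k, hk⟩ := E1_four h2 h hp.1 (by omega) hC h8
    omega
  · intro h4 s s' hs hss
    obtain ⟨h1, _⟩ := E1 h2 _ E ι L0 t rfl (by omega) h hp.1 hC (by omega)
    obtain ⟨e, he, rfl⟩ := tS_ne hs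
    obtain ⟨e', he', rfl⟩ := tS_ne (hss ▸ hs)
    have heE : e.1 ∈ E := by by_contra hh; exact he (hC.supp e hh)
    have heE' : e'.1 ∈ E := by by_contra hh; exact he' (hC.supp e' hh)
    rw [tS_edge h hp hn' hC.inv heE, tS_edge h hp hn' hC.inv heE'] at hss
    rcases h1 e e' he (mul_left_cancel₀ h2 hss) with rfl | rfl
    · rfl
    · exact (edge_inv h e).symm

end loc
end

section
theorem min5 (hL : Lag E L) (hp : Prim E L) (hn : E.card = 5) (hR : R ∈ L) (h0 : R ≠ 0) :
    Min L R := by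
  refine ⟨hR, h0, fun Q hQ hle => ?_⟩
  set X := E.filter fun v => Q v ≠ 0 with hX
  set Y := E.filter fun v => (Q + R) v ≠ 0 with hY
  have hd : Disjoint X Y := by
    rw [disjoint_left]
    intro v h1 h2
    simp only [hX, hY, mem_filter] at h1 h2
    rcases hle v with h | h
    · exact h1.2 h
    · apply h2.2; rw [Pi.add_apply, h, kadd]
  have hc : X.card + Y.card ≤ 5 := by
    rw [← card_union_of_disjoint hd, ← hn]
    exact card_le_card (union_subset (filter_subset _ _) (filter_subset _ _))
  have hQX : Q ∈ W X := mem_W.2 fun v hv => by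
    by_cases hvE : v ∈ E
    · by_contra hh; exact hv (mem_filter.2 ⟨hvE, hh⟩)
    · exact hL.supp hQ v hvE
  have hQY : Q + R ∈ W Y := mem_W.2 fun v hv => by
    by_cases hvE : v ∈ E
    · by_contra hh; exact hv (mem_filter.2 ⟨hvE, hh⟩)
    · exact hL.supp (L.add_mem hQ hR) v hvE
  by_cases h2 : X.card ≤ 2
  · left; exact hp.pair hL (by omega) hQ hQX h2
  · right; exact vadd_eq_zero.1 (hp.pair hL (by omega) (L.add_mem hQ hR) hQY (by omega))

section base
variable [DecidableEq F]

theorem ND_eq (h : Dg E ι) (hp : Prim E (LD E ι)) (hn : E.card = 5) 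
    (hu : u ∈ E) : ND ι u = E.erase u := by
  apply eq_of_subset_of_card_le
  · intro x hx
    obtain ⟨y, rfl⟩ := mem_ND.1 hx
    exact mem_erase.2 ⟨no_loop h hp.1 (by omega) hu y, h.mem (e := (u, y)) hu⟩
  · rw [card_erase_of_mem hu, card_ND h hp (by omega) hu]; omega

theorem sum_nbr (h : Dg E ι) (hp : Prim E (LD E ι)) (hn : E.card = 5) 
    (hu : u ∈ E) {M : Type} [AddCommMonoid M] (φ : V → M) (h0 : φ u = 0) :
    ∑ y, φ (ι (u, y)).1 = ∑ x ∈ E, φ x := by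
  rw [← sum_erase E h0, ← ND_eq h hp hn hu, ND, sum_image]
  intro y _ y' _ hy; exact simple h hp (by omega) hu hy

theorem E_base (h2 : (2 : F) ≠ 0) (h : Dg E ι) (hp : Prim E (LD E ι)) (hn : E.card = 5)
    {L0 : Spc V} (hC : Compat E ι L0 t) : Small ι t := by
  classical
  have hn4 : 4 ≤ E.card := by omega
  let f : Fin 5 ≃ E := (finCongr hn.symm).trans E.equivFin.symm
  let vv : Fin 5 → V := fun i => (f i : V)
  let g : V → Fin 5 := fun v => if hv : v ∈ E then f.symm ⟨v, hv⟩ else 0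
  have gv : ∀ i, g (vv i) = i := by
    intro i; simp only [g, vv]; rw [dif_pos (f i).2]; simp
  have vg : ∀ v ∈ E, vv (g v) = v := by
    intro v hv; simp only [g, vv]; rw [dif_pos hv]; simp
  have vE : ∀ i, vv i ∈ E := fun i => (f i).2
  have vinj : ∀ i j, vv i = vv j → i = j := fun i j hh => by rw [← gv i, hh, gv]
  have sumE : ∀ {M : Type} [AddCommMonoid M] (φ : V → M), ∑ x ∈ E, φ x = ∑ i, φ (vv i) := by
    intro M _ φ
    rw [← sum_coe_sort]
    exact (f.sum_comp (fun x : E => φ x)).symm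
  let T : Fin 5 → Fin 5 → F := fun i j => ∑ y, if (ι (vv i, y)).1 = vv j then t (vv i, y) else 0
  have hTt : ∀ u ∈ E, ∀ y, T (g u) (g (ι (u, y)).1) = t (u, y) := by
    intro u hu y
    have hE : (ι (u, y)).1 ∈ E := h.mem (e := (u, y)) hu
    simp only [T]
    rw [vg u hu, vg _ hE, sum_eq_single y]
    · simp
    · intro z _ hz
      rw [if_neg]; intro hh; exact hz (simple h hp hn4 hu hh)
    · simp
  have hnb : ∀ i j, i ≠ j → ∃ y, (ι (vv i, y)).1 = vv j := by
    intro i j hij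
    have : vv j ∈ ND ι (vv i) := by
      rw [ND_eq h hp hn (vE i)]; exact mem_erase.2 ⟨fun hh => hij (vinj _ _ hh).symm, vE j⟩
    exact mem_ND.1 this
  have hTt' : ∀ i y, T i (g (ι (vv i, y)).1) = t (vv i, y) := by
    intro i y; have := hTt (vv i) (vE i) y; rwa [gv] at this
  have hT : ∀ i j, T i j = T j i := by
    intro i j
    by_cases hij : i = j
    · rw [hij]
    obtain ⟨y, hy⟩ := hnb i j hij
    have e1 := hTt' i y
    rw [hy, gv] at e1
    have e2 := hTt' j (ι (vv i, y)).2
    rw [show (vv j, (ι (vv i, y)).2) = ι (vv i, y) by rw [← hy], h.inv, gv, hC.inv] at e2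
    rw [e1, e2]
  let P : (Fin 5 → Fin 5 → ZMod 2) → V × K → ZMod 2 := fun S e =>
    if e.1 ∈ E then S (g e.1) (g (ι e).1) else 0
  have hcyc : ∀ S, Ev S → Cyc E ι (P S) := by
    intro S hS
    refine ⟨fun e => ?_, fun v => ?_, fun e he => if_neg he⟩
    · simp only [P, h.mem_iff]; rw [h.inv, hS.sym]
    · simp only [P]
      by_cases hv : v ∈ E
      · simp only [hv, if_true]
        rw [sum_nbr h hp hn hv (fun x => S (g v) (g x)) (hS.diag _), sumE]
        simp only [gv]; exact hS.even _
      · simp [hv]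
  have hwt : ∀ S, Ev S → TT t (P S) = wt T S := by
    intro S hS
    unfold TT wt
    rw [Fintype.sum_prod_type, ← sum_subset (subset_univ E), sumE]
    · refine sum_congr rfl fun i _ => ?_
      have : ∀ y, (if P S (vv i, y) = 1 then t (vv i, y) else 0) =
          (fun x => if S i (g x) = 1 then T i (g x) else 0) (ι (vv i, y)).1 := by
        intro y
        simp only [P, vE, if_true, gv]; rw [hTt']
      simp only [this]
      rw [sum_nbr h hp hn (vE i) (fun x => if S i (g x) = 1 then T i (g x) else 0)
        (by rw [gv, hS.diag]; simp), sumE]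
      simp only [gv]
    · intro v _ hv
      simp [P, hv]
  let σ : (Fin 5 → Fin 5 → ZMod 2) → ZMod 2 := fun S => if bd (P S) ∈ L0 then 0 else 1
  have hPadd : ∀ S S', P (S + S') = P S + P S' := by
    intro S S'; ext1 e; simp only [P, Pi.add_apply]; split_ifs <;> simp
  have hL := LD_lag h
  have res := K5_lemma h2 hT σ ?_ ?_ ?_ ?_
  · rcases res with ⟨w, hw⟩ | ⟨a, b, c, e, hab, hce, hw⟩
    · right
      refine ⟨vv w, fun e he => ?_⟩
      have heE : e.1 ∈ E := by by_contra hh; exact he (hC.supp e hh)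
      by_contra hh; push Not at hh
      have h1 := hTt e.1 heE e.2
      have hE' := h.mem heE
      rw [hw] at h1
      · exact he h1.symm
      · intro h3; have := congrArg vv h3
        rw [vg _ heE, vg _ hE'] at this
        exact no_loop h hp.1 (by omega) heE e.2 this.symm
      · intro h3; exact hh.1 (by rw [← h3, vg _ heE])
      · intro h3; exact hh.2 (by rw [← h3, vg _ hE'])
    · left
      rw [KE_eq h2 h hp hn4 hC.inv hC.supp]
      have : (KE (tS ι t)) ⊆ {s(vv a, vv b), s(vv c, vv e)} := by
        intro s hs
        obtain ⟨q, hq, rfl⟩ := tS_ne (mem_KE.1 hs)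
        have heE : q.1 ∈ E := by by_contra hh; exact hq (hC.supp q hh)
        have hE' := h.mem heE
        have h1 := hTt q.1 heE q.2
        have hne : g q.1 ≠ g (ι q).1 := by
          intro h3; have := congrArg vv h3
          rw [vg _ heE, vg _ hE'] at this
          exact no_loop h hp.1 (by omega) heE q.2 this.symm
        rw [mem_insert, mem_singleton, edge, ← vg _ heE, ← vg _ hE']
        rcases hw _ _ hne with h3 | ⟨h3, h4⟩ | ⟨h3, h4⟩ | ⟨h3, h4⟩ | ⟨h3, h4⟩
        · exact absurd (h1.symm.trans h3) hq
        · left; rw [h3, h4]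
        · left; rw [h3, h4, Sym2.eq_swap]
        · right; rw [h3, h4]
        · right; rw [h3, h4, Sym2.eq_swap]
      have := (card_le_card this).trans card_le_two
      omega
  · have : P 0 = 0 := by ext1 e; simp [P]
    simp only [σ]; rw [this, bd_zero, if_pos L0.zero_mem]
  · intro S S' hS hS'
    simp only [σ]
    rw [hPadd, bd_add]
    have m1 : bd (P S) ∈ LD E ι := mem_LD.2 ⟨_, hcyc S hS, rfl⟩
    have m2 : bd (P S') ∈ LD E ι := mem_LD.2 ⟨_, hcyc S' hS', rfl⟩
    by_cases h1 : bd (P S) ∈ L0 <;> by_cases h3 : bd (P S') ∈ L0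
    · simp [h1, h3, L0.add_mem h1 h3]
    · have : bd (P S) + bd (P S') ∉ L0 := fun hh => h3 (by
        have := L0.add_mem h1 hh
        rwa [← add_assoc, vadd, zero_add] at this)
      simp [h1, h3, this]
    · have : bd (P S) + bd (P S') ∉ L0 := fun hh => h1 (by
        have := L0.add_mem hh h3
        rwa [vadd_cancel] at this)
      simp [h1, h3, this]
    · have := hC.idx _ m1 _ m2 h1 h3
      simp [h1, h3, this]; decide
  · simp only [σ]
    rw [if_pos]
    have : bd (P fun i j => if i = j then 0 else 1) = 0 := by
      ext1 v
      unfold bd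
      by_cases hv : v ∈ E
      · have : (fun y => P (fun i j => if i = j then 0 else 1) (v, y)) = fun _ => 1 := by
          ext1 y
          have hE' : (ι (v, y)).1 ∈ E := h.mem (e := (v, y)) hv
          simp only [P, hv, if_true]
          rw [if_neg]
          intro h3; have := congrArg vv h3
          rw [vg _ hv, vg _ hE'] at this
          exact no_loop h hp.1 (by omega) hv y this.symm
        rw [this, bdK_const]; rfl
      · have : (fun y => P (fun i j => if i = j then 0 else 1) (v, y)) = fun _ => 0 := by
          ext1 y; simp [P, hv]
        rw [this, bdK_const]; rfl
    rw [this]; exact L0.zero_mem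
  · intro S hS
    rw [← hwt S hS]
    have m1 : bd (P S) ∈ LD E ι := mem_LD.2 ⟨_, hcyc S hS, rfl⟩
    rw [hC.main _ (hcyc S hS)]
    · simp only [σ]; split_ifs with h1 <;> simp [h1]
    · by_cases h0 : bd (P S) = 0
      · left; exact h0
      · right; exact min5 hL hp hn m1 h0

theorem E_main (h2 : (2 : F) ≠ 0) : ∀ (n : ℕ) (E : Finset V) (ι : V × K → V × K) 
    (L0 : Spc V) (t : V × K → F), E.card = n + 5 → Dg E ι → Prim E (LD E ι) →
    Compat E ι L0 t → Small ι t := by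
  intro n
  induction n with
  | zero => intro E ι L0 t hE h hp hC; exact E_base h2 h hp hE hC
  | succ n ih =>
    intro E ι L0 t hE h hp hC
    refine E_step h2 h hp (by omega) hC fun u hu τ hτ hp' => ?_
    have hl := no_loop h hp.1 (by omega) hu
    exact ih _ _ _ _ (by rw [card_erase_of_mem hu]; omega) (smo_dg h hl hτ) hp'
      (hC.smo h hu hl hτ (single_notMem hp.1 (by omega) hu hτ))

/-- final form: the kink labelling is supported on two edges with opposite values, provided it is not a star -/
theorem E_final (h2 : (2 : F) ≠ 0) (h : Dg E ι) (hp : Prim E (LD E ι)) (hn : 5 ≤ E.card)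
    {L0 : Spc V} (hC : Compat E ι L0 t)
    (hst : ∀ w, ∃ e, t e ≠ 0 ∧ e.1 ≠ w ∧ (ι e).1 ≠ w) :
    ∃ (c : F) (e f : V × K), c ≠ 0 ∧ e.1 ∈ E ∧ f.1 ∈ E ∧ f ≠ e ∧ f ≠ ι e ∧ t e = c ∧ t f = - c ∧
      ∀ a, t a ≠ 0 → a = e ∨ a = ι e ∨ a = f ∨ a = ι f := by
  have hsm := E_main h2 (E.card - 5) E ι L0 t (by omega) h hp hC
  have h4 : (univ.filter fun e => t e ≠ 0).card ≤ 4 := by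
    rcases hsm with h4 | ⟨w, hw⟩
    · exact h4
    · exfalso
      obtain ⟨e, he, h1, h3⟩ := hst w
      rcases hw e he with h5 | h5
      · exact h1 h5
      · exact h3 h5
  obtain ⟨h1, h3⟩ := E1 h2 _ E ι L0 t rfl (by omega) h hp.1 hC (by omega)
  have : 0 < E.card := by omega
  obtain ⟨w, _⟩ := card_pos.1 this
  obtain ⟨e, he, _, _⟩ := hst w
  obtain ⟨f, hf⟩ := h3 e he
  have hf0 : t f ≠ 0 := by rw [hf]; exact neg_ne_zero.2 he
  have hee : t e ≠ t f := by
    rw [hf]; intro hh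
    have : 2 * t e = 0 := by linear_combination hh
    simp [h2, he] at this
  have heE : e.1 ∈ E := by by_contra hh; exact he (hC.supp e hh)
  have hfE : f.1 ∈ E := by by_contra hh; exact hf0 (hC.supp f hh)
  have hfe : f ≠ e := fun hh => hee (by rw [hh])
  have hfe' : f ≠ ι e := fun hh => hee (by rw [hh, hC.inv])
  refine ⟨t e, e, f, he, heE, hfE, hfe, hfe', rfl, hf, fun a ha => ?_⟩
  by_contra hh
  push Not at hh
  obtain ⟨a1, a2, a3, a4⟩ := hh
  have hff := h.fixE f hfE
  have hef := h.fixE e heE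
  have : ({a, e, ι e, f, ι f} : Finset (V × K)) ⊆ (univ.filter fun e => t e ≠ 0) := by
    intro x hx
    simp only [mem_insert, mem_singleton] at hx
    simp only [mem_filter, mem_univ, true_and]
    rcases hx with rfl | rfl | rfl | rfl | rfl
    · exact ha
    · exact he
    · rwa [hC.inv]
    · exact hf0
    · rwa [hC.inv]
  have hc := card_le_card this
  have inj : ∀ a b, ι a = ι b → a = b := fun a b hab => by rw [← h.inv a, hab, h.inv]
  have hh1 : e ≠ ι f := fun hh => hfe' (by rw [hh, h.inv])
  have hh2 : ι e ≠ ι f := fun hh => hfe (inj _ _ hh).symm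
  rw [card_insert_of_notMem (by simp [a1, a2, a3, a4]), card_insert_of_notMem (by simp [hef.symm, hfe.symm, hh1]),
    card_insert_of_notMem (by simp [hfe'.symm, hh2]), card_insert_of_notMem (by simp [hff.symm]), card_singleton] at hc
  omega

end base
end

section
theorem z2_ne_add : ∀ x y : ZMod 2, x ≠ y → x + y = 1 := by decide
theorem k4 : ∀ φ c k : K, φ ≠ 0 → c ≠ 0 → c ≠ φ → k = 0 ∨ k = φ ∨ k = c ∨ k = c + φ := by decide
theorem k4_univ : ∀ φ c : K, φ ≠ 0 → c ≠ 0 → c ≠ φ → (univ : Finset K) = {0, φ, c, c + φ} := by decide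
theorem k4_ne : ∀ φ c : K, φ ≠ 0 → c ≠ 0 → c ≠ φ → c + φ ≠ 0 ∧ c + φ ≠ φ ∧ c + φ ≠ c ∧ om φ c = 1 := by decide
theorem k4_sum {φ c : K} (h1 : φ ≠ 0) (h2 : c ≠ 0) (h3 : c ≠ φ) {M : Type*} [AddCommMonoid M] (f : K → M) :
    ∑ y, f y = f 0 + (f φ + (f c + f (c + φ))) := by
  obtain ⟨a1, a2, a3, _⟩ := k4_ne φ c h1 h2 h3
  rw [k4_univ φ c h1 h2 h3, sum_insert (by simp [h1.symm, h2.symm, a1.symm]),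
    sum_insert (by simp [h3.symm, a2.symm, h2]), sum_insert (by simp [a3.symm, h1]), sum_singleton]

def ins (ι' : V × K → V × K) (v : V) (φ c : K) (h1 h3 e : V × K) : V × K :=
  if e.1 = v then (if e.2 = 0 then h1 else if e.2 = φ then ι' h1 else if e.2 = c then h3 else ι' h3)
  else if e = h1 then (v, 0) else if e = ι' h1 then (v, φ) else if e = h3 then (v, c)
  else if e = ι' h3 then (v, c + φ) else ι' e

/-- hypotheses for inserting a vertex on two edges -/
structure InsH (E : Finset V) (ι' : V × K → V × K) (v : V) (φ : K) (h1 h3 : V × K) : Prop where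
  hv : v ∈ E
  hφ : φ ≠ 0
  dg : Dg (E.erase v) ι'
  m1 : h1.1 ∈ E.erase v
  m3 : h3.1 ∈ E.erase v
  n1 : h3 ≠ h1
  n2 : h3 ≠ ι' h1

variable {ι' : V × K → V × K} {v : V} {φ c : K} {h1 h3 : V × K}

section
variable (H : InsH E ι' v φ h1 h3) (hc0 : c ≠ 0) (hcφ : c ≠ φ)
include H hc0 hcφ

theorem ins_vals : ins ι' v φ c h1 h3 (v, 0) = h1 ∧ ins ι' v φ c h1 h3 (v, φ) = ι' h1 ∧
    ins ι' v φ c h1 h3 (v, c) = h3 ∧ ins ι' v φ c h1 h3 (v, c + φ) = ι' h3 := by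
  obtain ⟨a1, a2, a3, _⟩ := k4_ne φ c H.hφ hc0 hcφ
  refine ⟨?_, ?_, ?_, ?_⟩ <;> simp [ins, H.hφ, hc0, hcφ, a1, a2, a3]

theorem ins_vals' : ins ι' v φ c h1 h3 h1 = (v, 0) ∧ ins ι' v φ c h1 h3 (ι' h1) = (v, φ) ∧
    ins ι' v φ c h1 h3 h3 = (v, c) ∧ ins ι' v φ c h1 h3 (ι' h3) = (v, c + φ) := by
  have d1 : ι' h1 ≠ h1 := H.dg.fixE _ H.m1
  have d3 : ι' h3 ≠ h3 := H.dg.fixE _ H.m3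
  have d4 : ι' h3 ≠ h1 := fun h => H.n2 (by rw [← h, H.dg.inv])
  have d5 : ι' h3 ≠ ι' h1 := fun h => H.n1 (by rw [← H.dg.inv h3, h, H.dg.inv])
  have e1 : h1.1 ≠ v := (mem_erase.1 H.m1).1
  have e2 : (ι' h1).1 ≠ v := (mem_erase.1 (H.dg.mem H.m1)).1
  have e3 : h3.1 ≠ v := (mem_erase.1 H.m3).1
  have e4 : (ι' h3).1 ≠ v := (mem_erase.1 (H.dg.mem H.m3)).1
  refine ⟨?_, ?_, ?_, ?_⟩
  · simp [ins, e1]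
  · simp [ins, e2, d1]
  · simp [ins, e3, H.n1, H.n2]
  · simp [ins, e4, d3, d4, d5]

theorem ins_other (he : e.1 ≠ v) (a1 : e ≠ h1) (a2 : e ≠ ι' h1) (a3 : e ≠ h3)
    (a4 : e ≠ ι' h3) : ins ι' v φ c h1 h3 e = ι' e := by
  simp [ins, he, a1, a2, a3, a4]

theorem ins_cases (e : V × K) : e = (v, 0) ∨ e = (v, φ) ∨ e = (v, c) ∨ e = (v, c + φ) ∨ e = h1 ∨
    e = ι' h1 ∨ e = h3 ∨ e = ι' h3 ∨
    (e.1 ≠ v ∧ e ≠ h1 ∧ e ≠ ι' h1 ∧ e ≠ h3 ∧ e ≠ ι' h3 ∧ ins ι' v φ c h1 h3 e = ι' e) := by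
  by_cases hv : e.1 = v
  · obtain ⟨w, y⟩ := e
    simp only at hv; subst hv
    rcases k4 φ c y H.hφ hc0 hcφ with rfl | rfl | rfl | rfl <;> simp
  · by_cases a1 : e = h1
    · tauto
    by_cases a2 : e = ι' h1
    · tauto
    by_cases a3 : e = h3
    · tauto
    by_cases a4 : e = ι' h3
    · tauto
    have := ins_other H hc0 hcφ hv a1 a2 a3 a4
    tauto

theorem ins_dg : Dg E (ins ι' v φ c h1 h3) := by
  obtain ⟨b1, b2, b3, b4⟩ := ins_vals H hc0 hcφ
  obtain ⟨c1, c2, c3, c4⟩ := ins_vals' H hc0 hcφ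
  have e1 : h1.1 ≠ v := (mem_erase.1 H.m1).1
  have e2 : (ι' h1).1 ≠ v := (mem_erase.1 (H.dg.mem H.m1)).1
  have e3 : h3.1 ≠ v := (mem_erase.1 H.m3).1
  have e4 : (ι' h3).1 ≠ v := (mem_erase.1 (H.dg.mem H.m3)).1
  refine ⟨fun e => ?_, fun e he => ?_, fun e he => ?_⟩
  · rcases ins_cases H hc0 hcφ e with rfl | rfl | rfl | rfl | rfl | rfl | rfl | rfl | ⟨g0, g1, g2, g3, g4, g5⟩
    · rw [b1, c1]
    · rw [b2, c2]
    · rw [b3, c3]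
    · rw [b4, c4]
    · rw [c1, b1]
    · rw [c2, b2]
    · rw [c3, b3]
    · rw [c4, b4]
    · rw [g5, ins_other H hc0 hcφ, H.dg.inv]
      · by_cases heE : e.1 ∈ E.erase v
        · exact (mem_erase.1 (H.dg.mem heE)).1
        · rwa [H.dg.out e heE]
      · intro h; exact g2 (by rw [← h, H.dg.inv])
      · intro h; exact g1 (by rw [← H.dg.inv e, h, H.dg.inv])
      · intro h; exact g4 (by rw [← h, H.dg.inv])
      · intro h; exact g3 (by rw [← H.dg.inv e, h, H.dg.inv])
  · rcases ins_cases H hc0 hcφ e with rfl | rfl | rfl | rfl | rfl | rfl | rfl | rfl | ⟨g0, g1, g2, g3, g4, g5⟩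
    · rw [b1]; intro h; exact e1 (by rw [h])
    · rw [b2]; intro h; exact e2 (by rw [h])
    · rw [b3]; intro h; exact e3 (by rw [h])
    · rw [b4]; intro h; exact e4 (by rw [h])
    · rw [c1]; intro h; exact e1 (by rw [← h])
    · rw [c2]; intro h; exact e2 (by rw [← h])
    · rw [c3]; intro h; exact e3 (by rw [← h])
    · rw [c4]; intro h; exact e4 (by rw [← h])
    · rw [g5]; exact H.dg.fixE e (mem_erase.2 ⟨g0, he⟩)
  · have hE : e.1 ∉ E.erase v := fun h => he (mem_of_mem_erase h)
    rw [ins_other H hc0 hcφ, H.dg.out e hE]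
    · intro h; exact he (h ▸ H.hv)
    · intro h; exact hE (h ▸ H.m1)
    · intro h; exact hE (h ▸ H.dg.mem H.m1)
    · intro h; exact hE (h ▸ H.m3)
    · intro h; exact hE (h ▸ H.dg.mem H.m3)

/-- a labelling of the half edges with matching values on `v` gives a cycle -/
theorem ins_cyc (hi : ∀ e, e.1 ≠ v → e ≠ h1 → e ≠ ι' h1 → e ≠ h3 → e ≠ ι' h3 →
      p (ι' e) = p e) (hev : ∀ w, ∑ y, p (w, y) = 0) (hs : ∀ e, e.1 ∉ E → p e = 0)
    (q1 : p (v, 0) = p h1) (q2 : p (v, φ) = p (ι' h1)) (q3 : p (v, c) = p h3)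
    (q4 : p (v, c + φ) = p (ι' h3)) : Cyc E (ins ι' v φ c h1 h3) p := by
  obtain ⟨b1, b2, b3, b4⟩ := ins_vals H hc0 hcφ
  obtain ⟨c1, c2, c3, c4⟩ := ins_vals' H hc0 hcφ
  refine ⟨fun e => ?_, hev, hs⟩
  rcases ins_cases H hc0 hcφ e with rfl | rfl | rfl | rfl | rfl | rfl | rfl | rfl | ⟨g0, g1, g2, g3, g4, g5⟩
  · rw [b1, q1]
  · rw [b2, q2]
  · rw [b3, q3]
  · rw [b4, q4]
  · rw [c1, q1]
  · rw [c2, q2]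
  · rw [c3, q3]
  · rw [c4, q4]
  · rw [g5]; exact hi e g0 g1 g2 g3 g4

theorem ins_half (hp : Cyc (E.erase v) ι' p) :
    bd p + Pi.single v (if p h1 = p h3 then 0 else φ) ∈ LD E (ins ι' v φ c h1 h3) := by
  obtain ⟨a1, a2, a3, a4⟩ := k4_ne φ c H.hφ hc0 hcφ
  have e1 : h1.1 ≠ v := (mem_erase.1 H.m1).1
  have e2 : (ι' h1).1 ≠ v := (mem_erase.1 (H.dg.mem H.m1)).1
  have e3 : h3.1 ≠ v := (mem_erase.1 H.m3).1
  have e4 : (ι' h3).1 ≠ v := (mem_erase.1 (H.dg.mem H.m3)).1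
  set q : V × K → ZMod 2 := fun e => if e.1 = v then (if e.2 = 0 ∨ e.2 = φ then p h1 else p h3) else p e with hq
  have qv : ∀ y, q (v, y) = if y = 0 ∨ y = φ then p h1 else p h3 := fun y => by simp [hq]
  have qn : ∀ e, e.1 ≠ v → q e = p e := fun e he => by simp [hq, he]
  have r1 : q (v, 0) = p h1 := by simp [qv]
  have r2 : q (v, φ) = p h1 := by simp [qv]
  have r3 : q (v, c) = p h3 := by simp [qv, hc0, hcφ]
  have r4 : q (v, c + φ) = p h3 := by rw [qv, if_neg]; tauto
  refine mem_LD.2 ⟨q, ins_cyc H hc0 hcφ ?_ ?_ ?_ ?_ ?_ ?_ ?_, ?_⟩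
  · intro e he _ _ _ _
    rw [qn e he, qn, hp.inv]
    by_cases heE : e.1 ∈ E.erase v
    · exact (mem_erase.1 (H.dg.mem heE)).1
    · rwa [H.dg.out e heE]
  · intro w
    by_cases hw : w = v
    · subst hw
      rw [k4_sum H.hφ hc0 hcφ, r1, r2, r3, r4, z2add, add_zero, z2add]
    · have : ∀ y, q (w, y) = p (w, y) := fun y => qn _ hw
      simp only [this]; exact hp.even w
  · intro e he
    have hev : e.1 ≠ v := fun h => he (h ▸ H.hv)
    rw [qn e hev]; exact hp.supp e fun h => he (mem_of_mem_erase h)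
  · rw [r1, qn h1 e1]
  · rw [r2, qn _ e2, hp.inv]
  · rw [r3, qn _ e3]
  · rw [r4, qn _ e4, hp.inv]
  · ext1 w
    by_cases hw : w = v
    · subst hw
      rw [Pi.add_apply, hp.bd_supp (by simp), Pi.single_eq_same, zero_add]
      apply bdK_eq
      intro k
      rcases k4 φ c k H.hφ hc0 hcφ with rfl | rfl | rfl | rfl
      · rw [z2add, om_zero_right]
      · rw [r1, r2, z2add]; split_ifs <;> simp [om_self, om_zero_left]
      · rw [r1, r3]; split_ifs with hh
        · rw [hh, z2add, om_zero_left]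
        · rw [a4]; exact z2_ne_add _ _ hh
      · rw [r1, r4]; split_ifs with hh
        · rw [hh, z2add, om_zero_left]
        · rw [om_add_right, om_self, a4, add_zero]; exact z2_ne_add _ _ hh
    · rw [Pi.add_apply, Pi.single_eq_of_ne hw, add_zero]
      unfold bd; congr 1; ext1 y; exact qn _ hw

theorem ins_star (hcn : Conn (E.erase v) (LD (E.erase v) ι')) :
    ∃ R ∈ LD E (ins ι' v φ c h1 h3), R v ≠ 0 ∧ R v ≠ φ := by
  by_contra hno
  push Not at hno
  obtain ⟨b1, b2, b3, b4⟩ := ins_vals H hc0 hcφ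
  have hD := ins_dg H hc0 hcφ
  have hL := LD_lag hD
  have hm : Pi.single v φ ∈ LD E (ins ι' v φ c h1 h3) := by
    apply hL.mem
    · intro w hw; rw [Pi.single_eq_of_ne]; intro h; exact hw (h ▸ H.hv)
    · intro Q hQ
      rw [omV_comm, omV_single]
      by_cases h0 : Q v = 0
      · rw [h0, om_zero_left]
      · rw [hno Q hQ h0, om_self]
  obtain ⟨q, hq, hb⟩ := mem_LD.1 hm
  have bv : bd q v = φ := by rw [hb, Pi.single_eq_same]
  have qv : ∀ y, q (v, y + φ) = q (v, y) := fun y =>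
    even_eq (f := fun y => q (v, y)) (hq.even v) (by
      have : bdK (fun y => q (v, y)) = φ := bv
      rw [this, om_self])
  have qφ : q (v, φ) = q (v, 0) := by have := qv 0; rwa [zero_add] at this
  have k1 : q h1 = q (v, 0) := by rw [← hq.inv (v, 0), b1]
  have k2 : q (ι' h1) = q (v, 0) := by rw [← qφ, ← hq.inv (v, φ), b2]
  have k3 : q h3 = q (v, c) := by rw [← hq.inv (v, c), b3]
  have k4' : q (ι' h3) = q (v, c) := by rw [← qv, ← hq.inv (v, c + φ), b4]
  have hinv : ∀ e, e.1 ∈ E.erase v → q (ι' e) = q e := by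
    intro e he
    have hev := (mem_erase.1 he).1
    rcases ins_cases H hc0 hcφ e with rfl | rfl | rfl | rfl | rfl | rfl | rfl | rfl | ⟨g0, g1, g2, g3, g4, g5⟩
    · exact absurd rfl hev
    · exact absurd rfl hev
    · exact absurd rfl hev
    · exact absurd rfl hev
    · rw [k1, k2]
    · rw [H.dg.inv, k1, k2]
    · rw [k3, k4']
    · rw [H.dg.inv, k3, k4']
    · rw [← g5, hq.inv]
  have := conn_const H.dg hcn q hinv (fun w hw y => by
    have hwv := (mem_erase.1 hw).1
    have h0 : bdK (fun y => q (w, y)) = 0 := by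
      have : bd q w = 0 := by rw [hb, Pi.single_eq_of_ne hwv]
      exact this
    have := even_eq (f := fun y => q (w, y)) (hq.even w) (y := 0) (k := y) (by rw [h0, om_zero_left])
    rwa [zero_add] at this) h1 h3 H.m1 H.m3
  rw [k1, k3] at this
  have h5 := even_om (fun y => q (v, y)) (hq.even v) 0 c
  have h6 : bdK (fun y => q (v, y)) = φ := bv
  rw [zero_add, h6, this, z2add, (k4_ne φ c H.hφ hc0 hcφ).2.2.2] at h5
  exact absurd h5 (by decide)

theorem ins_swap (hR : R ∈ LD E (ins ι' v φ c h1 h3)) (r0 : R v ≠ 0) (rφ : R v ≠ φ) :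
    R + Pi.single v φ ∈ LD E (ins ι' v φ (c + φ) h1 h3) := by
  obtain ⟨b1, b2, b3, b4⟩ := ins_vals H hc0 hcφ
  obtain ⟨a1, a2, a3, a4⟩ := k4_ne φ c H.hφ hc0 hcφ
  have cc : c + φ + φ = c := by rw [add_assoc, kadd, add_zero]
  have e1 : h1.1 ≠ v := (mem_erase.1 H.m1).1
  have e2 : (ι' h1).1 ≠ v := (mem_erase.1 (H.dg.mem H.m1)).1
  have e3 : h3.1 ≠ v := (mem_erase.1 H.m3).1
  have e4 : (ι' h3).1 ≠ v := (mem_erase.1 (H.dg.mem H.m3)).1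
  obtain ⟨p, hp, rfl⟩ := mem_LD.1 hR
  set q : V × K → ZMod 2 := fun e => if e.1 = v then (if e.2 = 0 ∨ e.2 = φ then p e else p (v, e.2 + φ)) else p e with hq
  have qv : ∀ y, q (v, y) = if y = 0 ∨ y = φ then p (v, y) else p (v, y + φ) := fun y => by simp [hq]
  have qn : ∀ e, e.1 ≠ v → q e = p e := fun e he => by simp [hq, he]
  have r1 : q (v, 0) = p (v, 0) := by simp [qv]
  have r2 : q (v, φ) = p (v, φ) := by simp [qv]
  have r3 : q (v, c) = p (v, c + φ) := by simp [qv, hc0, hcφ]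
  have r4 : q (v, c + φ) = p (v, c) := by rw [qv, if_neg, cc]; tauto
  refine mem_LD.2 ⟨q, ins_cyc H a1 a2 ?_ ?_ ?_ ?_ ?_ ?_ ?_, ?_⟩
  · intro e he f1 f2 f3 f4
    rw [qn e he, qn]
    · rw [← ins_other H hc0 hcφ he f1 f2 f3 f4, hp.inv]
    by_cases heE : e.1 ∈ E.erase v
    · exact (mem_erase.1 (H.dg.mem heE)).1
    · rwa [H.dg.out e heE]
  · intro w
    by_cases hw : w = v
    · subst hw
      rw [k4_sum H.hφ hc0 hcφ, r1, r2, r3, r4, ← hp.even w, k4_sum H.hφ hc0 hcφ (fun y => p (w, y))]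
      ring
    · have : ∀ y, q (w, y) = p (w, y) := fun y => qn _ hw
      simp only [this]; exact hp.even w
  · intro e he
    have hev : e.1 ≠ v := fun h => he (h ▸ H.hv)
    rw [qn e hev]; exact hp.supp e he
  · rw [r1, qn h1 e1, ← b1, hp.inv]
  · rw [r2, qn _ e2, ← b2, hp.inv]
  · rw [r4, qn _ e3, ← b3, hp.inv]
  · rw [cc, r3, qn _ e4, ← b4, hp.inv]
  · ext1 w
    by_cases hw : w = v
    · subst hw
      rw [Pi.add_apply, Pi.single_eq_same]
      have hev := hp.even w
      have key := even_om (fun y => p (w, y)) hev 0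
      simp only [zero_add] at key
      change ∀ k, p (w, 0) + p (w, k) = om (bd p w) k at key
      have hr : om (bd p w) φ = 1 := om_ne _ _ r0 H.hφ rφ
      apply bdK_eq
      intro k
      rcases k4 φ c k H.hφ hc0 hcφ with rfl | rfl | rfl | rfl
      · rw [z2add, om_zero_right]
      · rw [r1, r2, key, om_add_left, om_self, add_zero]
      · rw [r1, r3, key, om_add_left, om_add_right, hr, a4]
      · rw [r1, r4, key, om_add_left, om_add_right, om_add_right, hr, a4, om_self, add_zero, add_assoc, z2add, add_zero]
    · rw [Pi.add_apply, Pi.single_eq_of_ne hw, add_zero]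
      unfold bd; congr 1; ext1 y; exact qn _ hw
end

theorem k_two' : ∀ a b φ : K, (φ ≠ 0 ∧ a ≠ 0) → (a ≠ φ ∧ b ≠ 0) → b ≠ φ → a + b = 0 ∨ a + b = φ := by decide
theorem k_two (a b φ : K) (h1 : φ ≠ 0) (h2 : a ≠ 0) (h3 : a ≠ φ) (h4 : b ≠ 0) (h5 : b ≠ φ) : a + b = 0 ∨ a + b = φ :=
  k_two' a b φ ⟨h1, h2⟩ ⟨h3, h4⟩ h5
theorem k_add_ne : ∀ x φ : K, x ≠ φ → x + φ ≠ 0 := by decide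
theorem k_third : ∀ φ : K, φ ≠ 0 → ∃ c : K, c ≠ 0 ∧ c ≠ φ := by decide

theorem insert_lemma (hL : Lag E L) (H : InsH E ι' v φ h1 h3) (hs : Pi.single v φ ∉ L)
    (hm : mnr L v φ = LD (E.erase v) ι') (hcn : Conn (E.erase v) (LD (E.erase v) ι'))
    (hlift : ∀ p, Cyc (E.erase v) ι' p → bd p + Pi.single v (if p h1 = p h3 then 0 else φ) ∈ L) :
    ∃ c, c ≠ 0 ∧ c ≠ φ ∧ Dg E (ins ι' v φ c h1 h3) ∧ L = LD E (ins ι' v φ c h1 h3) := by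
  have claim1 : ∀ c, c ≠ 0 → c ≠ φ → ∀ R ∈ L, (R v = 0 ∨ R v = φ) → R ∈ LD E (ins ι' v φ c h1 h3) := by
    intro c hc0 hcφ R hR hRv
    have h5 := kill_mem_mnr hR hRv
    rw [hm] at h5
    obtain ⟨p, hp, hpb⟩ := mem_LD.1 h5
    have h6 := ins_half H hc0 hcφ hp
    have h7 := hlift p hp
    set Q := bd p + Pi.single v (if p h1 = p h3 then 0 else φ) with hQ
    have hQv : Q v = 0 ∨ Q v = φ := by
      rw [hQ, Pi.add_apply, hp.bd_supp (by simp), Pi.single_eq_same]; split_ifs <;> simp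
    have : R + Q = 0 := by
      apply kill_inj hs (L.add_mem hR h7)
      · rcases hRv with a | a <;> rcases hQv with b | b <;> simp [a, b, kadd]
      · rw [kill_add, ← hpb]
        have : kill v Q = bd p := by
          ext1 w
          by_cases hw : w = v
          · subst hw; rw [kill_same, hp.bd_supp (by simp)]
          · rw [kill_ne hw, hQ, Pi.add_apply, Pi.single_eq_of_ne hw, add_zero]
        rw [this, vadd]
    rw [vadd_eq_zero.1 this]; exact h6
  have claim2 : ∀ c, c ≠ 0 → c ≠ φ → (∃ R ∈ L, R ∈ LD E (ins ι' v φ c h1 h3) ∧ R v ≠ 0 ∧ R v ≠ φ) →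
      L = LD E (ins ι' v φ c h1 h3) := by
    rintro c hc0 hcφ ⟨R, hR, hR', r0, rφ⟩
    apply hL.eq_of_le (LD_lag (ins_dg H hc0 hcφ))
    intro Q hQ
    by_cases hQv : Q v = 0 ∨ Q v = φ
    · exact claim1 c hc0 hcφ Q hQ hQv
    · push Not at hQv
      have h5 := claim1 c hc0 hcφ (Q + R) (L.add_mem hQ hR) (k_two _ _ _ H.hφ hQv.1 hQv.2 r0 rφ)
      have := (LD E (ins ι' v φ c h1 h3)).add_mem h5 hR'
      rwa [vadd_cancel] at this
  obtain ⟨c, hc0, hcφ⟩ := k_third φ H.hφ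
  obtain ⟨a1, a2, a3, a4⟩ := k4_ne φ c H.hφ hc0 hcφ
  obtain ⟨R, hR, r0, rφ⟩ := ins_star H hc0 hcφ hcn
  have hQ : ∃ Q ∈ L, Q v ≠ 0 ∧ Q v ≠ φ := by
    by_contra hno; push Not at hno
    apply hs
    apply hL.mem
    · intro w hw; rw [Pi.single_eq_of_ne]; intro h; exact hw (h ▸ H.hv)
    · intro Q hQ
      rw [omV_comm, omV_single]
      by_cases h0 : Q v = 0
      · rw [h0, om_zero_left]
      · rw [hno Q hQ h0, om_self]
  obtain ⟨Q, hQ, q0, qφ⟩ := hQ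
  have hDl := LD_lag (ins_dg H hc0 hcφ)
  have hS : (R + Q) v = 0 ∨ (R + Q) v = φ := k_two _ _ _ H.hφ r0 rφ q0 qφ
  have hk : kill v (R + Q) ∈ mnr L v φ := by
    apply (hL.mnr H.hv H.hφ).mem
    · intro w hw
      by_cases hwv : w = v
      · subst hwv; exact kill_same _ _
      · rw [kill_ne hwv]
        have hwE : w ∉ E := fun h => hw (mem_erase.2 ⟨hwv, h⟩)
        rw [Pi.add_apply, hDl.supp hR w hwE, hL.supp hQ w hwE, add_zero]
    · intro S hS'
      obtain ⟨T, hT, hTv, rfl⟩ := mem_mnr_iff.1 hS'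
      have o1 : om (T v) ((R + Q) v) = 0 := by
        rcases hS with a | a <;> rcases hTv with b | b <;> simp [a, b, om_self, om_zero_left, om_zero_right]
      rw [omV_kill (by rw [kill_same, om_zero_right]), omV_comm, omV_kill o1, omV_add_right,
        hL.iso hT hQ, hDl.iso (claim1 c hc0 hcφ T hT hTv) hR, add_zero]
  have hfin : R ∈ L ∨ R + Pi.single v φ ∈ L := by
    have h5 := (mem_mnr.1 hk).2
    rw [kill_eq] at h5
    have h6 : R + Q ∈ L ∨ R + Q + Pi.single v φ ∈ L := by
      rcases hS with a | a
      · rw [a, Pi.single_zero, add_zero] at h5; exact h5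
      · rw [a, vadd_cancel] at h5; exact h5.symm
    rcases h6 with h7 | h7
    · left; have := L.add_mem h7 hQ; rwa [vadd_cancel] at this
    · right; have := L.add_mem h7 hQ; rwa [add_right_comm, vadd_cancel] at this
  rcases hfin with h5 | h5
  · exact ⟨c, hc0, hcφ, ins_dg H hc0 hcφ, claim2 c hc0 hcφ ⟨R, h5, hR, r0, rφ⟩⟩
  · refine ⟨c + φ, a1, a2, ins_dg H a1 a2, claim2 _ a1 a2 ⟨_, h5, ins_swap H hc0 hcφ hR r0 rφ, ?_, ?_⟩⟩
    · rw [Pi.add_apply, Pi.single_eq_same]; exact k_add_ne _ _ rφ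
    · rw [Pi.add_apply, Pi.single_eq_same]; intro h; exact r0 (by simpa using h)
end

section
/-- `x` represents `L` over `F`. -/
structure Rep (F : Type) [Field F] {M : Type} [AddCommGroup M] [Module F M] (E : Finset V)
    (L : Spc V) (x : V → K → M) : Prop where
  zero : ∀ v, x v 0 = 0
  ind : ∀ S, (∀ v ∉ E, S v = 0) → ((∀ R ∈ L, le R S → R = 0) ↔
    ∀ l : V → F, ∑ v, l v • x v (S v) = 0 → ∀ v, S v ≠ 0 → l v = 0)

theorem le_refl' (R : V → K) : le R R := fun _ => Or.inr rfl

theorem le_supp {R S : V → K} (h : le R S) (hS : ∀ v ∉ X, S v = 0) : ∀ v ∉ X, R v = 0 := by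
  intro v hv; rcases h v with h | h
  · exact h
  · rw [h, hS v hv]

theorem le_kill {R Q : V → K} (h : le Q (kill u R)) : le Q R := by
  intro v
  rcases h v with h1 | h1
  · exact Or.inl h1
  · by_cases hv : v = u
    · subst hv; rw [kill_same] at h1; exact Or.inl h1
    · rw [kill_ne hv] at h1; exact Or.inr h1

section
variable {x : V → K → M}

/-- a relation exists for minimal vectors, with full support -/
theorem Rep.rel (hx : Rep F E L x) (hL : Lag E L) (hR : Min L R) :
    ∃ l : V → F, ∑ v, l v • x v (R v) = 0 ∧ ∀ v, l v ≠ 0 ↔ R v ≠ 0 := by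
  obtain ⟨h1, h2, h3⟩ := hR
  have hs := hL.supp h1
  have h4 : ¬ ∀ l : V → F, ∑ v, l v • x v (R v) = 0 → ∀ v, R v ≠ 0 → l v = 0 := fun h =>
    h2 ((hx.ind R hs).2 h R h1 (le_refl' R))
  push Not at h4
  obtain ⟨l, hl, v0, hv0, hlv0⟩ := h4
  refine ⟨fun v => if R v = 0 then 0 else l v, ?_, ?_⟩
  · rw [← hl]; apply sum_congr rfl; intro v _
    dsimp only
    split_ifs with h
    · rw [h, hx.zero, smul_zero, smul_zero]
    · rfl
  · intro u
    by_cases hu : R u = 0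
    · simp [hu]
    simp only [hu, if_false, ne_eq, not_false_eq_true, iff_true]
    intro hlu
    have hk : ∀ Q ∈ L, le Q (kill u R) → Q = 0 := by
      intro Q hQ hle
      rcases h3 Q hQ (le_kill hle) with h | h
      · exact h
      · exfalso; subst h
        have := hle u
        rw [kill_same] at this
        exact hu (by tauto)
    have h5 := (hx.ind (kill u R) (fun v hv => by
      by_cases hvu : v = u
      · rw [hvu, kill_same]
      · rw [kill_ne hvu, hs v hv])).1 hk l (by
        rw [← hl]; apply sum_congr rfl; intro v _
        by_cases hvu : v = u
        · rw [hvu, hlu, zero_smul, zero_smul]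
        · rw [kill_ne hvu])
    by_cases hvu : v0 = u
    · exact hlv0 (hvu ▸ hlu)
    · exact hlv0 (h5 v0 (by rwa [kill_ne hvu]))

/-- uniqueness of relations on a minimal vector -/
theorem Rep.uniq (hx : Rep F E L x) (hL : Lag E L) (hR : Min L R) {l : V → F}
    (hl : ∑ v, l v • x v (R v) = 0) (hu : R u ≠ 0) (hlu : l u = 0) : ∀ v, R v ≠ 0 → l v = 0 := by
  obtain ⟨h1, h2, h3⟩ := hR
  have hs := hL.supp h1
  have hk : ∀ Q ∈ L, le Q (kill u R) → Q = 0 := by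
    intro Q hQ hle
    rcases h3 Q hQ (le_kill hle) with h | h
    · exact h
    · exfalso; subst h
      have := hle u
      rw [kill_same] at this
      exact hu (by tauto)
  have h5 := (hx.ind (kill u R) (fun v hv => by
    by_cases hvu : v = u
    · rw [hvu, kill_same]
    · rw [kill_ne hvu, hs v hv])).1 hk l (by
      rw [← hl]; apply sum_congr rfl; intro v _
      by_cases hvu : v = u
      · rw [hvu, hlu, zero_smul, zero_smul]
      · rw [kill_ne hvu])
  intro v hv
  by_cases hvu : v = u
  · rw [hvu, hlu]
  · exact h5 v (by rwa [kill_ne hvu])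

theorem Rep.mnr (hx : Rep F E L x) (hu : u ∈ E) {i : K} (hi : i ≠ 0) (hs : Pi.single u i ∉ L) :
    Rep F (E.erase u) (mnr L u i) (fun v k => (Submodule.span F {x u i}).mkQ (x v k)) := by
  refine ⟨fun v => by simp only [hx.zero, map_zero], fun S hS => ?_⟩
  have hSu : S u = 0 := hS u (by simp)
  set S' := Function.update S u i with hS'
  have hS'u : S' u = i := by simp [hS']
  have hS'n : ∀ v, v ≠ u → S' v = S v := fun v hv => by simp [hS', hv]
  have h1 := hx.ind S' (fun v hv => by
    have : v ≠ u := fun h => hv (h ▸ hu)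
    rw [hS'n v this]; exact hS v (fun h => hv (mem_of_mem_erase h)))
  have h2 : (∀ R ∈ Z3.mnr L u i, le R S → R = 0) ↔ (∀ R ∈ L, le R S' → R = 0) := by
    constructor
    · intro h R hR hle
      have hRu : R u = 0 ∨ R u = i := by rw [← hS'u]; exact hle u
      refine kill_inj hs hR hRu (h _ (kill_mem_mnr hR hRu) fun v => ?_)
      by_cases hv : v = u
      · left; rw [hv, kill_same]
      · rw [kill_ne hv, ← hS'n v hv]; exact hle v
    · intro h R hR hle
      obtain ⟨Q, hQ, hQu, rfl⟩ := mem_mnr_iff.1 hR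
      have : Q = 0 := h Q hQ fun v => by
        by_cases hv : v = u
        · rw [hv, hS'u]; exact hQu
        · have := hle v
          rwa [kill_ne hv, ← hS'n v hv] at this
      rw [this]; ext1 v; simp [kill]
  rw [h2, h1]
  have h3 : ∀ l : V → F, ∑ v, l v • x v (S' v) = l u • x u i + ∑ v, l v • x v (S v) := by
    intro l
    rw [← add_sum_erase _ _ (mem_univ u), hS'u, ← add_sum_erase (a := u) univ (fun v => l v • x v (S v)) (mem_univ u),
      hSu, hx.zero, smul_zero, zero_add]
    congr 1
    exact sum_congr rfl fun v hv => by rw [hS'n v (ne_of_mem_erase hv)]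
  have h4 : ∀ l : V → F, ∑ v, l v • (Submodule.span F {x u i}).mkQ (x v (S v)) =
      (Submodule.span F {x u i}).mkQ (∑ v, l v • x v (S v)) := by intro l; simp [map_sum]
  constructor
  · intro h l hl v hv
    rw [h4] at hl
    rw [Submodule.mkQ_apply, Submodule.Quotient.mk_eq_zero, Submodule.mem_span_singleton] at hl
    obtain ⟨m, hm⟩ := hl
    have hvu : v ≠ u := fun h => hv (h ▸ hSu)
    have := h (Function.update l u (-m)) (by
      rw [h3]; simp only [Function.update_self]
      rw [neg_smul, hm, neg_add_eq_zero]
      apply sum_congr rfl; intro w _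
      by_cases hw : w = u
      · rw [hw, hSu, hx.zero, smul_zero, smul_zero]
      · simp [hw]) v (by rwa [hS'n v hvu])
    simpa [hvu] using this
  · intro h l hl
    rw [h3] at hl
    have hl' : ∀ v, S v ≠ 0 → l v = 0 := h l (by
      rw [h4, Submodule.mkQ_apply, Submodule.Quotient.mk_eq_zero, Submodule.mem_span_singleton]
      exact ⟨- l u, by rw [neg_smul]; exact neg_eq_of_add_eq_zero_right hl⟩)
    have hz : ∑ v, l v • x v (S v) = 0 := sum_eq_zero fun v _ => by
      by_cases hv : S v = 0
      · rw [hv, hx.zero, smul_zero]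
      · rw [hl' v hv, zero_smul]
    rw [hz, add_zero] at hl
    have h5 := (hx.ind (Pi.single u i) (fun v hv => by
      rw [Pi.single_eq_of_ne]; rintro rfl; exact hv hu)).1 (fun R hR hle => by
        have hRu : R u = 0 ∨ R u = i := by have := hle u; rwa [Pi.single_eq_same] at this
        refine kill_inj hs hR hRu ?_
        ext1 v
        by_cases hv : v = u
        · rw [hv, kill_same]; rfl
        · rw [kill_ne hv]; have := hle v; rw [Pi.single_eq_of_ne hv] at this; exact this.elim id id) l (by
      rw [← add_sum_erase _ _ (mem_univ u), Pi.single_eq_same, hl, zero_add]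
      exact sum_eq_zero fun v hv => by rw [Pi.single_eq_of_ne (ne_of_mem_erase hv), hx.zero, smul_zero]) u (by
      rwa [Pi.single_eq_same])
    intro v hv
    by_cases hvu : v = u
    · rw [hvu, h5]
    · exact hl' v (by rwa [hS'n v hvu] at hv)
end

/-- natural half-edge vectors for the representation `x` -/
structure Nrl (F : Type) [Field F] {M : Type} [AddCommGroup M] [Module F M] (E : Finset V)
    (ι : V × K → V × K) (x : V → K → M) (h : V × K → M) : Prop where
  sum : ∀ v ∈ E, ∑ y, h (v, y) = 0
  inv : ∀ e : V × K, e.1 ∈ E → h (ι e) = - h e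
  par : ∀ v ∈ E, ∀ τ : K, τ ≠ 0 → ∃ c : F, c ≠ 0 ∧ x v τ = c • (h (v, 0) + h (v, τ))
end

section
theorem z5 : ∀ i : ZMod 5, i+1+1 = i+2 ∧ i+1+2=i+3 ∧ i+1+3=i+4 ∧ i+1+4=i ∧ i+2+1=i+3 ∧ i+2+2=i+4 ∧ i+2+3=i ∧ i+2+4=i+1 ∧
  i+3+1=i+4 ∧ i+3+2=i ∧ i+3+3=i+1 ∧ i+3+4=i+2 ∧ i+4+1=i ∧ i+4+2=i+1 ∧ i+4+3=i+2 ∧ i+4+4=i+3 := by decide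

theorem sum5 {M : Type*} [AddCommMonoid M] (f : ZMod 5 → M) (i : ZMod 5) :
    ∑ j, f j = f i + f (i+1) + f (i+2) + f (i+3) + f (i+4) := by
  have h : ∀ g : ZMod 5 → M, ∑ j, g j = g 0 + g 1 + g 2 + g 3 + g 4 := fun g => Fin.sum_univ_five g
  rw [← Equiv.sum_comp (Equiv.addLeft i) f, h]
  simp

theorem base_lin (Φ χ ψ : ZMod 5 → M)
    (hΦ : ∀ m : ZMod 5 → F, ∑ i, m i • Φ i = 0 → ∀ i, m i = 0)
    (hψ : ∀ i (s m1 m2 m3 m4 : F), s • ψ i + m1 • Φ (i+1) + m2 • Φ (i+2) + m3 • Φ (i+3) + m4 • Φ (i+4) = 0 →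
      s = 0 ∧ m1 = 0 ∧ m2 = 0 ∧ m3 = 0 ∧ m4 = 0)
    (r1 : ∀ i, ∃ a b c : F, a ≠ 0 ∧ b ≠ 0 ∧ c ≠ 0 ∧ a • χ i + b • Φ (i+4) + c • Φ (i+1) = 0)
    (r2 : ∃ κ : ZMod 5 → F, (∀ i, κ i ≠ 0) ∧ ∑ i, κ i • χ i = 0)
    (r3 : ∀ i, ∃ a b c : F, a ≠ 0 ∧ b ≠ 0 ∧ c ≠ 0 ∧ a • ψ i + b • ψ (i+1) + c • χ (i+3) = 0)
    (r4 : ∀ i, ∃ a b c m e : F, b ≠ 0 ∧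
      a • ψ (i+4) + b • χ i + c • ψ (i+1) + m • Φ (i+2) + e • Φ (i+3) = 0) :
    ∃ α β γ : ZMod 5 → F, (∀ i, α i ≠ 0) ∧ (∀ i, β i ≠ 0) ∧ (∀ i, γ i ≠ 0) ∧
      (∀ i, β i • χ i = α (i+4) • Φ (i+4) - α (i+1) • Φ (i+1)) ∧
      (∀ i, γ i • ψ i - γ (i+1) • ψ (i+1) = α (i+2) • Φ (i+2) - α (i+4) • Φ (i+4)) := by
  obtain ⟨κ, hκ, hκs⟩ := r2
  have r1' : ∀ i, ∃ a b : F, a ≠ 0 ∧ b ≠ 0 ∧ χ i = a • Φ (i+4) + b • Φ (i+1) := by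
    intro i
    obtain ⟨a, b, c, ha, hb, hc, h⟩ := r1 i
    refine ⟨-(a⁻¹ * b), -(a⁻¹ * c), by simp [ha, hb], by simp [ha, hc], ?_⟩
    have : a⁻¹ • a • χ i = χ i := inv_smul_smul₀ ha _
    rw [← this]
    linear_combination (norm := module) a⁻¹ • h
  choose a b ha hb hab using r1'
  have key : ∀ j, κ (j+1) * a (j+1) + κ (j+4) * b (j+4) = 0 := by
    apply hΦ
    have e1 : ∑ j, (κ (j+1) * a (j+1)) • Φ j = ∑ i, (κ i * a i) • Φ (i+4) := by
      rw [← Equiv.sum_comp (Equiv.addRight (1 : ZMod 5)) (fun i => (κ i * a i) • Φ (i+4))]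
      simp [z5]
    have e2 : ∑ j, (κ (j+4) * b (j+4)) • Φ j = ∑ i, (κ i * b i) • Φ (i+1) := by
      rw [← Equiv.sum_comp (Equiv.addRight (4 : ZMod 5)) (fun i => (κ i * b i) • Φ (i+1))]
      simp [z5]
    simp only [add_smul, sum_add_distrib]
    rw [e1, e2, ← hκs, ← sum_add_distrib]
    apply sum_congr rfl; intro i _
    rw [hab i]; module
  set α : ZMod 5 → F := fun i => κ (i+1) * a (i+1) with hα
  have hα0 : ∀ i, α i ≠ 0 := fun i => mul_ne_zero (hκ _) (ha _)
  have hβ : ∀ i, κ i • χ i = α (i+4) • Φ (i+4) - α (i+1) • Φ (i+1) := by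
    intro i
    have h1 := key (i+1)
    simp only [z5] at h1
    rw [hab i]; simp only [hα, z5]
    have h2 : κ (i+2) * a (i+2) = - (κ i * b i) := by linear_combination h1
    rw [h2]; module
  have r3' : ∀ i, ∃ p q : F, p ≠ 0 ∧ q ≠ 0 ∧ p • ψ i + q • ψ (i+1) = α (i+2) • Φ (i+2) - α (i+4) • Φ (i+4) := by
    intro i
    obtain ⟨a, b, c, ha, hb, hc, h⟩ := r3 i
    have h1 := hβ (i+3)
    simp only [z5] at h1
    refine ⟨-(κ (i+3) * c⁻¹ * a), -(κ (i+3) * c⁻¹ * b), by simp [hκ, hc, ha], by simp [hκ, hc, hb], ?_⟩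
    rw [← h1]
    have : c⁻¹ • c • χ (i+3) = χ (i+3) := inv_smul_smul₀ hc _
    rw [← this]
    linear_combination (norm := module) (-(κ (i+3) * c⁻¹)) • h
  choose p q hp hq hpq using r3'
  have hpq' : ∀ i, p i + q (i+4) = 0 := by
    intro i
    obtain ⟨a, b, c, m, e, hb, h⟩ := r4 i
    have h1 := hβ i
    have h2 := hpq i
    have h3 := hpq (i+4)
    simp only [z5] at h3
    have h4 : b • χ i = (b * (κ i)⁻¹) • κ i • χ i := by
      rw [smul_smul, mul_assoc, inv_mul_cancel₀ (hκ i), mul_one]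
    rw [h4, h1] at h
    set b' := b * (κ i)⁻¹ with hb'
    have hb0 : b' ≠ 0 := mul_ne_zero hb (inv_ne_zero (hκ i))
    obtain ⟨k0, k1, k2, k3, k4⟩ := hψ i (- (a * q i * q (i+4)) - c * p (i+4) * p i)
      ((a * q i - b' * p (i+4) * q i) * α (i+1)) (c * p (i+4) * α (i+2) + p (i+4) * q i * m)
      (- (a * q i * α (i+3)) + p (i+4) * q i * e) ((b' * p (i+4) * q i - c * p (i+4)) * α (i+4)) (by
        linear_combination (norm := module) (p (i+4) * q i) • h - (a * q i) • h3 - (c * p (i+4)) • h2)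
    have k1' := (mul_eq_zero.1 k1).resolve_right (hα0 _)
    have k4' := (mul_eq_zero.1 k4).resolve_right (hα0 _)
    have : (b' * p (i+4) * q i) * (p i + q (i+4)) = 0 := by
      linear_combination (-1) * k0 - q (i+4) * k1' + p i * k4'
    exact (mul_eq_zero.1 this).resolve_left (mul_ne_zero (mul_ne_zero hb0 (hp _)) (hq _))
  refine ⟨α, κ, p, hα0, hκ, hp, hβ, fun i => ?_⟩
  have h1 := hpq' (i+1)
  simp only [z5] at h1
  rw [← hpq i]
  have : q i = - p (i+1) := by linear_combination h1
  rw [this]; module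
end

section
theorem exists_triple (hL : Lag E L) (hp : Prim E L) (hn : E.card = 5) {a b c : V} (ha : a ∈ E) (hb : b ∈ E)
    (hc : c ∈ E) (hab : a ≠ b) (hac : a ≠ c) (hbc : b ≠ c) :
    ∃ R ∈ L, R a ≠ 0 ∧ R b ≠ 0 ∧ R c ≠ 0 ∧ ∀ v, v ≠ a → v ≠ b → v ≠ c → R v = 0 := by
  set X : Finset V := {a, b, c} with hX
  have hXE : X ⊆ E := by intro v hv; simp [hX] at hv; rcases hv with rfl | rfl | rfl <;> assumption
  have hXc : X.card = 3 := by rw [hX, card_eq_three]; exact ⟨a, b, c, hab, hac, hbc, rfl⟩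
  have h1 := hL.dual hXE
  have h2 := card_sdiff_add_card_eq_card hXE
  have hd : d L X ≠ 0 := by omega
  have hne : L ⊓ W X ≠ ⊥ := by
    intro h; apply hd; unfold d; rw [h, finrank_bot]
  obtain ⟨R, hR, hR0⟩ := Submodule.exists_mem_ne_zero_of_ne_bot hne
  have hz : ∀ v, v ≠ a → v ≠ b → v ≠ c → R v = 0 := fun v h1 h2 h3 => hR.2 v (by simp [hX, h1, h2, h3])
  refine ⟨R, hR.1, ?_, ?_, ?_, hz⟩
  · intro h; apply hR0
    apply hp.pair hL (by omega) hR.1 (X := {b, c}) _ card_le_two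
    intro v hv; simp at hv
    by_cases hva : v = a
    · rw [hva, h]
    · exact hz v hva hv.1 hv.2
  · intro h; apply hR0
    apply hp.pair hL (by omega) hR.1 (X := {a, c}) _ card_le_two
    intro v hv; simp at hv
    by_cases hva : v = b
    · rw [hva, h]
    · exact hz v hv.1 hva hv.2
  · intro h; apply hR0
    apply hp.pair hL (by omega) hR.1 (X := {a, b}) _ card_le_two
    intro v hv; simp at hv
    by_cases hva : v = c
    · rw [hva, h]
    · exact hz v hv.1 hv.2 hva

/-- data of a pentagon labelling -/
structure Pent (E : Finset V) (L : Spc V) (g : ZMod 5 → V) (f : V → ZMod 5)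
    (R : ZMod 5 → V → K) (φ χ : ZMod 5 → K) : Prop where
  fg : ∀ i, f (g i) = i
  gf : ∀ v ∈ E, g (f v) = v
  mem : ∀ i, g i ∈ E
  RL : ∀ i, R i ∈ L
  r0 : ∀ i, R i (g i) = χ i
  r1 : ∀ i, R i (g (i+1)) = φ (i+1)
  r4 : ∀ i, R i (g (i+4)) = φ (i+4)
  r2 : ∀ i, R i (g (i+2)) = 0
  r3 : ∀ i, R i (g (i+3)) = 0
  φ0 : ∀ i, φ i ≠ 0
  χ0 : ∀ i, χ i ≠ 0
  χφ : ∀ i, χ i ≠ φ i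

theorem z5ne : ∀ i : ZMod 5, i ≠ i+1 ∧ i ≠ i+2 ∧ i ≠ i+3 ∧ i ≠ i+4 ∧ i+1 ≠ i+2 ∧ i+1 ≠ i+3 ∧ i+1 ≠ i+4 ∧
  i+2 ≠ i+3 ∧ i+2 ≠ i+4 ∧ i+3 ≠ i+4 := by decide

theorem z5cases : ∀ i j : ZMod 5, j = i ∨ j = i+1 ∨ j = i+2 ∨ j = i+3 ∨ j=i+4 := by decide

theorem sum_E5 {N : Type*} [AddCommMonoid N] {g : ZMod 5 → V} {f : V → ZMod 5} (fg : ∀ i, f (g i) = i)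
    (gf : ∀ v ∈ E, g (f v) = v) (F' : V → N) (h0 : ∀ v ∉ E, F' v = 0) : ∑ v, F' v = ∑ i, F' (g i) := by
  symm
  apply sum_of_injOn g
  · intro a _ b _ h; have := congrArg f h; rwa [fg, fg] at this
  · intro _ _; simp
  · intro v _ hv
    apply h0; intro hE; apply hv; exact ⟨f v, by simp, gf v hE⟩
  · intro _ _; rfl

theorem exists_pent (hL : Lag E L) (hp : Prim E L) (hn : E.card = 5) : ∃ g f R φ χ, Pent E L g f R φ χ := by
  classical
  obtain ⟨e⟩ : Nonempty (E ≃ ZMod 5) := Fintype.card_eq.1 (by rw [Fintype.card_coe, hn, ZMod.card])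
  let g : ZMod 5 → V := fun i => ((e.symm i : E) : V)
  let f : V → ZMod 5 := fun v => if h : v ∈ E then e ⟨v, h⟩ else 0
  have hg : ∀ i, g i ∈ E := fun i => (e.symm i).2
  have fg : ∀ i, f (g i) = i := by
    intro i; simp only [f]; rw [dif_pos (hg i)]; exact e.apply_symm_apply i
  have gf : ∀ v ∈ E, g (f v) = v := by
    intro v hv; simp [f, g, hv]
  have ginj : Function.Injective g := fun a b h => by have := congrArg f h; rwa [fg, fg] at this
  have tr : ∀ i : ZMod 5, ∃ R ∈ L, R (g (i+4)) ≠ 0 ∧ R (g i) ≠ 0 ∧ R (g (i+1)) ≠ 0 ∧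
      ∀ v, v ≠ g (i+4) → v ≠ g i → v ≠ g (i+1) → R v = 0 := by
    intro i
    apply exists_triple hL hp hn (hg _) (hg _) (hg _) <;> apply ginj.ne <;> revert i <;> decide
  choose R hRL hR4 hR0 hR1 hRz using tr
  have hz2 : ∀ i, R i (g (i+2)) = 0 := fun i => hRz i _ (ginj.ne (by revert i; decide)) (ginj.ne (by revert i; decide))
    (ginj.ne (by revert i; decide))
  have hz3 : ∀ i, R i (g (i+3)) = 0 := fun i => hRz i _ (ginj.ne (by revert i; decide)) (ginj.ne (by revert i; decide))
    (ginj.ne (by revert i; decide))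
  have iso : ∀ P Q, P ∈ L → Q ∈ L → ∀ i, om (P (g i)) (Q (g i)) + om (P (g (i+1))) (Q (g (i+1))) +
      om (P (g (i+2))) (Q (g (i+2))) + om (P (g (i+3))) (Q (g (i+3))) + om (P (g (i+4))) (Q (g (i+4))) = 0 := by
    intro P Q hP hQ i
    rw [← sum5 (fun i => om (P (g i)) (Q (g i))) i, ← sum_E5 (E := E) fg gf (fun v => om (P v) (Q v))]
    · exact hL.iso hP hQ
    · intro v hv; rw [hL.supp hP v hv, om_zero_left]
  have e14 : ∀ i, R (i+4) (g i) = R (i+1) (g i) := by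
    intro i
    have h := iso (R (i+4)) (R (i+1)) (hRL _) (hRL _) i
    have a1 := hz2 (i+4); have a2 := hz3 (i+4); have a3 := hz2 (i+1); have a4 := hz3 (i+1)
    simp only [z5] at a1 a2 a3 a4
    simp only [a1, a2, a3, a4, om_zero_left, om_zero_right, add_zero] at h
    have b1 := hR1 (i+4); have b2 := hR4 (i+1)
    simp only [z5] at b1 b2
    exact (om_eq_zero _ _ b2 h).resolve_left b1
  have ne01 : ∀ i, R i (g i) ≠ R (i+1) (g i) := by
    intro i heq
    have h := iso (R i) (R (i+1)) (hRL _) (hRL _) i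
    have a1 := hz2 i; have a2 := hz3 i; have a3 := hz2 (i+1); have a4 := hz3 (i+1)
    simp only [z5] at a3 a4
    simp only [a1, a2, a3, a4, om_zero_left, om_zero_right, add_zero] at h
    rw [heq, om_self, zero_add] at h
    have h1 := (om_eq_zero _ _ (hR0 _) h).resolve_left (hR1 _)
    have h3 : R i + R (i+1) = 0 := by
      apply hp.pair hL (by omega) (L.add_mem (hRL _) (hRL _)) (X := {g (i+4), g (i+2)}) _ card_le_two
      intro v hv; simp at hv
      by_cases hE : v ∈ E
      · rw [← gf v hE] at hv ⊢
        rw [Pi.add_apply]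
        rcases z5cases i (f v) with h | h | h | h | h <;> rw [h] at hv ⊢
        · rw [heq, kadd]
        · rw [h1, kadd]
        · simp at hv
        · rw [a2, a3, add_zero]
        · simp at hv
      · exact hL.supp (L.add_mem (hRL _) (hRL _)) v hE
    have h4 := congrFun (vadd_eq_zero.1 h3) (g (i+4))
    rw [a4] at h4
    exact hR4 i h4
  refine ⟨g, f, R, fun i => R (i+1) (g i), fun i => R i (g i), fg, gf, hg, hRL, fun _ => rfl, ?_, ?_, hz2, hz3, ?_,
    hR0, ne01⟩
  · intro i; have := e14 (i+1); simp only [z5] at this ⊢; exact this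
  · intro i; simp only [z5]
  · intro i; rw [← e14]; have := hR1 (i+4); simpa only [z5] using this
end

section
section
variable {g : ZMod 5 → V} {f : V → ZMod 5} {R : ZMod 5 → V → K} {φ χ : ZMod 5 → K} 

theorem Pent.indφ (P : Pent E L g f R φ χ) (hL : Lag E L) (hQ : Q ∈ L)
    (h : ∀ i, Q (g i) = 0 ∨ Q (g i) = φ i) : Q = 0 := by
  ext1 v
  by_cases hv : v ∈ E
  swap
  · exact hL.supp hQ v hv
  rw [← P.gf v hv]
  set i := f v
  have h1 := hL.iso hQ (P.RL i)
  rw [omV, sum_E5 P.fg P.gf _ (fun v hv => by rw [hL.supp hQ v hv, om_zero_left]), sum5 _ i, P.r0, P.r1, P.r2, P.r3, P.r4,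
    om_zero_right, om_zero_right, add_zero, add_zero] at h1
  have h2 : ∀ j, om (Q (g j)) (φ j) = 0 := by
    intro j; rcases h j with a | a <;> simp [a, om_zero_left, om_self]
  rw [h2, h2, add_zero, add_zero] at h1
  rcases h i with a | a
  · exact a
  · rw [a, om_ne _ _ (P.φ0 i) (P.χ0 i) (P.χφ i).symm] at h1; exact absurd h1 (by decide)

theorem Pent.indψ (P : Pent E L g f R φ χ) (hL : Lag E L) (hQ : Q ∈ L) {i : ZMod 5}
    (h : ∀ j, j ≠ i → Q (g j) = 0 ∨ Q (g j) = φ j) (hi : Q (g i) = 0 ∨ Q (g i) = χ i + φ i) : Q = 0 := by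
  apply P.indφ hL hQ
  intro j
  by_cases hj : j = i
  swap
  · exact h j hj
  subst hj; left
  have h1 := hL.iso hQ (P.RL j)
  rw [omV, sum_E5 P.fg P.gf _ (fun v hv => by rw [hL.supp hQ v hv, om_zero_left]), sum5 _ j, P.r0, P.r1, P.r2, P.r3, P.r4,
    om_zero_right, om_zero_right, add_zero, add_zero] at h1
  have h2 : ∀ k, k ≠ j → om (Q (g k)) (φ k) = 0 := by
    intro k hk; rcases h k hk with a | a <;> simp [a, om_zero_left, om_self]
  obtain ⟨n1, -, -, n4, -⟩ := z5ne j
  rw [h2 _ n1.symm, h2 _ n4.symm, add_zero, add_zero] at h1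
  rcases hi with a | a
  · exact a
  · rw [a, om_add_left, om_self, zero_add, om_ne _ _ (P.φ0 j) (P.χ0 j) (P.χφ j).symm] at h1; exact absurd h1 (by decide)

def io5 (E : Finset V) (g : ZMod 5 → V) (f : V → ZMod 5) (φ χ : ZMod 5 → K) (e : V × K) : V × K :=
  if e.1 ∉ E then e else
  if e.2 = 0 then (g (f e.1 + 1), χ (f e.1 + 1)) else
  if e.2 = φ (f e.1) then (g (f e.1 + 2), χ (f e.1 + 2) + φ (f e.1 + 2)) else
  if e.2 = χ (f e.1) then (g (f e.1 + 4), 0) else (g (f e.1 + 3), φ (f e.1 + 3))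

theorem Pent.io (P : Pent E L g f R φ χ) (i : ZMod 5) :
    io5 E g f φ χ (g i, 0) = (g (i+1), χ (i+1)) ∧ io5 E g f φ χ (g i, φ i) = (g (i+2), χ (i+2) + φ (i+2)) ∧
    io5 E g f φ χ (g i, χ i) = (g (i+4), 0) ∧ io5 E g f φ χ (g i, χ i + φ i) = (g (i+3), φ (i+3)) := by
  obtain ⟨a1, a2, a3, -⟩ := k4_ne _ _ (P.φ0 i) (P.χ0 i) (P.χφ i)
  refine ⟨?_, ?_, ?_, ?_⟩ <;> simp only [io5, P.mem, P.fg, not_true_eq_false, if_false, if_true, P.φ0, P.χ0, P.χφ, a1, a2, a3]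

theorem Pent.cases (P : Pent E L g f R φ χ) (e : V × K) (he : e.1 ∈ E) :
    ∃ i, e = (g i, 0) ∨ e = (g i, φ i) ∨ e = (g i, χ i) ∨ e = (g i, χ i + φ i) := by
  obtain ⟨v, y⟩ := e
  refine ⟨f v, ?_⟩
  rw [P.gf v he]
  rcases k4 _ _ y (P.φ0 (f v)) (P.χ0 _) (P.χφ _) with h | h | h | h <;> rw [h] <;> simp

theorem Pent.dg (P : Pent E L g f R φ χ) : Dg E (io5 E g f φ χ) := by
  have ginj : Function.Injective g := fun a b h => by have := congrArg f h; rwa [P.fg, P.fg] at this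
  constructor
  · intro e
    by_cases he : e.1 ∈ E
    · obtain ⟨i, h⟩ := P.cases e he
      obtain ⟨-, -, h3, -⟩ := P.io (i+1)
      obtain ⟨-, -, -, h4⟩ := P.io (i+2)
      obtain ⟨h1, -⟩ := P.io (i+4)
      obtain ⟨-, h2, -⟩ := P.io (i+3)
      obtain ⟨a1, a2, a3, a4⟩ := P.io i
      simp only [z5] at h1 h2 h3 h4
      rcases h with rfl | rfl | rfl | rfl
      · rw [a1, h3]
      · rw [a2, h4]
      · rw [a3, h1]
      · rw [a4, h2]
    · simp [io5, he]
  · intro e he heq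
    obtain ⟨i, h⟩ := P.cases e he
    obtain ⟨a1, a2, a3, a4⟩ := P.io i
    obtain ⟨n1, n2, n3, n4, -⟩ := z5ne i
    rcases h with rfl | rfl | rfl | rfl
    · rw [a1] at heq; exact n1.symm (ginj (congrArg Prod.fst heq))
    · rw [a2] at heq; exact n2.symm (ginj (congrArg Prod.fst heq))
    · rw [a3] at heq; exact n4.symm (ginj (congrArg Prod.fst heq))
    · rw [a4] at heq; exact n3.symm (ginj (congrArg Prod.fst heq))
  · intro e he; simp [io5, he]

theorem Pent.RLD (P : Pent E L g f R φ χ) (hL : Lag E L) (i : ZMod 5) : R i ∈ LD E (io5 E g f φ χ) := by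
  apply (LD_lag P.dg).mem (hL.supp (P.RL i))
  rintro Q ⟨p, hp, rfl⟩
  rw [omV, sum_E5 P.fg P.gf _ (fun v hv => by rw [hL.supp (P.RL i) v hv, om_zero_left]), sum5 _ i, P.r0, P.r1, P.r2, P.r3, P.r4,
    om_zero_left, om_zero_left, add_zero, add_zero, om_comm, om_comm _ (bd p (g (i+1))), om_comm _ (bd p (g (i+4)))]
  have e1 := even_om _ (hp.even (g i)) 0 (χ i)
  have e2 := even_om _ (hp.even (g (i+1))) (χ (i+1)) (φ (i+1))
  have e3 := even_om _ (hp.even (g (i+4))) 0 (φ (i+4))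
  change _ = om (bd p _) _ at e1
  change _ = om (bd p _) _ at e2
  change _ = om (bd p _) _ at e3
  rw [← e1, ← e2, ← e3, zero_add, zero_add, ← hp.inv (g i, 0), ← hp.inv (g i, χ i), (P.io i).1, (P.io i).2.2.1,
    ← hp.inv (g (i+4), φ (i+4)), (P.io (i+4)).2.1]
  simp only [z5]
  generalize p (g (i+1), χ (i+1)) = a; generalize p (g (i+4), 0) = b; generalize p (g (i+1), _) = c
  revert a b c; decide

theorem Pent.eqLD (P : Pent E L g f R φ χ) (hL : Lag E L) : L = LD E (io5 E g f φ χ) := by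
  symm
  apply (LD_lag P.dg).eq_of_le hL
  intro Q hQ
  apply hL.mem ((LD_lag P.dg).supp hQ)
  intro S hS
  -- S is a sum of rows
  have key : ∀ T ∈ L, T + ∑ i, (if om (T (g i)) (φ i) = 1 then R i else 0) = 0 := by
    intro T hT
    have hsum : ∑ i, (if om (T (g i)) (φ i) = 1 then R i else 0) ∈ L :=
      L.sum_mem fun i _ => by split_ifs; exacts [P.RL i, L.zero_mem]
    apply P.indφ hL (L.add_mem hT hsum)
    intro i
    apply om_eq_zero _ _ (P.φ0 i)
    rw [Pi.add_apply, om_add_left]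
    have a1 := P.r1 (i+4); have a2 := P.r2 (i+3); have a3 := P.r3 (i+2); have a4 := P.r4 (i+1)
    simp only [z5] at a1 a2 a3 a4
    have h2 : (∑ i, (if om (T (g i)) (φ i) = 1 then R i else 0)) (g i) =
      ∑ j, (if om (T (g j)) (φ j) = 1 then R j (g i) else 0) := by
      rw [Finset.sum_apply]; apply sum_congr rfl; intro j _; split_ifs <;> rfl
    rw [h2, sum5 _ i, P.r0, a1, a2, a3, a4]
    have h3 : om (χ i) (φ i) = 1 := om_ne _ _ (P.χ0 i) (P.φ0 i) (P.χφ i)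
    have h4 : ∀ (c : Prop) [Decidable c] (u : K), om (if c then u else 0) (φ i) = if c then om u (φ i) else 0 := by
      intro c _ u; split_ifs <;> simp [om_zero_left]
    simp only [om_add_left, h4, h3, om_self, om_zero_left, ite_self, add_zero]
    rcases z2 (om (T (g i)) (φ i)) with h | h <;> rw [h] <;> decide
  have h1 := vadd_eq_zero.1 (key S hS)
  rw [h1]
  have h2 : ∑ i, (if om (S (g i)) (φ i) = 1 then R i else 0) ∈ LD E (io5 E g f φ χ) :=
    Submodule.sum_mem _ fun i _ => by split_ifs; exacts [P.RLD hL i, Submodule.zero_mem _]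
  exact (LD_lag P.dg).iso hQ h2

end
end

section
section
variable {g : ZMod 5 → V} {f : V → ZMod 5} {R : ZMod 5 → V → K} {φ χ : ZMod 5 → K} {x : V → K → M}

theorem Pent.ind5 (P : Pent E L g f R φ χ) (hL : Lag E L) (hx : Rep F E L x) {T : ZMod 5 → K} (hT : ∀ j, T j ≠ 0)
    (h : ∀ Q ∈ L, (∀ j, Q (g j) = 0 ∨ Q (g j) = T j) → Q = 0) (m : ZMod 5 → F)
    (hm : ∑ j, m j • x (g j) (T j) = 0) : ∀ j, m j = 0 := by
  have h1 := (hx.ind (fun v => if v ∈ E then T (f v) else 0) (fun v hv => if_neg hv)).1 (fun Q hQ hle => h Q hQ fun j => by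
    have := hle (g j)
    simp only [P.mem, if_true, P.fg] at this; exact this) (fun v => m (f v)) (by
      rw [sum_E5 P.fg P.gf, ← hm]
      · apply sum_congr rfl; intro j _; simp only [P.mem, if_true, P.fg]
      · intro v hv; simp only [hv, if_false, hx.zero, smul_zero])
  intro j
  have := h1 (g j)
  simp only [P.mem, if_true, P.fg] at this; exact this (hT j)

theorem Pent.rel5 (P : Pent E L g f R φ χ) (hL : Lag E L) (hp : Prim E L) (hn : E.card = 5) (hx : Rep F E L x) 
    (hQ : Q ∈ L) (h0 : Q ≠ 0) : ∃ m : ZMod 5 → F, ∑ j, m j • x (g j) (Q (g j)) = 0 ∧ ∀ j, m j ≠ 0 ↔ Q (g j) ≠ 0 := by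
  obtain ⟨l, h1, h2⟩ := hx.rel hL (min5 hL hp hn hQ h0)
  refine ⟨fun j => l (g j), ?_, fun j => h2 _⟩
  rw [← h1, sum_E5 P.fg P.gf]
  intro v hv; rw [hL.supp hQ v hv, hx.zero, smul_zero]

def hh5 (E : Finset V) (f : V → ZMod 5) (φ χ : ZMod 5 → K) (Φ X Ψ : ZMod 5 → M) (e : V × K) : M :=
  let i := f e.1
  if e.2 = 0 then - Φ i + X i + Ψ i else
  if e.2 = φ i then - Φ i - X i - Ψ i else
  if e.2 = χ i then Φ i + X i - Ψ i else Φ i - X i + Ψ i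

theorem base_star (h2 : (2 : F) ≠ 0) (hL : Lag E L) (hp : Prim E L) (hn : E.card = 5) (hx : Rep F E L x) :
    ∃ ι h, Dg E ι ∧ L = LD E ι ∧ Nrl F E ι x h := by
  obtain ⟨g, f, R, φ, χ, P⟩ := exists_pent hL hp hn
  have hrow : ∀ i, R i (g i) = χ i ∧ R i (g (i+1)) = φ (i+1) ∧ R i (g (i+2)) = 0 ∧ R i (g (i+3)) = 0 ∧
    R i (g (i+4)) = φ (i+4) := fun i => ⟨P.r0 i, P.r1 i, P.r2 i, P.r3 i, P.r4 i⟩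
  have rows : ∀ i, (R (i+1) (g i) = φ i ∧ R (i+1) (g (i+1)) = χ (i+1) ∧ R (i+1) (g (i+2)) = φ (i+2) ∧
      R (i+1) (g (i+3)) = 0 ∧ R (i+1) (g (i+4)) = 0) ∧
      (R (i+2) (g i) = 0 ∧ R (i+2) (g (i+1)) = φ (i+1) ∧ R (i+2) (g (i+2)) = χ (i+2) ∧
      R (i+2) (g (i+3)) = φ (i+3) ∧ R (i+2) (g (i+4)) = 0) ∧
      (R (i+3) (g i) = 0 ∧ R (i+3) (g (i+1)) = 0 ∧ R (i+3) (g (i+2)) = φ (i+2) ∧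
      R (i+3) (g (i+3)) = χ (i+3) ∧ R (i+3) (g (i+4)) = φ (i+4)) ∧
      (R (i+4) (g i) = φ i ∧ R (i+4) (g (i+1)) = 0 ∧ R (i+4) (g (i+2)) = 0 ∧
      R (i+4) (g (i+3)) = φ (i+3) ∧ R (i+4) (g (i+4)) = χ (i+4)) := by
    intro i
    have a1 := hrow (i+1); have a2 := hrow (i+2); have a3 := hrow (i+3); have a4 := hrow (i+4)
    simp only [z5] at a1 a2 a3 a4
    tauto
  refine Exists.elim (base_lin (F := F) (fun i => x (g i) (φ i)) (fun i => x (g i) (χ i))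
    (fun i => x (g i) (χ i + φ i)) ?_ ?_ ?_ ?_ ?_ ?_) ?_
  rotate_left 6
  · rintro α ⟨β, γ, hα, hβ, hγ, e1, e2⟩
    set Φ : ZMod 5 → M := fun i => ((2 : F)⁻¹ * α i) • x (g i) (φ i) with hΦ
    set X : ZMod 5 → M := fun i => ((2 : F)⁻¹ * β i) • x (g i) (χ i) with hX
    set Ψ : ZMod 5 → M := fun i => ((2 : F)⁻¹ * γ i) • x (g i) (χ i + φ i) with hΨ
    have E1 : ∀ i, X i = Φ (i+4) - Φ (i+1) := by
      intro i; simp only [hX, hΦ, mul_smul]; rw [← smul_sub, ← e1 i]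
    have E2 : ∀ i, Ψ i = Ψ (i+1) + Φ (i+2) - Φ (i+4) := by
      intro i; have := e2 i
      simp only [hΨ, hΦ, mul_smul]
      rw [← smul_add, ← smul_sub]; congr 1
      rw [add_sub_assoc, ← e2 i]; abel
    have hv : ∀ i, hh5 E f φ χ Φ X Ψ (g i, 0) = - Φ i + X i + Ψ i ∧ hh5 E f φ χ Φ X Ψ (g i, φ i) = - Φ i - X i - Ψ i ∧
        hh5 E f φ χ Φ X Ψ (g i, χ i) = Φ i + X i - Ψ i ∧ hh5 E f φ χ Φ X Ψ (g i, χ i + φ i) = Φ i - X i + Ψ i := by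
      intro i
      obtain ⟨a1, a2, a3, -⟩ := k4_ne _ _ (P.φ0 i) (P.χ0 i) (P.χφ i)
      refine ⟨?_, ?_, ?_, ?_⟩ <;>
        simp only [hh5, P.mem, P.fg, not_true_eq_false, if_false, if_true, P.φ0, P.χ0, P.χφ, a1, a2, a3]
    refine ⟨io5 E g f φ χ, hh5 E f φ χ Φ X Ψ, P.dg, P.eqLD hL, ?_, ?_, ?_⟩
    · intro v hvE
      rw [k4_sum (P.φ0 (f v)) (P.χ0 (f v)) (P.χφ (f v)), ← P.gf v hvE, P.fg]
      obtain ⟨a1, a2, a3, a4⟩ := hv (f v)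
      rw [a1, a2, a3, a4]; abel
    · intro e he
      obtain ⟨i, hi⟩ := P.cases e he
      obtain ⟨a1, a2, a3, a4⟩ := P.io i
      obtain ⟨b1, b2, b3, b4⟩ := hv i
      obtain ⟨-, -, c3, -⟩ := hv (i+1)
      obtain ⟨-, -, -, c4⟩ := hv (i+2)
      obtain ⟨c1, -⟩ := hv (i+4)
      obtain ⟨-, c2, -⟩ := hv (i+3)
      have f1 := E1 (i+1); have f2 := E1 (i+2); have f3 := E1 (i+3); have f4 := E1 (i+4)
      have k1 := E2 (i+1); have k2 := E2 (i+2); have k3 := E2 (i+3); have k4 := E2 (i+4)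
      simp only [z5] at *
      rcases hi with rfl | rfl | rfl | rfl
      · rw [a1, b1, c3, E1 i, f1, E2 i]; abel
      · rw [a2, b2, c4, E1 i, f2, E2 i, k1]; abel
      · rw [a3, b3, c1, E1 i, f4, k4]; abel
      · rw [a4, b4, c2, E1 i, f3, k3, k4]; abel
    · intro v hvE τ hτ
      have t2 : ∀ c : F, c ≠ 0 → ∀ y : M, y = (c⁻¹) • ((2 : F)⁻¹ * c) • (2 : F) • y := by
        intro c hc y; simp only [smul_smul]
        rw [show c⁻¹ * (2⁻¹ * c * 2) = 1 by field_simp, one_smul]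
      rw [← P.gf v hvE]
      obtain ⟨b1, b2, b3, b4⟩ := hv (f v)
      rcases k4 _ _ τ (P.φ0 (f v)) (P.χ0 (f v)) (P.χφ (f v)) with h | h | h | h
      · exact absurd h hτ
      · refine ⟨-(α (f v))⁻¹, by simp [hα], ?_⟩
        rw [h, b1, b2]
        have := t2 _ (hα (f v)) (x (g (f v)) (φ (f v)))
        rw [smul_comm _ (2 : F), two_smul] at this
        rw [this]; simp only [hΦ]; module
      · refine ⟨(β (f v))⁻¹, by simp [hβ], ?_⟩
        rw [h, b1, b3]
        have := t2 _ (hβ (f v)) (x (g (f v)) (χ (f v)))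
        rw [smul_comm _ (2 : F), two_smul] at this
        rw [this]; simp only [hX]; module
      · refine ⟨(γ (f v))⁻¹, by simp [hγ], ?_⟩
        rw [h, b1, b4]
        have := t2 _ (hγ (f v)) (x (g (f v)) (χ (f v) + φ (f v)))
        rw [smul_comm _ (2 : F), two_smul] at this
        rw [this]; simp only [hΨ]; module
  · intro m hm
    exact P.ind5 hL hx P.φ0 (fun Q hQ h => P.indφ hL hQ h) m hm
  · intro i s m1 m2 m3 m4 hm
    obtain ⟨n1, n2, n3, n4, n5, n6, n7, n8, n9, n10⟩ := z5ne i
    have := P.ind5 hL hx (T := fun j => if j = i then χ i + φ i else φ j) (by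
      intro j; split_ifs
      · exact (k4_ne _ _ (P.φ0 i) (P.χ0 i) (P.χφ i)).1
      · exact P.φ0 j) (fun Q hQ h => P.indψ hL hQ (i := i) (fun j hj => by have := h j; rwa [if_neg hj] at this)
        (by have := h i; rwa [if_pos rfl] at this))
      (fun j => if j = i then s else if j = i+1 then m1 else if j = i+2 then m2 else if j = i+3 then m3 else m4)
      (by rw [sum5 _ i]; simp only [n1.symm, n2.symm, n3.symm, n4.symm, n5.symm, n6.symm, n7.symm, n8.symm, n9.symm, n10.symm, if_true, if_false]
          exact hm)
    have b0 := this i; have b1 := this (i+1); have b2 := this (i+2); have b3 := this (i+3); have b4 := this (i+4)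
    simp only [n1.symm, n2.symm, n3.symm, n4.symm, n5.symm, n6.symm, n7.symm, n8.symm, n9.symm, n10.symm, if_true, if_false] at b0 b1 b2 b3 b4
    exact ⟨b0, b1, b2, b3, b4⟩
  · intro i
    obtain ⟨c0, c1, c2, c3, c4⟩ := hrow i
    obtain ⟨m, h1, h3⟩ := P.rel5 hL hp hn hx (P.RL i) (fun h => P.χ0 i (by rw [← c0, h]; rfl))
    rw [sum5 _ i, c0, c1, c2, c3, c4] at h1
    simp only [hx.zero, smul_zero, add_zero] at h1
    refine ⟨m i, m (i+4), m (i+1), (h3 _).2 (by rw [c0]; exact P.χ0 i), (h3 _).2 (by rw [c4]; exact P.φ0 _),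
      (h3 _).2 (by rw [c1]; exact P.φ0 _), ?_⟩
    rw [← h1]; abel
  · have hs : ∀ i, (∑ j, R j) (g i) = χ i := by
      intro i
      rw [Finset.sum_apply, sum5 _ i, (hrow i).1, (rows i).1.1, (rows i).2.1.1, (rows i).2.2.1.1, (rows i).2.2.2.1]
      rw [add_zero, add_zero, add_assoc, kadd, add_zero]
    obtain ⟨m, h1, h3⟩ := P.rel5 hL hp hn hx (Q := ∑ j, R j) (L.sum_mem fun j _ => P.RL j)
      (fun h => P.χ0 0 (by rw [← hs 0, h]; rfl))
    simp only [hs] at h1 h3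
    exact ⟨m, fun i => (h3 i).2 (P.χ0 i), h1⟩
  · intro i
    obtain ⟨c0, c1, c2, c3, c4⟩ := hrow i
    obtain ⟨⟨a0, a1, a2, a3, a4⟩, -, ⟨b0, b1, b2, b3, b4⟩, -⟩ := rows i
    have s0 : (R i + R (i+1) + R (i+3)) (g i) = χ i + φ i := by
      simp only [Pi.add_apply, c0, a0, b0, add_zero]
    have s1 : (R i + R (i+1) + R (i+3)) (g (i+1)) = χ (i+1) + φ (i+1) := by
      simp only [Pi.add_apply, c1, a1, b1, add_zero]; rw [add_comm]
    have s2 : (R i + R (i+1) + R (i+3)) (g (i+2)) = 0 := by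
      simp only [Pi.add_apply, c2, a2, b2, zero_add, kadd]
    have s3 : (R i + R (i+1) + R (i+3)) (g (i+3)) = χ (i+3) := by
      simp only [Pi.add_apply, c3, a3, b3, zero_add, kadd]
    have s4 : (R i + R (i+1) + R (i+3)) (g (i+4)) = 0 := by
      simp only [Pi.add_apply, c4, a4, b4, add_zero, kadd]
    obtain ⟨m, h1, h3⟩ := P.rel5 hL hp hn hx (L.add_mem (L.add_mem (P.RL i) (P.RL (i+1))) (P.RL (i+3)))
      (fun h => P.χ0 (i+3) (by rw [← s3, h]; rfl))
    rw [sum5 _ i, s0, s1, s2, s3, s4] at h1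
    simp only [hx.zero, smul_zero, add_zero] at h1
    refine ⟨m i, m (i+1), m (i+3), (h3 _).2 (by rw [s0]; exact (k4_ne _ _ (P.φ0 i) (P.χ0 i) (P.χφ i)).1),
      (h3 _).2 (by rw [s1]; exact (k4_ne _ _ (P.φ0 _) (P.χ0 _) (P.χφ _)).1),
      (h3 _).2 (by rw [s3]; exact P.χ0 _), h1⟩
  · intro i
    obtain ⟨c0, c1, c2, c3, c4⟩ := hrow i
    obtain ⟨⟨a0, a1, a2, a3, a4⟩, -, -, ⟨b0, b1, b2, b3, b4⟩⟩ := rows i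
    have s0 : (R i + R (i+1) + R (i+4)) (g i) = χ i := by
      simp only [Pi.add_apply, c0, a0, b0]; rw [add_assoc, kadd, add_zero]
    have s1 : (R i + R (i+1) + R (i+4)) (g (i+1)) = χ (i+1) + φ (i+1) := by
      simp only [Pi.add_apply, c1, a1, b1, add_zero]; rw [add_comm]
    have s2 : (R i + R (i+1) + R (i+4)) (g (i+2)) = φ (i+2) := by
      simp only [Pi.add_apply, c2, a2, b2, zero_add, add_zero]
    have s3 : (R i + R (i+1) + R (i+4)) (g (i+3)) = φ (i+3) := by
      simp only [Pi.add_apply, c3, a3, b3, zero_add, add_zero]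
    have s4 : (R i + R (i+1) + R (i+4)) (g (i+4)) = χ (i+4) + φ (i+4) := by
      simp only [Pi.add_apply, c4, a4, b4, add_zero]; rw [add_comm]
    obtain ⟨m, h1, h3⟩ := P.rel5 hL hp hn hx (L.add_mem (L.add_mem (P.RL i) (P.RL (i+1))) (P.RL (i+4)))
      (fun h => P.χ0 i (by rw [← s0, h]; rfl))
    rw [sum5 _ i, s0, s1, s2, s3, s4] at h1
    refine ⟨m (i+4), m i, m (i+1), m (i+2), m (i+3), (h3 _).2 (by rw [s0]; exact P.χ0 i), ?_⟩
    rw [← h1]; abel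

end
end

section
theorem le_add {R Q : V → K} (h : le Q R) : le (R + Q) R := by
  intro v; rcases h v with h | h
  · right; rw [Pi.add_apply, h, add_zero]
  · left; rw [Pi.add_apply, h, kadd]

theorem min_ind {P : (V → K) → Prop} (h0 : P 0) (hm : ∀ R, Min L R → P R)
    (ha : ∀ R ∈ L, ∀ Q ∈ L, le Q R → P Q → P (R + Q) → P R) : ∀ R ∈ L, P R := by
  have key : ∀ n, ∀ R ∈ L, (univ.filter fun v => R v ≠ 0).card = n → P R := by
    intro n
    induction n using Nat.strong_induction_on with
    | _ n ih =>
      intro R hR hn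
      by_cases hR0 : R = 0
      · rw [hR0]; exact h0
      by_cases hmin : Min L R
      · exact hm R hmin
      have : ∃ Q ∈ L, le Q R ∧ Q ≠ 0 ∧ Q ≠ R := by
        by_contra hc; push Not at hc
        exact hmin ⟨hR, hR0, fun Q hQ hle => by
          by_cases h : Q = 0
          · exact Or.inl h
          · exact Or.inr (hc Q hQ hle h)⟩
      obtain ⟨Q, hQ, hle, hQ0, hQR⟩ := this
      have lt : ∀ S, le S R → S ≠ R → (univ.filter fun v => S v ≠ 0).card < n := by
        intro S hS hne
        rw [← hn]
        apply card_lt_card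
        rw [ssubset_iff_of_subset]
        · have : ∃ v, S v ≠ R v := by by_contra hc; push Not at hc; exact hne (funext hc)
          obtain ⟨v, hv⟩ := this
          have h1 := (hS v).resolve_right hv
          refine ⟨v, ?_, ?_⟩
          · simp; rw [h1] at hv; exact hv.symm
          · simp [h1]
        · intro v hv; simp at hv ⊢
          rw [← (hS v).resolve_left hv]; exact hv
      refine ha R hR Q hQ hle (ih _ (lt Q hle hQR) Q hQ rfl) (ih _ (lt _ (le_add hle) ?_) _ (L.add_mem hR hQ) rfl)
      intro h; apply hQ0; simpa using h
  exact fun R hR => key _ R hR rfl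

theorem exists_type (hL : Lag E L) (hc : Conn E L) (hn : 2 ≤ E.card) {v : V} (hv : v ∈ E) {i : K} (hi : i ≠ 0) :
    ∃ R ∈ L, R v = i := by
  have key : ∀ j : K, j ≠ 0 → ∃ R ∈ L, om (R v) j = 1 := by
    intro j hj
    by_contra hcon; push Not at hcon
    apply single_notMem hc hn hv hj
    apply hL.mem
    · intro w hw; rw [Pi.single_eq_of_ne]; rintro rfl; exact hw hv
    · intro Q hQ; rw [omV_comm, omV_single]
      exact (z2 _).resolve_right (hcon Q hQ)
  obtain ⟨R1, h1, o1⟩ := key i hi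
  have hj : R1 v ≠ 0 := by intro h; rw [h, om_zero_left] at o1; exact absurd o1 (by decide)
  obtain ⟨R2, h2, o2⟩ := key _ hj
  have aux : ∀ a b c : K, om a b = 1 → om c a = 1 → c = b ∨ a + c = b := by decide
  rcases aux _ _ _ o1 o2 with h | h
  · exact ⟨R2, h2, h⟩
  · exact ⟨R1 + R2, L.add_mem h1 h2, h⟩

theorem exists_min_type (hL : Lag E L) (hc : Conn E L) (hn : 2 ≤ E.card) {v : V} (hv : v ∈ E) {i : K} (hi : i ≠ 0) :
    ∃ R, Min L R ∧ R v = i := by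
  obtain ⟨R, hR, hRv⟩ := exists_type hL hc hn hv hi
  refine min_ind (L := L) (P := fun R => R v = i → ∃ R, Min L R ∧ R v = i) ?_ ?_ ?_ R hR hRv
  · intro h; exact absurd h.symm hi
  · intro R hm h; exact ⟨R, hm, h⟩
  · intro R hR Q hQ hle h1 h2 h3
    rcases hle v with h | h
    · exact h2 (by rw [Pi.add_apply, h, h3, add_zero])
    · exact h1 (by rw [h, h3])

/-- vectors below `T` -/
def WT (T : V → K) : Spc V where
  carrier := {R | ∀ w, R w = 0 ∨ R w = T w}
  add_mem' := by
    intro a b ha hb w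
    rw [Pi.add_apply]
    rcases ha w with h | h <;> rcases hb w with h' | h' <;> simp [h, h', kadd]
  zero_mem' := fun w => Or.inl rfl
  smul_mem' := by
    intro c R hR w
    rcases z2 c with rfl | rfl
    · left; simp
    · simpa using hR w

theorem WT_lag {T : V → K} (h0 : ∀ w ∉ E, T w = 0) (h1 : ∀ w ∈ E, T w ≠ 0) : Lag E (WT T) := by
  intro R
  constructor
  · intro h
    refine ⟨le_supp h h0, fun Q hQ => sum_eq_zero fun w _ => ?_⟩
    rcases h w with a | a <;> rcases hQ w with b | b <;> simp [a, b, om_self, om_zero_left, om_zero_right]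
  · rintro ⟨h2, h3⟩ w
    by_cases hw : w ∈ E
    · have := h3 (Pi.single w (T w)) (fun u => by
        by_cases hu : u = w
        · subst hu; right; simp
        · left; simp [hu])
      rw [omV_single] at this
      exact om_eq_zero _ _ (h1 w hw) this
    · exact Or.inl (h2 w hw)

theorem exists_row (hL : Lag E L) {T : V → K} (h0 : ∀ w ∉ E, T w = 0) (h1 : ∀ w ∈ E, T w ≠ 0)
    (hi : ∀ Q ∈ L, le Q T → Q = 0) (hu : u ∈ E) :
    ∃ R ∈ L, om (R u) (T u) = 1 ∧ ∀ w, w ≠ u → R w = 0 ∨ R w = T w := by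
  have hT := WT_lag h0 h1
  have hinf : L ⊓ WT T = ⊥ := by
    rw [eq_bot_iff]; intro Q hQ; exact hi Q hQ.1 hQ.2
  have hsup : L ⊔ WT T = W E := by
    apply Submodule.eq_of_le_of_finrank_eq (sup_le hL.le_W hT.le_W)
    have := Submodule.finrank_sup_add_finrank_inf_eq L (WT T)
    rw [hinf, finrank_bot, add_zero, hL.finrank, hT.finrank] at this
    rw [this, finrank_W]; ring
  obtain ⟨c, hc0, hcT⟩ := k_third (T u) (h1 u hu)
  have hmem : Pi.single u c ∈ L ⊔ WT T := by
    rw [hsup]; intro w hw; rw [Pi.single_eq_of_ne]; rintro rfl; exact hw hu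
  obtain ⟨R, hR, S, hS, hRS⟩ := Submodule.mem_sup.1 hmem
  have hReq : R = Pi.single u c + S := by rw [← hRS, vadd_cancel]
  refine ⟨R, hR, ?_, ?_⟩
  · rw [hReq, Pi.add_apply, Pi.single_eq_same, om_add_left, om_ne _ _ hc0 (h1 u hu) hcT]
    rcases hS u with a | a <;> simp [a, om_self, om_zero_left]
  · intro w hw
    rw [hReq, Pi.add_apply, Pi.single_eq_of_ne hw, zero_add]; exact hS w

/-- greedy extension of an independent partial transversal -/
theorem extend_T (hL : Lag E L) {S : V → K} (hS0 : ∀ w ∉ E, S w = 0) (hS : ∀ Q ∈ L, le Q S → Q = 0) :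
    ∃ T : V → K, (∀ w ∉ E, T w = 0) ∧ (∀ w ∈ E, T w ≠ 0) ∧ (∀ Q ∈ L, le Q T → Q = 0) ∧ le S T := by
  have key : ∀ n, ∀ S : V → K, (E.filter fun w => S w = 0).card = n → (∀ w ∉ E, S w = 0) →
      (∀ Q ∈ L, le Q S → Q = 0) →
      ∃ T : V → K, (∀ w ∉ E, T w = 0) ∧ (∀ w ∈ E, T w ≠ 0) ∧ (∀ Q ∈ L, le Q T → Q = 0) ∧ le S T := by
    intro n
    induction n with
    | zero =>
      intro S hn h0 h1
      refine ⟨S, h0, ?_, h1, le_refl' S⟩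
      intro w hw h
      have : w ∈ E.filter fun w => S w = 0 := by simp [hw, h]
      rw [card_eq_zero.1 hn] at this; simp at this
    | succ n ih =>
      intro S hn h0 h1
      have : (E.filter fun w => S w = 0).Nonempty := by rw [← card_pos]; omega
      obtain ⟨w, hw⟩ := this
      have hw' := hw
      simp only [mem_filter] at hw'
      obtain ⟨hwE, hSw⟩ := hw'
      have hex : ∃ i : K, i ≠ 0 ∧ ∀ Q ∈ L, le Q (Function.update S w i) → Q = 0 := by
        by_contra hc
        push Not at hc
        have bad : ∀ i : K, i ≠ 0 → ∃ Q ∈ L, le Q (Function.update S w i) ∧ Q w = i := by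
          intro i hi
          obtain ⟨Q, hQ, hle, hQ0⟩ := hc i hi
          refine ⟨Q, hQ, hle, ?_⟩
          have h2 := hle w
          simp only [Function.update_self] at h2
          rcases h2 with h2 | h2
          · exfalso; apply hQ0; apply h1 Q hQ
            intro u
            by_cases hu : u = w
            · left; rw [hu, h2]
            · have := hle u; simpa [hu] using this
          · exact h2
        obtain ⟨Q1, q1, l1, v1⟩ := bad (1, 0) (by decide)
        obtain ⟨Q2, q2, l2, v2⟩ := bad (0, 1) (by decide)
        have h3 := hL.iso q1 q2
        rw [omV, ← add_sum_erase _ _ (mem_univ w), v1, v2, sum_eq_zero, add_zero] at h3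
        · exact absurd h3 (by decide)
        · intro u hu
          have hu := ne_of_mem_erase hu
          have a := l1 u; have b := l2 u
          simp only [Function.update_of_ne hu] at a b
          rcases a with a | a <;> rcases b with b | b <;> simp [a, b, om_self, om_zero_left, om_zero_right]
      obtain ⟨i, hi, hind⟩ := hex
      obtain ⟨T, t1, t2, t3, t4⟩ := ih (Function.update S w i) (by
        have : E.filter (fun u => Function.update S w i u = 0) = (E.filter fun u => S u = 0).erase w := by
          ext u
          by_cases hu : u = w
          · subst hu; simp [hi]
          · simp [hu]
        rw [this, card_erase_of_mem hw]; omega) (fun u hu => by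
          rw [Function.update_of_ne]; exact h0 u hu
          rintro rfl; exact hu hwE) hind
      refine ⟨T, t1, t2, t3, fun u => ?_⟩
      by_cases hu : u = w
      · left; rw [hu, hSw]
      · have := t4 u; rwa [Function.update_of_ne hu] at this
  exact key _ S rfl hS0 hS

structure Frame (E : Finset V) (L : Spc V) (v : V) (φ τ : K) (T : V → K) (R : V → V → K) : Prop where
  T0 : ∀ w ∉ E, T w = 0
  T1 : ∀ w ∈ E, T w ≠ 0
  ind : ∀ Q ∈ L, (∀ w, om (Q w) (T w) = 0) → Q = 0
  RL : ∀ u ∈ E, R u ∈ L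
  Ru : ∀ u ∈ E, om (R u u) (T u) = 1
  Rw : ∀ u ∈ E, ∀ w, w ≠ u → R u w = 0 ∨ R u w = T w
  Tv : T v = φ
  Rv : R v v = φ + τ

theorem exists_frame (hL : Lag E L) {v : V} (hv : v ∈ E) {φ τ : K} (hφ : φ ≠ 0) (hτ : τ ≠ 0) (hτφ : τ ≠ φ)
    {Rs : V → K} (hRs : Min L Rs) (hRv : Rs v = φ + τ) : ∃ T R, Frame E L v φ τ T R := by
  have hs := hL.supp hRs.1
  have o1 : om φ (φ + τ) = 1 := by rw [om_add_right, om_self, zero_add, om_ne _ _ hφ hτ hτφ.symm]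
  obtain ⟨T, t0, t1, t2, t3⟩ := extend_T hL (S := Function.update Rs v φ) (by
    intro w hw; rw [Function.update_of_ne]; exact hs w hw
    rintro rfl; exact hw hv) (by
    intro Q hQ hle
    have h1 := hle v
    simp only [Function.update_self] at h1
    have h2 : ∀ w, w ≠ v → Q w = 0 ∨ Q w = Rs w := by
      intro w hw; have := hle w; rwa [Function.update_of_ne hw] at this
    rcases h1 with h1 | h1
    · rcases hRs.2.2 Q hQ (fun w => by
        by_cases hw : w = v
        · left; rw [hw, h1]
        · exact h2 w hw) with h3 | h3
      · exact h3
      · exfalso; rw [h3, hRv] at h1; rw [h1, om_zero_right] at o1; exact absurd o1 (by decide)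
    · exfalso
      have h3 := hL.iso hQ hRs.1
      rw [omV, ← add_sum_erase _ _ (mem_univ v), h1, hRv, o1, sum_eq_zero, add_zero] at h3
      · exact absurd h3 (by decide)
      · intro u hu
        rcases h2 u (ne_of_mem_erase hu) with a | a <;> simp [a, om_self, om_zero_left])
  have hTv : T v = φ := by
    have := t3 v; rw [Function.update_self] at this
    exact (this.resolve_left hφ).symm
  have rows : ∀ u, ∃ R : V → K, u ∈ E → (R ∈ L ∧ om (R u) (T u) = 1 ∧ ∀ w, w ≠ u → R w = 0 ∨ R w = T w) := by
    intro u
    by_cases hu : u ∈ E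
    · obtain ⟨R, h1, h2, h3⟩ := exists_row hL t0 t1 t2 hu
      exact ⟨R, fun _ => ⟨h1, h2, h3⟩⟩
    · exact ⟨0, fun h => absurd h hu⟩
  choose R hR using rows
  refine ⟨T, Function.update R v Rs, t0, t1, ?_, ?_, ?_, ?_, hTv, by rw [Function.update_self, hRv]⟩
  · intro Q hQ h
    apply t2 Q hQ
    intro w
    by_cases hw : w ∈ E
    · exact om_eq_zero _ _ (t1 w hw) (h w)
    · left; exact hL.supp hQ w hw
  · intro u hu
    by_cases h : u = v
    · subst h; rw [Function.update_self]; exact hRs.1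
    · rw [Function.update_of_ne h]; exact (hR u hu).1
  · intro u hu
    by_cases h : u = v
    · subst h; rw [Function.update_self, hRv, hTv, om_comm, o1]
    · rw [Function.update_of_ne h]; exact (hR u hu).2.1
  · intro u hu w hw
    by_cases h : u = v
    · subst h; rw [Function.update_self]
      have := t3 w; rw [Function.update_of_ne hw] at this; exact this
    · rw [Function.update_of_ne h]; exact (hR u hu).2.2 w hw
end

section
section
variable {x : V → K → M}

theorem kadd_eq : ∀ a b : K, a + b = 0 ↔ a = b := by decide

theorem om_smul_left (c : ZMod 2) (a b : K) : om (c • a) b = c * om a b := by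
  rcases z2 c with h | h <;> simp [h, om_zero_left]

theorem om_sum_left {ι : Type} (s : Finset ι) (f : ι → K) (b : K) : om (∑ i ∈ s, f i) b = ∑ i ∈ s, om (f i) b := by
  classical
  induction s using Finset.induction_on with
  | empty => simp [om_zero_left]
  | insert a s ha ih => rw [sum_insert ha, sum_insert ha, om_add_left, ih]

section frame
variable {v : V} {φ τ : K} {T : V → K} {R : V → V → K}

theorem Frame.omR (h : Frame E L v φ τ T R) (hu : u ∈ E) (w : V) : om (R u w) (T w) = if w = u then 1 else 0 := by
  split_ifs with hw
  · rw [hw]; exact h.Ru u hu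
  · rcases h.Rw u hu w hw with a | a <;> simp [a, om_zero_left, om_self]

theorem Frame.expand (h : Frame E L v φ τ T R) (hQ : Q ∈ L) (hX : X ⊆ E)
    (h0 : ∀ w ∉ X, om (Q w) (T w) = 0) : Q = ∑ u ∈ X, om (Q u) (T u) • R u := by
  rw [← vadd_eq_zero]
  apply h.ind
  · exact L.add_mem hQ (L.sum_mem fun u hu => L.smul_mem _ (h.RL u (hX hu)))
  · intro w
    rw [Pi.add_apply, om_add_left, Finset.sum_apply, om_sum_left]
    have : ∀ u ∈ X, om ((om (Q u) (T u) • R u) w) (T w) = if w = u then om (Q w) (T w) else 0 := by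
      intro u hu
      rw [Pi.smul_apply, om_smul_left, h.omR (hX hu)]
      split_ifs with hw
      · rw [hw, mul_one]
      · rw [mul_zero]
    rw [sum_congr rfl this, sum_ite_eq]
    split_ifs with hw
    · exact z2add _
    · rw [h0 w hw, add_zero]

theorem Frame.le_om (h : Frame E L v φ τ T R) {w : V} (hw : Q w = 0 ∨ Q w = T w) : om (Q w) (T w) = 0 := by
  rcases hw with a | a <;> simp [a, om_zero_left, om_self]

theorem Frame.sym (h : Frame E L v φ τ T R) (hL : Lag E L) {u w : V} (hu : u ∈ E) (hw : w ∈ E) (huw : u ≠ w) :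
    R u w = 0 ↔ R w u = 0 := by
  have h3 := hL.iso (h.RL u hu) (h.RL w hw)
  rw [omV, ← add_sum_erase _ _ (mem_univ u), ← add_sum_erase _ _ (mem_erase.2 ⟨huw.symm, mem_univ w⟩), sum_eq_zero, add_zero] at h3
  · have a := h.Rw u hu w huw.symm
    have b := h.Rw w hw u huw
    have e1 := h.Ru u hu
    have e2 := h.Ru w hw
    have t1 := h.T1 u hu
    have t2 := h.T1 w hw
    rw [om_comm] at e2
    constructor
    · intro e
      rcases b with b | b
      · exact b
      · rw [b, e, e1, om_zero_left, add_zero] at h3; exact absurd h3 (by decide)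
    · intro e
      rcases a with a | a
      · exact a
      · rw [a, e, e2, om_zero_right, zero_add] at h3; exact absurd h3 (by decide)
  · intro z hz
    simp only [mem_erase] at hz
    rcases h.Rw u hu z hz.2.1 with a | a <;> rcases h.Rw w hw z hz.1 with b | b <;>
      simp [a, b, om_self, om_zero_left, om_zero_right]

end frame

def Fits (L : Spc V) (x : V → K → M) (F : Type) [Field F] [Module F M] (v : V) (τ : K) (D : M) : Prop :=
  ∀ Q, Min L Q → Q v = τ → ∃ m : V → F, m v = 0 ∧ D = ∑ w, m w • x w (Q w)

theorem conv_sum (hx : ∀ w, x w 0 = 0) (k : V → F) {Q S : V → K} (h : ∀ w, k w = 0 ∨ Q w = 0 ∨ Q w = S w) :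
    ∑ w, k w • x w (Q w) = ∑ w, (if Q w = S w then k w else 0) • x w (S w) := by
  apply sum_congr rfl
  intro w _
  split_ifs with h1
  · rw [h1]
  · rcases h w with h2 | h2 | h2
    · simp [h2]
    · simp [h2, hx]
    · exact absurd h2 h1

theorem rel_at (hx : Rep F E L x) (hL : Lag E L) {v : V} {τ : K} (hτ : τ ≠ 0) (hQ : Min L Q) (hQv : Q v = τ) :
    ∃ a : V → F, a v = 0 ∧ (∀ w, w ≠ v → Q w ≠ 0 → a w ≠ 0) ∧ x v τ = ∑ w, a w • x w (Q w) := by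
  obtain ⟨l, h1, h2⟩ := hx.rel hL hQ
  have hv : l v ≠ 0 := (h2 v).2 (by rwa [hQv])
  refine ⟨fun w => if w = v then 0 else -(l v)⁻¹ * l w, by simp, ?_, ?_⟩
  · intro w hw hw'
    simp only [hw, if_false]
    exact mul_ne_zero (neg_ne_zero.2 (inv_ne_zero hv)) ((h2 w).2 hw')
  · rw [← add_sum_erase _ _ (mem_univ v)] at h1 ⊢
    have h3 : x v τ = -(l v)⁻¹ • ∑ w ∈ univ.erase v, l w • x w (Q w) := by
      rw [hQv] at h1
      rw [eq_neg_of_add_eq_zero_right h1, smul_neg, neg_smul, neg_neg, smul_smul, inv_mul_cancel₀ hv, one_smul]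
    rw [h3, smul_sum]
    simp only [if_true, zero_smul, zero_add]
    apply sum_congr rfl
    intro w hw
    rw [if_neg (ne_of_mem_erase hw), smul_smul]

theorem cmp (hx : Rep F E L x) (hL : Lag E L) {v : V} {τ : K} (hτ : τ ≠ 0) {D : M} (hD : Fits L x F v τ D) {Q S : V → K}
    (hQ : Min L Q) (hQv : Q v = τ) (hS0 : ∀ w ∉ E, S w = 0) (hSv : S v = τ) (hS : ∀ R ∈ L, le R S → R = 0)
    {q : V} (hqv : q ≠ v) (hq0 : Q q ≠ 0) (hqS : Q q ≠ S q) (hw : ∀ w, w ≠ q → Q w = 0 ∨ Q w = S w)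
    {δ : V → F} (hδv : δ v = 0) (hδ : D = ∑ w, δ w • x w (S w)) : ∀ w, S w ≠ 0 → δ w ≠ 0 → Q w = S w := by
  obtain ⟨m, m1, m2⟩ := hD Q hQ hQv
  obtain ⟨a, a1, a2, a3⟩ := rel_at hx hL hτ hQ hQv
  have ind := (hx.ind S hS0).1 hS
  have hmq : m q = 0 := by
    have e : ∑ w, (m q * a w - a q * m w) • x w (Q w) = ∑ w, (if Q w = S w then (m q * a w - a q * m w) else 0) • x w (S w) := by
      apply conv_sum hx.zero
      intro w
      by_cases h : w = q
      · left; rw [h]; ring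
      · right; exact hw w h
    have e1 : ∑ w, (m q * a w - a q * m w) • x w (Q w) = m q • x v τ - a q • D := by
      rw [a3]; rw [m2]
      rw [smul_sum, smul_sum, ← sum_sub_distrib]
      apply sum_congr rfl; intro w _; module
    have e2 : m q • x v τ = ∑ w, (if w = v then m q else 0) • x w (S w) := by
      rw [sum_eq_single v]
      · simp [hSv]
      · intro w _ h; simp [h]
      · simp
    have := ind (fun w => (if w = v then m q else 0) - a q * δ w - (if Q w = S w then (m q * a w - a q * m w) else 0)) (by
      simp only [sub_smul, sum_sub_distrib]
      rw [← e, e1, ← e2]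
      have : ∑ w, (a q * δ w) • x w (S w) = a q • D := by
        rw [hδ, smul_sum]; apply sum_congr rfl; intro w _; module
      rw [this]; abel) v (by rwa [hSv])
    simpa [hδv, a1, m1] using this
  have e : D = ∑ w, (if Q w = S w then m w else 0) • x w (S w) := by
    rw [m2]
    apply conv_sum hx.zero
    intro w
    by_cases h : w = q
    · left; rw [h, hmq]
    · right; exact hw w h
  intro w hSw hδw
  by_contra hne
  have := ind (fun w => δ w - (if Q w = S w then m w else 0)) (by
    simp only [sub_smul, sum_sub_distrib]
    rw [← e, ← hδ, sub_self]) w hSw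
  simp [hne] at this
  exact hδw this

theorem columns (hx : Rep F E L x) (hL : Lag E L) (hc : Conn E L) (hn : 2 ≤ E.card) {v : V} (hv : v ∈ E) {φ τ : K}
    (hφ : φ ≠ 0) (hτ : τ ≠ 0) (hτφ : τ ≠ φ) {y : M}
    (hy : ∀ Q, Min L Q → Q v = τ → ∃ m : V → F, m v = 0 ∧ (∀ w, w ≠ v → Q w ≠ 0 → m w ≠ 0) ∧ y = ∑ w, m w • x w (Q w)) :
    ∃ c : F, c ≠ 0 ∧ x v τ = c • y := by
  have hφτ : φ + τ ≠ 0 := by rw [Ne, kadd_eq φ τ]; exact fun h => hτφ h.symm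
  obtain ⟨Rs, hRs, hRv⟩ := exists_min_type hL hc hn hv hφτ
  obtain ⟨T, R, H⟩ := exists_frame hL hv hφ hτ hτφ hRs hRv
  have o1 : om φ τ = 1 := om_ne _ _ hφ hτ hτφ.symm
  have o2 : om τ φ = 1 := by rw [om_comm, o1]
  -- a neighbour
  have ⟨u0, hu0v, hu0E, hu0⟩ : ∃ u, u ≠ v ∧ u ∈ E ∧ R v u ≠ 0 := by
    by_contra hcon
    push Not at hcon
    apply single_notMem hc hn hv hφτ
    convert H.RL v hv using 1
    funext w
    by_cases hw : w = v
    · subst hw; rw [Pi.single_eq_same, H.Rv]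
    · rw [Pi.single_eq_of_ne hw]
      by_cases hwE : w ∈ E
      · exact (hcon w hw hwE).symm
      · exact (hL.supp (H.RL v hv) w hwE).symm
  -- facts for neighbours
  have nb : ∀ u, u ≠ v → u ∈ E → R v u ≠ 0 → R v u = T u ∧ R u v = φ := by
    intro u h1 h2 h3
    refine ⟨(H.Rw v hv u h1).resolve_left h3, ?_⟩
    rw [← H.Tv]
    exact (H.Rw u h2 v h1.symm).resolve_left fun h => h3 ((H.sym hL hv h2 h1.symm).2 h)
  have ruu : ∀ u ∈ E, R u u ≠ 0 ∧ R u u ≠ T u := by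
    intro u hu
    have := H.Ru u hu
    constructor
    · intro h; rw [h, om_zero_left] at this; exact absurd this (by decide)
    · intro h; rw [h, om_self] at this; exact absurd this (by decide)
  have addT : ∀ w a b, (a = 0 ∨ a = T w) → (b = 0 ∨ b = T w) → (a + b = 0 ∨ a + b = T w) := by
    rintro w a b (rfl | rfl) (rfl | rfl) <;> simp [kadd]
  -- Q_u
  have Qv : ∀ u, u ≠ v → u ∈ E → R v u ≠ 0 → (R u + R v) v = τ := by
    intro u h1 h2 h3
    rw [Pi.add_apply, (nb u h1 h2 h3).2, H.Rv, ← add_assoc, kadd, zero_add]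
  have Qu : ∀ u, u ≠ v → u ∈ E → R v u ≠ 0 → (R u + R v) u = R u u + T u := by
    intro u h1 h2 h3
    rw [Pi.add_apply, (nb u h1 h2 h3).1]
  have Qw : ∀ u ∈ E, ∀ w, w ≠ u → w ≠ v → (R u + R v) w = 0 ∨ (R u + R v) w = T w := by
    intro u h1 w h2 h3
    exact addT w _ _ (H.Rw u h1 w h2) (H.Rw v hv w h3)
  have Qmin : ∀ u, u ≠ v → u ∈ E → R v u ≠ 0 → Min L (R u + R v) := by
    intro u h1 h2 h3
    refine ⟨L.add_mem (H.RL u h2) (H.RL v hv), ?_, ?_⟩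
    · intro h; have := Qv u h1 h2 h3; rw [h] at this; exact hτ this.symm
    · intro Q hQ hle
      have hexp := H.expand hQ (X := {u, v}) (by intro w; simp; rintro (rfl | rfl) <;> assumption) (by
        intro w hw
        simp only [mem_insert, mem_singleton, not_or] at hw
        apply H.le_om
        rcases hle w with a | a
        · exact Or.inl a
        · rw [a]; exact Qw u h2 w hw.1 hw.2)
      rw [sum_pair h1] at hexp
      have hv' := hle v
      rw [Qv u h1 h2 h3] at hv'
      have hQv : Q v = om (Q u) (T u) • φ + om (Q v) (T v) • (φ + τ) := by
        conv_lhs => rw [hexp]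
        simp only [Pi.add_apply, Pi.smul_apply, (nb u h1 h2 h3).2, H.Rv]
      rcases z2 (om (Q u) (T u)) with a | a <;> rcases z2 (om (Q v) (T v)) with b | b <;> rw [a, b] at hQv hexp <;>
        simp only [zero_smul, one_smul, zero_add, add_zero] at hQv hexp
      · exact Or.inl hexp
      · exfalso; rw [hQv] at hv'
        rcases hv' with h | h
        · exact hφτ h
        · exact hφ (by simpa using h)
      · exfalso; rw [hQv] at hv'
        rcases hv' with h | h
        · exact hφ h
        · exact hτφ h.symm
      · exact Or.inr hexp
  have hTv := H.Tv
  -- choose the scaling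
  obtain ⟨a, a1, a2, a3⟩ := rel_at hx hL hτ (Qmin u0 hu0v hu0E hu0) (Qv u0 hu0v hu0E hu0)
  obtain ⟨m, m1, m2, m3⟩ := hy _ (Qmin u0 hu0v hu0E hu0) (Qv u0 hu0v hu0E hu0)
  have q0 : (R u0 + R v) u0 ≠ 0 := by
    rw [Qu u0 hu0v hu0E hu0, Ne, kadd_eq]; exact (ruu u0 hu0E).2
  have qT : ∀ u, u ≠ v → u ∈ E → R v u ≠ 0 → (R u + R v) u ≠ T u := by
    intro u h1 h2 h3
    rw [Qu u h1 h2 h3]; intro h; exact (ruu u h2).1 (by simpa using h)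
  have am := a2 u0 hu0v q0
  have mm := m2 u0 hu0v q0
  refine ⟨a u0 * (m u0)⁻¹, mul_ne_zero am (inv_ne_zero mm), ?_⟩
  set s := a u0 * (m u0)⁻¹ with hs
  rw [← sub_eq_zero]
  set D := x v τ - s • y with hDdef
  have hD : Fits L x F v τ D := by
    intro Q hQ hQv
    obtain ⟨a, a1, a2, a3⟩ := rel_at hx hL hτ hQ hQv
    obtain ⟨m, m1, m2, m3⟩ := hy _ hQ hQv
    refine ⟨fun w => a w - s * m w, by simp [a1, m1], ?_⟩
    rw [hDdef, a3, m3, smul_sum, ← sum_sub_distrib]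
    apply sum_congr rfl; intro w _; module
  have hD0 : ∃ δ : V → F, δ v = 0 ∧ D = ∑ w, δ w • x w (T w) := by
    have e : D = ∑ w, (a w - s * m w) • x w ((R u0 + R v) w) := by
      rw [hDdef, a3]; rw [m3]
      rw [smul_sum, ← sum_sub_distrib]
      apply sum_congr rfl; intro w _; module
    rw [conv_sum hx.zero (S := T)] at e
    · exact ⟨_, by simp [a1, m1], e⟩
    · intro w
      by_cases h : w = u0
      · left; rw [h, hs]; field_simp; ring
      by_cases h' : w = v
      · left; rw [h', a1, m1]; ring
      · right; exact Qw u0 hu0E w h h'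
  obtain ⟨δ, δv, hδ⟩ := hD0
  by_contra hne
  have ⟨z, hz⟩ : ∃ z, δ z • x z (T z) ≠ 0 := by
    by_contra hcon; push Not at hcon
    exact hne (by rw [hδ, sum_eq_zero fun w _ => hcon w])
  have hδz : δ z ≠ 0 := by rintro h; rw [h, zero_smul] at hz; exact hz rfl
  have hTz : T z ≠ 0 := by rintro h; rw [h, hx.zero, smul_zero] at hz; exact hz rfl
  have hzE : z ∈ E := by by_contra h; exact hTz (H.T0 z h)
  have hzv : z ≠ v := by rintro rfl; exact hδz δv
  -- step 2
  have S1 : ∀ Q ∈ L, le Q (Function.update T v τ) → Q = 0 := by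
    intro Q hQ hle
    have hw : ∀ w, w ≠ v → Q w = 0 ∨ Q w = T w := by
      intro w hw; have := hle w; rwa [Function.update_of_ne hw] at this
    have hv1 := hle v
    rw [Function.update_self] at hv1
    have h3 := hL.iso hQ (H.RL v hv)
    rw [omV, ← add_sum_erase _ _ (mem_univ v), sum_eq_zero, add_zero, H.Rv] at h3
    · have : Q v = 0 := by
        rcases hv1 with h | h
        · exact h
        · rw [h, om_add_right, om_self, o2] at h3; exact absurd h3 (by decide)
      apply H.ind Q hQ
      intro w
      apply H.le_om
      by_cases h : w = v
      · left; rw [h, this]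
      · exact hw w h
    · intro w hw'
      have hw' := ne_of_mem_erase hw'
      rcases hw w hw' with a | a <;> rcases H.Rw v hv w hw' with b | b <;> simp [a, b, om_self, om_zero_left, om_zero_right]
  have step2 : ∀ u, u ≠ v → u ∈ E → R v u ≠ 0 → ∀ w, w ≠ v → T w ≠ 0 → δ w ≠ 0 → (R u + R v) w = T w := by
    intro u h1 h2 h3 w hwv hTw hδw
    have := cmp hx hL hτ hD (Qmin u h1 h2 h3) (Qv u h1 h2 h3) (S := Function.update T v τ) (q := u)
      (by intro w hw; rw [Function.update_of_ne (by rintro rfl; exact hw hv)]; exact H.T0 w hw)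
      (Function.update_self ..) S1 h1 (by rw [Qu u h1 h2 h3, Ne, kadd_eq]; exact (ruu u h2).2)
      (by rw [Function.update_of_ne h1]; exact qT u h1 h2 h3)
      (by
        intro w hw
        by_cases h : w = v
        · right; rw [h, Function.update_self, Qv u h1 h2 h3]
        · rw [Function.update_of_ne h]; exact Qw u h2 w hw h)
      δv (by
        rw [hδ]; apply sum_congr rfl; intro w _
        by_cases h : w = v
        · rw [h, δv, zero_smul, zero_smul]
        · rw [Function.update_of_ne h]) w (by rwa [Function.update_of_ne hwv]) hδw
    rwa [Function.update_of_ne hwv] at this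
  have δN : ∀ u, u ≠ v → u ∈ E → R v u ≠ 0 → δ u = 0 := by
    intro u h1 h2 h3
    by_contra h
    exact qT u h1 h2 h3 (step2 u h1 h2 h3 u h1 (H.T1 u h2) h)
  have hRvz : R v z = 0 := by
    by_contra h; exact hδz (δN z hzv hzE h)
  have hu0z : R u0 z = T z := by
    have := step2 u0 hu0v hu0E hu0 z hzv hTz hδz
    rwa [Pi.add_apply, hRvz, add_zero] at this
  have hzu : z ≠ u0 := by rintro rfl; exact hu0 hRvz
  have hRzv : R z v = 0 := (H.sym hL hv hzE hzv.symm).1 hRvz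
  have hRzu : R z u0 = T u0 := by
    refine (H.Rw z hzE u0 hzu.symm).resolve_left fun h => ?_
    rw [← H.sym hL hu0E hzE hzu.symm, hu0z] at h; exact hTz h
  obtain ⟨n1, n2⟩ := nb u0 hu0v hu0E hu0
  set Q := R z + (R u0 + R v) with hQdef
  have Qv3 : Q v = τ := by rw [hQdef, Pi.add_apply, hRzv, zero_add, Qv u0 hu0v hu0E hu0]
  have Qu3 : Q u0 = R u0 u0 := by
    rw [hQdef, Pi.add_apply, hRzu, Pi.add_apply, n1, add_comm (R u0 u0), ← add_assoc, kadd, zero_add]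
  have Qz3 : Q z = R z z + T z := by
    rw [hQdef, Pi.add_apply, Pi.add_apply, hRvz, hu0z, add_zero]
  have Qw3 : ∀ w, w ≠ v → w ≠ u0 → w ≠ z → Q w = 0 ∨ Q w = T w := by
    intro w h1 h2 h3
    exact addT w _ _ (H.Rw z hzE w h3) (Qw u0 hu0E w h2 h1)
  have Qmin3 : Min L Q := by
    refine ⟨L.add_mem (H.RL z hzE) (L.add_mem (H.RL u0 hu0E) (H.RL v hv)), ?_, ?_⟩
    · intro h; rw [h] at Qv3; exact hτ Qv3.symm
    · intro P hP hle
      have hexp := H.expand hP (X := {z, u0, v}) (by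
        intro w; simp only [mem_insert, mem_singleton]; rintro (rfl | rfl | rfl) <;> assumption) (by
        intro w hw
        simp only [mem_insert, mem_singleton, not_or] at hw
        apply H.le_om
        rcases hle w with a | a
        · exact Or.inl a
        · rw [a]; exact Qw3 w hw.2.2 hw.2.1 hw.1)
      rw [sum_insert (by simp [hzu, hzv]), sum_pair hu0v] at hexp
      have hv' := hle v
      have hu' := hle u0
      rw [Qv3] at hv'
      rw [Qu3] at hu'
      have hPv : P v = om (P u0) (T u0) • φ + om (P v) (T v) • (φ + τ) := by
        conv_lhs => rw [hexp]
        simp only [Pi.add_apply, Pi.smul_apply, n2, H.Rv, hRzv, smul_zero, zero_add]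
      have hPu : P u0 = om (P z) (T z) • T u0 + (om (P u0) (T u0) • R u0 u0 + om (P v) (T v) • T u0) := by
        conv_lhs => rw [hexp]
        simp only [Pi.add_apply, Pi.smul_apply, n1, hRzu]
      have tu := H.T1 u0 hu0E
      have ru := ruu u0 hu0E
      rcases z2 (om (P u0) (T u0)) with a | a <;> rcases z2 (om (P v) (T v)) with b | b <;>
      rcases z2 (om (P z) (T z)) with c | c <;> rw [a, b] at hPv <;> rw [a, b, c] at hPu hexp <;>
        simp only [zero_smul, one_smul, zero_add, add_zero] at hPv hPu hexp
      · exact Or.inl hexp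
      · exfalso; rw [hPu] at hu'; rcases hu' with h | h
        · exact tu h
        · exact ru.2 h.symm
      · exfalso; rw [hPv] at hv'
        rcases hv' with h | h
        · exact hφτ h
        · exact hφ (by simpa using h)
      · exfalso; rw [hPv] at hv'
        rcases hv' with h | h
        · exact hφτ h
        · exact hφ (by simpa using h)
      · exfalso; rw [hPv] at hv'
        rcases hv' with h | h
        · exact hφ h
        · exact hτφ h.symm
      · exfalso; rw [hPv] at hv'
        rcases hv' with h | h
        · exact hφ h
        · exact hτφ h.symm
      · exfalso; rw [hPu] at hu'; rcases hu' with h | h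
        · rw [kadd_eq] at h; exact ru.2 h
        · exact tu (by simpa using h)
      · exact Or.inr hexp
  have S2 : ∀ Q ∈ L, le Q (Function.update (Function.update T v τ) u0 (R u0 u0)) → Q = 0 := by
    intro Q hQ hle
    have hw : ∀ w, w ≠ v → w ≠ u0 → Q w = 0 ∨ Q w = T w := by
      intro w hw hw'; have := hle w; rwa [Function.update_of_ne hw', Function.update_of_ne hw] at this
    have hv1 := hle v
    rw [Function.update_of_ne hu0v.symm, Function.update_self] at hv1
    have hu1 := hle u0
    rw [Function.update_self] at hu1
    have i1 := hL.iso hQ (H.RL v hv)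
    have i2 := hL.iso hQ (H.RL u0 hu0E)
    have side : ∀ c ∈ E, (c = v ∨ c = u0) → omV Q (R c) = om (Q v) (R c v) + om (Q u0) (R c u0) := by
      intro c hcE hc
      rw [omV, ← add_sum_erase _ _ (mem_univ v), ← add_sum_erase _ _ (mem_erase.2 ⟨hu0v, mem_univ u0⟩), sum_eq_zero, add_zero]
      intro w hw'
      simp only [mem_erase] at hw'
      rcases hw w hw'.2.1 hw'.1 with a | a <;>
        rcases H.Rw c hcE w (by rcases hc with rfl | rfl; exacts [hw'.2.1, hw'.1]) with b | b <;>
        simp [a, b, om_self, om_zero_left, om_zero_right]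
    rw [side v hv (Or.inl rfl), H.Rv, n1] at i1
    rw [side u0 hu0E (Or.inr rfl), n2] at i2
    have e2 : om (Q u0) (R u0 u0) = 0 := by
      rcases hu1 with h | h <;> simp [h, om_self, om_zero_left]
    rw [e2, add_zero] at i2
    have q1 : Q v = 0 := by
      rcases hv1 with h | h
      · exact h
      · rw [h, o2] at i2; exact absurd i2 (by decide)
    have q2 : Q u0 = 0 := by
      rcases hu1 with h | h
      · exact h
      · rw [h, q1, om_zero_left, H.Ru u0 hu0E] at i1; exact absurd i1 (by decide)
    apply H.ind Q hQ
    intro w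
    apply H.le_om
    by_cases h : w = v
    · left; rw [h, q1]
    by_cases h' : w = u0
    · left; rw [h', q2]
    exact hw w h h'
  have fin := cmp hx hL hτ hD Qmin3 Qv3 (S := Function.update (Function.update T v τ) u0 (R u0 u0)) (q := z)
    (by
      intro w hw
      rw [Function.update_of_ne (by rintro rfl; exact hw hu0E), Function.update_of_ne (by rintro rfl; exact hw hv)]
      exact H.T0 w hw)
    (by rw [Function.update_of_ne hu0v.symm, Function.update_self]) S2 hzv
    (by rw [Qz3, Ne, kadd_eq]; exact (ruu z hzE).2)
    (by rw [Function.update_of_ne hzu, Function.update_of_ne hzv, Qz3]; intro h; exact (ruu z hzE).1 (by simpa using h))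
    (by
      intro w hw
      by_cases h' : w = u0
      · right; rw [h', Function.update_self, Qu3]
      by_cases h : w = v
      · right; rw [h, Function.update_of_ne hu0v.symm, Function.update_self, Qv3]
      · rw [Function.update_of_ne h', Function.update_of_ne h]; exact Qw3 w h h' hw)
    δv (by
      rw [hδ]; apply sum_congr rfl; intro w _
      by_cases h' : w = u0
      · rw [h', δN u0 hu0v hu0E hu0, zero_smul, zero_smul]
      by_cases h : w = v
      · rw [h, δv, zero_smul, zero_smul]
      · rw [Function.update_of_ne h', Function.update_of_ne h]) z
    (by rwa [Function.update_of_ne hzu, Function.update_of_ne hzv]) hδz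
  rw [Function.update_of_ne hzu, Function.update_of_ne hzv, Qz3] at fin
  exact (ruu z hzE).1 (by simpa using fin)
end
end

section
theorem loc_sum {h x : K → M} (hs : ∑ y, h y = 0) (hx : ∀ τ, τ ≠ 0 → ∃ c : F, c ≠ 0 ∧ x τ = c • (h 0 + h τ))
    (f : K → ZMod 2) (hf : ∑ y, f y = 0) :
    ∃ l : F, ∑ y, (if f y = 1 then h y else 0) = l • x (bdK f) ∧ (l ≠ 0 ↔ bdK f ≠ 0) := by
  by_cases h0 : bdK f = 0
  · refine ⟨0, ?_, by simp [h0]⟩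
    have hc : ∀ y, f y = f 0 := by
      intro y
      have := even_eq hf (y := 0) (k := y) (by rw [h0, om_zero_left])
      rwa [zero_add] at this
    rw [zero_smul]
    rcases z2 (f 0) with a | a
    · simp [hc, a]
    · simp only [hc, a, if_true]; exact hs
  · obtain ⟨c, hc0, hc⟩ := hx _ h0
    have key : ∀ f : K → ZMod 2, ∑ y, f y = 0 → bdK f ≠ 0 → (∀ y, f y = 1 ↔ (if f 0 = 1 then (y = 0 ∨ y = bdK f) else ¬ (y = 0 ∨ y = bdK f))) := by
      apply ext4; simp only [sumK]; decide
    have k := key f hf h0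
    have e1 : ∑ y, (if (y = 0 ∨ y = bdK f) then h y else 0) = h 0 + h (bdK f) := by
      rw [← sum_filter]
      have : (univ.filter fun y => y = 0 ∨ y = bdK f) = {0, bdK f} := by ext y; simp
      rw [this, sum_pair (Ne.symm h0)]
    by_cases f0 : f 0 = 1
    · refine ⟨c⁻¹, ?_, by simp [h0, hc0]⟩
      simp only [f0, if_true] at k
      simp only [k]
      rw [e1, hc, smul_smul, inv_mul_cancel₀ hc0, one_smul]
    · refine ⟨-c⁻¹, ?_, by simp [h0, hc0]⟩
      simp only [f0, if_false] at k
      simp only [k]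
      have e2 : ∑ y, (if ¬ (y = 0 ∨ y = bdK f) then h y else 0) = ∑ y, h y - ∑ y, (if (y = 0 ∨ y = bdK f) then h y else 0) := by
        rw [← sum_sub_distrib]; apply sum_congr rfl; intro y _; by_cases hy : y = 0 ∨ y = bdK f
        · rw [if_neg (not_not.2 hy), if_pos hy, sub_self]
        · rw [if_pos hy, if_neg hy, sub_zero]
      rw [e2, hs, e1, hc, smul_smul, neg_mul, inv_mul_cancel₀ hc0]; module

def PS (h : V × K → M) (p : V × K → ZMod 2) : M := ∑ e, if p e = 1 then h e else 0

theorem glob_sum {x : V → K → M} {h : V × K → M}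
    (hs : ∀ v ∈ E, ∑ y, h (v, y) = 0) (hx : ∀ v ∈ E, ∀ τ : K, τ ≠ 0 → ∃ c : F, c ≠ 0 ∧ x v τ = c • (h (v, 0) + h (v, τ)))
    (hp : Cyc E ι p) : ∃ l : V → F, PS h p = ∑ w, l w • x w (bd p w) ∧ ∀ w, l w ≠ 0 ↔ bd p w ≠ 0 := by
  have : ∀ w, ∃ l : F, ∑ y, (if p (w, y) = 1 then h (w, y) else 0) = l • x w (bd p w) ∧ (l ≠ 0 ↔ bd p w ≠ 0) := by
    intro w
    by_cases hw : w ∈ E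
    · exact loc_sum (hs w hw) (hx w hw) _ (hp.even w)
    · refine ⟨0, ?_, ?_⟩
      · rw [zero_smul]; apply sum_eq_zero; intro y _; rw [hp.supp _ hw]; simp
      · simp [hp.bd_supp hw]
  choose l hl1 hl2 using this
  refine ⟨l, ?_, hl2⟩
  rw [PS, Fintype.sum_prod_type]
  exact sum_congr rfl fun w _ => hl1 w

theorem two_sum (hD : Dg E ι) {h : V × K → M} {z : M}
    (ht : ∀ e : V × K, e.1 ∈ E → h e + h (ι e) = t e • z) (hp : Cyc E ι p) :
    (2 : F) • PS h p = TT t p • z := by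
  have e1 : PS h p = ∑ e, if p e = 1 then h (ι e) else 0 := by
    rw [PS]
    rw [← Equiv.sum_comp (Function.Involutive.toPerm ι hD.inv)]
    apply sum_congr rfl; intro e _
    change (if p (ι e) = 1 then h (ι e) else 0) = _
    rw [hp.inv]
  rw [two_smul]
  nth_rw 2 [e1]
  rw [PS, ← sum_add_distrib, TT, sum_smul]
  apply sum_congr rfl; intro e _
  by_cases he : e.1 ∈ E
  · split_ifs with h1
    · exact ht e he
    · simp
  · simp [hp.supp e he]

theorem mnr_cases {v : V} {φ : K} (hR : R ∈ mnr L v φ) : R v = 0 ∧ (R ∈ L ∨ R + Pi.single v φ ∈ L) := by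
  obtain ⟨Q, hQ, h1, h2⟩ := mem_mnr_iff.1 hR
  refine ⟨by rw [h2, kill_same], ?_⟩
  rcases h1 with h1 | h1
  · left; rw [h2, kill_of_zero h1]; exact hQ
  · right; convert hQ using 1
    funext w
    rw [h2]
    by_cases hw : w = v
    · subst hw; simp [kill_same, h1]
    · simp [kill_ne hw, hw]

theorem mem_mnr_of {v : V} {φ : K} (hR : R ∈ L) (h : R v = 0) : R ∈ mnr L v φ := by
  have := kill_mem_mnr (i := φ) hR (Or.inl h)
  rwa [kill_of_zero h] at this

theorem lift_h (h2 : (2 : F) ≠ 0) {x : V → K → M} {z : M} {h' : V × K → M ⧸ Submodule.span F {z}}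
    (hN : Nrl F E ι (fun v k => (Submodule.span F {z}).mkQ (x v k)) h') :
    ∃ h : V × K → M, (∀ v ∈ E, ∑ y, h (v, y) = 0) ∧
      (∀ v ∈ E, ∀ τ : K, τ ≠ 0 → ∃ c : F, c ≠ 0 ∧ x v τ = c • (h (v, 0) + h (v, τ))) ∧
      ∀ e, e.1 ∈ E → (Submodule.span F {z}).mkQ (h e) = h' e := by
  have : ∀ v τ, ∃ c : F, c ≠ 0 ∧ (v ∈ E → τ ≠ 0 → (Submodule.span F {z}).mkQ (x v τ) = c • (h' (v, 0) + h' (v, τ))) := by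
    intro v τ
    by_cases h : v ∈ E ∧ τ ≠ 0
    · obtain ⟨c, h1, h2⟩ := hN.par v h.1 τ h.2
      exact ⟨c, h1, fun _ _ => h2⟩
    · exact ⟨1, one_ne_zero, fun a b => absurd ⟨a, b⟩ h⟩
  choose c hc hcx using this
  set X : V → K → M := fun v τ => (c v τ)⁻¹ • x v τ with hX
  set h0 : V → M := fun v => (2:F)⁻¹ • (X v (1,0) + X v (0,1) + X v (1,1)) with hh0
  have d1 : ((1:ZMod 2),(0:ZMod 2)) ≠ 0 := by decide
  have d2 : ((0:ZMod 2),(1:ZMod 2)) ≠ 0 := by decide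
  have d3 : ((1:ZMod 2),(1:ZMod 2)) ≠ 0 := by decide
  have d0 : ((0:ZMod 2),(0:ZMod 2)) = 0 := rfl
  have mX : ∀ v ∈ E, ∀ τ, τ ≠ 0 → (Submodule.span F {z}).mkQ (X v τ) = h' (v, 0) + h' (v, τ) := by
    intro v hv τ hτ
    rw [hX]; dsimp only
    rw [map_smul, hcx v τ hv hτ, smul_smul, inv_mul_cancel₀ (hc v τ), one_smul]
  have two : ∀ v, (2:F) • h0 v = X v (1,0) + X v (0,1) + X v (1,1) := by
    intro v; rw [hh0]; dsimp only; rw [smul_smul, mul_inv_cancel₀ h2, one_smul]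
  have m0 : ∀ v ∈ E, (Submodule.span F {z}).mkQ (h0 v) = h' (v, 0) := by
    intro v hv
    have s := hN.sum v hv
    rw [sumK] at s
    have e : (2:F) • (Submodule.span F {z}).mkQ (h0 v) = (2:F) • h' (v, 0) := by
      rw [← map_smul, two, map_add, map_add, mX v hv _ d1, mX v hv _ d2, mX v hv _ d3]
      try rw [d0] at s
      linear_combination (norm := module) s
    have := congrArg (fun m => (2:F)⁻¹ • m) e
    simpa [smul_smul, inv_mul_cancel₀ h2] using this
  refine ⟨fun e => if e.2 = 0 then h0 e.1 else X e.1 e.2 - h0 e.1, ?_, ?_, ?_⟩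
  · intro v hv
    rw [sumK]
    simp only [d1, d2, d3, d0, if_true, if_false]
    linear_combination (norm := module) -two v
  · intro v hv τ hτ
    refine ⟨c v τ, hc v τ, ?_⟩
    simp only [hτ, if_true, if_false]
    rw [add_sub_cancel, hX]; dsimp only
    rw [smul_smul, mul_inv_cancel₀ (hc v τ), one_smul]
  · rintro ⟨v, τ⟩ hv
    dsimp only at hv ⊢
    split_ifs with h
    · subst h; exact m0 v hv
    · rw [map_sub, m0 v hv, mX v hv τ h]; abel

theorem step_compat (h2 : (2 : F) ≠ 0) (hL : Lag E L) {x : V → K → M} (hx : Rep F E L x) {v : V} (hv : v ∈ E) {φ : K} (hφ : φ ≠ 0)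
    (hs : Pi.single v φ ∉ L) (hD : Dg (E.erase v) ι) (hm : mnr L v φ = LD (E.erase v) ι) {h : V × K → M}
    (hsum : ∀ v', v' ∈ E.erase v → ∑ y, h (v', y) = 0)
    (hpar : ∀ v', v' ∈ E.erase v → ∀ τ : K, τ ≠ 0 → ∃ c : F, c ≠ 0 ∧ x v' τ = c • (h (v', 0) + h (v', τ)))
    (hz : x v φ ≠ 0) (ht : ∀ e : V × K, e.1 ∈ E.erase v → h e + h (ι e) = t e • x v φ)
    (ht0 : ∀ e : V × K, e.1 ∉ E.erase v → t e = 0) : Compat (E.erase v) ι (mnr L v φ ⊓ L) t := by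
  have hLm := hL.mnr hv hφ
  have hxm := hx.mnr hv hφ hs
  refine ⟨?_, ht0, ?_, ?_, ?_⟩
  · intro e
    by_cases he : e.1 ∈ E.erase v
    · have a := ht e he
      have b := ht (ι e) (hD.mem he)
      rw [hD.inv, add_comm, a] at b
      exact (smul_left_injective F hz b).symm
    · rw [hD.out e he]
  · rw [← hm]; exact inf_le_left
  · rw [← hm]
    intro R hR Q hQ hR0 hQ0
    have hR1 : R ∉ L := fun h => hR0 ⟨hR, h⟩
    have hQ1 : Q ∉ L := fun h => hQ0 ⟨hQ, h⟩
    have a := (mnr_cases hR).2.resolve_left hR1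
    have b := (mnr_cases hQ).2.resolve_left hQ1
    refine ⟨Submodule.add_mem _ hR hQ, ?_⟩
    have := L.add_mem a b
    rwa [add_add_add_comm, vadd, add_zero] at this
  · intro p hp hbd
    obtain ⟨l, l1, l2⟩ := glob_sum hsum hpar hp
    have tw := two_sum hD ht hp
    rcases hbd with hbd | hbd
    · rw [hbd]
      refine ⟨fun _ => Submodule.zero_mem _, fun _ => ?_⟩
      rw [hbd] at l1
      simp only [Pi.zero_apply, hx.zero, smul_zero, sum_const_zero] at l1
      rw [l1, smul_zero] at tw
      exact (smul_eq_zero.1 tw.symm).resolve_right hz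
    · rw [← hm] at hbd
      set R := bd p with hR
      have hRv := (mnr_cases hbd.1).1
      have hle : ∀ Q ∈ L, le Q R → Q ∈ mnr L v φ := by
        intro Q hQ hQR
        refine mem_mnr_of hQ ?_
        have := hQR v; rw [hRv] at this; tauto
      constructor
      · intro hT
        rw [hT, zero_smul] at tw
        have tw := (smul_eq_zero.1 tw).resolve_left h2
        rw [l1] at tw
        refine ⟨hbd.1, ?_⟩
        by_contra hRL
        have := (hx.ind R (by
          intro u hu
          exact hLm.supp hbd.1 u (fun h => hu (mem_of_mem_erase h)))).1 (by
            intro Q hQ hQR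
            rcases hbd.2.2 Q (hle Q hQ hQR) hQR with h | h
            · exact h
            · rw [h] at hQ; exact absurd hQ hRL) l tw
        apply hbd.2.1
        funext w
        by_contra hw
        exact (l2 w).2 hw (this w hw)
      · intro hRL
        have hmin : Min L R := ⟨hRL.2, hbd.2.1, fun Q hQ hQR => hbd.2.2 Q (hle Q hQ hQR) hQR⟩
        obtain ⟨l', h1, h3⟩ := hx.rel hL hmin
        obtain ⟨u, hu⟩ : ∃ u, R u ≠ 0 := by
          by_contra hc; push Not at hc; exact hbd.2.1 (funext hc)
        have hu' := (h3 u).2 hu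
        have hk : (Submodule.span F {x v φ}).mkQ (PS h p) = 0 := by
          have : (2:F) • (Submodule.span F {x v φ}).mkQ (PS h p) = 0 := by
            rw [← map_smul, tw, map_smul]
            have : (Submodule.span F {x v φ}).mkQ (x v φ) = 0 := by
              rw [Submodule.mkQ_apply, Submodule.Quotient.mk_eq_zero]; exact Submodule.mem_span_singleton_self _
            rw [this, smul_zero]
          exact (smul_eq_zero.1 this).resolve_left h2
        have un := hxm.uniq hLm hbd (l := fun w => l w - l u * (l' u)⁻¹ * l' w) (by
          have e : ∑ w, (l w - l u * (l' u)⁻¹ * l' w) • x w (R w) = PS h p := by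
            rw [l1]
            simp only [sub_smul, sum_sub_distrib]
            simp only [mul_smul, ← smul_sum, h1, smul_zero, sub_zero]
          rw [← e, map_sum] at hk
          rw [← hk]
          apply sum_congr rfl; intro w _; rw [map_smul]) hu (by field_simp; ring)
        have e : PS h p = 0 := by
          rw [l1]
          have : ∑ w, l w • x w (R w) = (l u * (l' u)⁻¹) • ∑ w, l' w • x w (R w) := by
            rw [smul_sum]; apply sum_congr rfl; intro w _
            by_cases hw : R w = 0
            · rw [hw, hx.zero]; simp
            · have := un w hw
              rw [sub_eq_zero] at this
              rw [this, mul_smul]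
          rw [this, h1, smul_zero]
        rw [e, smul_zero] at tw
        exact (smul_eq_zero.1 tw.symm).resolve_right hz

theorem step_star (hL : Lag E L) (hp : Prim E L) (hn : 6 ≤ E.card) {v : V} (hv : v ∈ E) {φ : K} (hφ : φ ≠ 0)
    (hD : Dg (E.erase v) ι) (hm : mnr L v φ = LD (E.erase v) ι) 
    (hC : Compat (E.erase v) ι (mnr L v φ ⊓ L) t) (w : V) : ∃ e, t e ≠ 0 ∧ e.1 ≠ w ∧ (ι e).1 ≠ w := by
  have hLm := hL.mnr hv hφ
  by_contra hcon
  push Not at hcon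
  have hcE : (E.erase v).card = E.card - 1 := card_erase_of_mem hv
  have ⟨w, hw, hcon⟩ : ∃ w ∈ E.erase v, ∀ e, t e ≠ 0 → e.1 = w ∨ (ι e).1 = w := by
    by_cases hw : w ∈ E.erase v
    · exact ⟨w, hw, fun e he => by by_cases h : e.1 = w; exacts [Or.inl h, Or.inr (hcon e he h)]⟩
    · obtain ⟨w', hw'⟩ : (E.erase v).Nonempty := by rw [← card_pos]; omega
      refine ⟨w', hw', fun e he => ?_⟩
      exfalso
      have heE : e.1 ∈ E.erase v := by by_contra h; exact he (hC.supp e h)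
      have h1 : e.1 ≠ w := by rintro h; exact hw (h ▸ heE)
      exact hw (hcon e he h1 ▸ hD.mem heE)
  have key : ∀ R ∈ mnr L v φ, R w = 0 → R ∈ L := by
    apply min_ind
    · intro _; exact L.zero_mem
    · intro R hR hRw
      have hR1 := hR.1
      rw [hm, mem_LD] at hR1
      obtain ⟨p, hp, hpR⟩ := hR1
      have hcst : ∀ y, p (w, y) = p (w, 0) := by
        intro y
        have := even_eq (hp.even w) (y := 0) (k := y) (by
          have : bdK (fun y => p (w, y)) = 0 := by rw [← hRw, ← hpR]; rfl
          rw [this, om_zero_left])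
        rwa [zero_add] at this
      have ⟨q, hq, hqR, hq0⟩ : ∃ q, Cyc (E.erase v) ι q ∧ bd q = R ∧ ∀ y, q (w, y) = 0 := by
        rcases z2 (p (w, 0)) with a | a
        · exact ⟨p, hp, hpR, fun y => by rw [hcst, a]⟩
        · have h1 : Cyc (E.erase v) ι (fun e => if e.1 ∈ E.erase v then 1 else 0) := by
            refine ⟨fun e => ?_, fun u => ?_, fun e he => by rw [if_neg he]⟩
            · simp only [hD.mem_iff]
            · rw [sumK]; by_cases hu : u ∈ E.erase v <;> simp only [hu, if_true, if_false] <;> decide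
          refine ⟨_, hp.add h1, ?_, ?_⟩
          · rw [bd_add, hpR]
            have : bd (fun e : V × K => if e.1 ∈ E.erase v then (1 : ZMod 2) else 0) = 0 := by
              funext u; exact bdK_const _
            rw [this, add_zero]
          · intro y
            simp only [Pi.add_apply, hcst, a, if_pos hw]; decide
      have hT : TT t q = 0 := by
        rw [TT]; apply sum_eq_zero; intro e _
        split_ifs with h1
        · by_contra hte
          rcases hcon e hte with h | h
          · have := hq0 e.2; rw [← h] at this; rw [this] at h1; exact absurd h1 (by decide)
          · have := hq0 (ι e).2; rw [← h] at this; rw [← hq.inv, this] at h1; exact absurd h1 (by decide)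
        · rfl
      have := (hC.main q hq (Or.inr (by rw [hqR, ← hm]; exact hR))).1 hT
      rw [hqR] at this
      exact this.2
    · intro R hR Q hQ hle h1 h2 hRw
      have hQw : Q w = 0 := by have := hle w; rw [hRw] at this; tauto
      have := L.add_mem (h2 (by rw [Pi.add_apply, hRw, hQw, add_zero])) (h1 hQw)
      rwa [vadd_cancel] at this
  have hX1 : {w} ⊆ E.erase v := by simpa using hw
  have du := hLm.dual hX1
  have hle : d (mnr L v φ) (E.erase v \ {w}) ≤ d L (E.erase v \ {w}) := by
    apply Submodule.finrank_mono
    rintro R ⟨h1, h2⟩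
    refine ⟨key R h1 ?_, h2⟩
    exact mem_W.1 h2 w (by simp)
  have c1 : (E.erase v \ {w}).card = E.card - 2 := by
    rw [card_sdiff_of_subset hX1, hcE, card_singleton]; omega
  have hsub : E.erase v \ {w} ⊆ E := sdiff_subset.trans (erase_subset _ _)
  have := hp.2 (E.erase v \ {w}) hsub (by omega) (by rw [card_sdiff_of_subset hsub]; omega)
  rw [card_singleton] at du
  omega

theorem TT_two (hD : Dg E ι) (hti : ∀ e, t (ι e) = t e) {c : F} {e f : V × K}
    (he : e.1 ∈ E) (hf : f.1 ∈ E) (h1 : f ≠ e) (h2 : f ≠ ι e) (te : t e = c) (tf : t f = -c)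
    (h0 : ∀ a, t a ≠ 0 → a = e ∨ a = ι e ∨ a = f ∨ a = ι f) (hp : Cyc E ι p) :
    TT t p = 2 * c * ((if p e = 1 then 1 else 0) - (if p f = 1 then 1 else 0)) := by
  have n1 : e ≠ ι e := (hD.fixE e he).symm
  have n2 : f ≠ ι f := (hD.fixE f hf).symm
  have n3 : e ≠ ι f := by rintro h; apply h2; rw [h, hD.inv]
  have n4 : ι e ≠ ι f := by intro h; apply h1; have := congrArg ι h; rw [hD.inv, hD.inv] at this; exact this.symm
  have : TT t p = ∑ a ∈ ({e, ι e, f, ι f} : Finset (V × K)), if p a = 1 then t a else 0 := by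
    rw [TT]; symm
    apply sum_subset (subset_univ _)
    intro a _ ha
    simp only [mem_insert, mem_singleton] at ha
    have : t a = 0 := by by_contra h; exact ha (h0 a h)
    rw [this, ite_self]
  rw [this, sum_insert (by simp [n1, h1.symm, n3]), sum_insert (by simp [h2.symm, n4]), sum_pair n2, hti, hti, hp.inv, hp.inv, te, tf]
  split_ifs <;> ring
end

section
theorem z2_iff4 : ∀ a b c d : ZMod 2, a + b = c + d ↔ (a = c ↔ b = d) := by decide

theorem step_lift (h2 : (2 : F) ≠ 0) {v : V} {φ : K}
    (hD : Dg (E.erase v) ι) (hm : mnr L v φ = LD (E.erase v) ι) (hc : Conn (E.erase v) (LD (E.erase v) ι))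
    (hC : Compat (E.erase v) ι (mnr L v φ ⊓ L) t) {c : F} {e f : V × K} (hc0 : c ≠ 0)
    (he : e.1 ∈ E.erase v) (hf : f.1 ∈ E.erase v) (h1 : f ≠ e) (h3 : f ≠ ι e) (te : t e = c) (tf : t f = -c)
    (h0 : ∀ a, t a ≠ 0 → a = e ∨ a = ι e ∨ a = f ∨ a = ι f) :
    ∀ p, Cyc (E.erase v) ι p → bd p + Pi.single v (if p e = p f then 0 else φ) ∈ L := by
  have key : ∀ R ∈ mnr L v φ, ∀ p, Cyc (E.erase v) ι p → bd p = R → bd p + Pi.single v (if p e = p f then 0 else φ) ∈ L := by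
    apply min_ind
    · intro p hp hb
      have : p e = p f := by
        apply conn_const hD hc p (fun e _ => hp.inv e) _ e f he hf
        intro u hu y
        have := even_eq (hp.even u) (y := 0) (k := y) (by
          have : bdK (fun y => p (u, y)) = 0 := congrFun hb u
          rw [this, om_zero_left])
        rwa [zero_add] at this
      rw [hb, if_pos this, Pi.single_zero, add_zero]; exact L.zero_mem
    · intro R hR p hp hb
      have hM := hC.main p hp (Or.inr (by rw [hb, ← hm]; exact hR))
      rw [TT_two hD hC.inv he hf h1 h3 te tf h0 hp, hb] at hM
      rw [hb]
      by_cases hpe : p e = p f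
      · rw [if_pos hpe, Pi.single_zero, add_zero]
        exact (hM.1 (by rw [hpe]; ring)).2
      · rw [if_neg hpe]
        refine (mnr_cases hR.1).2.resolve_left fun hRL => ?_
        have := hM.2 ⟨hR.1, hRL⟩
        rcases z2 (p e) with a | a <;> rcases z2 (p f) with b | b <;> rw [a, b] at this hpe <;> simp [h2, hc0] at this hpe
    · intro R hR Q hQ _ hPQ hPRQ p hp hb
      have hQ' := hQ
      rw [hm, mem_LD] at hQ'
      obtain ⟨q, hq, hqb⟩ := hQ'
      have a1 := hPQ q hq hqb
      have a2 := hPRQ (p + q) (hp.add hq) (by rw [bd_add, hb, hqb])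
      have := L.add_mem a2 a1
      convert this using 1
      rw [bd_add, add_add_add_comm, vadd_cancel, ← Pi.single_add]
      congr 2
      simp only [Pi.add_apply]
      simp only [z2_iff4]
      by_cases b1 : p e = p f <;> by_cases b2 : q e = q f <;> simp [b1, b2, kadd]
  intro p hp
  exact key (bd p) (by rw [hm]; exact ⟨p, hp, rfl⟩) p hp rfl

theorem star_step (h2 : (2 : F) ≠ 0) (hL : Lag E L) (hp : Prim E L) (hn : 6 ≤ E.card) {x : V → K → M} (hx : Rep F E L x)
    {v : V} (hv : v ∈ E) {φ : K} (hφ : φ ≠ 0) {ι' : V × K → V × K} (hD : Dg (E.erase v) ι')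
    (hm : mnr L v φ = LD (E.erase v) ι') (hpm : Prim (E.erase v) (mnr L v φ)) {h' : V × K → M ⧸ Submodule.span F {x v φ}}
    (hN : Nrl F (E.erase v) ι' (fun w k => (Submodule.span F {x v φ}).mkQ (x w k)) h') :
    ∃ ι h, Dg E ι ∧ L = LD E ι ∧ Nrl F E ι x h := by
  classical
  have hs : Pi.single v φ ∉ L := single_notMem hp.1 (by omega) hv hφ
  have hcE : (E.erase v).card = E.card - 1 := card_erase_of_mem hv
  have hz : x v φ ≠ 0 := by
    intro h0
    have := (hx.ind (Pi.single v φ) (fun w hw => Pi.single_eq_of_ne (by rintro rfl; exact hw hv) _)).1 (by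
      intro R hR hle
      have hw : ∀ w, w ≠ v → R w = 0 := by
        intro w hw; have := hle w; rw [Pi.single_eq_of_ne hw] at this; tauto
      have hv' := hle v
      rw [Pi.single_eq_same] at hv'
      rcases hv' with h | h
      · funext w
        by_cases hw' : w = v
        · rw [hw', h]; rfl
        · exact hw w hw'
      · exfalso; apply hs
        convert hR using 1
        funext w
        by_cases hw' : w = v
        · rw [hw', h, Pi.single_eq_same]
        · rw [Pi.single_eq_of_ne hw', hw w hw']) (Pi.single v 1) (by
          apply sum_eq_zero; intro w _
          by_cases hw : w = v
          · subst hw; simp [h0]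
          · simp [hw]) v (by simpa using hφ)
    simp at this
  obtain ⟨h, hsum, hpar, hmk⟩ := lift_h h2 hN
  have : ∀ e : V × K, ∃ t : F, (e.1 ∈ E.erase v → h e + h (ι' e) = t • x v φ) ∧ (e.1 ∉ E.erase v → t = 0) := by
    intro e
    by_cases he : e.1 ∈ E.erase v
    · have : h e + h (ι' e) ∈ Submodule.span F {x v φ} := by
        rw [← Submodule.Quotient.mk_eq_zero, ← Submodule.mkQ_apply, map_add, hmk e he, hmk _ (hD.mem he), hN.inv e he]
        abel
      obtain ⟨t, ht⟩ := Submodule.mem_span_singleton.1 this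
      exact ⟨t, fun _ => ht.symm, fun h => absurd he h⟩
    · exact ⟨0, fun h => absurd h he, fun _ => rfl⟩
  choose t ht ht0 using this
  have hC := step_compat h2 hL hx hv hφ hs hD hm hsum hpar hz ht ht0
  have hpm' := hpm
  rw [hm] at hpm'
  obtain ⟨c, e, f, hc0, he, hf, n1, n2, te, tf, tz⟩ := E_final h2 hD hpm' (by omega) hC (step_star hL hp hn hv hφ hD hm hC)
  have H : InsH E ι' v φ e f := ⟨hv, hφ, hD, he, hf, n1, n2⟩
  obtain ⟨c', hc'0, hc'φ, hDι, hLι⟩ := insert_lemma hL H hs hm hpm'.1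
    (step_lift h2 hD hm hpm'.1 hC hc0 he hf n1 n2 te tf tz)
  set ι := ins ι' v φ c' e f with hι
  obtain ⟨i0, i1, i2, i3⟩ := ins_vals H hc'0 hc'φ
  rw [← hι] at i0 i1 i2 i3
  have nv : ∀ a : V × K, a.1 ∈ E.erase v → a.1 ≠ v := fun a ha => ne_of_mem_erase ha
  have ivn : ∀ y, (ι (v, y)).1 ≠ v := by
    intro y
    rcases k4 φ c' y hφ hc'0 hc'φ with rfl | rfl | rfl | rfl
    · rw [i0]; exact nv _ he
    · rw [i1]; exact nv _ (hD.mem he)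
    · rw [i2]; exact nv _ hf
    · rw [i3]; exact nv _ (hD.mem hf)
  set g : V × K → M := fun a => if a.1 = v then - h (ι a) else h a with hg
  have gv : ∀ y, g (v, y) = - h (ι (v, y)) := fun y => by simp [hg]
  have gw : ∀ a : V × K, a.1 ≠ v → g a = h a := fun a ha => by simp [hg, ha]
  have hinv : ∀ a : V × K, a.1 ∈ E → g (ι a) = - g a := by
    rintro ⟨a, y⟩ ha
    by_cases hav : a = v
    · subst hav; rw [gv, gw _ (ivn y), neg_neg]
    by_cases hb : (ι (a, y)).1 = v
    · obtain ⟨b, hb'⟩ : ∃ b, ι (a, y) = (v, b) := ⟨(ι (a, y)).2, by rw [← hb]⟩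
      rw [hb', gv, ← hb', hDι.inv, gw _ hav]
    · rw [gw _ hb, gw _ hav]
      have o : ∀ b, (a, y) ≠ ι (v, b) := by
        intro b h; apply hb; rw [h, hDι.inv]
      have e1 : ι (a, y) = ι' (a, y) := ins_other H hc'0 hc'φ hav (by rw [← i0]; exact o _) (by rw [← i1]; exact o _) (by rw [← i2]; exact o _) (by rw [← i3]; exact o _)
      have t0 : t (a, y) = 0 := by
        by_contra hne
        rcases tz _ hne with h | h | h | h
        · exact o 0 (by rw [h, i0])
        · exact o φ (by rw [h, i1])
        · exact o c' (by rw [h, i2])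
        · exact o (c' + φ) (by rw [h, i3])
      have := ht (a, y) (mem_erase.2 ⟨hav, ha⟩)
      rw [t0, zero_smul] at this
      rw [e1]; exact (neg_eq_of_add_eq_zero_right this).symm
  have hte := ht e he
  have htf := ht f hf
  rw [te] at hte
  rw [tf] at htf
  have gsum : ∀ w ∈ E, ∑ y, g (w, y) = 0 := by
    intro w hw
    by_cases hwv : w = v
    · rw [hwv, k4_sum hφ hc'0 hc'φ]
      rw [gv, gv, gv, gv, i0, i1, i2, i3]
      linear_combination (norm := module) -hte - htf
    · rw [← hsum w (mem_erase.2 ⟨hwv, hw⟩)]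
      exact sum_congr rfl fun y _ => gw _ hwv
  have gpar : ∀ w ∈ E, w ≠ v → ∀ τ : K, τ ≠ 0 → ∃ c : F, c ≠ 0 ∧ x w τ = c • (g (w, 0) + g (w, τ)) := by
    intro w hw hwv τ hτ
    rw [gw _ hwv, gw _ hwv]
    exact hpar w (mem_erase.2 ⟨hwv, hw⟩) τ hτ
  refine ⟨ι, g, hDι, hLι, gsum, hinv, ?_⟩
  intro w hw τ hτ
  by_cases hwv : w ≠ v
  · exact gpar w hw hwv τ hτ
  push Not at hwv
  subst hwv
  by_cases hτφ : τ = φ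
  · subst hτφ
    refine ⟨(-c)⁻¹, inv_ne_zero (neg_ne_zero.2 hc0), ?_⟩
    rw [gv, gv, i0, i1, ← neg_add, hte, ← neg_smul, smul_smul, inv_mul_cancel₀ (neg_ne_zero.2 hc0), one_smul]
  · apply columns hx hL hp.1 (by omega) hw hφ hτ hτφ
    intro Q hQ hQw
    have hQL := hQ.1
    rw [hLι, mem_LD] at hQL
    obtain ⟨p, hpc, hpQ⟩ := hQL
    obtain ⟨l, l1, l2⟩ := glob_sum (F := F) (x := fun a k => if a = w then g (w, 0) + g (w, k) else x a k) gsum (by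
      intro a ha k hk
      by_cases haw : a = w
      · subst haw; exact ⟨1, one_ne_zero, by simp⟩
      · simp only [haw, if_false]; exact gpar a ha haw k hk) hpc
    have tw := two_sum (F := F) (t := 0) (z := (0 : M)) hDι (h := g) (by
      intro a ha; rw [hinv a ha]; simp) hpc
    rw [smul_zero] at tw
    have tw := (smul_eq_zero.1 tw).resolve_left h2
    rw [tw, hpQ, ← add_sum_erase _ _ (mem_univ w), if_pos rfl, hQw] at l1
    rw [hpQ] at l2
    have lw := (l2 w).2 (by rwa [hQw])
    refine ⟨fun a => if a = w then 0 else -(l w)⁻¹ * l a, by simp, ?_, ?_⟩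
    · intro a ha hQa
      simp only [ha, if_false]
      exact mul_ne_zero (neg_ne_zero.2 (inv_ne_zero lw)) ((l2 a).2 hQa)
    · rw [← add_sum_erase _ _ (mem_univ w)]; dsimp only; rw [if_pos rfl, zero_smul, zero_add]
      have e1 : g (w, 0) + g (w, τ) = (-(l w)⁻¹) • ∑ a ∈ univ.erase w, l a • x a (Q a) := by
        have : ∑ a ∈ univ.erase w, l a • x a (Q a) = - (l w • (g (w, 0) + g (w, τ))) := by
          rw [eq_neg_iff_add_eq_zero, add_comm]
          rw [l1]
          congr 1
          apply sum_congr rfl; intro a ha; rw [if_neg (ne_of_mem_erase ha)]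
        rw [this, smul_neg, neg_smul, neg_neg, smul_smul, inv_mul_cancel₀ lw, one_smul]
      rw [e1, smul_sum]
      apply sum_congr rfl; intro a ha
      rw [if_neg (ne_of_mem_erase ha), smul_smul]

theorem star (h2 : (2 : F) ≠ 0) : ∀ (n : ℕ) (E : Finset V) (L : Spc V) (M : Type) [AddCommGroup M] [Module F M]
    (x : V → K → M), E.card = n → 5 ≤ n → Lag E L → Prim E L → Rep F E L x → ∃ ι h, Dg E ι ∧ L = LD E ι ∧ Nrl F E ι x h := by
  intro n
  induction n with
  | zero => intros; omega
  | succ n ih =>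
    intro E L M _ _ x hE hn hL hp hx
    by_cases h5 : n + 1 = 5
    · exact base_star h2 hL hp (by omega) hx
    · obtain ⟨v, _, _, hv, _, _, _, _, _, ⟨φ, hφ, hpm⟩, _⟩ := three_red hL hp (by omega)
      have hs : Pi.single v φ ∉ L := single_notMem hp.1 (by omega) hv hφ
      obtain ⟨ι', h', a1, a2, a3⟩ := ih (E.erase v) (mnr L v φ) _ _ (by rw [card_erase_of_mem hv]; omega) (by omega)
        (hL.mnr hv hφ) hpm (hx.mnr hv hφ hs)
      exact star_step h2 hL hp (by omega) hx hv hφ a1 a2 hpm a3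
end

section
/-- The Lagrangian space of the graph with adjacency matrix `A`, restricted to `E`. -/
def LA (A : Matrix V V (ZMod 2)) (E : Finset V) : Spc V where
  carrier := {R | (∀ v ∉ E, R v = 0) ∧ ∀ v ∈ E, (R v).1 = ∑ w, A v w * (R w).2}
  zero_mem' := ⟨fun _ _ => rfl, fun _ _ => by simp⟩
  add_mem' := by
    rintro a b ⟨ha, ha'⟩ ⟨hb, hb'⟩
    refine ⟨fun v hv => by simp [ha v hv, hb v hv], fun v hv => ?_⟩
    simp [ha' v hv, hb' v hv, mul_add, sum_add_distrib]
  smul_mem' := by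
    rintro c a ⟨ha, ha'⟩
    refine ⟨fun v hv => by simp [ha v hv], fun v hv => ?_⟩
    simp only [Pi.smul_apply, Prod.smul_fst, Prod.smul_snd, ha' v hv, smul_eq_mul, mul_sum]
    exact sum_congr rfl fun w _ => by ring

theorem mem_LA : R ∈ LA A E ↔ (∀ v ∉ E, R v = 0) ∧ ∀ v ∈ E, (R v).1 = ∑ w, A v w * (R w).2 := Iff.rfl

/-- The vector of the graph space with prescribed second coordinates. -/
def vec (A : Matrix V V (ZMod 2)) (E : Finset V) (g : V → ZMod 2) (v : V) : K :=
  if v ∈ E then (∑ w, A v w * (if w ∈ E then g w else 0), g v) else 0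

theorem vec_mem (g : V → ZMod 2) : vec A E g ∈ LA A E := by
  refine ⟨fun v hv => by simp [vec, hv], fun v hv => ?_⟩
  simp only [vec, hv, if_true]
  refine sum_congr rfl fun w _ => ?_
  by_cases hw : w ∈ E <;> simp [hw]

theorem vec_eq (hR : R ∈ LA A E) : R = vec A E (fun v => (R v).2) := by
  ext1 v
  by_cases hv : v ∈ E
  · simp only [vec, hv, if_true]
    refine Prod.ext ?_ rfl
    rw [hR.2 v hv]
    refine sum_congr rfl fun w _ => ?_
    by_cases hw : w ∈ E <;> simp [hw, hR.1 w]
  · simp [vec, hv, hR.1 v hv]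

theorem LA_ext (hR : R ∈ LA A E) (h : ∀ v, (R v).2 = 0) : R = 0 := by
  rw [vec_eq hR]; ext1 v; simp [vec, h]

theorem LA_of_rows (hs : A.IsSymm) (h1 : ∀ v ∉ E, R v = 0)
    (h2 : ∀ u ∈ E, omV R (vec A E (Pi.single u 1)) = 0) : R ∈ LA A E := by
  have hs' : ∀ v w, A v w = A w v := fun v w => hs.apply w v
  refine ⟨h1, fun u hu => ?_⟩
  have h3 := h2 u hu
  unfold omV om at h3
  rw [sum_add_distrib] at h3
  have h4 : ∑ v, (R v).1 * (vec A E (Pi.single u 1) v).2 = (R u).1 := by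
    rw [sum_eq_single u]
    · simp [vec, hu]
    · intro b _ hb; simp only [vec]; split_ifs <;> simp [hb]
    · simp
  have h5 : ∑ v, (R v).2 * (vec A E (Pi.single u 1) v).1 = ∑ w, A u w * (R w).2 := by
    refine sum_congr rfl fun v _ => ?_
    by_cases hv : v ∈ E
    · simp only [vec, hv, if_true]
      rw [sum_eq_single u]
      · simp [hu, hs' v u, mul_comm]
      · intro b _ hb; simp [hb]
      · simp
    · simp [h1 v hv]
  rw [h4, h5] at h3
  have h6 : ∀ a b : ZMod 2, a + b = 0 → a = b := by decide
  exact h6 _ _ h3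

theorem LA_lag (hs : A.IsSymm) : Lag E (LA A E) := by
  have hs' : ∀ v w, A v w = A w v := fun v w => hs.apply w v
  intro R
  constructor
  · intro hR
    refine ⟨hR.1, fun Q hQ => ?_⟩
    have h1 : ∀ (R Q : V → K), R ∈ LA A E → Q ∈ LA A E → ∑ v, (R v).1 * (Q v).2 = ∑ v, ∑ w, A v w * (R w).2 * (Q v).2 := by
      intro R Q hR hQ
      refine sum_congr rfl fun v _ => ?_
      by_cases hv : v ∈ E
      · rw [hR.2 v hv, sum_mul]
      · simp [hR.1 v hv, hQ.1 v hv]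
    unfold omV om
    rw [sum_add_distrib, h1 R Q hR hQ]
    have h2 : ∑ v, (R v).2 * (Q v).1 = ∑ v, (Q v).1 * (R v).2 := sum_congr rfl fun v _ => mul_comm _ _
    rw [h2, h1 Q R hQ hR, sum_comm]
    have h3 : ∑ y, ∑ x, A x y * (R y).2 * (Q x).2 = ∑ v, ∑ w, A v w * (Q w).2 * (R v).2 :=
      sum_congr rfl fun v _ => sum_congr rfl fun w _ => by rw [hs' w v]; ring
    rw [h3, z2add]
  · rintro ⟨h1, h2⟩
    exact LA_of_rows hs h1 fun u _ => h2 _ (vec_mem _)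

theorem LA_single (hd : ∀ v, A v v = 0) {z : V} (hz : z ∈ E) : Pi.single z ((1, 0) : K) ∉ LA A E := by
  intro h
  have := LA_ext h (fun v => by by_cases hv : v = z <;> simp [hv, Pi.single_apply])
  have := congrFun this z
  simp at this

theorem LA_mnr (hs : A.IsSymm) {z : V} (hz : z ∈ E) : mnr (LA A E) z (1, 0) = LA A (E.erase z) := by
  refine ((LA_lag hs).mnr hz (by decide)).eq_of_le (LA_lag hs) ?_
  intro R hR
  obtain ⟨Q, hQ, hQz, rfl⟩ := mem_mnr_iff.1 hR
  have hq2 : (Q z).2 = 0 := by rcases hQz with h | h <;> simp [h]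
  refine ⟨fun v hv => ?_, fun v hv => ?_⟩
  · by_cases h : v = z
    · subst h; exact kill_same _ _
    · rw [kill_ne h]; exact hQ.1 v (fun h' => hv (mem_erase.2 ⟨h, h'⟩))
  · rw [kill_ne (ne_of_mem_erase hv), hQ.2 v (mem_of_mem_erase hv)]
    refine sum_congr rfl fun w _ => ?_
    by_cases h : w = z
    · subst h; rw [kill_same, hq2]; simp
    · rw [kill_ne h]

/-- `A` restricted to `E` is representable over `F`. -/
def RepA (F : Type) [Field F] (A : Matrix V V (ZMod 2)) (E : Finset V) : Prop :=
  ∃ (M : Type) (_ : AddCommGroup M) (_ : Module F M) (x : V → K → M), Rep F E (LA A E) x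

theorem RepA.erase (hs : A.IsSymm) (hd : ∀ v, A v v = 0) (h : RepA F A E) (z : V) : RepA F A (E.erase z) := by
  by_cases hz : z ∈ E
  · obtain ⟨M, _, _, x, hx⟩ := h
    have := hx.mnr hz (i := (1, 0)) (by decide) (LA_single hd hz)
    rw [LA_mnr hs hz] at this
    exact ⟨_, _, _, _, this⟩
  · rwa [erase_eq_of_notMem hz]

theorem RepA.mono (hs : A.IsSymm) (hd : ∀ v, A v v = 0) (h : RepA F A E) : ∀ {X : Finset V}, X ⊆ E → RepA F A X := by
  intro X hX
  induction hn : (E \ X).card generalizing E with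
  | zero =>
    have : E ⊆ X := by rwa [card_eq_zero, sdiff_eq_empty_iff_subset] at hn
    rwa [subset_antisymm hX this]
  | succ n ih =>
    obtain ⟨z, hz⟩ := card_pos.1 (show 0 < (E \ X).card by omega)
    rw [mem_sdiff] at hz
    refine ih (h.erase hs hd z) (subset_erase.2 ⟨hX, hz.2⟩) ?_
    rw [erase_sdiff_comm, card_erase_of_mem (mem_sdiff.2 hz)]; omega
end

section
/-- The subword on the letters `u`, `v`. -/
def fl (u v : V) (w : List V) : List V := w.filter (fun x => decide (x = u ∨ x = v))

/-- Interlacement. -/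
def Il (u v : V) (l : List V) : Prop := l = [u, v, u, v] ∨ l = [v, u, v, u]

theorem Il_comm {u v : V} {l : List V} : Il u v l ↔ Il v u l := Or.comm

/-- `w` is a double occurrence word realizing `A` on `E`. -/
def Wd (A : Matrix V V (ZMod 2)) (E : Finset V) (w : List V) : Prop :=
  (∀ v, w.count v = if v ∈ E then 2 else 0) ∧
    ∀ u ∈ E, ∀ v ∈ E, u ≠ v → (A u v = 1 ↔ Il u v (fl u v w))

theorem fl_append (u v : V) (w w' : List V) : fl u v (w ++ w') = fl u v w ++ fl u v w' := List.filter_append ..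

theorem fl_comm (u v : V) (w : List V) : fl u v w = fl v u w := by
  unfold fl; congr 1; ext x; simp [or_comm]

theorem fl_rep {u v : V} {w : List V} (h : w.count v = 0) : fl u v w = List.replicate (w.count u) u := by
  unfold fl
  rw [← List.filter_eq]
  apply List.filter_congr
  intro x hx
  have : x ≠ v := by rintro rfl; exact List.count_eq_zero.1 h hx
  simp [this]

theorem fl_nil {u v : V} {w : List V} (h : w.count v = 0) (h' : w.count u = 0) : fl u v w = [] := by
  rw [fl_rep h, h']; rfl

theorem fl_cons_ne {u v x : V} {w : List V} (h : x ≠ u) (h' : x ≠ v) : fl u v (x :: w) = fl u v w := by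
  unfold fl; rw [List.filter_cons_of_neg]; simp [h, h']

theorem Il_rot {u v : V} {l l' : List V} (h : Il u v (l ++ l')) : Il u v (l' ++ l) := by
  have h1 := List.rotate_append_length_eq l l'
  rw [← h1]
  have h2 : (l ++ l').length = 4 := by rcases h with h | h <;> rw [h] <;> rfl
  rw [List.length_append] at h2
  have h3 : l.length ≤ 4 := by omega
  generalize l.length = n at *
  rcases h with h | h <;> rw [h] <;> interval_cases n <;> simp [Il, List.rotate]

theorem Il_rot_iff {u v : V} {l l' : List V} : Il u v (l ++ l') ↔ Il u v (l' ++ l) := ⟨Il_rot, Il_rot⟩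

theorem Il_mix {u v : V} (h : u ≠ v) {a p b c r e : ℕ} (h1 : a + p + b = 2) (h2 : c + r + e = 2) :
    Il u v (List.replicate a u ++ (List.replicate e v ++ List.replicate c v) ++ List.replicate p u ++
      List.replicate r v ++ List.replicate b u) ↔ p = 1 ∧ r = 1 := by
  have ha : a ≤ 2 := by omega
  have hp : p ≤ 2 := by omega
  have hc : c ≤ 2 := by omega
  have hr : r ≤ 2 := by omega
  obtain rfl : b = 2 - a - p := by omega
  obtain rfl : e = 2 - c - r := by omega
  have h' := h.symm
  interval_cases a <;> interval_cases p <;> (try omega) <;> interval_cases c <;> interval_cases r <;>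
    (try omega) <;> simp [Il, List.replicate_succ, h, h']

theorem Il_one {u v : V} (h : u ≠ v) {a p b : ℕ} (h1 : a + p + b = 2) :
    Il u v (List.replicate a u ++ v :: (List.replicate p u ++ v :: List.replicate b u)) ↔ p = 1 := by
  have := Il_mix h h1 (c := 1) (r := 1) (e := 0) rfl
  simpa using this

theorem two_split {w : List V} {y : V} (h : w.count y = 2) :
    ∃ a p b, w = a ++ y :: (p ++ y :: b) ∧ a.count y = 0 ∧ p.count y = 0 ∧ b.count y = 0 := by
  obtain ⟨a, t, rfl, ha⟩ := List.eq_append_cons_of_mem (List.count_pos_iff.1 (show 0 < w.count y by omega))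
  rw [List.count_append, List.count_cons_self, List.count_eq_zero.2 ha] at h
  obtain ⟨p, b, rfl, hp⟩ := List.eq_append_cons_of_mem (List.count_pos_iff.1 (show 0 < t.count y by omega))
  rw [List.count_append, List.count_cons_self, List.count_eq_zero.2 hp] at h
  exact ⟨a, p, b, rfl, List.count_eq_zero.2 ha, List.count_eq_zero.2 hp, by omega⟩

theorem Wd.concat (hs : A.IsSymm) {X Y : Finset V} (hd : Disjoint X Y) {w w' : List V} (h : Wd A X w) (h' : Wd A Y w')
    (hA : ∀ x ∈ X, ∀ y ∈ Y, A x y = 0) : Wd A (X ∪ Y) (w ++ w') := by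
  have hXY : ∀ x ∈ X, x ∉ Y := fun x hx hy => disjoint_left.1 hd hx hy
  have hYX : ∀ x ∈ Y, x ∉ X := fun x hx hy => disjoint_left.1 hd hy hx
  have mix : ∀ u ∈ X, ∀ v ∈ Y, (A u v = 1 ↔ Il u v (fl u v (w ++ w'))) := by
    intro u hu v hv
    have huv : u ≠ v := by rintro rfl; exact hXY u hu hv
    rw [hA u hu v hv, fl_append, fl_rep (by rw [h.1]; simp [hYX v hv]), fl_comm u v w',
      fl_rep (by rw [h'.1]; simp [hXY u hu]), h.1, h'.1]
    simp [hu, hv, Il, List.replicate_succ, huv, huv.symm]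
  refine ⟨fun v => ?_, ?_⟩
  · rw [List.count_append, h.1, h'.1]
    by_cases h1 : v ∈ X
    · simp [h1, hXY v h1]
    · simp [h1]
  · intro u hu v hv huv
    rw [mem_union] at hu hv
    rcases hu with hu | hu <;> rcases hv with hv | hv
    · rw [fl_append, fl_nil (w := w') (by rw [h'.1]; simp [hXY v hv]) (by rw [h'.1]; simp [hXY u hu]), List.append_nil]
      exact h.2 u hu v hv huv
    · exact mix u hu v hv
    · rw [hs.apply v u, Il_comm, fl_comm]; exact mix v hv u hu
    · rw [fl_append, fl_nil (w := w) (by rw [h.1]; simp [hYX v hv]) (by rw [h.1]; simp [hYX u hu]), List.nil_append]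
      exact h'.2 u hu v hv huv

theorem Wd.glue (hs : A.IsSymm) {X Y : Finset V} (hd : Disjoint X Y) {x0 y0 : V} (hx0 : x0 ∈ X) (hy0 : y0 ∈ Y) {w w' : List V}
    (h : Wd A (insert y0 X) w) (h' : Wd A (insert x0 Y) w')
    (hA : ∀ x ∈ X, ∀ y ∈ Y, A x y = A x y0 * A x0 y) : ∃ w, Wd A (X ∪ Y) w := by
  have hXY : ∀ x ∈ X, x ∉ Y := fun x hx hy => disjoint_left.1 hd hx hy
  have hYX : ∀ x ∈ Y, x ∉ X := fun x hx hy => disjoint_left.1 hd hy hx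
  obtain ⟨a, p, b, rfl, ha, hp, hb⟩ := two_split (w := w) (y := y0) (by rw [h.1]; simp)
  obtain ⟨c, r, e, rfl, hc, hr, he⟩ := two_split (w := w') (y := x0) (by rw [h'.1]; simp)
  have cX : ∀ u ∈ X, a.count u + p.count u + b.count u = 2 ∧ c.count u = 0 ∧ r.count u = 0 ∧ e.count u = 0 := by
    intro u hu
    have h1 := h.1 u; have h2 := h'.1 u
    have hne : y0 ≠ u := by rintro rfl; exact hXY _ hu hy0
    rw [if_pos (mem_insert_of_mem hu)] at h1
    simp only [List.count_append, List.count_cons_of_ne hne] at h1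
    refine ⟨by omega, ?_⟩
    by_cases hux : u = x0
    · subst hux; exact ⟨hc, hr, he⟩
    · rw [if_neg (by simp [hux, hXY u hu])] at h2
      simp only [List.count_append, List.count_cons_of_ne (Ne.symm hux)] at h2
      omega
  have cY : ∀ u ∈ Y, c.count u + r.count u + e.count u = 2 ∧ a.count u = 0 ∧ p.count u = 0 ∧ b.count u = 0 := by
    intro u hu
    have h1 := h'.1 u; have h2 := h.1 u
    have hne : x0 ≠ u := by rintro rfl; exact hXY _ hx0 hu
    rw [if_pos (mem_insert_of_mem hu)] at h1
    simp only [List.count_append, List.count_cons_of_ne hne] at h1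
    refine ⟨by omega, ?_⟩
    by_cases hux : u = y0
    · subst hux; exact ⟨ha, hp, hb⟩
    · rw [if_neg (by simp [hux, hYX u hu])] at h2
      simp only [List.count_append, List.count_cons_of_ne (Ne.symm hux)] at h2
      omega
  have mix : ∀ u ∈ X, ∀ v ∈ Y, (A u v = 1 ↔ Il u v (fl u v (a ++ (e ++ c) ++ p ++ r ++ b))) := by
    intro u hu v hv
    obtain ⟨u1, u2, u3, u4⟩ := cX u hu
    obtain ⟨v1, v2, v3, v4⟩ := cY v hv
    have huv : u ≠ v := by rintro rfl; exact hXY u hu hv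
    have huy : u ≠ y0 := by rintro rfl; exact hXY u hu hy0
    have hvx : v ≠ x0 := by rintro rfl; exact hXY _ hx0 hv
    have e1 : A u y0 = 1 ↔ p.count u = 1 := by
      rw [h.2 u (mem_insert_of_mem hu) y0 (mem_insert_self _ _) huy, ← Il_one huy u1]
      have : ∀ t, fl u y0 (y0 :: t) = y0 :: fl u y0 t := fun t => by unfold fl; rw [List.filter_cons_of_pos]; simp
      rw [fl_append, this, fl_append, this, fl_rep ha, fl_rep hp, fl_rep hb]
    have e2 : A x0 v = 1 ↔ r.count v = 1 := by
      rw [hs.apply v x0, h'.2 v (mem_insert_of_mem hv) x0 (mem_insert_self _ _) hvx, ← Il_one hvx v1]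
      have : ∀ t, fl v x0 (x0 :: t) = x0 :: fl v x0 t := fun t => by unfold fl; rw [List.filter_cons_of_pos]; simp
      rw [fl_append, this, fl_append, this, fl_rep hc, fl_rep hr, fl_rep he]
    have e3 : ∀ α β : ZMod 2, α * β = 1 ↔ α = 1 ∧ β = 1 := by decide
    rw [hA u hu v hv, e3, e1, e2, ← Il_mix huv u1 v1]
    simp only [fl_append]
    rw [fl_rep (w := a) v2, fl_rep (w := p) v3, fl_rep (w := b) v4, fl_comm u v e, fl_comm u v c, fl_comm u v r,
      fl_rep u2, fl_rep u3, fl_rep u4]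
  refine ⟨a ++ (e ++ c) ++ p ++ r ++ b, fun v => ?_, ?_⟩
  · simp only [List.count_append]
    by_cases h1 : v ∈ X
    · have := cX v h1; rw [if_pos (mem_union_left _ h1)]; omega
    · by_cases h2 : v ∈ Y
      · have := cY v h2; rw [if_pos (mem_union_right _ h2)]; omega
      · have h3 := h.1 v; have h4 := h'.1 v
        have n1 : v ≠ y0 := by rintro rfl; exact h2 hy0
        have n2 : v ≠ x0 := by rintro rfl; exact h1 hx0
        rw [if_neg (by simp [h1, n1])] at h3
        rw [if_neg (by simp [h2, n2])] at h4
        rw [if_neg (by simp [h1, h2])]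
        simp only [List.count_append, List.count_cons_of_ne (Ne.symm n1), List.count_cons_of_ne (Ne.symm n2)] at h3 h4
        omega
  · intro u hu v hv huv
    rw [mem_union] at hu hv
    rcases hu with hu | hu <;> rcases hv with hv | hv
    · rw [h.2 u (mem_insert_of_mem hu) v (mem_insert_of_mem hv) huv]
      have n1 : y0 ≠ u := by rintro rfl; exact hXY _ hu hy0
      have n2 : y0 ≠ v := by rintro rfl; exact hXY _ hv hy0
      obtain ⟨_, u2, u3, u4⟩ := cX u hu
      obtain ⟨_, v2, v3, v4⟩ := cX v hv
      simp only [fl_append, fl_cons_ne n1 n2, fl_nil v2 u2, fl_nil v3 u3, fl_nil v4 u4, List.append_nil, List.append_assoc, List.nil_append]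
    · exact mix u hu v hv
    · rw [hs.apply v u, Il_comm, fl_comm]; exact mix v hv u hu
    · rw [h'.2 u (mem_insert_of_mem hu) v (mem_insert_of_mem hv) huv]
      have n1 : x0 ≠ u := by rintro rfl; exact hXY _ hx0 hu
      have n2 : x0 ≠ v := by rintro rfl; exact hXY _ hx0 hv
      obtain ⟨_, u2, u3, u4⟩ := cY u hu
      obtain ⟨_, v2, v3, v4⟩ := cY v hv
      simp only [fl_append, fl_cons_ne n1 n2, fl_nil v2 u2, fl_nil v3 u3, fl_nil v4 u4, List.append_nil, List.append_assoc, List.nil_append]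
      rw [← List.append_assoc, Il_rot_iff]

/-- Small words. -/
theorem Wd.small (hs : A.IsSymm) (hE : E.card ≤ 3) : ∃ w, Wd A E w := by
  have key : ∀ a b : V, A a b = A b a := fun a b => hs.apply b a
  have z : ∀ a b, A a b = 0 ∨ A a b = 1 := fun a b => z2 _
  have sy : ∀ w u v, (A u v = 1 ↔ Il u v (fl u v w)) → (A v u = 1 ↔ Il v u (fl v u w)) := by
    intro w u v h; rw [key, h, Il_comm, fl_comm]
  have e : E.card = 0 ∨ E.card = 1 ∨ E.card = 2 ∨ E.card = 3 := by omega
  rcases e with e | e | e | e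
  · rw [card_eq_zero] at e; subst e
    exact ⟨[], by simp [Wd]⟩
  · obtain ⟨a, rfl⟩ := card_eq_one.1 e
    refine ⟨[a, a], fun v => ?_, ?_⟩
    · rcases eq_or_ne v a with rfl | h
      · simp
      · simp [List.count_cons, h, h.symm]
    · simp only [mem_singleton]; rintro u rfl v rfl h; exact absurd rfl h
  · obtain ⟨a, b, hab, rfl⟩ := card_eq_two.1 e
    have h' := hab.symm
    have mk : ∀ w : List V, (∀ v, w.count v = if v ∈ ({a, b} : Finset V) then 2 else 0) →
        (A a b = 1 ↔ Il a b (fl a b w)) → Wd A {a, b} w := by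
      intro w h1 h2
      refine ⟨h1, fun u hu v hv huv => ?_⟩
      simp only [mem_insert, mem_singleton] at hu hv
      rcases hu with rfl | rfl <;> rcases hv with rfl | rfl
      · exact absurd rfl huv
      · exact h2
      · exact sy _ _ _ h2
      · exact absurd rfl huv
    rcases z a b with h | h
    on_goal 1 => refine ⟨[a, a, b, b], mk _ (fun v => ?_) (by simp [h, fl, Il, hab, h'])⟩
    on_goal 2 => refine ⟨[a, b, a, b], mk _ (fun v => ?_) (by simp [h, fl, Il, hab, h'])⟩
    all_goals
      rcases eq_or_ne v a with rfl | h1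
      · simp [List.count_cons, h']
      rcases eq_or_ne v b with rfl | h2
      · simp [List.count_cons, hab]
      simp [List.count_cons, h1, h2, h1.symm, h2.symm]
  · obtain ⟨a, b, c, hab, hac, hbc, rfl⟩ := card_eq_three.1 e
    have hab' := hab.symm
    have hac' := hac.symm
    have hbc' := hbc.symm
    have mk : ∀ w : List V, w.Perm [a, a, b, b, c, c] →
        (A a b = 1 ↔ Il a b (fl a b w)) → (A a c = 1 ↔ Il a c (fl a c w)) → (A b c = 1 ↔ Il b c (fl b c w)) → ∃ w, Wd A {a, b, c} w := by
      intro w h1 h2 h3 h4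
      refine ⟨w, fun v => ?_, fun u hu v hv huv => ?_⟩
      · rw [h1.count_eq]
        by_cases h1 : v = a
        · subst h1; simp [List.count_cons, hab', hac']
        by_cases h2 : v = b
        · subst h2; simp [List.count_cons, hab, hbc']
        by_cases h3 : v = c
        · subst h3; simp [List.count_cons, hbc, hac]
        simp [List.count_cons, h1, h2, h3, Ne.symm h1, Ne.symm h2, Ne.symm h3]
      simp only [mem_insert, mem_singleton] at hu hv
      rcases hu with rfl | rfl | rfl <;> rcases hv with rfl | rfl | rfl
      · exact absurd rfl huv
      · exact h2
      · exact h3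
      · exact sy _ _ _ h2
      · exact absurd rfl huv
      · exact h4
      · exact sy _ _ _ h3
      · exact sy _ _ _ h4
      · exact absurd rfl huv
    have pc : ∀ w : List V, w.length = 6 → w.count a = 2 → w.count b = 2 → w.count c = 2 → w.Perm [a, a, b, b, c, c] := by
      intro w h0 h1 h2 h3
      refine (List.Subperm.perm_of_length_le ?_ (by simp [h0])).symm
      rw [List.subperm_ext_iff]
      intro x hx
      simp only [List.mem_cons, List.not_mem_nil, or_false] at hx
      have : x = a ∨ x = b ∨ x = c := by tauto
      rcases this with rfl | rfl | rfl
      · simp [h1, List.count_cons, hab', hac']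
      · simp [h2, List.count_cons, hab, hbc']
      · simp [h3, List.count_cons, hbc, hac]
    have go : ∀ w : List V, w.length = 6 ∧ (w.count a = 2 ∧ w.count b = 2 ∧ w.count c = 2) ∧ (A a b = 1 ↔ Il a b (fl a b w)) ∧
        (A a c = 1 ↔ Il a c (fl a c w)) ∧ (A b c = 1 ↔ Il b c (fl b c w)) → ∃ w, Wd A {a, b, c} w :=
      fun w h => mk w (pc w h.1 h.2.1.1 h.2.1.2.1 h.2.1.2.2) h.2.2.1 h.2.2.2.1 h.2.2.2.2
    (rcases z a b with h1 | h1 <;> rcases z a c with h2 | h2 <;> rcases z b c with h3 | h3) <;>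
      [apply go [a, a, b, b, c, c];
      apply go [b, c, b, c, a, a];
      apply go [a, c, a, c, b, b];
      apply go [a, c, a, b, c, b];
      apply go [a, b, a, b, c, c];
      apply go [a, b, a, c, b, c];
      apply go [b, a, b, c, a, c];
      apply go [a, b, c, a, b, c]] <;>
      simp [h1, h2, h3, fl, Il, List.count_cons, hab, hac, hbc, hab', hac', hbc']
end

section
variable {s : ℕ → V × K} {N : ℕ}
/-- The opposite half-edge at a vertex. -/
def sh (e : V × K) : V × K := (e.1, e.2 + (1, 0))

theorem sh_sh (e : V × K) : sh (sh e) = e := by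
  refine Prod.ext rfl ?_
  show e.2 + (1, 0) + (1, 0) = e.2
  rw [add_assoc, kadd, add_zero]

theorem sh_ne (e : V × K) : sh e ≠ e := by
  intro h
  have h1 : e.2 + (1, 0) = e.2 := congrArg Prod.snd h
  simp at h1

theorem sh_inj {e e' : V × K} (h : sh e = sh e') : e = e' := by rw [← sh_sh e, h, sh_sh]

/-- An Euler tour. -/
structure Tour (E : Finset V) (ι : V × K → V × K) (s : ℕ → V × K) (N : ℕ) : Prop where
  next : ∀ k, k + 1 < N → ι (sh (s k)) = s (k + 1)
  inj : ∀ k l, k < N → l < N → s k = s l → k = l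
  nsh : ∀ k l, k < N → l < N → s k ≠ sh (s l)
  mem : ∀ k, k < N → (s k).1 ∈ E
  surj : ∀ e : V × K, e.1 ∈ E → ∃ k < N, e = s k ∨ e = sh (s k)

/-- `i < j` are the occurrences of `v`. -/
structure Oc (a : ℕ → V) (N : ℕ) (v : V) (i j : ℕ) : Prop where
  lt : i < j
  ltN : j < N
  ai : a i = v
  aj : a j = v
  only : ∀ k < N, a k = v → k = i ∨ k = j

theorem coset : ∀ y y' z : K, y' ≠ y → y' ≠ y + (1, 0) → z = y ∨ z = y + (1, 0) ∨ z = y' ∨ z = y' + (1, 0) := by decide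

theorem Tour.occ (h : Tour E ι s N) {v : V} (hv : v ∈ E) : ∃ i j, Oc (fun k => (s k).1) N v i j ∧
    (s j).2 ≠ (s i).2 ∧ (s j).2 ≠ (s i).2 + (1, 0) := by
  have key : ∀ i j, i < j → i < N → j < N → (s i).1 = v → (s j).1 = v → Oc (fun k => (s k).1) N v i j ∧
    (s j).2 ≠ (s i).2 ∧ (s j).2 ≠ (s i).2 + (1, 0) := by
    intro i j hij hi hj h1 h2
    have n1 : (s j).2 ≠ (s i).2 := fun hc => by
      have := h.inj j i hj hi (Prod.ext (h2.trans h1.symm) hc); omega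
    have n2 : (s j).2 ≠ (s i).2 + (1, 0) := fun hc => h.nsh j i hj hi (Prod.ext (h2.trans h1.symm) hc)
    refine ⟨⟨hij, hj, h1, h2, fun k hk hkv => ?_⟩, n1, n2⟩
    rcases coset _ _ (s k).2 n1 n2 with hc | hc | hc | hc
    · exact Or.inl (h.inj k i hk hi (Prod.ext (hkv.trans h1.symm) hc))
    · exact absurd (show s k = sh (s i) from Prod.ext (hkv.trans h1.symm) hc) (h.nsh k i hk hi)
    · exact Or.inr (h.inj k j hk hj (Prod.ext (hkv.trans h2.symm) hc))
    · exact absurd (show s k = sh (s j) from Prod.ext (hkv.trans h2.symm) hc) (h.nsh k j hk hj)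
  obtain ⟨i, hi, hi'⟩ := h.surj (v, 0) hv
  obtain ⟨j, hj, hj'⟩ := h.surj (v, (0, 1)) hv
  have vi : (s i).1 = v := by rcases hi' with h | h <;> simpa [sh] using (congrArg Prod.fst h).symm
  have vj : (s j).1 = v := by rcases hj' with h | h <;> simpa [sh] using (congrArg Prod.fst h).symm
  rcases lt_trichotomy i j with hij | hij | hij
  · exact ⟨i, j, key i j hij hi hj vi vj⟩
  · exfalso
    subst hij
    have e1 : (s i).2 = 0 ∨ (s i).2 + (1, 0) = 0 := by
      rcases hi' with h | h
      · exact Or.inl (congrArg Prod.snd h).symm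
      · exact Or.inr (congrArg Prod.snd h).symm
    have e2 : (s i).2 = (0, 1) ∨ (s i).2 + (1, 0) = (0, 1) := by
      rcases hj' with h | h
      · exact Or.inl (congrArg Prod.snd h).symm
      · exact Or.inr (congrArg Prod.snd h).symm
    have : ∀ y : K, (y = 0 ∨ y + (1, 0) = 0) → (y = (0, 1) ∨ y + (1, 0) = (0, 1)) → False := by decide
    exact this _ e1 e2
  · exact ⟨j, i, key j i hij hj hi vj vi⟩

theorem bd_loc1 : ∀ f : K → ZMod 2, ∀ y y' : K, y' ≠ y → y' ≠ y + (1, 0) →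
    ∑ z, f z = f y + f (y + (1, 0)) + f y' + f (y' + (1, 0)) := by
  intro f y y' h h'
  have : (univ : Finset K) = {y, y + (1, 0), y', y' + (1, 0)} := by revert y y'; decide
  have n1 : y ∉ ({y + (1, 0), y', y' + (1, 0)} : Finset K) := by revert y y'; decide
  have n2 : y + (1, 0) ∉ ({y', y' + (1, 0)} : Finset K) := by revert y y'; decide
  have n3 : y' ∉ ({y' + (1, 0)} : Finset K) := by revert y y'; decide
  rw [this, sum_insert n1, sum_insert n2, sum_insert n3, sum_singleton]
  ring

theorem bd_loc2 (f : K → ZMod 2) (y y' : K) (h : y' ≠ y) (h' : y' ≠ y + (1, 0))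
    (h1 : f y = f (y + (1, 0))) (h2 : f y' = f (y' + (1, 0))) : bdK f = (f y + f y', 0) := by
  apply bdK_eq
  intro k
  have c0 := coset _ _ 0 h h'
  have ck := coset _ _ k h h'
  have g : ∀ z, (z = y ∨ z = y + (1, 0)) → f z = f y := by rintro z (rfl | rfl); exacts [rfl, h1.symm]
  have g' : ∀ z, (z = y' ∨ z = y' + (1, 0)) → f z = f y' := by rintro z (rfl | rfl); exacts [rfl, h2.symm]
  have a1 : ∀ y k : K, (0 = y ∨ 0 = y + (1, 0)) → (k = y ∨ k = y + (1, 0)) → k.2 = 0 := by decide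
  have a2 : ∀ y y' k : K, y' ≠ y → y' ≠ y + (1, 0) → (0 = y ∨ 0 = y + (1, 0)) → (k = y' ∨ k = y' + (1, 0)) → k.2 = 1 := by decide
  have a3 : ∀ y y' k : K, y' ≠ y → y' ≠ y + (1, 0) → (0 = y' ∨ 0 = y' + (1, 0)) → (k = y ∨ k = y + (1, 0)) → k.2 = 1 := by decide
  have om' : ∀ c : ZMod 2, om (c, 0) k = c * k.2 := fun c => by simp [om]
  rw [om']
  rw [← or_assoc] at c0 ck
  rcases c0 with c0 | c0 <;> rcases ck with ck | ck
  · rw [g 0 c0, g k ck, a1 y k c0 ck, z2add, mul_zero]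
  · rw [g 0 c0, g' k ck, a2 y y' k h h' c0 ck, mul_one]
  · rw [g' 0 c0, g k ck, a3 y y' k h h' c0 ck, mul_one, add_comm]
  · rw [g' 0 c0, g' k ck, a1 y' k c0 ck, z2add, mul_zero]

theorem bd_loc3 (f : K → ZMod 2) (y y' : K) (h : y' ≠ y) (h' : y' ≠ y + (1, 0))
    (h1 : f y = 0) (h2 : f (y + (1, 0)) = 1) (h3 : f y' = 1) (h4 : f (y' + (1, 0)) = 0) :
    bdK f = y + y' + (1, 0) := by
  apply bdK_eq
  intro k
  have c0 := coset _ _ 0 h h'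
  have ck := coset _ _ k h h'
  have g : ∀ z, f z = if z = y ∨ z = y' + (1, 0) then 0 else 1 := by
    intro z
    have n1 : ∀ y y' : K, y' ≠ y → y' ≠ y + (1, 0) → ¬ (y + (1, 0) = y ∨ y + (1, 0) = y' + (1, 0)) := by decide
    have n2 : ∀ y y' : K, y' ≠ y → ¬ (y' = y ∨ y' = y' + (1, 0)) := by decide
    rcases coset _ _ z h h' with rfl | rfl | rfl | rfl
    · rw [h1, if_pos (Or.inl rfl)]
    · rw [h2, if_neg (n1 y y' h h')]
    · rw [h3, if_neg (n2 y _ h)]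
    · rw [h4, if_pos (Or.inr rfl)]
  rw [g, g]
  have : ∀ y y' k : K, y' ≠ y → y' ≠ y + (1, 0) → (if 0 = y ∨ 0 = y' + (1, 0) then (0 : ZMod 2) else 1) +
    (if k = y ∨ k = y' + (1, 0) then 0 else 1) = om (y + y' + (1, 0)) k := by decide
  exact this y y' k h h'

/-- indicator bit of `i < k < j` -/
def bit (i j k : ℕ) : ZMod 2 := if i < k ∧ k < j then 1 else 0

theorem Tour.row (hD : Dg E ι) (h : Tour E ι s N) {i j : ℕ} (hu : u ∈ E) (ho : Oc (fun k => (s k).1) N u i j) :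
    ∃ p, Cyc E ι p ∧ bd p u = (s i).2 + (s j).2 + (1, 0) ∧ ∀ w ∈ E, w ≠ u → ∀ k l, Oc (fun k => (s k).1) N w k l →
      bd p w = (bit i j k + bit i j l, 0) := by
  classical
  have hjN := ho.ltN
  have hij := ho.lt
  let p : V × K → ZMod 2 := fun e => if ∃ k, i ≤ k ∧ k < j ∧ (e = sh (s k) ∨ e = s (k + 1)) then 1 else 0
  have p1 : ∀ e, p e = 1 ↔ ∃ k, i ≤ k ∧ k < j ∧ (e = sh (s k) ∨ e = s (k + 1)) := by
    intro e; show (if _ then _ else _) = _ ↔ _; split_ifs with hc <;> simp [hc]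
  have z1 : ∀ {a b : ZMod 2}, (a = 1 ↔ b = 1) → a = b := by decide
  have ps : ∀ k < N, p (s k) = if i < k ∧ k ≤ j then 1 else 0 := by
    intro k hk
    apply z1
    rw [p1]
    trans i < k ∧ k ≤ j
    · constructor
      · rintro ⟨m, h1, h2, h3 | h3⟩
        · exact absurd h3 (h.nsh _ _ hk (by omega))
        · have := h.inj _ _ hk (by omega) h3; omega
      · rintro ⟨h1, h2⟩
        exact ⟨k - 1, by omega, by omega, Or.inr (by rw [Nat.sub_add_cancel (by omega)])⟩
    · split_ifs with hc <;> simp [hc]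
  have pt : ∀ k < N, p (sh (s k)) = if i ≤ k ∧ k < j then 1 else 0 := by
    intro k hk
    apply z1
    rw [p1]
    trans i ≤ k ∧ k < j
    · constructor
      · rintro ⟨m, h1, h2, h3 | h3⟩
        · have := h.inj _ _ hk (by omega) (sh_inj h3); omega
        · exact absurd h3.symm (h.nsh _ _ (by omega) hk)
      · rintro ⟨h1, h2⟩
        exact ⟨k, h1, h2, Or.inl rfl⟩
    · split_ifs with hc <;> simp [hc]
  have inv1 : ∀ e, p e = 1 → p (ι e) = 1 := by
    intro e he
    rw [p1] at he ⊢
    obtain ⟨k, h1, h2, rfl | rfl⟩ := he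
    · exact ⟨k, h1, h2, Or.inr (h.next k (by omega))⟩
    · exact ⟨k, h1, h2, Or.inl (by rw [← h.next k (by omega), hD.inv])⟩
  have ab : ∀ w k l, Oc (fun k => (s k).1) N w k l → (p (w, (s k).2) = p (s k) ∧ p (w, (s k).2 + (1, 0)) = p (sh (s k))) ∧
      p (w, (s l).2) = p (s l) ∧ p (w, (s l).2 + (1, 0)) = p (sh (s l)) := by
    intro w k l ho'
    have e1 : (w, (s k).2) = s k := Prod.ext ho'.ai.symm rfl
    have e2 : (w, (s l).2) = s l := Prod.ext ho'.aj.symm rfl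
    have e3 : (w, (s k).2 + (1, 0)) = sh (s k) := Prod.ext ho'.ai.symm rfl
    have e4 : (w, (s l).2 + (1, 0)) = sh (s l) := Prod.ext ho'.aj.symm rfl
    rw [e1, e2, e3, e4]; exact ⟨⟨rfl, rfl⟩, rfl, rfl⟩
  have nn : ∀ w k l, Oc (fun k => (s k).1) N w k l → (s l).2 ≠ (s k).2 ∧ (s l).2 ≠ (s k).2 + (1, 0) := by
    intro w k l ho'
    have hlN := ho'.ltN
    have hkl := ho'.lt
    have e1 : (s l).1 = (s k).1 := ho'.aj.trans ho'.ai.symm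
    exact ⟨fun hc => by have := h.inj l k hlN (by omega) (Prod.ext e1 hc); omega,
      fun hc => h.nsh l k hlN (by omega) (Prod.ext e1 hc)⟩
  have vals : ∀ w, w ≠ u → ∀ k l, Oc (fun k => (s k).1) N w k l → p (s k) = bit i j k ∧ p (sh (s k)) = bit i j k ∧
      p (s l) = bit i j l ∧ p (sh (s l)) = bit i j l := by
    intro w hw k l ho'
    have hlN := ho'.ltN
    have hkl := ho'.lt
    have ne : ∀ m, (s m).1 = w → m ≠ i ∧ m ≠ j := fun m hm =>
      ⟨by rintro rfl; exact hw (hm.symm.trans ho.ai), by rintro rfl; exact hw (hm.symm.trans ho.aj)⟩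
    have n1 := ne k ho'.ai
    have n2 := ne l ho'.aj
    rw [ps k (by omega), pt k (by omega), ps l hlN, pt l hlN]
    unfold bit
    refine ⟨?_, ?_, ?_, ?_⟩ <;> congr 1 <;> apply propext <;> omega
  have valu : p (s i) = 0 ∧ p (sh (s i)) = 1 ∧ p (s j) = 1 ∧ p (sh (s j)) = 0 := by
    rw [ps i (by omega), pt i (by omega), ps j hjN, pt j hjN]
    simp [hij]
  refine ⟨p, ⟨fun e => z1 ⟨fun hp => ?_, inv1 e⟩, fun v => ?_, fun e he => ?_⟩, ?_, ?_⟩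
  · have := inv1 _ hp; rwa [hD.inv] at this
  · by_cases hv : v ∈ E
    · obtain ⟨k, l, ho', -⟩ := h.occ hv
      obtain ⟨n1, n2⟩ := nn _ _ _ ho'
      obtain ⟨⟨b1, b2⟩, b3, b4⟩ := ab _ _ _ ho'
      rw [bd_loc1 (fun y => p (v, y)) _ _ n1 n2, b1, b2, b3, b4]
      by_cases hvu : v = u
      · subst hvu
        have ei := ho'.only i (by omega) ho.ai
        have ej := ho'.only j hjN ho.aj
        have hkl := ho'.lt
        obtain ⟨rfl, rfl⟩ : i = k ∧ j = l := by omega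
        rw [valu.1, valu.2.1, valu.2.2.1, valu.2.2.2]; decide
      · obtain ⟨c1, c2, c3, c4⟩ := vals v hvu k l ho'
        rw [c1, c2, c3, c4, z2add, zero_add, z2add]
    · apply sum_eq_zero
      intro y _
      rcases z2 (p (v, y)) with h0 | h0
      · exact h0
      · exfalso
        obtain ⟨k, h1, h2, h3 | h3⟩ := (p1 _).1 h0
        · exact hv (by have := h.mem k (by omega); rwa [show (s k).1 = v from (congrArg Prod.fst h3).symm] at this)
        · exact hv (by have := h.mem (k + 1) (by omega); rwa [← h3] at this)
  · rcases z2 (p e) with h0 | h0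
    · exact h0
    · exfalso
      obtain ⟨k, h1, h2, h3 | h3⟩ := (p1 _).1 h0
      · exact he (by have := h.mem k (by omega); rwa [show (s k).1 = e.1 from (congrArg Prod.fst h3).symm] at this)
      · exact he (by have := h.mem (k + 1) (by omega); rwa [← h3] at this)
  · obtain ⟨n1, n2⟩ := nn _ _ _ ho
    obtain ⟨⟨b1, b2⟩, b3, b4⟩ := ab _ _ _ ho
    exact bd_loc3 (fun y => p (u, y)) _ _ n1 n2 (b1.trans valu.1) (b2.trans valu.2.1) (b3.trans valu.2.2.1) (b4.trans valu.2.2.2)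
  · intro w hw hwu k l ho'
    obtain ⟨n1, n2⟩ := nn _ _ _ ho'
    obtain ⟨⟨b1, b2⟩, b3, b4⟩ := ab _ _ _ ho'
    obtain ⟨c1, c2, c3, c4⟩ := vals w hwu k l ho'
    have := bd_loc2 (fun y => p (w, y)) _ _ n1 n2 (by rw [b1, b2, c1, c2]) (by rw [b3, b4, c3, c4])
    rw [b1, b3, c1, c3] at this
    exact this

theorem filter_range {P : ℕ → Bool} {l : List ℕ} (hl : l.Pairwise (· < ·)) (hm : ∀ t, t ∈ l ↔ t < N ∧ P t = true) :
    (List.range N).filter P = l := by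
  have h1 : ((List.range N).filter P).Pairwise (· < ·) := List.Pairwise.filter _ List.pairwise_lt_range
  refine List.Perm.eq_of_pairwise (le := (· < ·)) (fun a b _ _ h h' => absurd h (lt_asymm h')) h1 hl ?_
  rw [List.perm_ext_iff_of_nodup (h1.imp (fun h => ne_of_lt h)) (hl.imp (fun h => ne_of_lt h))]
  intro t; rw [hm]; simp

theorem Oc.il {a : ℕ → V} {u v : V} (huv : u ≠ v) {i j k l : ℕ} (hu : Oc a N u i j) (hv : Oc a N v k l) :
    Il u v (fl u v ((List.range N).map a)) ↔ bit i j k + bit i j l = 1 := by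
  obtain ⟨u1, u2, u3, u4, u5⟩ := hu
  obtain ⟨v1, v2, v3, v4, v5⟩ := hv
  have ne : ∀ m m', a m = u → a m' = v → m ≠ m' := by rintro m m' h1 h2 rfl; exact huv (h1.symm.trans h2)
  have n1 := ne i k u3 v3
  have n2 := ne i l u3 v4
  have n3 := ne j k u4 v3
  have n4 := ne j l u4 v4
  have hf : ∀ q : List ℕ, q.Pairwise (· < ·) → (∀ t, t ∈ q ↔ (t = i ∨ t = j) ∨ (t = k ∨ t = l)) →
      fl u v ((List.range N).map a) = q.map a := by
    intro q hq hm
    unfold fl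
    rw [List.filter_map]
    congr 1
    refine filter_range hq fun t => ?_
    rw [hm]
    simp only [Function.comp, decide_eq_true_eq]
    constructor
    · rintro ((rfl | rfl) | (rfl | rfl))
      · exact ⟨by omega, Or.inl u3⟩
      · exact ⟨by omega, Or.inl u4⟩
      · exact ⟨by omega, Or.inr v3⟩
      · exact ⟨by omega, Or.inr v4⟩
    · rintro ⟨h1, h2 | h2⟩
      · exact Or.inl (u5 t h1 h2)
      · exact Or.inr (v5 t h1 h2)
  have e : (i < j ∧ j < k ∧ k < l) ∨ (i < k ∧ k < j ∧ j < l) ∨ (i < k ∧ k < l ∧ l < j) ∨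
    (k < i ∧ i < j ∧ j < l) ∨ (k < i ∧ i < l ∧ l < j) ∨ (k < l ∧ l < i ∧ i < j) := by omega
  have huv' := huv.symm
  rcases e with ⟨e1, e2, e3⟩ | ⟨e1, e2, e3⟩ | ⟨e1, e2, e3⟩ | ⟨e1, e2, e3⟩ | ⟨e1, e2, e3⟩ | ⟨e1, e2, e3⟩
  · rw [hf [i, j, k, l] (by simp; omega) (by simp; grind), bit, bit, if_neg (by omega), if_neg (by omega)]
    simp [Il, u3, u4, v3, v4, huv, huv']
  · rw [hf [i, k, j, l] (by simp; omega) (by simp; grind), bit, bit, if_pos (by omega), if_neg (by omega)]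
    simp [Il, u3, u4, v3, v4, huv, huv']
  · rw [hf [i, k, l, j] (by simp; omega) (by simp; grind), bit, bit, if_pos (by omega), if_pos (by omega)]
    simp [Il, u3, u4, v3, v4, huv, huv', z2add]
  · rw [hf [k, i, j, l] (by simp; omega) (by simp; grind), bit, bit, if_neg (by omega), if_neg (by omega)]
    simp [Il, u3, u4, v3, v4, huv, huv']
  · rw [hf [k, i, l, j] (by simp; omega) (by simp; grind), bit, bit, if_neg (by omega), if_pos (by omega)]
    simp [Il, u3, u4, v3, v4, huv, huv']
  · rw [hf [k, l, i, j] (by simp; omega) (by simp; grind), bit, bit, if_neg (by omega), if_neg (by omega)]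
    simp [Il, u3, u4, v3, v4, huv, huv']

theorem Tour.word (hs : A.IsSymm) (hD : Dg E ι) (h : Tour E ι s N) (hL : LA A E = LD E ι) :
    Wd A E ((List.range N).map (fun k => (s k).1)) := by
  refine ⟨fun v => ?_, fun u hu v hv huv => ?_⟩
  · rw [List.count, List.countP_map, List.countP_eq_length_filter]
    split_ifs with hv
    · obtain ⟨i, j, ho, -⟩ := h.occ hv
      rw [filter_range (l := [i, j]) (by simpa using ho.lt)]
      · rfl
      · intro t
        have h1 := ho.lt
        have h2 := ho.ltN
        simp only [List.mem_cons, List.not_mem_nil, or_false, Function.comp, beq_iff_eq]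
        constructor
        · rintro (rfl | rfl)
          · exact ⟨by omega, ho.ai⟩
          · exact ⟨by omega, ho.aj⟩
        · rintro ⟨h3, h4⟩; exact ho.only t h3 h4
    · rw [List.length_eq_zero_iff, List.filter_eq_nil_iff]
      intro t ht
      simp only [Function.comp, beq_iff_eq]
      rintro rfl
      exact hv (h.mem t (List.mem_range.1 ht))
  · obtain ⟨i, j, ho, n1, n2⟩ := h.occ hu
    obtain ⟨k, l, ho', -⟩ := h.occ hv
    rw [ho.il huv ho']
    obtain ⟨p, hp, hpu, hpw⟩ := h.row hD hu ho
    have hR : bd p ∈ LA A E := by rw [hL]; exact ⟨p, hp, rfl⟩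
    have h1 := hR.2 v hv
    rw [sum_eq_single u] at h1
    · have : ∀ y y' : K, y' ≠ y → y' ≠ y + (1, 0) → (y + y' + (1, 0)).2 = 1 := by decide
      rw [hpu, this _ _ n1 n2, mul_one, hpw v hv huv.symm k l ho', hs.apply u v] at h1
      rw [← h1]
    · intro w _ hw
      by_cases hwE : w ∈ E
      · obtain ⟨k, l, ho', -⟩ := h.occ hwE
        rw [hpw w hwE hw k l ho', mul_zero]
      · rw [hp.bd_supp hwE]; simp
    · simp
end

section
variable {s : ℕ → V × K} {N : ℕ}
theorem tour_exists (hD : Dg E ι) (hL : LA A E = LD E ι) (hc : Conn E (LD E ι)) (hE : E.Nonempty) :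
    ∃ s N, Tour E ι s N := by
  classical
  obtain ⟨v0, hv0⟩ := hE
  let g : V × K → V × K := fun e => ι (sh e)
  have gdef : ∀ e, g e = ι (sh e) := fun _ => rfl
  have ginj : Function.Injective g := by
    intro a b h
    have := congrArg ι h
    rw [gdef, gdef, hD.inv, hD.inv] at this
    exact sh_inj this
  let e0 : V × K := (v0, 0)
  have gm : ∀ k, (g^[k] e0).1 ∈ E := by
    intro k
    induction k with
    | zero => exact hv0
    | succ k ih => rw [Function.iterate_succ_apply']; exact hD.mem ih
  have per : e0 ∈ Function.periodicPts g := ginj.mem_periodicPts e0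
  have hN := Function.minimalPeriod_pos_of_mem_periodicPts per
  have claim : ∀ n e, g^[n] (sh (g^[n] e)) = sh e := by
    intro n e
    induction n with
    | zero => rfl
    | succ n ih =>
      rw [Function.iterate_succ_apply, Function.iterate_succ_apply']
      have : g (sh (g (g^[n] e))) = sh (g^[n] e) := by rw [gdef, sh_sh, gdef, hD.inv]
      rw [this, ih]
  have iti : ∀ n, Function.Injective (g^[n]) := fun n => ginj.iterate n
  have nsh : ∀ k l, g^[k] e0 ≠ sh (g^[l] e0) := by
    intro k l h
    have h1 := congrArg (g^[l]) h
    rw [claim, ← Function.iterate_add_apply] at h1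
    rcases Nat.even_or_odd' (l + k) with ⟨t, ht | ht⟩
    · rw [ht, two_mul, Function.iterate_add_apply, ← claim t e0] at h1
      exact sh_ne _ (iti t h1).symm
    · have e : l + k = t + (t + 1) := by omega
      rw [e, Function.iterate_add_apply, ← claim t e0] at h1
      have h2 := iti t h1
      rw [Function.iterate_succ_apply'] at h2
      exact hD.fixE (sh (g^[t] e0)) (gm t) h2
  refine ⟨fun k => g^[k] e0, Function.minimalPeriod g e0, fun k _ => ?_, fun k l hk hl h => ?_, fun k l _ _ => nsh k l, fun k _ => gm k, ?_⟩
  · rw [Function.iterate_succ_apply']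
  · exact Function.iterate_injOn_Iio_minimalPeriod hk hl h
  · let p : V × K → ZMod 2 := fun e => if ∃ k, e = g^[k] e0 ∨ e = sh (g^[k] e0) then 1 else 0
    have p1 : ∀ e, p e = 1 ↔ ∃ k, e = g^[k] e0 ∨ e = sh (g^[k] e0) := by
      intro e; show (if _ then _ else _) = _ ↔ _; split_ifs with hc <;> simp [hc]
    have z1 : ∀ {a b : ZMod 2}, (a = 1 ↔ b = 1) → a = b := by decide
    have inv1 : ∀ e, p e = 1 → p (ι e) = 1 := by
      intro e he
      rw [p1] at he ⊢
      obtain ⟨k, rfl | rfl⟩ := he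
      · refine ⟨k + (Function.minimalPeriod g e0 - 1), Or.inr ?_⟩
        have : g^[k] e0 = g (g^[k + (Function.minimalPeriod g e0 - 1)] e0) := by
          rw [← Function.iterate_succ_apply' g, show (k + (Function.minimalPeriod g e0 - 1)).succ = k + Function.minimalPeriod g e0 by omega,
            Function.iterate_add_apply, Function.iterate_minimalPeriod]
        rw [this, gdef, hD.inv]
      · exact ⟨k + 1, Or.inl (by rw [Function.iterate_succ_apply'])⟩
    have psh1 : ∀ e, p e = 1 → p (sh e) = 1 := by
      intro e he
      rw [p1] at he ⊢
      obtain ⟨k, rfl | rfl⟩ := he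
      · exact ⟨k, Or.inr rfl⟩
      · exact ⟨k, Or.inl (sh_sh _)⟩
    have psh : ∀ e, p (sh e) = p e := fun e => z1 ⟨fun h => by have := psh1 _ h; rwa [sh_sh] at this, psh1 e⟩
    have pE : ∀ e, e.1 ∉ E → p e = 0 := by
      intro e he
      rcases z2 (p e) with h0 | h0
      · exact h0
      · exfalso
        obtain ⟨k, rfl | rfl⟩ := (p1 e).1 h0
        · exact he (gm k)
        · exact he (gm k)
    have pv : ∀ v, p (v, (1, 0)) = p (v, (0, 0)) ∧ p (v, (1, 1)) = p (v, (0, 1)) :=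
      fun v => ⟨psh (v, (0, 0)), psh (v, (0, 1))⟩
    have hcyc : Cyc E ι p := by
      refine ⟨fun e => z1 ⟨fun h => by have := inv1 _ h; rwa [hD.inv] at this, inv1 e⟩, fun v => ?_, pE⟩
      rw [sumK, (pv v).1, (pv v).2, z2add, zero_add, z2add]
    have hb0 : bd p = 0 := by
      have hm : bd p ∈ LA A E := by rw [hL]; exact ⟨p, hcyc, rfl⟩
      refine LA_ext hm fun v => ?_
      show p (v, (0, 1)) + p (v, (1, 1)) = 0
      rw [(pv v).2, z2add]
    have hconst := conn_const hD hc p (fun e _ => hcyc.inv e) (fun v _ y => by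
      have h1 : bdK (fun y => p (v, y)) = 0 := congrFun hb0 v
      have h2 := even_eq (hcyc.even v) (y := 0) (k := y) (by rw [h1]; exact om_zero_left y)
      simpa using h2)
    intro e he
    have h1 : p e = 1 := by rw [hconst e e0 he hv0, p1]; exact ⟨0, Or.inl rfl⟩
    obtain ⟨k, hk⟩ := (p1 e).1 h1
    refine ⟨k % Function.minimalPeriod g e0, Nat.mod_lt _ hN, ?_⟩
    rwa [Function.iterate_mod_minimalPeriod_eq]

/-- Second coordinates. -/
def sndL : (V → K) →ₗ[ZMod 2] (V → ZMod 2) where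
  toFun R v := (R v).2
  map_add' _ _ := rfl
  map_smul' _ _ := rfl

/-- Functions supported on `X` killed by a functional. -/
def Gs (X : Finset V) (c : V → ZMod 2) : Submodule (ZMod 2) (V → ZMod 2) where
  carrier := {g | (∀ v ∉ X, g v = 0) ∧ ∑ v, c v * g v = 0}
  zero_mem' := by simp
  add_mem' := by
    rintro a b ⟨h1, h2⟩ ⟨h3, h4⟩
    exact ⟨fun v hv => by simp [h1 v hv, h3 v hv], by simp [mul_add, sum_add_distrib, h2, h4]⟩
  smul_mem' := by
    rintro t a ⟨h1, h2⟩
    refine ⟨fun v hv => by simp [h1 v hv], ?_⟩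
    have : ∑ v, c v * (t • a) v = t * ∑ v, c v * a v := by rw [mul_sum]; exact sum_congr rfl fun v _ => by simp; ring
    rw [this, h2, mul_zero]

theorem finrank_Gs0 (X : Finset V) : Module.finrank (ZMod 2) (Gs X 0) = X.card := by
  let e : Gs X 0 ≃ₗ[ZMod 2] (X → ZMod 2) :=
    { toFun := fun g v => g.1 v
      map_add' := fun _ _ => rfl
      map_smul' := fun _ _ => rfl
      invFun := fun f => ⟨fun v => if h : v ∈ X then f ⟨v, h⟩ else 0, fun v hv => by simp [hv], by simp⟩
      left_inv := fun g => by
        ext v; by_cases h : v ∈ X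
        · simp [h]
        · simp [h, g.2.1 v h]
      right_inv := fun f => by ext v; simp }
  rw [e.finrank_eq]; simp

theorem finrank_Gs (X : Finset V) {c : V → ZMod 2} {x0 : V} (hx : x0 ∈ X) (hc : c x0 = 1) :
    Module.finrank (ZMod 2) (Gs X c) + 1 ≤ X.card := by
  rw [← finrank_Gs0]
  apply Nat.succ_le_of_lt
  apply Submodule.finrank_lt_finrank_of_lt
  refine lt_of_le_of_ne (fun g hg => ⟨hg.1, by simp⟩) fun h => ?_
  have : Pi.single x0 1 ∈ Gs X c := by
    rw [h]; exact ⟨fun v hv => by rw [Pi.single_eq_of_ne]; rintro rfl; exact hv hx, by simp⟩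
  have := this.2
  simp [Pi.single_apply, hc] at this

theorem finrank_map_snd (X : Finset V) : Module.finrank (ZMod 2) ((LA A E ⊓ W X).map sndL) = d (LA A E) X := by
  unfold d
  have : Function.Injective ((sndL (V := V)).domRestrict (LA A E ⊓ W X)) := by
    rw [← LinearMap.ker_eq_bot, LinearMap.ker_eq_bot']
    intro R h
    exact Subtype.ext (LA_ext R.2.1 fun v => congrFun h v)
  rw [← LinearMap.finrank_range_of_inj this, LinearMap.range_domRestrict]

theorem sum_zero_of_mem (hR : R ∈ LA A E) (hX : R ∈ W X) {y : V} (hy : y ∈ E) (hyX : y ∉ X) :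
    ∑ w, A y w * (R w).2 = 0 := by
  rw [← hR.2 y hy, hX y hyX]; rfl

/-- `X` is a union of components. -/
theorem cut_zero (hd : X.card ≤ d (LA A E) X) {x y : V} (hx : x ∈ X) (hy : y ∈ E) (hyX : y ∉ X) : A y x = 0 := by
  have h1 : (LA A E ⊓ W X).map sndL = Gs X 0 := by
    apply Submodule.eq_of_le_of_finrank_le
    · rintro _ ⟨R, hR, rfl⟩
      exact ⟨fun v hv => by show (R v).2 = 0; rw [hR.2 v hv]; rfl, by simp⟩
    · rw [finrank_map_snd, finrank_Gs0]; exact hd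
  have h2 : Pi.single x 1 ∈ Gs X 0 :=
    ⟨fun v hv => by rw [Pi.single_eq_of_ne]; rintro rfl; exact hv hx, by simp⟩
  rw [← h1] at h2
  obtain ⟨R, hR, hRe⟩ := h2
  have h3 := sum_zero_of_mem hR.1 hR.2 hy hyX
  have h4 : ∀ w, (R w).2 = (Pi.single x 1 : V → ZMod 2) w := fun w => congrFun hRe w
  simpa [h4, Pi.single_apply] using h3

/-- A split. -/
theorem split_rank (hX : X ⊆ E) (hd : X.card ≤ d (LA A E) X + 1) {x0 y0 : V} (hx0 : x0 ∈ X) (hy0 : y0 ∈ E) (hy0X : y0 ∉ X)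
    (h0 : A y0 x0 = 1) {x y : V} (hx : x ∈ X) (hy : y ∈ E) (hyX : y ∉ X) : A y x = A y x0 * A y0 x := by
  have h1 : (LA A E ⊓ W X).map sndL = Gs X (A y0) := by
    apply Submodule.eq_of_le_of_finrank_le
    · rintro _ ⟨R, hR, rfl⟩
      exact ⟨fun v hv => by show (R v).2 = 0; rw [hR.2 v hv]; rfl, sum_zero_of_mem hR.1 hR.2 hy0 hy0X⟩
    · rw [finrank_map_snd]; have := finrank_Gs X hx0 h0; omega
  have sg : ∀ z x : V, ∑ v, A z v * (Pi.single x (1 : ZMod 2) : V → ZMod 2) v = A z x := fun z x => by simp [Pi.single_apply]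
  have h2 : (Pi.single x 1 + A y0 x • Pi.single x0 1 : V → ZMod 2) ∈ Gs X (A y0) := by
    refine ⟨fun v hv => ?_, ?_⟩
    · have n1 : v ≠ x := by rintro rfl; exact hv hx
      have n2 : v ≠ x0 := by rintro rfl; exact hv hx0
      simp [n1, n2]
    · simp only [Pi.add_apply, Pi.smul_apply, smul_eq_mul, mul_add, sum_add_distrib, sg]
      simp only [mul_left_comm _ (A y0 x), ← mul_sum, sg, h0, mul_one, z2add]
  rw [← h1] at h2
  obtain ⟨R, hR, hRe⟩ := h2
  have h3 := sum_zero_of_mem hR.1 hR.2 hy hyX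
  have h4 : ∀ w, (R w).2 = (Pi.single x 1 + A y0 x • Pi.single x0 1 : V → ZMod 2) w := fun w => congrFun hRe w
  simp only [h4, Pi.add_apply, Pi.smul_apply, smul_eq_mul, mul_add, sum_add_distrib, sg] at h3
  simp only [mul_left_comm _ (A y0 x), ← mul_sum, sg] at h3
  have h6 : ∀ a b : ZMod 2, a + b = 0 → a = b := by decide
  rw [h6 _ _ h3, mul_comm]

theorem no_four (hs : A.IsSymm) (hdg : ∀ v, A v v = 0) (hE : E.card = 4) : ¬ Prim E (LA A E) := by
  intro hp
  obtain ⟨a, b, c, e, hab, hac, hae, hbc, hbe, hce, rfl⟩ := card_eq_four.1 hE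
  have key : ∀ x y z t : V, ({x, y, z, t} : Finset V) = {a, b, c, e} → x ≠ y → x ≠ z → x ≠ t → y ≠ z → y ≠ t → z ≠ t →
      A z x * A t y + A z y * A t x ≠ 0 := by
    intro x y z t hS n1 n2 n3 n4 n5 n6 hdet
    rw [← hS] at hp
    have hc4 : 4 ≤ ({x, y, z, t} : Finset V).card := by rw [hS, hE]
    have hal : ∀ p q r s : ZMod 2, p * s + q * r = 0 → ∃ α β, (α ≠ 0 ∨ β ≠ 0) ∧ p * α + q * β = 0 ∧ r * α + s * β = 0 := by decide
    obtain ⟨α, β, hne, e1, e2⟩ := hal (A z x) (A z y) (A t x) (A t y) hdet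
    let g : V → ZMod 2 := fun v => if v = x then α else if v = y then β else 0
    have hsum : ∀ v, ∑ w, A v w * (if w ∈ ({x, y, z, t} : Finset V) then g w else 0) = A v x * α + A v y * β := by
      intro v
      rw [← sum_subset (subset_univ {x, y}), sum_pair n1]
      · simp [g, n1.symm]
      · intro w _ hw
        simp only [mem_insert, mem_singleton, not_or] at hw
        simp [g, hw.1, hw.2]
    have hR := vec_mem (A := A) (E := {x, y, z, t}) g
    have h0 := hp.pair (LA_lag hs) hc4 hR (X := {x, y}) (by
      intro v hv
      simp only [mem_insert, mem_singleton, not_or] at hv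
      unfold vec
      rw [hsum]
      split_ifs with hm
      · simp only [mem_insert, mem_singleton, hv.1, hv.2, false_or] at hm
        have gv : g v = 0 := by simp [g, hv.1, hv.2]
        rcases hm with rfl | rfl
        · rw [e1, gv]; rfl
        · rw [e2, gv]; rfl
      · rfl) card_le_two
    have gx := congrArg Prod.snd (congrFun h0 x)
    have gy := congrArg Prod.snd (congrFun h0 y)
    simp only [vec, g, mem_insert, true_or, or_true, if_true, n1.symm, if_false, Pi.zero_apply, Prod.snd_zero] at gx gy
    rcases hne with h | h
    · exact h gx
    · exact h gy
  have k1 := key a b c e rfl hab hac hae hbc hbe hce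
  have k2 := key a c b e (by ext v; simp only [mem_insert, mem_singleton]; tauto) hac hab hae hbc.symm hce hbe
  have k3 := key a e b c (by ext v; simp only [mem_insert, mem_singleton]; tauto) hae hab hac hbe.symm hce.symm hbc
  rw [hs.apply a c, hs.apply b e, hs.apply b c, hs.apply a e] at k1
  rw [hs.apply a b, hs.apply c e, hs.apply a e] at k2
  rw [hs.apply a b, hs.apply a c] at k3
  rw [mul_comm (A b e)] at k3
  have fin : ∀ p q r : ZMod 2, p + q ≠ 0 → r + q ≠ 0 → r + p ≠ 0 → False := by decide
  exact fin _ _ _ k1 k2 k3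

theorem le_d (hX : X ⊆ E) (h : ∀ x ∈ X, ∀ y ∈ E, y ∉ X → A y x = 0) : X.card ≤ d (LA A E) X := by
  rw [← finrank_map_snd, ← finrank_Gs0]
  apply Submodule.finrank_mono
  intro g hg
  refine ⟨vec A E g, ⟨vec_mem g, fun v hv => ?_⟩, ?_⟩
  · unfold vec
    split_ifs with hvE
    · rw [hg.1 v hv, sum_eq_zero]
      · rfl
      · intro w _
        by_cases hw : w ∈ X
        · rw [h w hw v hvE hv, zero_mul]
        · rw [hg.1 w hw]; simp
    · rfl
  · ext v
    show (vec A E g v).2 = g v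
    unfold vec
    split_ifs with hvE
    · rfl
    · rw [hg.1 v (fun h => hvE (hX h))]; rfl

theorem words (h2 : (2 : F) ≠ 0) (hs : A.IsSymm) (hdg : ∀ v, A v v = 0) : ∀ (n : ℕ) (E : Finset V), E.card = n → RepA F A E → ∃ w, Wd A E w := by
  intro n
  induction n using Nat.strong_induction_on with
  | _ n ih =>
  intro E hE hR
  by_cases h3 : E.card ≤ 3
  · exact Wd.small hs h3
  have hne : E.Nonempty := card_pos.1 (by omega)
  by_cases hc : Conn E (LA A E)
  · by_cases hp : Prim E (LA A E)
    · have h4 : E.card ≠ 4 := fun h4 => no_four hs hdg h4 hp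
      obtain ⟨M, _, _, x, hx⟩ := hR
      obtain ⟨ι, -, hD, hL, -⟩ := star h2 n E (LA A E) M x hE (by omega) (LA_lag hs) hp hx
      obtain ⟨s, N, hT⟩ := tour_exists hD hL (hL ▸ hc) hne
      exact ⟨_, hT.word hs hD hL⟩
    · unfold Prim at hp
      push Not at hp
      obtain ⟨X, hX, hX2, hY2, hd⟩ := hp hc
      have hcard := card_sdiff_add_card_eq_card hX
      have hXne : X.Nonempty := card_pos.1 (by omega)
      have hXE : X ≠ E := by rintro rfl; simp at hY2
      obtain ⟨x0, hx0, y0, hy0, hy0X, h0⟩ : ∃ x0 ∈ X, ∃ y0 ∈ E, y0 ∉ X ∧ A y0 x0 = 1 := by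
        by_contra hcon
        push Not at hcon
        have h1 := le_d (A := A) hX fun x hx y hy hyX => by
          rcases z2 (A y x) with h | h
          · exact h
          · exact absurd h (hcon x hx y hy hyX)
        have h2 := hc X hX hXne hXE
        omega
      have hsub1 : insert y0 X ⊆ E := insert_subset hy0 hX
      have hsub2 : insert x0 (E \ X) ⊆ E := insert_subset (hX hx0) sdiff_subset
      have c1 : (insert y0 X).card = X.card + 1 := card_insert_of_notMem hy0X
      have c2 : (insert x0 (E \ X)).card = (E \ X).card + 1 := card_insert_of_notMem (by simp [hx0])
      obtain ⟨w, hw⟩ := ih _ (by omega) (insert y0 X) rfl (hR.mono hs hdg hsub1)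
      obtain ⟨w', hw'⟩ := ih _ (by omega) (insert x0 (E \ X)) rfl (hR.mono hs hdg hsub2)
      have := Wd.glue hs disjoint_sdiff hx0 (mem_sdiff.2 ⟨hy0, hy0X⟩) hw hw' fun x hx y hy => by
        rw [mem_sdiff] at hy
        have := split_rank hX (by omega) hx0 hy0 hy0X h0 hx hy.1 hy.2
        rw [hs.apply y x, this, hs.apply x0 y, hs.apply x y0, mul_comm]
      rwa [union_sdiff_of_subset hX] at this
  · unfold Conn at hc
    push Not at hc
    obtain ⟨X, hX, hXne, hXE, hd⟩ := hc
    have hcard := card_sdiff_add_card_eq_card hX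
    have hpos := card_pos.2 hXne
    have hpos2 : 0 < (E \ X).card := by
      rw [card_pos, sdiff_nonempty]; exact fun h => hXE (subset_antisymm hX h)
    obtain ⟨w, hw⟩ := ih _ (by omega) X rfl (hR.mono hs hdg hX)
    obtain ⟨w', hw'⟩ := ih _ (by omega) (E \ X) rfl (hR.mono hs hdg sdiff_subset)
    have := Wd.concat hs disjoint_sdiff hw hw' fun x hx y hy => by
      rw [mem_sdiff] at hy
      rw [hs.apply y x]
      exact cut_zero (by omega) hx hy.1 hy.2
    rw [union_sdiff_of_subset hX] at this
    exact ⟨_, this⟩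
end

section
variable {s : ℕ → V × K} {N : ℕ}
theorem tour_of_word {n : ℕ} {a : ℕ → V} (ha : ∀ v, ∃ i j, Oc a (n + 1) v i j) : ∃ ι s, Dg univ ι ∧ Tour univ ι s (n + 1) ∧
    (∀ k, (s k).1 = a k) ∧ ∀ v i j, Oc a (n + 1) v i j → (s i).2 + (s j).2 + (1, 0) = (0, 1) := by
  classical
  let s : ℕ → V × K := fun k => (a k, if ∃ k' < k, a k' = a k then (1, 1) else 0)
  have s1 : ∀ k, (s k).1 = a k := fun _ => rfl
  have s2 : ∀ k, (s k).2 = 0 ∨ (s k).2 = (1, 1) := by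
    intro k; show (if _ then _ else _) = _ ∨ (if _ then _ else _) = _; split_ifs <;> simp
  have so : ∀ v i j, Oc a (n + 1) v i j → s i = (v, 0) ∧ s j = (v, (1, 1)) := by
    intro v i j h
    have hij := h.lt
    have hj := h.ltN
    refine ⟨Prod.ext h.ai (if_neg ?_), Prod.ext h.aj (if_pos ⟨i, h.lt, h.ai.trans h.aj.symm⟩)⟩
    rintro ⟨k, hk, hk'⟩
    rcases h.only k (by omega) (hk'.trans h.ai) with h | h <;> omega
  have inj : ∀ k l, k < n + 1 → l < n + 1 → s k = s l → k = l := by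
    intro k l hk hl h
    obtain ⟨i, j, ho⟩ := ha (a k)
    obtain ⟨e1, e2⟩ := so _ _ _ ho
    have h1 := ho.only k hk rfl
    have h2 := ho.only l hl (congrArg Prod.fst h).symm
    rcases h1 with rfl | rfl <;> rcases h2 with rfl | rfl
    · rfl
    · rw [e1, e2] at h; exact absurd (congrArg Prod.snd h) (by decide : ¬ ((0 : K) = (1, 1)))
    · rw [e1, e2] at h; exact absurd (congrArg Prod.snd h) (by decide : ¬ (((1, 1) : K) = 0))
    · rfl
  have nsh : ∀ k l, s k ≠ sh (s l) := by
    intro k l h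
    have h1 : (s k).2 = (s l).2 + (1, 0) := congrArg Prod.snd h
    have : ∀ x y : K, (x = 0 ∨ x = (1, 1)) → (y = 0 ∨ y = (1, 1)) → x ≠ y + (1, 0) := by decide
    exact this _ _ (s2 k) (s2 l) h1
  have surj : ∀ e : V × K, ∃ k < n + 1, e = s k ∨ e = sh (s k) := by
    rintro ⟨v, y⟩
    obtain ⟨i, j, ho⟩ := ha v
    obtain ⟨e1, e2⟩ := so _ _ _ ho
    have hij := ho.lt
    have hj := ho.ltN
    have : y = 0 ∨ y = (1, 0) ∨ y = (1, 1) ∨ y = (0, 1) := by revert y; decide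
    rcases this with rfl | rfl | rfl | rfl
    · exact ⟨i, by omega, Or.inl e1.symm⟩
    · exact ⟨i, by omega, Or.inr (by rw [e1]; simp [sh])⟩
    · exact ⟨j, by omega, Or.inl e2.symm⟩
    · exact ⟨j, by omega, Or.inr (by rw [e2]; exact Prod.ext rfl (by decide : ((0, 1) : K) = (1, 1) + (1, 0)))⟩
  let b : Fin (n + 1) × Bool → V × K := fun x => if x.2 then sh (s x.1) else s x.1
  have bb : Function.Bijective b := by
    constructor
    · rintro ⟨k, x⟩ ⟨l, y⟩ h
      cases x <;> cases y
      · have : s k = s l := h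
        rw [Prod.mk.injEq]; exact ⟨Fin.ext (inj _ _ k.2 l.2 this), rfl⟩
      · exact absurd (show s k = sh (s l) from h) (nsh _ _)
      · exact absurd (show s l = sh (s k) from h.symm) (nsh _ _)
      · have : sh (s k) = sh (s l) := h
        rw [Prod.mk.injEq]; exact ⟨Fin.ext (inj _ _ k.2 l.2 (sh_inj this)), rfl⟩
    · intro e
      obtain ⟨k, hk, h | h⟩ := surj e
      · exact ⟨(⟨k, hk⟩, false), h.symm⟩
      · exact ⟨(⟨k, hk⟩, true), h.symm⟩
  let β := Equiv.ofBijective b bb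
  let σ : Fin (n + 1) × Bool → Fin (n + 1) × Bool := fun x =>
    if x.2 then (finRotate (n + 1) x.1, false) else ((finRotate (n + 1)).symm x.1, true)
  have σσ : ∀ x, σ (σ x) = x := by rintro ⟨k, x⟩; cases x <;> simp [σ]
  refine ⟨fun e => β (σ (β.symm e)), s, ⟨fun e => by simp [σσ], fun e _ h => ?_, fun e he => absurd (mem_univ _) he⟩,
    ⟨fun k hk => ?_, inj, fun k l _ _ => nsh k l, fun k _ => mem_univ _, fun e _ => surj e⟩, s1, ?_⟩
  · have h1 : σ (β.symm e) = β.symm e := by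
      apply β.injective; simpa using h
    generalize β.symm e = x at h1
    obtain ⟨k, x⟩ := x
    cases x <;> simp [σ] at h1
  · have e1 : β.symm (sh (s k)) = (⟨k, by omega⟩, true) := by
      rw [Equiv.symm_apply_eq]; rfl
    show β (σ (β.symm (sh (s k)))) = s (k + 1)
    rw [e1]
    have e2 : σ (⟨k, by omega⟩, true) = (⟨k + 1, hk⟩, false) := by
      show (finRotate (n + 1) ⟨k, _⟩, false) = _
      rw [finRotate_of_lt (by omega)]
    rw [e2]; rfl
  · intro v i j ho
    obtain ⟨e1, e2⟩ := so _ _ _ ho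
    rw [e1, e2]; dsimp only; decide

theorem LD_of_word (hs : A.IsSymm) (hdg : ∀ v, A v v = 0) {w : List V} (hw : Wd A univ w) : ∃ ι, Dg univ ι ∧ LA A univ = LD univ ι := by
  classical
  rcases isEmpty_or_nonempty V with hV | ⟨⟨v0⟩⟩
  · refine ⟨id, ⟨fun _ => rfl, fun e => isEmptyElim e.1, fun e => isEmptyElim e.1⟩, ?_⟩
    ext R
    rw [Subsingleton.elim R 0]; simp
  have hl : w.length ≠ 0 := by
    intro h
    have := hw.1 v0
    rw [List.length_eq_zero_iff.1 h] at this
    simp at this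
  obtain ⟨n, hn⟩ := Nat.exists_eq_succ_of_ne_zero hl
  let a : ℕ → V := fun k => w.getD k v0
  have hwa : w = (List.range (n + 1)).map a := by
    apply List.ext_getElem
    · simp [hn]
    · intro i h1 h2
      simp [a, h1]
  have ho : ∀ v, ∃ i j, Oc a (n + 1) v i j := by
    intro v
    have h1 := hw.1 v
    rw [hwa, List.count, List.countP_map, List.countP_eq_length_filter, if_pos (mem_univ _), List.length_eq_two] at h1
    obtain ⟨i, j, hij⟩ := h1
    have hp : ((List.range (n + 1)).filter ((fun x => x == v) ∘ a)).Pairwise (· < ·) := List.Pairwise.filter _ List.pairwise_lt_range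
    have hm : ∀ t, t ∈ [i, j] ↔ t < n + 1 ∧ a t = v := by intro t; rw [← hij]; simp
    rw [hij] at hp
    refine ⟨i, j, by simpa using hp, ((hm j).1 (by simp)).1, ((hm i).1 (by simp)).2, ((hm j).1 (by simp)).2, fun k hk hkv => ?_⟩
    simpa using (hm k).2 ⟨hk, hkv⟩
  obtain ⟨ι, s, hD, hT, hsa, hso⟩ := tour_of_word ho
  have hsa' : (fun k => (s k).1) = a := funext hsa
  refine ⟨ι, hD, (Lag.eq_of_le (LD_lag hD) (LA_lag hs) fun R hR => ?_).symm⟩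
  obtain ⟨q, hq, rfl⟩ := hR
  refine LA_of_rows hs (fun v hv => absurd (mem_univ _) hv) fun u _ => ?_
  obtain ⟨i, j, hij⟩ := ho u
  obtain ⟨p, hp, hpu, hpw⟩ := hT.row hD (mem_univ u) (by rw [hsa']; exact hij)
  have : vec A univ (Pi.single u 1) = bd p := by
    ext1 v
    have hv : vec A univ (Pi.single u 1) v = (A v u, (Pi.single u (1 : ZMod 2) : V → ZMod 2) v) := by
      simp [vec, Pi.single_apply]
    rw [hv]
    by_cases hvu : v = u
    · subst hvu
      rw [hpu, hso _ _ _ hij, hdg]; simp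
    · obtain ⟨k, l, hkl⟩ := ho v
      rw [hpw v (mem_univ _) hvu k l (by rw [hsa']; exact hkl)]
      have h1 := hw.2 u (mem_univ _) v (mem_univ _) (Ne.symm hvu)
      rw [hwa, hij.il (Ne.symm hvu) hkl] at h1
      have z1 : ∀ {a b : ZMod 2}, (a = 1 ↔ b = 1) → a = b := by decide
      rw [hs.apply u v, z1 h1]; simp [hvu]
  rw [this]
  exact LD_iso hD hq hp

/-- The relations of the universal representation. -/
def Nn (F : Type) [Field F] (ι : V × K → V × K) : Submodule F (V × K → F) where
  carrier := {m | ∃ (q : V × K → F) (b : V → F), (∀ e, q (ι e) = q e) ∧ ∀ e, m e = q e + b e.1}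
  zero_mem' := ⟨0, 0, by simp, by simp⟩
  add_mem' := by
    rintro m m' ⟨q, b, h1, h2⟩ ⟨q', b', h1', h2'⟩
    exact ⟨q + q', b + b', fun e => by simp [h1, h1'], fun e => by simp [h2, h2']; ring⟩
  smul_mem' := by
    rintro c m ⟨q, b, h1, h2⟩
    exact ⟨c • q, c • b, fun e => by simp [h1], fun e => by simp [h2]; ring⟩

/-- generators -/
def Dl (F : Type) [Field F] (v : V) (k : K) : V × K → F :=
  fun e => if e.1 = v ∧ k ≠ 0 ∧ (e.2 = 0 ∨ e.2 = k) then 1 else 0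

/-- a representative of the complementary coset -/
def oo (k : K) : K := if k = 0 then 0 else if k = (1, 0) then (0, 1) else (1, 0)

theorem oo_prop {T : Type} (f : K → T) (S : K) (h : ∀ y, f (y + S) = f y) (h0 : S = 0 → ∀ y, f y = f 0) :
    ∀ y, ¬ (S ≠ 0 ∧ (y = 0 ∨ y = S)) → f y = f (oo S) := by
  intro y hy
  by_cases hS : S = 0
  · rw [h0 hS y, h0 hS (oo S)]
  · have : ∀ S y : K, S ≠ 0 → ¬ (S ≠ 0 ∧ (y = 0 ∨ y = S)) → y = oo S ∨ y = oo S + S := by unfold oo; decide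
    rcases this S y hS hy with h1 | h1
    · rw [h1]
    · rw [h1, h]

set_option maxHeartbeats 1000000 in
theorem Dg.rep (hD : Dg univ ι) : Rep F univ (LD univ ι) (fun v k => (Nn F ι).mkQ (Dl F v k)) := by
  classical
  refine ⟨fun v => ?_, fun S _ => ?_⟩
  · have : Dl F v 0 = 0 := by ext e; simp [Dl]
    rw [this, map_zero]
  have hsum : ∀ (l : V → F) (e : V × K), (∑ v, l v • Dl F v (S v)) e = if S e.1 ≠ 0 ∧ (e.2 = 0 ∨ e.2 = S e.1) then l e.1 else 0 := by
    intro l e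
    rw [Finset.sum_apply, sum_eq_single e.1]
    · simp [Dl]
    · intro v _ hv; simp [Dl, Ne.symm hv]
    · simp
  have hrel : ∀ l : V → F, (∑ v, l v • (Nn F ι).mkQ (Dl F v (S v)) = 0) ↔ ∃ (q : V × K → F) (b : V → F), (∀ e, q (ι e) = q e) ∧
      ∀ e : V × K, (if S e.1 ≠ 0 ∧ (e.2 = 0 ∨ e.2 = S e.1) then l e.1 else 0) = q e + b e.1 := by
    intro l
    simp only [← map_smul, ← map_sum]
    rw [Submodule.mkQ_apply, Submodule.Quotient.mk_eq_zero]
    simp only [← hsum]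
    rfl
  constructor
  · intro h l hl v0 hv0
    by_contra hlv
    obtain ⟨q, b, hq, hqb⟩ := (hrel l).1 hl
    let p : V × K → ZMod 2 := fun e => if q e = q (v0, 0) then 1 else 0
    have hqS : ∀ v y, q (v, y + S v) = q (v, y) := by
      intro v y
      have h1 := hqb (v, y)
      have h2 := hqb (v, y + S v)
      dsimp only at h1 h2
      have : (S v ≠ 0 ∧ (y = 0 ∨ y = S v)) ↔ (S v ≠ 0 ∧ (y + S v = 0 ∨ y + S v = S v)) := by
        have t : ∀ k y : K, (k ≠ 0 ∧ (y = 0 ∨ y = k)) ↔ (k ≠ 0 ∧ (y + k = 0 ∨ y + k = k)) := by decide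
        exact t (S v) y
      rw [if_congr this rfl rfl, h2] at h1
      exact add_right_cancel h1
    have hpS : ∀ v y, p (v, y + S v) = p (v, y) := fun v y => by simp only [p, hqS]
    have hp0 : ∀ v, S v = 0 → ∀ y, p (v, y) = p (v, 0) := by
      intro v hv y
      have h1 := hqb (v, y)
      have h2 := hqb (v, 0)
      simp only [hv, ne_eq, not_true_eq_false, false_and, if_false] at h1 h2
      have : q (v, y) = q (v, 0) := add_right_cancel (h1.symm.trans h2)
      simp only [p, this]
    have hloc : ∀ v, ∑ y, p (v, y) = 0 ∧ (bd p v = 0 ∨ bd p v = S v) := by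
      intro v
      have : ∀ (f : K → ZMod 2), ∀ S : K, f (0 + S) = f 0 → f ((1, 0) + S) = f (1, 0) → f ((0, 1) + S) = f (0, 1) → (S ≠ 0 ∨ (f (1, 0) = f 0 ∧ f (0, 1) = f 0 ∧ f (1, 1) = f 0)) →
          (∑ y, f y = 0 ∧ (bdK f = 0 ∨ bdK f = S)) := by
        apply ext4; simp only [sumK]; decide
      exact this (fun y => p (v, y)) (S v) (hpS v _) (hpS v _) (hpS v _) (by
        by_cases hv : S v = 0
        · exact Or.inr ⟨hp0 v hv _, hp0 v hv _, hp0 v hv _⟩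
        · exact Or.inl hv)
    have hcyc : Cyc univ ι p := ⟨fun e => by simp only [p, hq], fun v => (hloc v).1, fun e he => absurd (mem_univ _) he⟩
    have h0 := h _ ⟨p, hcyc, rfl⟩ (fun v => (hloc v).2)
    have h1 := even_eq (hcyc.even v0) (y := 0) (k := oo (S v0)) (by
      have : bdK (fun y => p (v0, y)) = 0 := congrFun h0 v0
      rw [this]; exact om_zero_left _)
    have hpv : p (v0, 0) = 1 := if_pos rfl
    rw [zero_add, hpv] at h1
    have h2 : q (v0, oo (S v0)) = q (v0, 0) := by
      by_contra hc
      have : p (v0, oo (S v0)) = 0 := if_neg hc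
      rw [this] at h1; exact zero_ne_one h1
    have h3 := hqb (v0, 0)
    have h4 := hqb (v0, oo (S v0))
    have h5 : ∀ k : K, k ≠ 0 → ¬ (k ≠ 0 ∧ (oo k = 0 ∨ oo k = k)) := by unfold oo; decide
    rw [if_neg (h5 _ hv0), h2] at h4
    rw [if_pos ⟨hv0, Or.inl rfl⟩, ← h4] at h3
    exact hlv h3
  · intro h R hR hle
    obtain ⟨p, hp, rfl⟩ := hR
    have hpS : ∀ v y, p (v, y + S v) = p (v, y) := by
      intro v y
      apply even_eq (f := fun y => p (v, y)) (hp.even v)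
      rcases hle v with h | h
      · rw [show bdK (fun y => p (v, y)) = 0 from h]; exact om_zero_left _
      · rw [show bdK (fun y => p (v, y)) = S v from h]; exact om_self _
    have hconst : ∀ v, bd p v = 0 → ∀ y, p (v, y) = p (v, 0) := by
      intro v hv y
      have := even_eq (f := fun y => p (v, y)) (hp.even v) (y := 0) (k := y) (by
        rw [show bdK (fun y => p (v, y)) = 0 from hv]; exact om_zero_left _)
      simpa using this
    have hp0 : ∀ v, S v = 0 → bd p v = 0 := by
      intro v hv; rcases hle v with h | h
      · exact h
      · rw [h, hv]
    let q : V × K → F := fun e => if p e = 1 then 1 else 0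
    have hqp : ∀ e e', q e = q e' → p e = p e' := by
      intro e e' hqq
      simp only [q] at hqq
      rcases z2 (p e) with h1 | h1 <;> rcases z2 (p e') with h2 | h2 <;> rw [h1, h2] at hqq ⊢
      · rw [if_neg zero_ne_one, if_pos rfl] at hqq; exact absurd hqq zero_ne_one
      · rw [if_neg zero_ne_one, if_pos rfl] at hqq; exact absurd hqq.symm zero_ne_one
    have hrl := h (fun v => q (v, 0) - q (v, oo (S v))) ((hrel _).2 ⟨q, fun v => - q (v, oo (S v)), fun e => by simp only [q, hp.inv], ?_⟩)
    · ext1 v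
      by_cases hv : S v = 0
      · exact hp0 v hv
      · have h1 := hqp _ _ (sub_eq_zero.1 (hrl v hv))
        have hall : (fun y => p (v, y)) = fun _ => p (v, 0) := by
          ext1 y
          by_cases hy : S v ≠ 0 ∧ (y = 0 ∨ y = S v)
          · rcases hy.2 with rfl | rfl
            · rfl
            · have := hpS v 0; rwa [zero_add] at this
          · rw [oo_prop (fun y => p (v, y)) (S v) (hpS v) (fun h => absurd h hv) y hy, ← h1]
        show bdK (fun y => p (v, y)) = 0
        rw [hall, bdK_const]
    · rintro ⟨v, y⟩
      dsimp only
      split_ifs with hy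
      · have : q (v, y) = q (v, 0) := by
          rcases hy.2 with rfl | rfl
          · rfl
          · have := hpS v 0; rw [zero_add] at this; simp only [q, this]
        rw [this]; ring
      · have := oo_prop (fun y => q (v, y)) (S v) (fun y => by simp only [q, hpS]) (fun h y => by simp only [q, hconst v (hp0 v h) y]) y hy
        rw [this]; ring

theorem RepA_of_word (F : Type) [Field F] (hs : A.IsSymm) (hdg : ∀ v, A v v = 0) {w : List V} (hw : Wd A univ w) : RepA F A univ := by
  obtain ⟨ι, hD, hL⟩ := LD_of_word hs hdg hw
  have := hD.rep (F := F)
  rw [← hL] at this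
  exact ⟨_, _, _, _, this⟩
end

section
/-- The three nonzero elements of `K`. -/
def kk (i : Fin 3) : K := if i = 0 then (1, 0) else if i = 1 then (0, 1) else (1, 1)
/-- The inverse of `kk`. -/
def ki (k : K) : Fin 3 := if k = (1, 0) then 0 else if k = (0, 1) then 1 else 2
theorem ki_kk : ∀ i, ki (kk i) = i := by unfold ki kk; decide
theorem kk_ki : ∀ k, k ≠ 0 → kk (ki k) = k := by unfold ki kk; decide
theorem kk_ne : ∀ i, kk i ≠ 0 := by unfold kk; decide

/-- The family indexed by `K` attached to a family indexed by `Fin 3`. -/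
def xx (y : V × Fin 3 → M) (v : V) (k : K) : M := if k = 0 then 0 else y (v, ki k)

/-- The subtransversal of a vector. -/
def TS (S : V → K) : Set (V × Fin 3) := {p | S p.1 = kk p.2}

theorem TS_sub (S : V → K) : Subtransversal3 (TS S) := by
  intro v i j hi hj
  have h1 : S v = kk i := hi
  have h2 : S v = kk j := hj
  rw [← ki_kk i, ← ki_kk j, ← h1, ← h2]

theorem TS_surj {T : Set (V × Fin 3)} (h : Subtransversal3 T) : ∃ S, T = TS S := by
  classical
  refine ⟨fun v => if h : ∃ i, (v, i) ∈ T then kk h.choose else 0, ?_⟩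
  ext ⟨v, i⟩
  show _ ↔ (if h : ∃ i, (v, i) ∈ T then kk h.choose else 0) = kk i
  split_ifs with hv
  · constructor
    · intro hi; rw [h v _ _ hv.choose_spec hi]
    · intro hi
      have := congrArg ki hi
      rw [ki_kk, ki_kk] at this
      rw [← this]; exact hv.choose_spec
  · constructor
    · intro hi; exact absurd ⟨i, hi⟩ hv
    · intro hi; exact absurd hi.symm (kk_ne i)

theorem TS_li (y : V × Fin 3 → M) (S : V → K) : LinearIndepOn F y (TS S) ↔
    ∀ l : V → F, ∑ v, l v • xx y v (S v) = 0 → ∀ v, S v ≠ 0 → l v = 0 := by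
  classical
  have hT : TS S = (fun v => (v, ki (S v))) '' ((univ.filter fun v => S v ≠ 0 : Finset V) : Set V) := by
    ext ⟨v, i⟩
    constructor
    · intro h
      have h' : S v = kk i := h
      refine ⟨v, by simp [h', kk_ne], by simp [h', ki_kk]⟩
    · rintro ⟨u, hu, he⟩
      obtain ⟨rfl, rfl⟩ := Prod.mk.injEq _ _ _ _ ▸ he
      exact (kk_ki _ (by simpa using hu)).symm
  have h1 : LinearIndepOn F y (TS S) ↔ LinearIndepOn F (y ∘ fun v => (v, ki (S v))) ((univ.filter fun v => S v ≠ 0 : Finset V) : Set V) := by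
    rw [hT]
    exact ⟨fun h => h.comp_of_image fun a _ b _ h => congrArg Prod.fst h, fun h => h.image_of_comp⟩
  rw [h1, linearIndepOn_finset_iff]
  have h2 : ∀ l : V → F, ∑ v, l v • xx y v (S v) = ∑ v ∈ univ.filter (fun v => S v ≠ 0), l v • (y ∘ fun v => (v, ki (S v))) v := by
    intro l
    rw [sum_filter]
    refine sum_congr rfl fun v _ => ?_
    by_cases h : S v = 0 <;> simp [xx, h]
  simp only [h2, mem_filter, mem_univ, true_and]

theorem li_rank {I : Type} [Finite I] (y : I → M) (T : Set I) :
    LinearIndepOn F y T ↔ T.ncard = Module.finrank F (Submodule.span F (y '' T)) := by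
  classical
  have := Fintype.ofFinite T
  rw [LinearIndepOn, linearIndependent_iff_card_eq_finrank_span, ← Nat.card_eq_fintype_card, Nat.card_coe_set_eq,
    Set.finrank, Set.image_eq_range]

theorem rank_le {F' M' : Type} [Field F'] [AddCommGroup M'] [Module F' M'] {I : Type} [Finite I] (y : I → M) (z : I → M') (S : Set I)
    (h : ∀ T ⊆ S, LinearIndepOn F y T → LinearIndepOn F' z T) :
    Module.finrank F (Submodule.span F (y '' S)) ≤ Module.finrank F' (Submodule.span F' (z '' S)) := by
  obtain ⟨B, hB, -, hsp, hli⟩ := exists_linearIndepOn_extension (linearIndepOn_empty F y) (Set.empty_subset S)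
  have e1 : Submodule.span F (y '' S) = Submodule.span F (y '' B) :=
    le_antisymm (Submodule.span_le.2 hsp) (Submodule.span_mono (Set.image_mono hB))
  rw [e1, ← (li_rank y B).1 hli, (li_rank z B).1 (h B hB hli)]
  have : Module.Finite F' (Submodule.span F' (z '' S)) := Module.Finite.span_of_finite F' (Set.toFinite _)
  exact Submodule.finrank_mono (Submodule.span_mono (Set.image_mono hB))

/-- The columns of the defining matrix. -/
def cols {m n R : Type} (P : Matrix m n R) : n → m → R := fun j i => P i j

theorem IAS_rep (A : Matrix V V (ZMod 2)) : Rep (ZMod 2) univ (LA A univ) (xx (cols (IASmat A))) := by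
  classical
  have hx : ∀ v k u, xx (cols (IASmat A)) v k u = (if u = v then k.1 else 0) + A u v * k.2 := by
    intro v k u
    have : k = 0 ∨ k = (1, 0) ∨ k = (0, 1) ∨ k = (1, 1) := by revert k; decide
    rcases this with rfl | rfl | rfl | rfl
    · simp [xx]
    · simp [xx, ki, cols, IASmat]
    · simp [xx, ki, cols, IASmat]
    · simp [xx, ki, cols, IASmat]
  have hr : ∀ (l : V → ZMod 2) (S : V → K), ∑ v, l v • xx (cols (IASmat A)) v (S v) = 0 ↔ (fun v => l v • S v) ∈ LA A univ := by
    intro l S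
    have z : ∀ a b : ZMod 2, a + b = 0 ↔ a = b := by decide
    rw [mem_LA, funext_iff]
    have : ∀ u, (∑ v, l v • xx (cols (IASmat A)) v (S v)) u = (l u • S u).1 + ∑ w, A u w * (l w • S w).2 := by
      intro u
      rw [Finset.sum_apply]
      simp only [Pi.smul_apply, hx, smul_eq_mul, mul_add, sum_add_distrib, mul_ite, mul_zero, sum_ite_eq, mem_univ, if_true,
        Prod.smul_fst, Prod.smul_snd]
      congr 1
      exact sum_congr rfl fun w _ => by ring
    simp only [this, Pi.zero_apply, z, mem_univ, not_true_eq_false, false_imp_iff, implies_true, true_and, true_imp_iff]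
  refine ⟨fun v => by simp [xx], fun S _ => ⟨fun h l hl v hv => ?_, fun h R hR hle => ?_⟩⟩
  · have h1 := h _ ((hr l S).1 hl) fun v => by
      rcases z2 (l v) with h | h <;> simp [h]
    have h2 := congrFun h1 v
    rcases z2 (l v) with h3 | h3
    · exact h3
    · simp [h3] at h2; exact absurd h2 hv
  · have e : R = fun v => (if R v = 0 then (0 : ZMod 2) else 1) • S v := by
      ext1 v
      by_cases h0 : R v = 0
      · simp [h0]
      · simp [h0, (hle v).resolve_left h0]
    have h1 := h _ ((hr _ S).2 (e ▸ hR))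
    ext1 v
    by_contra h0
    have h0 : ¬ R v = 0 := h0
    have h2 := h1 v (by rw [← (hle v).resolve_left h0]; exact h0)
    rw [if_neg h0] at h2
    exact one_ne_zero h2

theorem colSpan_eq {m n R : Type} [Field R] (P : Matrix m n R) (S : Set n) :
    colSpanRank R P S = Module.finrank R (Submodule.span R (cols P '' S)) := rfl

theorem Z3Rep_of (h : RepA F A univ) : Z3Rep F A := by
  classical
  obtain ⟨M, _, _, x, hx⟩ := h
  let N := Submodule.span F (Set.range fun p : V × Fin 3 => x p.1 (kk p.2))
  have : Module.Finite F N := Module.Finite.span_of_finite F (Set.toFinite _)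
  let b := Module.finBasis F N
  let c : V × Fin 3 → N := fun p => ⟨x p.1 (kk p.2), Submodule.subset_span ⟨p, rfl⟩⟩
  let P : Matrix (Fin (Module.finrank F N)) (V × Fin 3) F := fun i p => b.equivFun (c p) i
  let g : (Fin (Module.finrank F N) → F) →ₗ[F] M := N.subtype ∘ₗ b.equivFun.symm.toLinearMap
  have gi : Function.Injective g := (Submodule.subtype_injective N).comp b.equivFun.symm.injective
  have gx : ∀ v k, g (xx (cols P) v k) = x v k := by
    intro v k
    by_cases hk : k = 0
    · simp [xx, hk, hx.zero]
    · rw [xx, if_neg hk]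
      show ((b.equivFun.symm (b.equivFun (c (v, ki k))) : N) : M) = _
      rw [LinearEquiv.symm_apply_apply]
      show x v (kk (ki k)) = _
      rw [kk_ki k hk]
  have key : ∀ T, Subtransversal3 T → (LinearIndepOn F (cols P) T ↔ LinearIndepOn (ZMod 2) (cols (IASmat A)) T) := by
    intro T hT
    obtain ⟨S, rfl⟩ := TS_surj hT
    rw [TS_li, TS_li, ← (IAS_rep A).ind S (by simp), hx.ind S (by simp)]
    have : ∀ l : V → F, ∑ v, l v • xx (cols P) v (S v) = 0 ↔ ∑ v, l v • x v (S v) = 0 := by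
      intro l
      rw [← gi.eq_iff, map_sum, map_zero]
      simp only [map_smul, gx]
    simp only [this]
  have sub : ∀ S, Subtransversal3 S → ∀ T : Set (V × Fin 3), T ⊆ S → Subtransversal3 T :=
    fun S hS T hTS v i j hi hj => hS v i j (hTS hi) (hTS hj)
  refine ⟨_, P, fun S hS => ?_⟩
  rw [colSpan_eq, colSpan_eq]
  exact le_antisymm (rank_le _ _ _ fun T hT => (key T (sub S hS T hT)).1) (rank_le _ _ _ fun T hT => (key T (sub S hS T hT)).2)

theorem Z3Rep.repA (h : Z3Rep F A) : RepA F A univ := by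
  obtain ⟨k, P, hP⟩ := h
  refine ⟨Fin k → F, _, _, xx (cols P), fun v => by simp [xx], fun S hS => ?_⟩
  have := hP _ (TS_sub S)
  rw [colSpan_eq, colSpan_eq] at this
  rw [(IAS_rep A).ind S hS, ← TS_li, ← TS_li, li_rank, li_rank, this]

theorem inter_iff {w : List V} (hw : ∀ v, w.count v = 2) {u v : V} (huv : u ≠ v) : Interlaced w u v ↔ Il u v (fl u v w) := by
  have hlen : (fl u v w).length = 4 := by
    have : ∀ l : List V, (fl u v l).length = l.count u + l.count v := by
      intro l
      induction l with
      | nil => simp [fl]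
      | cons a l ih =>
        unfold fl at ih ⊢
        simp only [Bool.decide_or] at ih ⊢
        rw [List.filter_cons, List.count_cons, List.count_cons]
        by_cases h1 : a = u
        · subst h1; simp [huv, ih]; omega
        · by_cases h2 : a = v
          · subst h2; simp [h1, ih]; omega
          · simp [h1, h2, ih]
    rw [this, hw, hw]
  have hsub : (fl u v w).Sublist w := List.filter_sublist
  have key : ∀ l : List V, l.length = 4 → fl u v l = l → (l.Sublist w ↔ fl u v w = l) := by
    intro l h4 hl
    constructor
    · intro h
      have h1 : (fl u v l).Sublist (fl u v w) := h.filter _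
      rw [hl] at h1
      exact (h1.eq_of_length (by rw [hlen, h4])).symm
    · rintro h; rw [← h]; exact hsub
  exact or_congr (key _ rfl (by simp [fl])) (key _ rfl (by simp [fl]))

theorem circle_iff (hs : A.IsSymm) (hd : ∀ v, A v v = 0) : IsCircleGraph A ↔ ∃ w, Wd A univ w := by
  constructor
  · rintro ⟨w, h1, h2⟩
    refine ⟨w, fun v => by simpa using h1 v, fun u _ v _ huv => ?_⟩
    rw [h2 u v, ← inter_iff h1 huv]
    exact ⟨fun h => h.2, fun h => ⟨huv, h⟩⟩
  · rintro ⟨w, h1, h2⟩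
    have h1 : ∀ v, w.count v = 2 := fun v => by simpa using h1 v
    refine ⟨w, h1, fun u v => ?_⟩
    by_cases huv : u = v
    · subst huv; simp [hd]
    · rw [h2 u (mem_univ _) v (mem_univ _) huv, inter_iff h1 huv]
      exact ⟨fun h => ⟨huv, h⟩, fun h => h.2⟩
end
end Z3

/-- Theorem (main): for a simple graph `G`, the following are equivalent:
(1) `G` is a circle graph; (2) `Z₃(G)` is representable over every field;
(3) `Z₃(G)` is representable over some field of characteristic ≠ 2. -/
theorem circle_graph_iff_Z3_representable
    {V : Type} [Fintype V] [DecidableEq V] (A : Matrix V V (ZMod 2))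
    (hsym : A.IsSymm) (hdiag : ∀ v, A v v = 0) :
    (IsCircleGraph A ↔ ∀ (F : Type) [Field F], Z3Rep F A) ∧
    (IsCircleGraph A ↔ ∃ (F : Type) (_ : Field F), ringChar F ≠ 2 ∧ Z3Rep F A) := by
  have h12 : IsCircleGraph A → ∀ (F : Type) [Field F], Z3Rep F A := by
    intro h F _
    obtain ⟨w, hw⟩ := (Z3.circle_iff hsym hdiag).1 h
    exact Z3.Z3Rep_of (Z3.RepA_of_word F hsym hdiag hw)
  have h31 : (∃ (F : Type) (_ : Field F), ringChar F ≠ 2 ∧ Z3Rep F A) → IsCircleGraph A := by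
    rintro ⟨F, _, hc, h⟩
    exact (Z3.circle_iff hsym hdiag).2 (Z3.words (Ring.two_ne_zero hc) hsym hdiag _ _ rfl (Z3.Z3Rep.repA h))
  have h23 : (∀ (F : Type) [Field F], Z3Rep F A) → ∃ (F : Type) (_ : Field F), ringChar F ≠ 2 ∧ Z3Rep F A :=
    fun h => ⟨ℚ, inferInstance, by rw [ringChar.eq_zero]; norm_num, h ℚ⟩
  exact ⟨⟨h12, fun h => h31 (h23 h)⟩, ⟨fun h => h23 (h12 h), h31⟩⟩
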